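/- Let ℓ ∈ ℤ and j ≥ −ℓ. Suppose p ≤ q, 1/p + 1/q ≤ 1, and 1/p + 3/q ≥ 1. Then for every ε > 0 there is a constant C (independent of j, ℓ, f) such that ‖ e^{it√(−Δ)} 𝒫_j f ‖_{L^q(ℝ²×[2^ℓ, 2^{ℓ+1}], dx dt)} ≤ C · 2^{(3/2)(1/p − 1/q)(ℓ+j) + (3/q − 2/p)ℓ + ε(ℓ+j)} ‖f‖_{L^p(ℝ²)}. -/

import Mathlib

open MeasureTheory Real Set
open scoped ENNReal

noncomputable section

/-- Euclidean norm on `ℝ²` (the product norm on `ℝ × ℝ` is the sup norm, so we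
spell out the Euclidean one). -/
def enorm2 (ξ : ℝ × ℝ) : ℝ := Real.sqrt (ξ.1 ^ 2 + ξ.2 ^ 2)

/-- Fourier transform on `ℝ²` (nonunitary convention). -/
def ft2 (g : ℝ × ℝ → ℂ) (ξ : ℝ × ℝ) : ℂ :=
  ∫ y : ℝ × ℝ, Complex.exp (-(Complex.I) * ((y.1 * ξ.1 + y.2 * ξ.2 : ℝ) : ℂ)) * g y

/-- Fourier transform of the arclength measure `dσ` on the unit circle in `ℝ²`. -/
def sigmaHat (ξ : ℝ × ℝ) : ℂ :=
  ∫ θ in Set.Ioc (0:ℝ) (2 * π),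
    Complex.exp (-(Complex.I) * ((ξ.1 * Real.cos θ + ξ.2 * Real.sin θ : ℝ) : ℂ))

/-- The operator `𝒜_t g(r,x₃) = (2π)⁻² ∫ e^{i(((r²+t²)/2)ξ₁+x₃ξ₂)} \widehat{dσ}(trξ) ĝ(ξ) dξ`. -/
def Aop (g : ℝ × ℝ → ℂ) (t r x₃ : ℝ) : ℂ :=
  (((2 * π) ^ (-2 : ℤ) : ℝ) : ℂ) *
    ∫ ξ : ℝ × ℝ,
      Complex.exp (Complex.I * ((((r ^ 2 + t ^ 2) / 2) * ξ.1 + x₃ * ξ.2 : ℝ) : ℂ)) *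
        sigmaHat (t * r * ξ.1, t * r * ξ.2) * ft2 g ξ

/-- A Littlewood–Paley bump: nonnegative, smooth, supported in `[1−10⁻³, 2+10⁻³]`,
with `∑_{j∈ℤ} φ(2^{−j}s) = 1` for all `s > 0`. -/
def IsLPBump (φ : ℝ → ℝ) : Prop :=
  ContDiff ℝ (⊤ : ℕ∞) φ ∧ (∀ s, 0 ≤ φ s) ∧
    Function.support φ ⊆ Set.Icc (1 - 1/1000) (2 + 1/1000) ∧
    ∀ s : ℝ, 0 < s → HasSum (fun j : ℤ => φ ((2:ℝ) ^ (-j) * s)) 1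

/-- The Littlewood–Paley projection `𝒫_j`, defined via its multiplier `φ(2^{−j}|ξ|)`. -/
def proj (φ : ℝ → ℝ) (j : ℤ) (g : ℝ × ℝ → ℂ) (x : ℝ × ℝ) : ℂ :=
  (((2 * π) ^ (-2 : ℤ) : ℝ) : ℂ) *
    ∫ ξ : ℝ × ℝ,
      Complex.exp (Complex.I * ((x.1 * ξ.1 + x.2 * ξ.2 : ℝ) : ℂ)) *
        ((φ ((2:ℝ) ^ (-j) * enorm2 ξ) : ℝ) : ℂ) * ft2 g ξ

/-- `φ_{<ℓ}(s) = ∑_{j<ℓ} φ(2^{−j} s)`. -/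
def philt (φ : ℝ → ℝ) (l : ℤ) (s : ℝ) : ℝ :=
  ∑' j : ℤ, if j < l then φ ((2:ℝ) ^ (-j) * s) else 0

/-- The projection `𝒫_{<ℓ}`, with multiplier `φ_{<ℓ}(|ξ|)`. -/
def projLt (φ : ℝ → ℝ) (l : ℤ) (g : ℝ × ℝ → ℂ) (x : ℝ × ℝ) : ℂ :=
  (((2 * π) ^ (-2 : ℤ) : ℝ) : ℂ) *
    ∫ ξ : ℝ × ℝ,
      Complex.exp (Complex.I * ((x.1 * ξ.1 + x.2 * ξ.2 : ℝ) : ℂ)) *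
        ((philt φ l (enorm2 ξ) : ℝ) : ℂ) * ft2 g ξ

/-- The wave propagator `e^{it√(−Δ)} f(x) = (2π)^{−2} ∫ e^{i(x·ξ+t|ξ|)} f̂(ξ) dξ` on `ℝ²`. -/
def waveProp (f : ℝ × ℝ → ℂ) (t : ℝ) (x : ℝ × ℝ) : ℂ :=
  (((2 * π) ^ (-2 : ℤ) : ℝ) : ℂ) *
    ∫ ξ : ℝ × ℝ,
      Complex.exp (Complex.I * ((x.1 * ξ.1 + x.2 * ξ.2 + t * enorm2 ξ : ℝ) : ℂ)) * ft2 f ξ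

section Plancherel

open FourierTransform

variable {V : Type*} [NormedAddCommGroup V] [InnerProductSpace ℝ V] [FiniteDimensional ℝ V]
  [MeasurableSpace V] [BorelSpace V]

/-- The `L²` Fourier transform of an integrable function is its Fourier integral. -/
theorem fourier_toLp_ae_eq {f : V → ℂ} (hf : Integrable f) (h2 : MemLp f 2) :
    ((𝓕 (h2.toLp f) : Lp ℂ 2 (volume : Measure V)) : V → ℂ) =ᵐ[volume] 𝓕 f := by
  have hc : Continuous (𝓕 f) :=
    VectorFourier.fourierIntegral_continuous Real.continuous_fourierChar
      (by exact continuous_inner) hf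
  refine ae_eq_of_integral_contDiff_smul_eq ?_ hc.locallyIntegrable ?_
  · exact (Lp.memLp _).locallyIntegrable (by norm_num)
  intro g hg hgs
  have hg' : ContDiff ℝ (⊤ : ℕ∞) (fun x => (g x : ℂ)) :=
    Complex.ofRealCLM.contDiff.comp hg
  have hgs' : HasCompactSupport (fun x => (g x : ℂ)) :=
    hgs.comp_left (g := fun x : ℝ => (x : ℂ)) (by simp)
  have key := congrArg (fun T => T (hgs'.toSchwartzMap hg'))
    (MeasureTheory.Lp.fourier_toTemperedDistribution_eq (h2.toLp f))
  simp only [TemperedDistribution.fourier_apply, Lp.toTemperedDistribution_apply] at key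
  have e1 : ∀ (u : V → ℂ), ∫ x, g x • u x = ∫ x, (hgs'.toSchwartzMap hg') x • u x := by
    intro u
    refine integral_congr_ae (Filter.Eventually.of_forall fun x => ?_)
    simp
  rw [e1, e1, ← key]
  have e2 := VectorFourier.integral_fourierIntegral_smul_eq_flip (μ := (volume : Measure V))
    (ν := (volume : Measure V)) (L := innerₗ V) Real.continuous_fourierChar
    (by exact continuous_inner) (hgs'.toSchwartzMap hg').integrable hf
  have e3 : (innerₗ V).flip = innerₗ V := by
    ext x y; simp
  rw [e3] at e2
  have e4 : ∫ x, (𝓕 (hgs'.toSchwartzMap hg') : SchwartzMap V ℂ) x • (h2.toLp f : V → ℂ) x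
      = ∫ x, (𝓕 (hgs'.toSchwartzMap hg') : SchwartzMap V ℂ) x • f x := by
    refine integral_congr_ae ?_
    filter_upwards [h2.coeFn_toLp] with x hx
    rw [hx]
  rw [e4]
  exact e2

theorem lintegral_enorm_sq_fourier {f : V → ℂ} (hf : Integrable f) (h2 : MemLp f 2) :
    ∫⁻ ξ, ‖𝓕 f ξ‖ₑ ^ 2 = ∫⁻ x, ‖f x‖ₑ ^ 2 := by
  have h := MeasureTheory.Lp.norm_fourier_eq (h2.toLp f)
  rw [Lp.norm_def, Lp.norm_def, ENNReal.toReal_eq_toReal_iff' (Lp.eLpNorm_ne_top _)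
    (Lp.eLpNorm_ne_top _), eLpNorm_congr_ae (fourier_toLp_ae_eq hf h2),
    eLpNorm_congr_ae h2.coeFn_toLp] at h
  have h' := congrArg (fun a : ℝ≥0∞ => a ^ 2) h
  simp only [eLpNorm_eq_lintegral_rpow_enorm_toReal (p := 2) (by norm_num) (by norm_num)] at h'
  have aux : ∀ a : ℝ≥0∞, (a ^ (1 / (2 : ℝ≥0∞).toReal)) ^ 2 = a := fun a => by
    rw [← ENNReal.rpow_natCast, ← ENNReal.rpow_mul]
    norm_num
  rw [aux, aux] at h'
  simpa using h'

end Plancherel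

/-- The Euclidean inner product on `ℝ²`. -/
def dot2 (x ξ : ℝ × ℝ) : ℝ := x.1 * ξ.1 + x.2 * ξ.2

/-- The Euclidean inner product on `ℝ² × ℝ`. -/
def dot3 (y η : (ℝ × ℝ) × ℝ) : ℝ := dot2 y.1 η.1 + y.2 * η.2

/-- The Fourier transform on `ℝ² × ℝ` (nonunitary convention). -/
def ft3 (g : (ℝ × ℝ) × ℝ → ℂ) (η : (ℝ × ℝ) × ℝ) : ℂ :=
  ∫ y, Complex.exp (-Complex.I * (dot3 y η : ℂ)) * g y

theorem ft2_eq (g : ℝ × ℝ → ℂ) (ξ : ℝ × ℝ) :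
    ft2 g ξ = ∫ y, Complex.exp (-Complex.I * (dot2 y ξ : ℂ)) * g y := rfl

theorem lintegral_comp_smul_real {E : Type*} [NormedAddCommGroup E] [NormedSpace ℝ E]
    [FiniteDimensional ℝ E] [MeasurableSpace E] [BorelSpace E] (μ : Measure E)
    [μ.IsAddHaarMeasure] (f : E → ℝ≥0∞) {r : ℝ} (hr : 0 < r) :
    ∫⁻ x, f (r • x) ∂μ
      = ENNReal.ofReal ((r ^ Module.finrank ℝ E)⁻¹) * ∫⁻ x, f x ∂μ := by
  have h := lintegral_map_equiv (μ := μ) f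
    (Homeomorph.smulOfNeZero r hr.ne' : E ≃ₜ E).toMeasurableEquiv
  have e : Measure.map ((Homeomorph.smulOfNeZero r hr.ne' : E ≃ₜ E).toMeasurableEquiv) μ
      = ENNReal.ofReal |(r ^ Module.finrank ℝ E)⁻¹| • μ :=
    Measure.map_addHaar_smul μ hr.ne'
  rw [e, lintegral_smul_measure, abs_of_pos (by positivity)] at h
  simpa using h.symm

instance isAddHaarMeasure_volume_prod_prod :
    (volume : Measure ((ℝ × ℝ) × ℝ)).IsAddHaarMeasure :=
  inferInstanceAs ((volume : Measure (ℝ × ℝ)).prod (volume : Measure ℝ)).IsAddHaarMeasure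

theorem measurePreserving_ofLp2 :
    MeasurePreserving (fun v : WithLp 2 (ℝ × ℝ) => v.ofLp) :=
  WithLp.volume_preserving_ofLp ℝ ℝ

theorem measurePreserving_ofLp3 :
    MeasurePreserving
      (fun v : WithLp 2 (WithLp 2 (ℝ × ℝ) × ℝ) => ((v.ofLp.1.ofLp, v.ofLp.2) : (ℝ × ℝ) × ℝ)) :=
  (measurePreserving_ofLp2.prod (MeasurePreserving.id (volume : Measure ℝ))).comp
    (WithLp.volume_preserving_ofLp (WithLp 2 (ℝ × ℝ)) ℝ)

theorem measurableEmbedding_ofLp2 :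
    MeasurableEmbedding (fun v : WithLp 2 (ℝ × ℝ) => v.ofLp) :=
  (MeasurableEquiv.toLp 2 (ℝ × ℝ)).symm.measurableEmbedding

theorem measurableEmbedding_ofLp3 :
    MeasurableEmbedding
      (fun v : WithLp 2 (WithLp 2 (ℝ × ℝ) × ℝ) => ((v.ofLp.1.ofLp, v.ofLp.2) : (ℝ × ℝ) × ℝ)) :=
  (measurableEmbedding_ofLp2.prodMap MeasurableEmbedding.id).comp
    (MeasurableEquiv.toLp 2 (WithLp 2 (ℝ × ℝ) × ℝ)).symm.measurableEmbedding

open FourierTransform in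
theorem ft2_eq_fourier (g : ℝ × ℝ → ℂ) (ξ : ℝ × ℝ) :
    ft2 g ξ = 𝓕 (fun v : WithLp 2 (ℝ × ℝ) => g v.ofLp) (WithLp.toLp 2 ((2 * π)⁻¹ • ξ)) := by
  rw [Real.fourier_eq', ft2, ← measurePreserving_ofLp2.integral_comp measurableEmbedding_ofLp2]
  refine integral_congr_ae (Filter.Eventually.of_forall fun v => ?_)
  simp only [smul_eq_mul, WithLp.prod_inner_apply]
  congr 2
  simp
  field_simp

open FourierTransform in
theorem ft3_eq_fourier (g : (ℝ × ℝ) × ℝ → ℂ) (η : (ℝ × ℝ) × ℝ) :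
    ft3 g η = 𝓕 (fun v : WithLp 2 (WithLp 2 (ℝ × ℝ) × ℝ) => g (v.ofLp.1.ofLp, v.ofLp.2))
      (WithLp.toLp 2 (WithLp.toLp 2 ((2 * π)⁻¹ • η.1), (2 * π)⁻¹ • η.2)) := by
  rw [Real.fourier_eq', ft3, ← measurePreserving_ofLp3.integral_comp measurableEmbedding_ofLp3]
  refine integral_congr_ae (Filter.Eventually.of_forall fun v => ?_)
  simp only [smul_eq_mul, WithLp.prod_inner_apply, dot3, dot2]
  congr 2
  simp
  field_simp

/-- Plancherel on `ℝ²`. -/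
theorem lintegral_enorm_sq_ft2 {g : ℝ × ℝ → ℂ} (hg : Integrable g) (h2 : MemLp g 2) :
    ∫⁻ ξ, ‖ft2 g ξ‖ₑ ^ 2 = ENNReal.ofReal ((2 * π) ^ 2) * ∫⁻ x, ‖g x‖ₑ ^ 2 := by
  have mp := measurePreserving_ofLp2
  have h := lintegral_enorm_sq_fourier (f := fun v : WithLp 2 (ℝ × ℝ) => g v.ofLp)
    (mp.integrable_comp_of_integrable hg) (h2.comp_measurePreserving mp)
  rw [mp.lintegral_comp_emb measurableEmbedding_ofLp2 (fun x => ‖g x‖ₑ ^ 2)] at h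
  rw [← h, ← (WithLp.volume_preserving_toLp ℝ ℝ).lintegral_comp_emb
    (MeasurableEquiv.toLp 2 (ℝ × ℝ)).measurableEmbedding]
  simp_rw [ft2_eq_fourier]
  rw [lintegral_comp_smul_real volume
    (fun ξ : ℝ × ℝ => ‖FourierTransform.fourier (fun v : WithLp 2 (ℝ × ℝ) => g v.ofLp)
      (WithLp.toLp 2 ξ)‖ₑ ^ 2) (by positivity : 0 < (2 * π)⁻¹)]
  congr 2
  simp
  field_simp

/-- Plancherel on `ℝ² × ℝ`. -/
theorem lintegral_enorm_sq_ft3 {g : (ℝ × ℝ) × ℝ → ℂ} (hg : Integrable g) (h2 : MemLp g 2) :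
    ∫⁻ ξ, ‖ft3 g ξ‖ₑ ^ 2 = ENNReal.ofReal ((2 * π) ^ 3) * ∫⁻ x, ‖g x‖ₑ ^ 2 := by
  have mp := measurePreserving_ofLp3
  have h := lintegral_enorm_sq_fourier
    (f := fun v : WithLp 2 (WithLp 2 (ℝ × ℝ) × ℝ) => g (v.ofLp.1.ofLp, v.ofLp.2))
    (mp.integrable_comp_of_integrable hg) (h2.comp_measurePreserving mp)
  rw [mp.lintegral_comp_emb measurableEmbedding_ofLp3 (fun x => ‖g x‖ₑ ^ 2)] at h
  rw [← h]
  have e := mp.lintegral_comp_emb measurableEmbedding_ofLp3 (fun ξ : (ℝ × ℝ) × ℝ =>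
    ‖FourierTransform.fourier
      (fun v : WithLp 2 (WithLp 2 (ℝ × ℝ) × ℝ) => g (v.ofLp.1.ofLp, v.ofLp.2))
      (WithLp.toLp 2 (WithLp.toLp 2 ξ.1, ξ.2))‖ₑ ^ 2)
  rw [show (∫⁻ ξ, ‖FourierTransform.fourier
      (fun v : WithLp 2 (WithLp 2 (ℝ × ℝ) × ℝ) => g (v.ofLp.1.ofLp, v.ofLp.2)) ξ‖ₑ ^ 2)
      = _ from e]
  simp_rw [ft3_eq_fourier]
  have e2 := lintegral_comp_smul_real volume (fun ξ : (ℝ × ℝ) × ℝ =>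
    ‖FourierTransform.fourier
      (fun v : WithLp 2 (WithLp 2 (ℝ × ℝ) × ℝ) => g (v.ofLp.1.ofLp, v.ofLp.2))
      (WithLp.toLp 2 (WithLp.toLp 2 ξ.1, ξ.2))‖ₑ ^ 2) (by positivity : 0 < (2 * π)⁻¹)
  simp only [Prod.smul_fst, Prod.smul_snd] at e2
  rw [e2]
  congr 2
  simp
  field_simp

/-- The inverse Fourier transform on `ℝ²`. -/
def ift2 (a : ℝ × ℝ → ℂ) (x : ℝ × ℝ) : ℂ :=
  (((2 * π) ^ (-2 : ℤ) : ℝ) : ℂ) * ∫ ξ, Complex.exp (Complex.I * (dot2 x ξ : ℂ)) * a ξ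

theorem dot2_comm (x y : ℝ × ℝ) : dot2 x y = dot2 y x := by
  simp [dot2, mul_comm]

theorem dot2_neg_left (x y : ℝ × ℝ) : dot2 (-x) y = - dot2 x y := by
  simp [dot2]; ring

theorem ift2_eq_ft2 (a : ℝ × ℝ → ℂ) (x : ℝ × ℝ) :
    ift2 a x = (((2 * π) ^ (-2 : ℤ) : ℝ) : ℂ) * ft2 a (-x) := by
  rw [ift2, ft2_eq]
  congr 1
  refine integral_congr_ae (Filter.Eventually.of_forall fun v => ?_)
  simp only [dot2_comm v, dot2_neg_left]
  simp

open FourierTransform in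
theorem ift2_eq_fourierInv (a : ℝ × ℝ → ℂ) (x : ℝ × ℝ) :
    ift2 a x = (((2 * π) ^ (-2 : ℤ) : ℝ) : ℂ) *
      𝓕⁻ (fun v : WithLp 2 (ℝ × ℝ) => a v.ofLp) (WithLp.toLp 2 ((2 * π)⁻¹ • x)) := by
  rw [ift2_eq_ft2, ft2_eq_fourier, Real.fourierInv_eq_fourier_neg]
  simp

/-- A smooth compactly supported function on `ℝ²` as a Schwartz function on the Euclidean
plane. -/
def bumpSchwartz {a : ℝ × ℝ → ℂ} (ha : ContDiff ℝ (⊤ : ℕ∞) a) (hs : HasCompactSupport a) :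
    SchwartzMap (WithLp 2 (ℝ × ℝ)) ℂ :=
  (hs.comp_homeomorph
    (WithLp.prodContinuousLinearEquiv 2 ℝ ℝ ℝ).toHomeomorph).toSchwartzMap
    (ha.comp (WithLp.prodContinuousLinearEquiv 2 ℝ ℝ ℝ).contDiff)

open FourierTransform in
theorem ift2_eq_schwartz {a : ℝ × ℝ → ℂ} (ha : ContDiff ℝ (⊤ : ℕ∞) a)
    (hs : HasCompactSupport a) (x : ℝ × ℝ) :
    ift2 a x = (((2 * π) ^ (-2 : ℤ) : ℝ) : ℂ) *
      (𝓕⁻ (bumpSchwartz ha hs) : SchwartzMap (WithLp 2 (ℝ × ℝ)) ℂ)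
        (WithLp.toLp 2 ((2 * π)⁻¹ • x)) := by
  rw [ift2_eq_fourierInv, SchwartzMap.fourierInv_coe]
  rfl

theorem integrable_ift2 {a : ℝ × ℝ → ℂ} (ha : ContDiff ℝ (⊤ : ℕ∞) a) (hs : HasCompactSupport a) :
    Integrable (ift2 a) := by
  rw [funext (ift2_eq_schwartz ha hs)]
  refine Integrable.const_mul ?_ _
  have h := ((WithLp.volume_preserving_toLp ℝ ℝ).integrable_comp_emb
    (MeasurableEquiv.toLp 2 (ℝ × ℝ)).measurableEmbedding).2
    (FourierTransform.fourierInv (bumpSchwartz ha hs)).integrable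
  exact h.comp_smul (by positivity)

open FourierTransform in
theorem ft2_ift2 {a : ℝ × ℝ → ℂ} (ha : ContDiff ℝ (⊤ : ℕ∞) a) (hs : HasCompactSupport a)
    (ξ : ℝ × ℝ) : ft2 (ift2 a) ξ = a ξ := by
  have h1 : 𝓕 (𝓕⁻ (bumpSchwartz ha hs)) = bumpSchwartz ha hs := by simp
  have h2 : a ξ = (𝓕 (𝓕⁻ (bumpSchwartz ha hs)) : SchwartzMap (WithLp 2 (ℝ × ℝ)) ℂ)
      (WithLp.toLp 2 ξ) := by
    rw [h1]; rfl
  rw [h2, SchwartzMap.fourier_coe, Real.fourier_eq', ft2_eq,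
    ← (WithLp.volume_preserving_toLp ℝ ℝ).integral_comp
      (MeasurableEquiv.toLp 2 (ℝ × ℝ)).measurableEmbedding]
  have h3 := Measure.integral_comp_smul (volume : Measure (ℝ × ℝ)) (fun y =>
    Complex.exp (((-2 * π * inner ℝ (WithLp.toLp 2 y) (WithLp.toLp 2 ξ) : ℝ) : ℂ) * Complex.I) •
    (𝓕⁻ (bumpSchwartz ha hs) : SchwartzMap (WithLp 2 (ℝ × ℝ)) ℂ) (WithLp.toLp 2 y))
    (2 * π)⁻¹
  have h4 : (((|((2 * π)⁻¹ ^ Module.finrank ℝ (ℝ × ℝ))⁻¹| : ℝ)) : ℂ) ≠ 0 := by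
    have : (0:ℝ) < |((2 * π)⁻¹ ^ Module.finrank ℝ (ℝ × ℝ))⁻¹| := by positivity
    exact_mod_cast this.ne'
  rw [Complex.real_smul] at h3
  rw [← mul_right_inj' h4, ← h3, ← integral_const_mul]
  refine integral_congr_ae (Filter.Eventually.of_forall fun v => ?_)
  have hπ := Real.pi_ne_zero
  simp only [ift2_eq_schwartz ha hs, smul_eq_mul]
  rw [mul_left_comm (Complex.exp _), ← mul_assoc]
  have : (((|((2 * π)⁻¹ ^ Module.finrank ℝ (ℝ × ℝ))⁻¹| : ℝ)) : ℂ)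
      * (((2 * π) ^ (-2 : ℤ) : ℝ) : ℂ) = 1 := by
    rw [abs_of_pos (by positivity)]
    rw [← Complex.ofReal_mul, ← Complex.ofReal_one, show Module.finrank ℝ (ℝ × ℝ) = 2 by simp]
    congr 1
    rw [zpow_neg, inv_pow, inv_inv]
    exact mul_inv_cancel₀ (by positivity)
  rw [this, one_mul]
  congr 2
  simp [dot2, WithLp.prod_inner_apply]
  field_simp

open FourierTransform in
theorem exists_decay_fourier_bump {a : ℝ → ℂ} (ha : ContDiff ℝ (⊤ : ℕ∞) a)
    (hs : HasCompactSupport a) :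
    ∃ C, ∀ t : ℝ, ‖∫ s, a s * Complex.exp (Complex.I * ((t * s : ℝ) : ℂ))‖ * (1 + |t|) ^ 2 ≤ C := by
  set f := hs.toSchwartzMap ha
  have e : ∀ t : ℝ, ∫ s, a s * Complex.exp (Complex.I * ((t * s : ℝ) : ℂ))
      = (𝓕⁻ f : SchwartzMap ℝ ℂ) ((2 * π)⁻¹ * t) := by
    intro t
    rw [SchwartzMap.fourierInv_coe, Real.fourierInv_eq']
    refine integral_congr_ae (Filter.Eventually.of_forall fun v => ?_)
    have : f v = a v := rfl
    simp only [this, smul_eq_mul]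
    rw [mul_comm]
    congr 2
    have hπ := Real.pi_ne_zero
    simp
    field_simp
  refine ⟨(2 * π) ^ 2 * (2 ^ 2 * (Finset.Iic (2, 0)).sup
    (fun m => SchwartzMap.seminorm ℝ m.1 m.2) (𝓕⁻ f)), fun t => ?_⟩
  have h := SchwartzMap.one_add_le_sup_seminorm_apply (𝕜 := ℝ) (m := (2, 0)) (k := 2) (n := 0)
    le_rfl le_rfl (𝓕⁻ f) ((2 * π)⁻¹ * t)
  rw [norm_iteratedFDeriv_zero, Real.norm_eq_abs, abs_mul, abs_of_pos (by positivity)] at h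
  rw [e]
  have h2 : 1 + |t| ≤ (2 * π) * (1 + (2 * π)⁻¹ * |t|) := by
    have := Real.pi_gt_three
    field_simp
    nlinarith
  calc _ ≤ ‖(𝓕⁻ f : SchwartzMap ℝ ℂ) ((2 * π)⁻¹ * t)‖ * ((2 * π) * (1 + (2 * π)⁻¹ * |t|)) ^ 2 := by
        gcongr
    _ = (2 * π) ^ 2 * ((1 + (2 * π)⁻¹ * |t|) ^ 2 * ‖(𝓕⁻ f : SchwartzMap ℝ ℂ) ((2 * π)⁻¹ * t)‖) := by
        ring
    _ ≤ _ := by gcongr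

/-- A real quadratic polynomial given by its coefficients. -/
def quad (p : ℝ × ℝ × ℝ) (v : ℝ) : ℝ := p.1 + p.2.1 * v + p.2.2 * v ^ 2

theorem abs_quad_extrapolate {p : ℝ × ℝ × ℝ} {α L c v : ℝ} (hL : 0 < L)
    (h : ∀ u ∈ Icc α (α + L), |quad p u| ≤ c) (hv : v ∈ Icc (α - 2 * L) (α + 3 * L)) :
    |quad p v| ≤ 49 * c := by
  obtain ⟨x, rfl⟩ : ∃ x, v = α + x * L := ⟨(v - α) / L, by field_simp; ring⟩
  have hx1 : -2 ≤ x := by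
    by_contra hh; push Not at hh; nlinarith [hv.1, mul_lt_mul_of_pos_right hh hL]
  have hx2 : x ≤ 3 := by
    by_contra hh; push Not at hh; nlinarith [hv.2, mul_lt_mul_of_pos_right hh hL]
  have h0 := abs_le.1 (h α ⟨le_rfl, by linarith⟩)
  have h1 := abs_le.1 (h (α + L / 2) ⟨by linarith, by linarith⟩)
  have h2 := abs_le.1 (h (α + L) ⟨by linarith, le_rfl⟩)
  have e : quad p (α + x * L) = (2 * x - 1) * (x - 1) * quad p α
      + 4 * x * (1 - x) * quad p (α + L / 2) + x * (2 * x - 1) * quad p (α + L) := by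
    simp only [quad]; ring
  have hc : 0 ≤ c := (abs_nonneg _).trans (h α ⟨le_rfl, by linarith⟩)
  have b3 : |(2 * x - 1) * (x - 1)| + |4 * x * (1 - x)| + |x * (2 * x - 1)| ≤ 49 := by
    rcases abs_cases ((2 * x - 1) * (x - 1)) with h | h <;>
    rcases abs_cases (4 * x * (1 - x)) with h' | h' <;>
    rcases abs_cases (x * (2 * x - 1)) with h'' | h'' <;>
    nlinarith [sq_nonneg (2 * x - 1), mul_nonneg (by linarith : 0 ≤ x + 2) (by linarith : 0 ≤ 3 - x)]
  rw [e]
  calc _ ≤ |(2 * x - 1) * (x - 1) * quad p α| + |4 * x * (1 - x) * quad p (α + L / 2)|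
        + |x * (2 * x - 1) * quad p (α + L)| := by
        exact (abs_add_le _ _).trans (by gcongr; exact abs_add_le _ _)
    _ ≤ |(2 * x - 1) * (x - 1)| * c + |4 * x * (1 - x)| * c + |x * (2 * x - 1)| * c := by
        rw [abs_mul _ (quad p α), abs_mul _ (quad p (α + L / 2)), abs_mul _ (quad p (α + L))]
        gcongr
        exacts [abs_le.2 h0, abs_le.2 h1, abs_le.2 h2]
    _ = (|(2 * x - 1) * (x - 1)| + |4 * x * (1 - x)| + |x * (2 * x - 1)|) * c := by ring
    _ ≤ _ := by gcongr

theorem abs_quad_deriv_le {p : ℝ × ℝ × ℝ} {α s c v : ℝ} (hs : 0 < s)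
    (h : ∀ u ∈ Icc α (α + s), |quad p u| ≤ c) (hv : v ∈ Icc α (α + s)) :
    |p.2.1 + 2 * p.2.2 * v| * s ≤ 8 * c := by
  obtain ⟨x, rfl⟩ : ∃ x, v = α + x * s := ⟨(v - α) / s, by field_simp; ring⟩
  have hx1 : 0 ≤ x := by
    by_contra hh; push Not at hh; nlinarith [hv.1, mul_lt_mul_of_pos_right hh hs]
  have hx2 : x ≤ 1 := by
    by_contra hh; push Not at hh; nlinarith [hv.2, mul_lt_mul_of_pos_right hh hs]
  have h0 := h α ⟨le_rfl, by linarith⟩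
  have h1 := h (α + s / 2) ⟨by linarith, by linarith⟩
  have h2 := h (α + s) ⟨by linarith, le_rfl⟩
  have e : (p.2.1 + 2 * p.2.2 * (α + x * s)) * s = (4 * x - 3) * quad p α
      + (4 - 8 * x) * quad p (α + s / 2) + (4 * x - 1) * quad p (α + s) := by
    simp only [quad]; ring
  have hc : 0 ≤ c := (abs_nonneg _).trans h0
  have b3 : |4 * x - 3| + |4 - 8 * x| + |4 * x - 1| ≤ 8 := by
    rcases abs_cases (4 * x - 3) with h | h <;>
    rcases abs_cases (4 - 8 * x) with h' | h' <;>
    rcases abs_cases (4 * x - 1) with h'' | h'' <;> linarith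
  rw [← abs_of_pos hs, ← abs_mul, abs_of_pos hs, e]
  calc _ ≤ |(4 * x - 3) * quad p α| + |(4 - 8 * x) * quad p (α + s / 2)|
        + |(4 * x - 1) * quad p (α + s)| :=
        (abs_add_le _ _).trans (by gcongr; exact abs_add_le _ _)
    _ ≤ |4 * x - 3| * c + |4 - 8 * x| * c + |4 * x - 1| * c := by
        rw [abs_mul _ (quad p α), abs_mul _ (quad p (α + s / 2)), abs_mul _ (quad p (α + s))]
        gcongr
    _ = (|4 * x - 3| + |4 - 8 * x| + |4 * x - 1|) * c := by ring
    _ ≤ _ := by gcongr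

theorem abs_quad_le_of_deriv_nonneg {p : ℝ × ℝ × ℝ} {v₁ v₂ v c : ℝ}
    (h1 : |quad p v₁| ≤ c) (h2 : |quad p v₂| ≤ c) (hv : v ∈ Icc v₁ v₂)
    (d1 : 0 ≤ p.2.1 + 2 * p.2.2 * v₁) (d2 : 0 ≤ p.2.1 + 2 * p.2.2 * v₂) : |quad p v| ≤ c := by
  have hd : 0 ≤ p.2.1 + 2 * p.2.2 * v := by
    rcases le_total 0 p.2.2 with h | h
    · nlinarith [mul_le_mul_of_nonneg_left hv.1 h]
    · nlinarith [mul_le_mul_of_nonneg_left hv.2 (neg_nonneg.2 h)]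
  have a1 : quad p v₁ ≤ quad p v := by
    have : quad p v - quad p v₁ = (v - v₁) *
        ((p.2.1 + 2 * p.2.2 * v₁) + (p.2.1 + 2 * p.2.2 * v)) / 2 := by simp only [quad]; ring
    nlinarith [mul_nonneg (sub_nonneg.2 hv.1) (add_nonneg d1 hd)]
  have a2 : quad p v ≤ quad p v₂ := by
    have : quad p v₂ - quad p v = (v₂ - v) *
        ((p.2.1 + 2 * p.2.2 * v₂) + (p.2.1 + 2 * p.2.2 * v)) / 2 := by simp only [quad]; ring
    nlinarith [mul_nonneg (sub_nonneg.2 hv.2) (add_nonneg d2 hd)]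
  rw [abs_le] at *
  constructor <;> linarith [h1.1, h2.2]

/-- Two pairs of points that give nearly the same difference of parabolas are close. -/
theorem pair_close {p : ℝ × ℝ × ℝ} {α s lam κ E h₁ h₁' h₂ h₂' w₁ w₁' w₂ w₂' : ℝ}
    (hlam : 0 < lam) (hls : lam ≤ s) (hE : 2 * E + 6 * κ * s ^ 2 ≤ lam ^ 2 / 3)
    (hh₁ : h₁ ∈ Icc 1 (1 + κ)) (hh₁' : h₁' ∈ Icc 1 (1 + κ))
    (hh₂ : h₂ ∈ Icc 1 (1 + κ)) (hh₂' : h₂' ∈ Icc 1 (1 + κ))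
    (hw₁ : w₁ ∈ Icc α (α + s)) (hw₁' : w₁' ∈ Icc α (α + s))
    (hw₂ : w₂ ∈ Icc α (α + s)) (hw₂' : w₂' ∈ Icc α (α + s))
    (hd : lam ≤ |w₁ - w₁'|)
    (e₁ : ∀ v ∈ Icc α (α + s), |quad p v - (h₁ * (v - w₁) ^ 2 - h₁' * (v - w₁') ^ 2)| ≤ E)
    (e₂ : ∀ v ∈ Icc α (α + s), |quad p v - (h₂ * (v - w₂) ^ 2 - h₂' * (v - w₂') ^ 2)| ≤ E) :
    |w₁ - w₂| < lam ∧ |w₁' - w₂'| < lam := by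
  have hs : 0 < s := hlam.trans_le hls
  set e := 2 * E + 6 * κ * s ^ 2 with he
  have approx : ∀ h h' w w', h ∈ Icc 1 (1 + κ) → h' ∈ Icc 1 (1 + κ) → w ∈ Icc α (α + s) →
      w' ∈ Icc α (α + s) → ∀ v ∈ Icc α (α + s),
      |(h * (v - w) ^ 2 - h' * (v - w') ^ 2) - (w' - w) * (2 * v - (w + w'))| ≤ κ * s ^ 2 := by
    intro h h' w w' hh hh' hw hw' v hv
    have q1 : (v - w) ^ 2 ≤ s ^ 2 := by
      apply sq_le_sq'  <;> linarith [hv.1, hv.2, hw.1, hw.2]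
    have q2 : (v - w') ^ 2 ≤ s ^ 2 := by
      apply sq_le_sq'  <;> linarith [hv.1, hv.2, hw'.1, hw'.2]
    have e : (h * (v - w) ^ 2 - h' * (v - w') ^ 2) - (w' - w) * (2 * v - (w + w'))
      = (h - 1) * (v - w) ^ 2 - (h' - 1) * (v - w') ^ 2 := by ring
    have a1 : 0 ≤ (h - 1) * (v - w) ^ 2 := mul_nonneg (by linarith [hh.1]) (sq_nonneg _)
    have a2 : 0 ≤ (h' - 1) * (v - w') ^ 2 := mul_nonneg (by linarith [hh'.1]) (sq_nonneg _)
    have a3 : (h - 1) * (v - w) ^ 2 ≤ κ * s ^ 2 :=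
      mul_le_mul (by linarith [hh.2]) q1 (sq_nonneg _) (by linarith [hh.1, hh.2])
    have a4 : (h' - 1) * (v - w') ^ 2 ≤ κ * s ^ 2 :=
      mul_le_mul (by linarith [hh'.2]) q2 (sq_nonneg _) (by linarith [hh'.1, hh'.2])
    rw [e, abs_le]; constructor <;> linarith
  have diff : ∀ v ∈ Icc α (α + s),
      |(w₁' - w₁) * (2 * v - (w₁ + w₁')) - (w₂' - w₂) * (2 * v - (w₂ + w₂'))| ≤ e := by
    intro v hv
    have t1 := abs_le.1 (approx _ _ _ _ hh₁ hh₁' hw₁ hw₁' v hv)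
    have t2 := abs_le.1 (approx _ _ _ _ hh₂ hh₂' hw₂ hw₂' v hv)
    have t3 := abs_le.1 (e₁ v hv)
    have t4 := abs_le.1 (e₂ v hv)
    have : 0 ≤ κ * s ^ 2 := mul_nonneg (by linarith [hh₁.1, hh₁.2]) (sq_nonneg _)
    rw [abs_le]; constructor <;> linarith [t1.1, t1.2, t2.1, t2.2, t3.1, t3.2, t4.1, t4.2]
  have z1 := abs_le.1 (diff α ⟨le_rfl, by linarith⟩)
  have z2 := abs_le.1 (diff (α + s) ⟨by linarith, le_rfl⟩)
  -- difference of the `d`s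
  have D : |(w₁' - w₁) - (w₂' - w₂)| * s ≤ e := by
    rw [show |(w₁' - w₁) - (w₂' - w₂)| * s = |((w₁' - w₁) - (w₂' - w₂)) * s| by
      rw [abs_mul, abs_of_pos hs], abs_le]
    constructor <;> nlinarith [z1.1, z1.2, z2.1, z2.2]
  have he3 : e ≤ lam ^ 2 / 3 := hE
  have D' : |(w₁' - w₁) - (w₂' - w₂)| ≤ lam / 3 := by
    by_contra hh
    push Not at hh
    have : lam / 3 * lam < |(w₁' - w₁) - (w₂' - w₂)| * s :=
      mul_lt_mul hh hls hlam (abs_nonneg _)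
    nlinarith
  have S : |w₁' - w₁| * |(w₁ + w₁') - (w₂ + w₂')| ≤ 3 * e := by
    rw [← abs_mul]
    have m2 : |2 * α - (w₂ + w₂')| ≤ 2 * s := by
      rw [abs_le]; constructor <;> linarith [hw₂.1, hw₂.2, hw₂'.1, hw₂'.2]
    have : (w₁' - w₁) * ((w₁ + w₁') - (w₂ + w₂')) =
        ((w₁' - w₁) - (w₂' - w₂)) * (2 * α - (w₂ + w₂')) -
        ((w₁' - w₁) * (2 * α - (w₁ + w₁')) - (w₂' - w₂) * (2 * α - (w₂ + w₂'))) := by ring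
    rw [this]
    have b1 : |((w₁' - w₁) - (w₂' - w₂)) * (2 * α - (w₂ + w₂'))| ≤ 2 * e := by
      rw [abs_mul]
      calc _ ≤ |(w₁' - w₁) - (w₂' - w₂)| * (2 * s) := by gcongr
        _ ≤ 2 * e := by linarith
    have b2 := diff α ⟨le_rfl, by linarith⟩
    rw [abs_le] at *
    constructor <;> linarith [b1.1, b1.2, b2.1, b2.2]
  have S' : |(w₁ + w₁') - (w₂ + w₂')| ≤ lam := by
    by_contra hh
    push Not at hh
    rw [abs_sub_comm] at hd
    have : lam * lam < |w₁' - w₁| * |(w₁ + w₁') - (w₂ + w₂')| :=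
      mul_lt_mul' hd hh hlam.le (hlam.trans_le hd)
    nlinarith
  rw [abs_le] at D' S'
  constructor <;> rw [abs_lt] <;> constructor <;> linarith [D'.1, D'.2, S'.1, S'.2]

theorem enorm_sum_sq_le {ι : Type*} (T : Finset ι) (g : ι → ℂ) :
    ‖∑ t ∈ T, g t‖ₑ ^ 2 ≤ T.card * ∑ t ∈ T, ‖g t‖ₑ ^ 2 := by
  have key : ‖∑ t ∈ T, g t‖ ^ 2 ≤ T.card * ∑ t ∈ T, ‖g t‖ ^ 2 :=
    (pow_le_pow_left₀ (norm_nonneg _) (norm_sum_le _ _) 2).trans sq_sum_le_card_mul_sum_sq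
  have h := ENNReal.ofReal_le_ofReal key
  rw [ENNReal.ofReal_mul (by positivity), ENNReal.ofReal_sum_of_nonneg (fun _ _ => by positivity),
    ENNReal.ofReal_pow (norm_nonneg _), ofReal_norm, ENNReal.ofReal_natCast] at h
  refine h.trans (le_of_eq ?_)
  congr 1
  refine Finset.sum_congr rfl fun t _ => ?_
  rw [ENNReal.ofReal_pow (norm_nonneg _), ofReal_norm]

theorem enorm_add_sq_le (z w : ℂ) : ‖z + w‖ₑ ^ 2 ≤ 2 * ‖z‖ₑ ^ 2 + 2 * ‖w‖ₑ ^ 2 := by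
  have := enorm_sum_sq_le (Finset.univ : Finset (Fin 2)) ![z, w]
  simpa [mul_add] using this

theorem div_two_pow_div {B a a' i : ℕ} (h1 : a ≤ a') (h2 : a' ≤ B) :
    i / 2 ^ (B - a') / 2 ^ (a' - a) = i / 2 ^ (B - a) := by
  rw [Nat.div_div_eq_div_mul, ← pow_add]
  congr 2
  omega

theorem block_lower {K B n : ℕ} (h : B ≤ K) :
    ((n / 2 ^ (K - B) : ℕ) : ℝ) / 2 ^ B ≤ n / 2 ^ K := by
  have e : (2 : ℝ) ^ K = 2 ^ B * 2 ^ (K - B) := by rw [← pow_add]; congr 1; omega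
  rw [e, div_le_div_iff₀ (by positivity) (by positivity)]
  have : ((n / 2 ^ (K - B) : ℕ) : ℝ) * 2 ^ (K - B) ≤ n := by
    exact_mod_cast Nat.div_mul_le_self n (2 ^ (K - B))
  nlinarith [pow_pos (two_pos : (0 : ℝ) < 2) B]

theorem block_upper {K B n : ℕ} (h : B ≤ K) :
    ((n : ℝ) + 1) / 2 ^ K ≤ ((n / 2 ^ (K - B) : ℕ) + 1 : ℝ) / 2 ^ B := by
  have e : (2 : ℝ) ^ K = 2 ^ B * 2 ^ (K - B) := by rw [← pow_add]; congr 1; omega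
  rw [e, div_le_div_iff₀ (by positivity) (by positivity)]
  have : ((n : ℝ) + 1) ≤ ((n / 2 ^ (K - B) : ℕ) + 1 : ℝ) * 2 ^ (K - B) := by
    have := Nat.lt_div_mul_add (a := n) (b := 2 ^ (K - B)) (by positivity)
    have h2 : n + 1 ≤ (n / 2 ^ (K - B) + 1) * 2 ^ (K - B) := by rw [add_mul, one_mul]; omega
    exact_mod_cast h2
  nlinarith [pow_pos (two_pos : (0 : ℝ) < 2) B]

theorem quad_neg (p : ℝ × ℝ × ℝ) (v : ℝ) : quad (-p) v = - quad p v := by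
  simp [quad]; ring

/-- A one-signed family of active blocks is covered by two dyadic intervals of comparable size. -/
theorem exists_cover_of_deriv_nonneg {p : ℝ × ℝ × ℝ} {B a j : ℕ} {c : ℝ} (haB : a ≤ B)
    (A : Finset ℕ) (hA : ∀ i ∈ A, i / 2 ^ (B - a) = j)
    (hact : ∀ i ∈ A, ∀ v ∈ Icc ((i : ℝ) / 2 ^ B) (((i : ℝ) + 1) / 2 ^ B), |quad p v| ≤ c)
    (hd : ∀ i ∈ A, 0 ≤ p.2.1 + 2 * p.2.2 * (((i : ℝ) + 1 / 2) / 2 ^ B)) :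
    ∃ T : Finset (ℕ × ℕ), T.card ≤ 2 ∧
      (∀ t ∈ T, a ≤ t.1 ∧ t.1 ≤ B ∧ t.2 / 2 ^ (t.1 - a) = j ∧
        ∀ v ∈ Icc ((t.2 : ℝ) / 2 ^ t.1) (((t.2 : ℝ) + 1) / 2 ^ t.1), |quad p v| ≤ 49 * c) ∧
      ∀ i ∈ A, ∃ t ∈ T, i / 2 ^ (B - t.1) = t.2 := by
  rcases A.eq_empty_or_nonempty with rfl | hne
  · exact ⟨∅, by simp, by simp, by simp⟩
  set i₁ := A.min' hne with hi₁
  set i₂ := A.max' hne with hi₂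
  have m₁ : i₁ ∈ A := A.min'_mem hne
  have m₂ : i₂ ∈ A := A.max'_mem hne
  have h12 : i₁ ≤ i₂ := A.min'_le _ m₂
  set L := i₂ + 1 - i₁ with hL
  set e := Nat.clog 2 L with he
  have e1 : L ≤ 2 ^ e := Nat.le_pow_clog one_lt_two L
  have e2 : 2 ^ e < 2 * L := by
    rcases Nat.lt_or_ge 1 L with h | h
    · have := Nat.pow_pred_clog_lt_self (b := 2) one_lt_two h
      rw [← he] at this
      have e0 : 0 < e := Nat.clog_pos one_lt_two h
      calc 2 ^ e = 2 * 2 ^ e.pred := by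
            rw [← pow_succ']; congr 1; rw [Nat.pred_eq_sub_one]; omega
        _ < _ := by omega
    · have : L = 1 := by omega
      simp [he, this]
  have eB : e ≤ B - a := by
    rw [he, Nat.clog_le_iff_le_pow one_lt_two]
    have h1 := hA _ m₁
    have h2 := hA _ m₂
    have u1 := Nat.div_mul_le_self i₁ (2 ^ (B - a))
    have u2 := Nat.lt_div_mul_add (a := i₂) (b := 2 ^ (B - a)) (by positivity)
    rw [h1] at u1; rw [h2] at u2
    omega
  have hB : (0 : ℝ) < 2 ^ B := by positivity
  have hLr : (L : ℝ) = i₂ + 1 - i₁ := by rw [hL, Nat.cast_sub (by omega)]; push_cast; ring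
  have hull : ∀ u ∈ Icc ((i₁ : ℝ) / 2 ^ B) ((i₁ : ℝ) / 2 ^ B + L / 2 ^ B), |quad p u| ≤ c := by
    intro u hu
    have hu2 : u ≤ ((i₂ : ℝ) + 1) / 2 ^ B := by
      refine hu.2.trans (le_of_eq ?_); rw [hLr]; ring
    rcases le_or_gt u (((i₁ : ℝ) + 1) / 2 ^ B) with h | h
    · exact hact _ m₁ u ⟨hu.1, h⟩
    rcases le_or_gt ((i₂ : ℝ) / 2 ^ B) u with h' | h'
    · exact hact _ m₂ u ⟨h', hu2⟩
    refine abs_quad_le_of_deriv_nonneg (v₁ := ((i₁ : ℝ) + 1 / 2) / 2 ^ B)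
      (v₂ := ((i₂ : ℝ) + 1 / 2) / 2 ^ B) (hact _ m₁ _ ⟨?_, ?_⟩) (hact _ m₂ _ ⟨?_, ?_⟩)
      ⟨le_trans ?_ h.le, h'.le.trans ?_⟩ (hd _ m₁) (hd _ m₂) <;>
    · apply div_le_div_of_nonneg_right _ hB.le; linarith
  have hLpos : (0 : ℝ) < L / 2 ^ B := by
    apply div_pos _ hB
    have : 0 < L := by omega
    exact_mod_cast this
  have e2r : (2 : ℝ) ^ e ≤ 2 * L := by exact_mod_cast e2.le
  have scale : ∀ q : ℕ, (q : ℝ) / 2 ^ (B - e) = q * 2 ^ e / 2 ^ B := by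
    intro q
    have : (2 : ℝ) ^ B = 2 ^ (B - e) * 2 ^ e := by rw [← pow_add]; congr 1; omega
    rw [this]; field_simp
  have good : ∀ i ∈ A, ∀ v ∈ Icc (((i / 2 ^ e : ℕ) : ℝ) / 2 ^ (B - e))
      ((((i / 2 ^ e : ℕ) : ℝ) + 1) / 2 ^ (B - e)), |quad p v| ≤ 49 * c := by
    intro i hi v hv
    have l1 : i₁ ≤ i := A.min'_le _ hi
    have l2 : i ≤ i₂ := A.le_max' _ hi
    have l1r : (i₁ : ℝ) ≤ i := by exact_mod_cast l1
    have l2r : (i : ℝ) ≤ i₂ := by exact_mod_cast l2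
    have u1 : (((i / 2 ^ e : ℕ) : ℝ)) * 2 ^ e ≤ i := by
      exact_mod_cast Nat.div_mul_le_self i (2 ^ e)
    have u2 : (i : ℝ) ≤ ((i / 2 ^ e : ℕ) : ℝ) * 2 ^ e + 2 ^ e := by
      exact_mod_cast (Nat.lt_div_mul_add (a := i) (b := 2 ^ e) (by positivity)).le
    have v1 := hv.1
    have v2 := hv.2
    rw [scale] at v1
    have := scale (i / 2 ^ e + 1)
    push_cast at this
    rw [this] at v2
    refine abs_quad_extrapolate hLpos hull ⟨le_trans ?_ v1, v2.trans ?_⟩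
    · rw [show (i₁ : ℝ) / 2 ^ B - 2 * (L / 2 ^ B) = (i₁ - 2 * L) / 2 ^ B by ring]
      apply div_le_div_of_nonneg_right _ hB.le
      linarith
    · rw [show (i₁ : ℝ) / 2 ^ B + 3 * (L / 2 ^ B) = (i₁ + 3 * L) / 2 ^ B by ring]
      apply div_le_div_of_nonneg_right _ hB.le
      linarith
  have par : ∀ i ∈ A, i / 2 ^ e / 2 ^ (B - e - a) = j := by
    intro i hi
    rw [← hA i hi, Nat.div_div_eq_div_mul, ← pow_add]
    congr 2; omega
  refine ⟨{(B - e, i₁ / 2 ^ e), (B - e, i₂ / 2 ^ e)}, Finset.card_le_two, ?_, ?_⟩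
  · intro t ht
    rcases Finset.mem_insert.1 ht with rfl | ht
    · exact ⟨by simp only; omega, by simp only; omega, par _ m₁, good _ m₁⟩
    · rw [Finset.mem_singleton] at ht; subst ht
      exact ⟨by simp only; omega, by simp only; omega, par _ m₂, good _ m₂⟩
  · intro i hi
    have l1 : i₁ ≤ i := A.min'_le _ hi
    have l2 : i ≤ i₂ := A.le_max' _ hi
    have hBe : B - (B - e) = e := by omega
    have q1 := Nat.div_le_div_right (c := 2 ^ e) l1
    have q2 := Nat.div_le_div_right (c := 2 ^ e) l2
    have q3 : i₂ / 2 ^ e ≤ i₁ / 2 ^ e + 1 := by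
      rw [← Nat.add_div_right _ (by positivity)]
      exact Nat.div_le_div_right (by omega)
    rcases (by omega : i / 2 ^ e = i₁ / 2 ^ e ∨ i / 2 ^ e = i₂ / 2 ^ e) with h | h
    · exact ⟨(B - e, i₁ / 2 ^ e), by simp, by simp only [hBe, h]⟩
    · exact ⟨(B - e, i₂ / 2 ^ e), by simp, by simp only [hBe, h]⟩

theorem exists_cover {p : ℝ × ℝ × ℝ} {B a j : ℕ} {c : ℝ} (haB : a ≤ B)
    (A : Finset ℕ) (hA : ∀ i ∈ A, i / 2 ^ (B - a) = j)
    (hact : ∀ i ∈ A, ∀ v ∈ Icc ((i : ℝ) / 2 ^ B) (((i : ℝ) + 1) / 2 ^ B), |quad p v| ≤ c) :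
    ∃ T : Finset (ℕ × ℕ), T.card ≤ 4 ∧
      (∀ t ∈ T, a ≤ t.1 ∧ t.1 ≤ B ∧ t.2 / 2 ^ (t.1 - a) = j ∧
        ∀ v ∈ Icc ((t.2 : ℝ) / 2 ^ t.1) (((t.2 : ℝ) + 1) / 2 ^ t.1), |quad p v| ≤ 49 * c) ∧
      ∀ i ∈ A, ∃ t ∈ T, i / 2 ^ (B - t.1) = t.2 := by
  classical
  obtain ⟨T₁, c₁, h₁, k₁⟩ := exists_cover_of_deriv_nonneg (p := p) (c := c) haB
    (A.filter fun i => 0 ≤ p.2.1 + 2 * p.2.2 * (((i : ℝ) + 1 / 2) / 2 ^ B))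
    (fun i hi => hA i (Finset.mem_filter.1 hi).1) (fun i hi => hact i (Finset.mem_filter.1 hi).1)
    (fun i hi => (Finset.mem_filter.1 hi).2)
  obtain ⟨T₂, c₂, h₂, k₂⟩ := exists_cover_of_deriv_nonneg (p := -p) (c := c) haB
    (A.filter fun i => ¬ 0 ≤ p.2.1 + 2 * p.2.2 * (((i : ℝ) + 1 / 2) / 2 ^ B))
    (fun i hi => hA i (Finset.mem_filter.1 hi).1)
    (fun i hi v hv => by
      rw [quad_neg, abs_neg]; exact hact i (Finset.mem_filter.1 hi).1 v hv)
    (fun i hi => by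
      have := (Finset.mem_filter.1 hi).2
      simp only [Prod.snd_neg, Prod.fst_neg]
      linarith)
  refine ⟨T₁ ∪ T₂, (Finset.card_union_le _ _).trans (by omega), ?_, ?_⟩
  · intro t ht
    rcases Finset.mem_union.1 ht with ht | ht
    · exact h₁ t ht
    · obtain ⟨x1, x2, x3, x4⟩ := h₂ t ht
      refine ⟨x1, x2, x3, fun v hv => ?_⟩
      have := x4 v hv
      rwa [quad_neg, abs_neg] at this
  · intro i hi
    by_cases hs : 0 ≤ p.2.1 + 2 * p.2.2 * (((i : ℝ) + 1 / 2) / 2 ^ B)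
    · obtain ⟨t, ht, h⟩ := k₁ i (Finset.mem_filter.2 ⟨hi, hs⟩)
      exact ⟨t, Finset.mem_union_left _ ht, h⟩
    · obtain ⟨t, ht, h⟩ := k₂ i (Finset.mem_filter.2 ⟨hi, hs⟩)
      exact ⟨t, Finset.mem_union_right _ ht, h⟩

/-- A finite dyadic cover can be made disjoint, whence a quadratic bound for the full sum. -/
theorem enorm_sum_sq_le_of_cover {B : ℕ} (A : Finset ℕ) (g : ℕ → ℂ) (T : Finset (ℕ × ℕ))
    (hT : ∀ t ∈ T, t.1 ≤ B) (hcov : ∀ i ∈ A, ∃ t ∈ T, i / 2 ^ (B - t.1) = t.2) :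
    ‖∑ i ∈ A, g i‖ₑ ^ 2 ≤
      T.card * ∑ t ∈ T, ‖∑ i ∈ A.filter (fun i => i / 2 ^ (B - t.1) = t.2), g i‖ₑ ^ 2 := by
  classical
  have hex : ∀ i ∈ A, ∃ a', (a', i / 2 ^ (B - a')) ∈ T := by
    intro i hi
    obtain ⟨t, ht, h⟩ := hcov i hi
    exact ⟨t.1, by rw [h]; exact ht⟩
  set τ : ℕ → ℕ × ℕ := fun i =>
    if h : ∃ a', (a', i / 2 ^ (B - a')) ∈ T then (Nat.find h, i / 2 ^ (B - Nat.find h))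
    else (0, 0) with hτ
  have hτT : ∀ i ∈ A, τ i ∈ T := by
    intro i hi
    simp only [hτ, dif_pos (hex i hi)]
    exact Nat.find_spec (hex i hi)
  rw [← Finset.sum_fiberwise_of_maps_to hτT g]
  refine (enorm_sum_sq_le T _).trans ?_
  gcongr with t ht
  rcases Finset.eq_empty_or_nonempty (A.filter fun i => τ i = t) with h0 | ⟨i₀, hi₀⟩
  · rw [h0]; simp
  · rw [Finset.mem_filter] at hi₀
    suffices hs : A.filter (fun i => τ i = t) = A.filter fun i => i / 2 ^ (B - t.1) = t.2 by
      rw [hs]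
    ext i
    simp only [Finset.mem_filter, and_congr_right_iff]
    intro hi
    have h0 := hi₀.2
    have hτe : ∀ (i : ℕ) (h : ∃ a', (a', i / 2 ^ (B - a')) ∈ T),
        τ i = (Nat.find h, i / 2 ^ (B - Nat.find h)) := fun i h => by simp only [hτ, dif_pos h]
    rw [hτe i₀ (hex i₀ hi₀.1)] at h0
    constructor
    · intro h
      rw [hτe i (hex i hi)] at h
      rw [← h]
    · intro h
      rw [hτe i (hex i hi)]
      have ht1 : t.1 = Nat.find (hex i₀ hi₀.1) := (congrArg Prod.fst h0).symm
      have ht2 : t.2 = i₀ / 2 ^ (B - t.1) := by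
        rw [ht1]; exact (congrArg Prod.snd h0).symm
      have hf : Nat.find (hex i hi) = t.1 := by
        rw [Nat.find_eq_iff]
        refine ⟨by rw [h]; exact ht, fun a' ha' hm => ?_⟩
        rw [ht1] at ha'
        refine Nat.find_min (hex i₀ hi₀.1) ha' ?_
        rw [← ht1] at ha'
        have c1 := div_two_pow_div (i := i) ha'.le (hT t ht)
        have c2 := div_two_pow_div (i := i₀) ha'.le (hT t ht)
        rw [← c2, ← ht2, ← h, c1]
        exact hm
      rw [hf, h]

section

/-- Bilinear combination of a family of functions indexed by pairs. -/
def pairSum {X : Type*} (C : Finset ℕ) (H : ℕ → ℕ → X → ℂ) (c : ℕ → ℕ → ℂ) (x : X) : ℂ :=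
  ∑ n ∈ C, ∑ m ∈ C, c n m * H n m x

/-- The data of a multiscale high-low argument: frequency-side functions `H n m`, whose
combinations are isometric to those of `f n * conj (f m)`, each living near the set where the
quadratic polynomial `P x` is a difference of two squares. -/
structure IsMultiscale {X Y : Type*} [MeasurableSpace X] [MeasurableSpace Y]
    (μ : Measure X) (ν : Measure Y) (κ₀ : ℝ≥0∞) (k N : ℕ) (C : Finset ℕ) (f : ℕ → Y → ℂ)
    (H : ℕ → ℕ → X → ℂ) (P : X → ℝ × ℝ × ℝ) : Prop where
  lt : ∀ n ∈ C, n < 2 ^ (k * N)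
  sep : ∀ n ∈ C, ∀ m ∈ C, ∀ b < N, n / 2 ^ (k * N - k * b) = m / 2 ^ (k * N - k * b) →
    n / 2 ^ (k * N - k * (b + 1)) ≠ m / 2 ^ (k * N - k * (b + 1)) →
    n / 2 ^ (k * N - k * (b + 1)) + 2 ≤ m / 2 ^ (k * N - k * (b + 1)) ∨
    m / 2 ^ (k * N - k * (b + 1)) + 2 ≤ n / 2 ^ (k * N - k * (b + 1))
  meas_f : ∀ n, Measurable (f n)
  meas_H : ∀ n m, Measurable (H n m)
  meas_P : Measurable P
  norm : ∀ c : ℕ → ℕ → ℂ, ∫⁻ x, ‖pairSum C H c x‖ₑ ^ 2 ∂μ =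
    κ₀ * ∫⁻ y, ‖pairSum C (fun n m y => f n y * starRingEnd ℂ (f m y)) c y‖ₑ ^ 2 ∂ν
  loc : ∀ n ∈ C, ∀ m ∈ C, ∀ x, H n m x ≠ 0 →
    ∃ h ∈ Icc (1 : ℝ) (1 + 1 / (10 ^ 8 * (2 ^ k) ^ 4)),
    ∃ h' ∈ Icc (1 : ℝ) (1 + 1 / (10 ^ 8 * (2 ^ k) ^ 4)),
    ∃ w ∈ Icc ((n : ℝ) / 2 ^ (k * N)) (((n : ℝ) + 1) / 2 ^ (k * N)),
    ∃ w' ∈ Icc ((m : ℝ) / 2 ^ (k * N)) (((m : ℝ) + 1) / 2 ^ (k * N)),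
    ∀ v ∈ Icc (0 : ℝ) 1, |quad (P x) v - (h * (v - w) ^ 2 - h' * (v - w') ^ 2)| ≤
      (1 / 2 ^ (k * N)) ^ 2 / 8

/-- Coefficients selecting the pairs in a common block of length `2^{-B}` inside the dyadic
interval `j` of length `2^{-a}`. -/
def diagCoef (K B a j n m : ℕ) : ℂ :=
  if n / 2 ^ (K - B) = m / 2 ^ (K - B) ∧ n / 2 ^ (K - a) = j then 1 else 0

/-- Points where the polynomial is small on the dyadic interval `j` of length `2^{-a}`. -/
def smallSet {X : Type*} (P : X → ℝ × ℝ × ℝ) (B a j : ℕ) : Set X :=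
  {x | ∀ v ∈ Icc ((j : ℝ) / 2 ^ a) (((j : ℝ) + 1) / 2 ^ a), |quad (P x) v| ≤ 100 / (2 ^ B) ^ 2}

theorem measurableSet_smallSet {X : Type*} [MeasurableSpace X] {P : X → ℝ × ℝ × ℝ}
    (hP : Measurable P) (B a j : ℕ) : MeasurableSet (smallSet P B a j) := by
  have hcl : IsClosed {p : ℝ × ℝ × ℝ | ∀ v ∈ Icc ((j : ℝ) / 2 ^ a) (((j : ℝ) + 1) / 2 ^ a),
      |quad p v| ≤ 100 / (2 ^ B) ^ 2} := by
    simp only [Set.ofPred_forall]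
    refine isClosed_iInter fun v => isClosed_iInter fun _ => ?_
    refine isClosed_le ?_ continuous_const
    unfold quad
    fun_prop
  exact hP hcl.measurableSet

theorem sum_pairs_le (T : Finset (ℕ × ℕ)) (S : Finset ℕ) (R : ℕ → Finset ℕ) (Φ : ℕ → ℕ → ℝ≥0∞)
    (h : ∀ t ∈ T, t.1 ∈ S ∧ t.2 ∈ R t.1) :
    ∑ t ∈ T, Φ t.1 t.2 ≤ ∑ a ∈ S, ∑ j ∈ R a, Φ a j := by
  rw [Finset.sum_sigma']
  have : ∑ t ∈ T, Φ t.1 t.2 =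
      ∑ s ∈ T.map (Equiv.sigmaEquivProd ℕ ℕ).symm.toEmbedding, Φ s.1 s.2 := by
    rw [Finset.sum_map]; rfl
  rw [this]
  refine Finset.sum_le_sum_of_subset fun s hs => ?_
  obtain ⟨t, ht, rfl⟩ := Finset.mem_map.1 hs
  exact Finset.mem_sigma.2 (h t ht)

variable {X : Type*} {C : Finset ℕ} {H : ℕ → ℕ → X → ℂ}

theorem measurable_pairSum [MeasurableSpace X] (hH : ∀ n m, Measurable (H n m)) (c : ℕ → ℕ → ℂ) :
    Measurable (pairSum C H c) := by
  unfold pairSum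
  exact Finset.measurable_sum _ fun n _ => Finset.measurable_sum _ fun m _ =>
    (hH n m).const_mul _

theorem pairSum_congr {c c' : ℕ → ℕ → ℂ} {x : X}
    (h : ∀ n ∈ C, ∀ m ∈ C, H n m x ≠ 0 → c n m = c' n m) :
    pairSum C H c x = pairSum C H c' x := by
  unfold pairSum
  refine Finset.sum_congr rfl fun n hn => Finset.sum_congr rfl fun m hm => ?_
  by_cases h0 : H n m x = 0
  · simp [h0]
  · rw [h n hn m hm h0]

theorem pairSum_sum {ι : Type*} (T : Finset ι) (c : ι → ℕ → ℕ → ℂ) (x : X) :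
    pairSum C H (fun n m => ∑ t ∈ T, c t n m) x = ∑ t ∈ T, pairSum C H (c t) x := by
  unfold pairSum
  simp only [Finset.sum_mul]
  symm
  rw [Finset.sum_comm]
  exact Finset.sum_congr rfl fun n _ => Finset.sum_comm

theorem pairSum_add (c c' : ℕ → ℕ → ℂ) (x : X) :
    pairSum C H (fun n m => c n m + c' n m) x = pairSum C H c x + pairSum C H c' x := by
  simp only [pairSum, add_mul, Finset.sum_add_distrib]

/-- Coefficients selecting the pairs in a given pair of blocks. -/
def blockCoef (K B : ℕ) (t : ℕ × ℕ) (n m : ℕ) : ℂ :=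
  if t = (n / 2 ^ (K - B), m / 2 ^ (K - B)) then 1 else 0

theorem exists_of_pairSum_blockCoef_ne_zero {K B : ℕ} {t : ℕ × ℕ} {x : X}
    (h : pairSum C H (blockCoef K B t) x ≠ 0) :
    ∃ n ∈ C, ∃ m ∈ C, H n m x ≠ 0 ∧ n / 2 ^ (K - B) = t.1 ∧ m / 2 ^ (K - B) = t.2 := by
  unfold pairSum at h
  obtain ⟨n, hn, h⟩ := Finset.exists_ne_zero_of_sum_ne_zero h
  obtain ⟨m, hm, h⟩ := Finset.exists_ne_zero_of_sum_ne_zero h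
  refine ⟨n, hn, m, hm, right_ne_zero_of_mul h, ?_⟩
  have := left_ne_zero_of_mul h
  unfold blockCoef at this
  rw [ne_eq, ite_eq_right_iff, Classical.not_imp] at this
  rw [this.1]
  exact ⟨rfl, rfl⟩

variable {Y : Type*} [MeasurableSpace X] [MeasurableSpace Y] {μ : Measure X} {ν : Measure Y}
  {κ₀ : ℝ≥0∞} {k N : ℕ} {f : ℕ → Y → ℂ} {P : X → ℝ × ℝ × ℝ}

/-- Kakeya-type pointwise bound at one frequency point. -/
theorem IsMultiscale.pointwise_kakeya (D : IsMultiscale μ ν κ₀ k N C f H P) {b a j : ℕ}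
    (hb : b ≤ N) (ha : a ≤ k * b) (x : X) :
    ‖pairSum C H (diagCoef (k * N) (k * b) a j) x‖ₑ ^ 2 ≤
      4 * ∑ a' ∈ Finset.Icc a (k * b),
        ∑ j' ∈ (Finset.range (2 ^ a')).filter (fun j' => j' / 2 ^ (a' - a) = j),
        (smallSet P (k * b) a' j').indicator
          (fun x => ‖pairSum C H (diagCoef (k * N) (k * b) a' j') x‖ₑ ^ 2) x := by
  classical
  set K := k * N with hK
  set B := k * b with hB
  have hBK : B ≤ K := Nat.mul_le_mul_left k hb
  set g : ℕ → ℂ := fun i => pairSum C H (blockCoef K B (i, i)) x with hg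
  have gne : ∀ i, g i ≠ 0 → ∃ n ∈ C, ∃ m ∈ C, H n m x ≠ 0 ∧ n / 2 ^ (K - B) = i ∧
      m / 2 ^ (K - B) = i := fun i hi => exists_of_pairSum_blockCoef_ne_zero hi
  set A : Finset ℕ := (Finset.range (2 ^ B)).filter fun i => g i ≠ 0 ∧ i / 2 ^ (B - a) = j with hA
  have ltB : ∀ n ∈ C, n / 2 ^ (K - B) < 2 ^ B := by
    intro n hn
    rw [Nat.div_lt_iff_lt_mul (by positivity), ← pow_add]
    have := D.lt n hn
    rwa [show B + (K - B) = K by omega]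
  have key : ∀ a' ∈ Finset.Icc a B, ∀ j', j' / 2 ^ (a' - a) = j →
      pairSum C H (diagCoef K B a' j') x = ∑ i ∈ A.filter (fun i => i / 2 ^ (B - a') = j'), g i := by
    intro a' ha' j' hj'
    rw [Finset.mem_Icc] at ha'
    have e1 : ∑ i ∈ A.filter (fun i => i / 2 ^ (B - a') = j'), g i =
        ∑ i ∈ (Finset.range (2 ^ B)).filter (fun i => i / 2 ^ (B - a') = j'), g i := by
      refine Finset.sum_subset ?_ ?_
      · intro i hi
        simp only [hA, Finset.mem_filter] at hi ⊢
        exact ⟨hi.1.1, hi.2⟩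
      · intro i hi hi'
        simp only [hA, Finset.mem_filter] at hi hi'
        by_contra h0
        refine hi' ⟨⟨hi.1, h0, ?_⟩, hi.2⟩
        rw [← div_two_pow_div ha'.1 ha'.2, hi.2, hj']
    rw [e1, hg, ← pairSum_sum]
    refine pairSum_congr fun n hn m hm _ => ?_
    simp only [diagCoef, blockCoef, Prod.mk.injEq]
    by_cases h : n / 2 ^ (K - B) = m / 2 ^ (K - B)
    · simp only [h, true_and, and_self]
      rw [Finset.sum_ite_eq']
      simp only [Finset.mem_filter, Finset.mem_range, ltB m hm, true_and]
      rw [← h, div_two_pow_div ha'.2 hBK]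
    · rw [if_neg (fun hh => h hh.1), Finset.sum_eq_zero]
      intro i _
      rw [if_neg]
      rintro ⟨rfl, h'⟩
      exact h h'
  have hact : ∀ i ∈ A, ∀ v ∈ Icc ((i : ℝ) / 2 ^ B) (((i : ℝ) + 1) / 2 ^ B),
      |quad (P x) v| ≤ 2 / (2 ^ B) ^ 2 := by
    intro i hi v hv
    simp only [hA, Finset.mem_filter, Finset.mem_range] at hi
    obtain ⟨n, hn, m, hm, hne, rfl, h2⟩ := gne i hi.2.1
    obtain ⟨h, hh, h', hh', w, hw, w', hw', hP⟩ := D.loc n hn m hm x hne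
    have l1 := (block_lower (n := n) hBK).trans hw.1
    have l2 := hw.2.trans (block_upper (n := n) hBK)
    have l3 := (block_lower (n := m) hBK).trans hw'.1
    have l4 := hw'.2.trans (block_upper (n := m) hBK)
    rw [h2] at l3 l4
    set i := n / 2 ^ (K - B)
    have hBpos : (0 : ℝ) < 2 ^ B := by positivity
    have il : ((i : ℝ) + 1) / 2 ^ B = i / 2 ^ B + 1 / 2 ^ B := by ring
    have iB : (i : ℝ) + 1 ≤ 2 ^ B := by exact_mod_cast hi.1
    have hv01 : v ∈ Icc (0 : ℝ) 1 := ⟨le_trans (by positivity) hv.1,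
      hv.2.trans ((div_le_one hBpos).2 iB)⟩
    have hPv := abs_le.1 (hP v hv01)
    rw [il] at l2 l4
    have hv2 := hv.2
    rw [il] at hv2
    have hv1 := hv.1
    have hKB : (1 / 2 ^ K : ℝ) ≤ 1 / 2 ^ B :=
      one_div_le_one_div_of_le hBpos (pow_le_pow_right₀ one_le_two hBK)
    have hκ : (1 : ℝ) / (10 ^ 8 * (2 ^ k) ^ 4) ≤ 1 / 2 := by
      apply one_div_le_one_div_of_le (by norm_num)
      have : (1 : ℝ) ≤ (2 ^ k) ^ 4 := one_le_pow₀ (one_le_pow₀ one_le_two)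
      nlinarith
    rw [show (2 : ℝ) / (2 ^ B) ^ 2 = 2 * (1 / 2 ^ B) ^ 2 by ring]
    set lam : ℝ := 1 / 2 ^ B
    have q1 : (v - w) ^ 2 ≤ lam ^ 2 := by
      apply sq_le_sq' <;> linarith
    have q2 : (v - w') ^ 2 ≤ lam ^ 2 := by
      apply sq_le_sq' <;> linarith
    have q3 : (1 / 2 ^ K : ℝ) ^ 2 ≤ lam ^ 2 := pow_le_pow_left₀ (by positivity) hKB 2
    have a1 : h * (v - w) ^ 2 ≤ 3 / 2 * lam ^ 2 :=
      mul_le_mul (by linarith [hh.2]) q1 (sq_nonneg _) (by norm_num)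
    have a2 : h' * (v - w') ^ 2 ≤ 3 / 2 * lam ^ 2 :=
      mul_le_mul (by linarith [hh'.2]) q2 (sq_nonneg _) (by norm_num)
    have a3 : 0 ≤ h * (v - w) ^ 2 := mul_nonneg (by linarith [hh.1]) (sq_nonneg _)
    have a4 : 0 ≤ h' * (v - w') ^ 2 := mul_nonneg (by linarith [hh'.1]) (sq_nonneg _)
    rw [abs_le]
    constructor <;> linarith [hPv.1, hPv.2, sq_nonneg lam]
  obtain ⟨T, hT4, hT, hcov⟩ := exists_cover (p := P x) (j := j) ha A
    (fun i hi => (Finset.mem_filter.1 hi).2.2) hact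
  have hAsum : pairSum C H (diagCoef K B a j) x = ∑ i ∈ A, g i := by
    rw [key a (Finset.mem_Icc.2 ⟨le_rfl, ha⟩) j (by simp)]
    congr 1
    refine Finset.filter_true_of_mem fun i hi => (Finset.mem_filter.1 hi).2.2
  rw [hAsum]
  refine (enorm_sum_sq_le_of_cover A g T (fun t ht => (hT t ht).2.1) hcov).trans ?_
  refine mul_le_mul' (by exact_mod_cast hT4) ?_
  have hz : ∀ t ∈ T, ¬ t.2 < 2 ^ t.1 →
      A.filter (fun i => i / 2 ^ (B - t.1) = t.2) = ∅ := by
    intro t ht hlt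
    refine Finset.filter_false_of_mem fun i hi h => hlt ?_
    rw [← h, Nat.div_lt_iff_lt_mul (by positivity), ← pow_add,
      show t.1 + (B - t.1) = B by have := (hT t ht).2.1; omega]
    exact Finset.mem_range.1 (Finset.mem_filter.1 hi).1
  rw [← Finset.sum_filter_of_ne (p := fun t : ℕ × ℕ => t.2 < 2 ^ t.1)]
  swap
  · intro t ht hne
    by_contra hlt
    rw [hz t ht hlt] at hne
    simp at hne
  refine le_trans ?_ (sum_pairs_le (T.filter fun t => t.2 < 2 ^ t.1) _ _ _ fun t ht => ?_)
  · refine Finset.sum_le_sum fun t ht => ?_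
    obtain ⟨h1, h2, h3, h4⟩ := hT t (Finset.mem_filter.1 ht).1
    rw [indicator_of_mem, key t.1 (Finset.mem_Icc.2 ⟨h1, h2⟩) t.2 h3]
    intro v hv
    refine (h4 v hv).trans ?_
    rw [show (49 : ℝ) * (2 / (2 ^ B) ^ 2) = 98 / (2 ^ B) ^ 2 by ring]
    gcongr
    norm_num
  · obtain ⟨h1, h2, h3, -⟩ := hT t (Finset.mem_filter.1 ht).1
    exact ⟨Finset.mem_Icc.2 ⟨h1, h2⟩, Finset.mem_filter.2
      ⟨Finset.mem_range.2 (Finset.mem_filter.1 ht).2, h3⟩⟩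

end

section

variable {X Y : Type*} [MeasurableSpace X] [MeasurableSpace Y] {μ : Measure X} {ν : Measure Y}
  {κ₀ : ℝ≥0∞} {k N : ℕ} {C : Finset ℕ} {f : ℕ → Y → ℂ} {H : ℕ → ℕ → X → ℂ} {P : X → ℝ × ℝ × ℝ}

/-- Coefficients selecting the pairs in a common block of length `2^{-B₀}` but in different blocks
of length `2^{-B}`, inside the dyadic interval `j` of length `2^{-a}`. -/
def offCoef (K B₀ B a j n m : ℕ) : ℂ :=
  if n / 2 ^ (K - B₀) = m / 2 ^ (K - B₀) ∧ n / 2 ^ (K - B) ≠ m / 2 ^ (K - B) ∧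
    n / 2 ^ (K - a) = j then 1 else 0

theorem diagCoef_eq_add {K B₀ B : ℕ} (h0 : B₀ ≤ B) (hB : B ≤ K) (a j n m : ℕ) :
    diagCoef K B₀ a j n m = diagCoef K B a j n m + offCoef K B₀ B a j n m := by
  unfold diagCoef offCoef
  by_cases h : n / 2 ^ (K - B) = m / 2 ^ (K - B)
  · have : n / 2 ^ (K - B₀) = m / 2 ^ (K - B₀) := by
      rw [← div_two_pow_div h0 hB, h, div_two_pow_div h0 hB]
    simp [h, this]
  · simp [h]

/-- On a wide interval where the polynomial is small the off-diagonal part vanishes. -/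
theorem IsMultiscale.off_eq_zero (D : IsMultiscale μ ν κ₀ k N C f H P) {b a j : ℕ}
    (hb : b < N) (ha : a ≤ k * b) (hj : j < 2 ^ a) (hbig : 404 * 2 ^ k * 2 ^ a < 2 ^ (k * b))
    {x : X} (hx : x ∈ smallSet P (k * b) a j) :
    pairSum C H (offCoef (k * N) (k * b) (k * (b + 1)) a j) x = 0 := by
  have hBK : k * (b + 1) ≤ k * N := Nat.mul_le_mul_left k hb
  have hB0K : k * b ≤ k * N := Nat.mul_le_mul_left k hb.le
  have haK : a ≤ k * N := ha.trans hB0K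
  rw [pairSum_congr (c' := fun _ _ => 0)]
  · simp [pairSum]
  intro n hn m hm hne
  unfold offCoef
  rw [if_neg]
  rintro ⟨h1, h2, h3⟩
  have h3' : m / 2 ^ (k * N - a) = j := by
    rw [← h3, ← div_two_pow_div ha hB0K, ← h1, div_two_pow_div ha hB0K]
  obtain ⟨h, hh, h', hh', w, hw, w', hw', hP⟩ := D.loc n hn m hm x hne
  have c1 := (block_lower (n := n) haK).trans hw.1
  have c2 := hw.2.trans (block_upper (n := n) haK)
  have c3 := (block_lower (n := m) haK).trans hw'.1
  have c4 := hw'.2.trans (block_upper (n := m) haK)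
  rw [h3] at c1 c2
  rw [h3'] at c3 c4
  have hsep : 1 / 2 ^ (k * (b + 1)) ≤ |w - w'| := by
    have d1 := (block_lower (n := n) hBK).trans hw.1
    have d2 := hw.2.trans (block_upper (n := n) hBK)
    have d3 := (block_lower (n := m) hBK).trans hw'.1
    have d4 := hw'.2.trans (block_upper (n := m) hBK)
    rcases D.sep n hn m hm b hb h1 h2 with hs | hs
    · have hs' : ((n / 2 ^ (k * N - k * (b + 1)) : ℕ) : ℝ) + 2 ≤
        (m / 2 ^ (k * N - k * (b + 1)) : ℕ) := by exact_mod_cast hs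
      have := div_le_div_of_nonneg_right hs' (by positivity : (0 : ℝ) ≤ 2 ^ (k * (b + 1)))
      rw [abs_sub_comm]
      refine le_trans ?_ (le_abs_self _)
      rw [add_div] at d2 this
      have : (2 : ℝ) / 2 ^ (k * (b + 1)) = 1 / 2 ^ (k * (b + 1)) + 1 / 2 ^ (k * (b + 1)) := by ring
      linarith
    · have hs' : ((m / 2 ^ (k * N - k * (b + 1)) : ℕ) : ℝ) + 2 ≤
        (n / 2 ^ (k * N - k * (b + 1)) : ℕ) := by exact_mod_cast hs
      have := div_le_div_of_nonneg_right hs' (by positivity : (0 : ℝ) ≤ 2 ^ (k * (b + 1)))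
      refine le_trans ?_ (le_abs_self _)
      rw [add_div] at d4 this
      have : (2 : ℝ) / 2 ^ (k * (b + 1)) = 1 / 2 ^ (k * (b + 1)) + 1 / 2 ^ (k * (b + 1)) := by ring
      linarith
  set s : ℝ := 1 / 2 ^ a with hs
  have ej : ((j : ℝ) + 1) / 2 ^ a = j / 2 ^ a + s := by rw [hs]; ring
  have hspos : 0 < s := by positivity
  have hj1 : ((j : ℝ) + 1) / 2 ^ a ≤ 1 := by
    rw [div_le_one (by positivity)]; exact_mod_cast hj
  rw [ej] at c2 c4 hj1
  set β : ℝ := 1 / 2 ^ (k * b) with hβ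
  have hβpos : 0 < β := by positivity
  have hℓ : (1 / 2 ^ (k * N) : ℝ) ≤ β :=
    one_div_le_one_div_of_le (by positivity) (pow_le_pow_right₀ one_le_two hB0K)
  have hℓ2 : (1 / 2 ^ (k * N) : ℝ) ^ 2 ≤ β ^ 2 := pow_le_pow_left₀ (by positivity) hℓ 2
  set Q : ℝ × ℝ × ℝ := (h * w ^ 2 - h' * w' ^ 2, -2 * h * w + 2 * h' * w', h - h') with hQ
  have hQe : ∀ v, quad Q v = h * (v - w) ^ 2 - h' * (v - w') ^ 2 := by
    intro v; simp only [quad, hQ]; ring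
  have hQs : ∀ v ∈ Icc ((j : ℝ) / 2 ^ a) (j / 2 ^ a + s), |quad Q v| ≤ 101 * β ^ 2 := by
    intro v hv
    have p1 := abs_le.1 (hx v (by rw [ej]; exact hv))
    have p2 := abs_le.1 (hP v ⟨le_trans (by positivity) hv.1, hv.2.trans hj1⟩)
    rw [show (100 : ℝ) / (2 ^ (k * b)) ^ 2 = 100 * β ^ 2 by rw [hβ]; ring] at p1
    rw [hQe, abs_le]
    constructor <;> linarith [p1.1, p1.2, p2.1, p2.2]
  have hd := abs_quad_deriv_le hspos hQs (v := w') ⟨c3, c4⟩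
  have hd' : Q.2.1 + 2 * Q.2.2 * w' = 2 * h * (w' - w) := by simp only [hQ]; ring
  rw [hd', abs_mul, abs_of_nonneg (by linarith [hh.1]), abs_sub_comm] at hd
  have hbigr : (404 : ℝ) * 2 ^ k * 2 ^ a < 2 ^ (k * b) := by exact_mod_cast hbig
  have hkk : (1 / 2 ^ (k * (b + 1)) : ℝ) = β * (1 / 2 ^ k) := by
    rw [hβ, mul_add, pow_add, mul_one]; field_simp
  rw [hkk] at hsep
  have l1 : 2 * (β * (1 / 2 ^ k)) * s ≤ 8 * (101 * β ^ 2) := by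
    refine le_trans ?_ hd
    have : β * (1 / 2 ^ k) ≤ h * |w - w'| :=
      hsep.trans (le_mul_of_one_le_left (abs_nonneg _) hh.1)
    nlinarith
  have l2 : s ≤ 404 * β * 2 ^ k := by
    have h2k : (0 : ℝ) < 2 ^ k := by positivity
    have : 2 * β * s ≤ 2 * β * (404 * β * 2 ^ k) := by
      have := mul_le_mul_of_nonneg_right l1 h2k.le
      calc 2 * β * s = 2 * (β * (1 / 2 ^ k)) * s * 2 ^ k := by field_simp
        _ ≤ _ := this
        _ = _ := by ring
    exact le_of_mul_le_mul_left this (by positivity)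
  rw [hs, hβ, div_le_iff₀ (by positivity)] at l2
  have l3 : 404 * (1 / 2 ^ (k * b)) * 2 ^ k * 2 ^ a = (404 * 2 ^ k * 2 ^ a) / (2 : ℝ) ^ (k * b) := by
    ring
  rw [l3, le_div_iff₀ (by positivity)] at l2
  linarith

/-- Pairs of distinct sibling blocks inside a dyadic interval. -/
def siblingPairs (B₀ B a j : ℕ) : Finset (ℕ × ℕ) :=
  (Finset.range (2 ^ B) ×ˢ Finset.range (2 ^ B)).filter fun t =>
    t.1 / 2 ^ (B - B₀) = t.2 / 2 ^ (B - B₀) ∧ t.1 ≠ t.2 ∧ t.1 / 2 ^ (B - a) = j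

/-- On a narrow interval the off-diagonal part obeys a Córdoba-type square function bound. -/
theorem IsMultiscale.off_pointwise (D : IsMultiscale μ ν κ₀ k N C f H P) {b a j : ℕ}
    (hb : b < N) (ha : a ≤ k * b) (hj : j < 2 ^ a)
    (hsmall : 2 ^ (k * b) ≤ 404 * 2 ^ k * 2 ^ a) (x : X) :
    ‖pairSum C H (offCoef (k * N) (k * b) (k * (b + 1)) a j) x‖ₑ ^ 2 ≤
      9 * ∑ t ∈ siblingPairs (k * b) (k * (b + 1)) a j,
        ‖pairSum C H (blockCoef (k * N) (k * (b + 1)) t) x‖ₑ ^ 2 := by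
  classical
  have hBK : k * (b + 1) ≤ k * N := Nat.mul_le_mul_left k hb
  have hB0B : k * b ≤ k * (b + 1) := Nat.mul_le_mul_left k (Nat.le_succ b)
  have haB : a ≤ k * (b + 1) := ha.trans hB0B
  set K := k * N with hK
  set B := k * (b + 1) with hB
  set Q := siblingPairs (k * b) B a j with hQ
  set Z : ℕ × ℕ → ℂ := fun t => pairSum C H (blockCoef K B t) x with hZ
  have ltB : ∀ n ∈ C, n / 2 ^ (K - B) < 2 ^ B := by
    intro n hn
    rw [Nat.div_lt_iff_lt_mul (by positivity), ← pow_add]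
    have := D.lt n hn
    rwa [show B + (K - B) = K by omega]
  have e1 : pairSum C H (offCoef K (k * b) B a j) x = ∑ t ∈ Q, Z t := by
    rw [hZ, ← pairSum_sum]
    refine pairSum_congr fun n hn m hm _ => ?_
    unfold blockCoef offCoef
    rw [Finset.sum_ite_eq']
    congr 1
    simp only [hQ, siblingPairs, Finset.mem_filter, Finset.mem_product, Finset.mem_range, ltB n hn,
      ltB m hm, div_two_pow_div hB0B hBK, div_two_pow_div haB hBK, true_and, and_self]
  set A := Q.filter fun t => Z t ≠ 0 with hA
  have e2 : ∑ t ∈ Q, Z t = ∑ t ∈ A, Z t := (Finset.sum_filter_ne_zero Q).symm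
  have close : ∀ t ∈ A, ∀ t' ∈ A, (t'.1 ≤ t.1 + 1 ∧ t.1 ≤ t'.1 + 1) ∧
      (t'.2 ≤ t.2 + 1 ∧ t.2 ≤ t'.2 + 1) := by
    have data : ∀ t ∈ A, ∃ h ∈ Icc (1 : ℝ) (1 + 1 / (10 ^ 8 * (2 ^ k) ^ 4)),
        ∃ h' ∈ Icc (1 : ℝ) (1 + 1 / (10 ^ 8 * (2 ^ k) ^ 4)),
        ∃ w ∈ Icc ((t.1 : ℝ) / 2 ^ B) (((t.1 : ℝ) + 1) / 2 ^ B),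
        ∃ w' ∈ Icc ((t.2 : ℝ) / 2 ^ B) (((t.2 : ℝ) + 1) / 2 ^ B),
        w ∈ Icc ((j : ℝ) / 2 ^ a) (j / 2 ^ a + 1 / 2 ^ a) ∧
        w' ∈ Icc ((j : ℝ) / 2 ^ a) (j / 2 ^ a + 1 / 2 ^ a) ∧ 1 / 2 ^ B ≤ |w - w'| ∧
        ∀ v ∈ Icc (0 : ℝ) 1, |quad (P x) v - (h * (v - w) ^ 2 - h' * (v - w') ^ 2)| ≤
          (1 / 2 ^ K) ^ 2 / 8 := by
      intro t ht
      obtain ⟨htQ, htZ⟩ := Finset.mem_filter.1 ht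
      obtain ⟨n, hn, m, hm, hne, rfl', rfl''⟩ := exists_of_pairSum_blockCoef_ne_zero htZ
      obtain ⟨t1, t2⟩ := t
      simp only at rfl' rfl''
      subst rfl' rfl''
      obtain ⟨h, hh, h', hh', w, hw, w', hw', hP⟩ := D.loc n hn m hm x hne
      simp only [hQ, siblingPairs, Finset.mem_filter, Finset.mem_product, Finset.mem_range] at htQ
      obtain ⟨-, q1, q2, q3⟩ := htQ
      have q4 : m / 2 ^ (K - B) / 2 ^ (B - a) = j := by
        rw [← q3, div_two_pow_div haB hBK, div_two_pow_div haB hBK]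
        rw [div_two_pow_div hB0B hBK, div_two_pow_div hB0B hBK] at q1
        rw [← div_two_pow_div ha (hB0B.trans hBK), ← q1, div_two_pow_div ha (hB0B.trans hBK)]
      have d1 := (block_lower (n := n) hBK).trans hw.1
      have d2 := hw.2.trans (block_upper (n := n) hBK)
      have d3 := (block_lower (n := m) hBK).trans hw'.1
      have d4 := hw'.2.trans (block_upper (n := m) hBK)
      refine ⟨h, hh, h', hh', w, ⟨d1, d2⟩, w', ⟨d3, d4⟩, ?_, ?_, ?_, hP⟩
      · have c1 := (block_lower (n := n / 2 ^ (K - B)) haB).trans d1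
        have c2 := d2.trans (block_upper (n := n / 2 ^ (K - B)) haB)
        rw [q3] at c1 c2
        exact ⟨c1, c2.trans (le_of_eq (by ring))⟩
      · have c1 := (block_lower (n := m / 2 ^ (K - B)) haB).trans d3
        have c2 := d4.trans (block_upper (n := m / 2 ^ (K - B)) haB)
        rw [q4] at c1 c2
        exact ⟨c1, c2.trans (le_of_eq (by ring))⟩
      · rw [div_two_pow_div hB0B hBK, div_two_pow_div hB0B hBK] at q1
        rcases D.sep n hn m hm b hb q1 q2 with hs | hs
        · have hs' : ((n / 2 ^ (K - B) : ℕ) : ℝ) + 2 ≤ (m / 2 ^ (K - B) : ℕ) := by exact_mod_cast hs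
          have := div_le_div_of_nonneg_right hs' (by positivity : (0 : ℝ) ≤ 2 ^ B)
          rw [abs_sub_comm]
          refine le_trans ?_ (le_abs_self _)
          rw [add_div] at d2 this
          have : (2 : ℝ) / 2 ^ B = 1 / 2 ^ B + 1 / 2 ^ B := by ring
          linarith
        · have hs' : ((m / 2 ^ (K - B) : ℕ) : ℝ) + 2 ≤ (n / 2 ^ (K - B) : ℕ) := by exact_mod_cast hs
          have := div_le_div_of_nonneg_right hs' (by positivity : (0 : ℝ) ≤ 2 ^ B)
          refine le_trans ?_ (le_abs_self _)
          rw [add_div] at d4 this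
          have : (2 : ℝ) / 2 ^ B = 1 / 2 ^ B + 1 / 2 ^ B := by ring
          linarith
    intro t ht t' ht'
    obtain ⟨h, hh, h', hh', w, hw, w', hw', hwa, hwa', hd, hP⟩ := data t ht
    obtain ⟨i, hi, i', hi', z, hz, z', hz', hza, hza', -, hP'⟩ := data t' ht'
    have hj1 : (j : ℝ) / 2 ^ a + 1 / 2 ^ a ≤ 1 := by
      rw [← add_div, div_le_one (by positivity)]; exact_mod_cast hj
    have sub : ∀ v ∈ Icc ((j : ℝ) / 2 ^ a) (j / 2 ^ a + 1 / 2 ^ a), v ∈ Icc (0 : ℝ) 1 :=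
      fun v hv => ⟨le_trans (by positivity) hv.1, hv.2.trans hj1⟩
    have hnum : 2 * ((1 / 2 ^ K) ^ 2 / 8) + 6 * (1 / (10 ^ 8 * (2 ^ k) ^ 4)) * (1 / 2 ^ a) ^ 2 ≤
        (1 / 2 ^ B : ℝ) ^ 2 / 3 := by
      have hℓ : (1 / 2 ^ K : ℝ) ≤ 1 / 2 ^ B :=
        one_div_le_one_div_of_le (by positivity) (pow_le_pow_right₀ one_le_two hBK)
      have hℓ2 : (1 / 2 ^ K : ℝ) ^ 2 ≤ (1 / 2 ^ B) ^ 2 := pow_le_pow_left₀ (by positivity) hℓ 2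
      have hs : (2 : ℝ) ^ (k * b) ≤ 404 * 2 ^ k * 2 ^ a := by exact_mod_cast hsmall
      have hBe : (2 : ℝ) ^ B = 2 ^ (k * b) * 2 ^ k := by rw [hB, mul_add, pow_add, mul_one]
      have hs2 : (2 : ℝ) ^ B ≤ 404 * (2 ^ k) ^ 2 * 2 ^ a := by
        rw [hBe]
        have := mul_le_mul_of_nonneg_right hs (by positivity : (0 : ℝ) ≤ 2 ^ k)
        linarith
      have hs3 : (1 / 2 ^ a : ℝ) ≤ 404 * (2 ^ k) ^ 2 * (1 / 2 ^ B) := by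
        rw [mul_one_div, div_le_div_iff₀ (by positivity) (by positivity)]; linarith
      have hs4 := pow_le_pow_left₀ (by positivity) hs3 2
      have : 6 * (1 / (10 ^ 8 * (2 ^ k) ^ 4)) * (1 / 2 ^ a : ℝ) ^ 2 ≤
          6 * (1 / (10 ^ 8 * (2 ^ k) ^ 4)) * (404 * (2 ^ k) ^ 2 * (1 / 2 ^ B)) ^ 2 := by gcongr
      have e : 6 * (1 / (10 ^ 8 * (2 ^ k) ^ 4)) * (404 * (2 ^ k) ^ 2 * (1 / 2 ^ B)) ^ 2 =
          (6 * 404 ^ 2 / 10 ^ 8) * (1 / 2 ^ B : ℝ) ^ 2 := by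
        field_simp
      rw [e] at this
      nlinarith [sq_nonneg (1 / 2 ^ B : ℝ)]
    obtain ⟨r1, r2⟩ := pair_close (p := P x) (by positivity)
      (one_div_le_one_div_of_le (by positivity) (pow_le_pow_right₀ one_le_two haB))
      hnum hh hh' hi hi' hwa hwa' hza hza' hd
      (fun v hv => hP v (sub v hv)) (fun v hv => hP' v (sub v hv))
    have fin : ∀ (m m' : ℕ) (u u' : ℝ), u ∈ Icc ((m : ℝ) / 2 ^ B) (((m : ℝ) + 1) / 2 ^ B) →
        u' ∈ Icc ((m' : ℝ) / 2 ^ B) (((m' : ℝ) + 1) / 2 ^ B) → |u - u'| < 1 / 2 ^ B →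
        m' ≤ m + 1 := by
      intro m m' u u' hu hu' huu
      have := (abs_lt.1 huu).1
      have h3 : (m' : ℝ) / 2 ^ B < (m + 2) / 2 ^ B := by
        have : ((m : ℝ) + 2) / 2 ^ B = (m + 1) / 2 ^ B + 1 / 2 ^ B := by ring
        linarith [hu.2, hu'.1]
      rw [div_lt_div_iff_of_pos_right (by positivity)] at h3
      have : m' < m + 2 := by exact_mod_cast h3
      omega
    exact ⟨⟨fin _ _ _ _ hw hz r1, fin _ _ _ _ hz hw (by rwa [abs_sub_comm])⟩,
      ⟨fin _ _ _ _ hw' hz' r2, fin _ _ _ _ hz' hw' (by rwa [abs_sub_comm])⟩⟩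
  have hcard : A.card ≤ 9 := by
    rcases A.eq_empty_or_nonempty with h | ⟨t, ht⟩
    · simp [h]
    · have : A ⊆ Finset.Icc (t.1 - 1) (t.1 + 1) ×ˢ Finset.Icc (t.2 - 1) (t.2 + 1) := by
        intro t' ht'
        have := close t ht t' ht'
        simp only [Finset.mem_product, Finset.mem_Icc]
        omega
      refine (Finset.card_le_card this).trans ?_
      rw [Finset.card_product, Nat.card_Icc, Nat.card_Icc]
      calc _ ≤ 3 * 3 := Nat.mul_le_mul (by omega) (by omega)
        _ = 9 := rfl
  rw [e1, e2]
  refine (enorm_sum_sq_le A Z).trans (mul_le_mul' (by exact_mod_cast hcard) ?_)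
  exact Finset.sum_le_sum_of_subset (Finset.filter_subset _ _)

end

section

variable {X Y : Type*} [MeasurableSpace X] [MeasurableSpace Y] {μ : Measure X} {ν : Measure Y}
  {κ₀ : ℝ≥0∞} {k N : ℕ} {C : Finset ℕ} {f : ℕ → Y → ℂ} {H : ℕ → ℕ → X → ℂ} {P : X → ℝ × ℝ × ℝ}

theorem sum_enorm_sq_eq {ι : Type*} (T : Finset ι) (F : ι → ℂ) :
    ‖∑ i ∈ T, F i * starRingEnd ℂ (F i)‖ₑ = ∑ i ∈ T, ‖F i‖ₑ ^ 2 := by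
  have : ∑ i ∈ T, F i * starRingEnd ℂ (F i) = ((∑ i ∈ T, ‖F i‖ ^ 2 : ℝ) : ℂ) := by
    push_cast
    exact Finset.sum_congr rfl fun i _ => by rw [Complex.mul_conj, Complex.normSq_eq_norm_sq]; simp
  rw [this, ← ofReal_norm, Complex.norm_real, Real.norm_of_nonneg (by positivity),
    ENNReal.ofReal_sum_of_nonneg (fun _ _ => by positivity)]
  refine Finset.sum_congr rfl fun i _ => ?_
  rw [ENNReal.ofReal_pow (norm_nonneg _), ofReal_norm]

theorem IsMultiscale.sum_block_le (D : IsMultiscale μ ν κ₀ k N C f H P) {b a j : ℕ}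
    (hb : b < N) (ha : a ≤ k * b) :
    ∑ t ∈ siblingPairs (k * b) (k * (b + 1)) a j,
      ∫⁻ x, ‖pairSum C H (blockCoef (k * N) (k * (b + 1)) t) x‖ₑ ^ 2 ∂μ ≤
    ∫⁻ x, ‖pairSum C H (diagCoef (k * N) (k * (b + 1)) a j) x‖ₑ ^ 2 ∂μ := by
  classical
  have hBK : k * (b + 1) ≤ k * N := Nat.mul_le_mul_left k hb
  have hB0B : k * b ≤ k * (b + 1) := Nat.mul_le_mul_left k (Nat.le_succ b)
  have haB : a ≤ k * (b + 1) := ha.trans hB0B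
  set K := k * N with hK
  set B := k * (b + 1) with hB
  have ltB : ∀ n ∈ C, n / 2 ^ (K - B) < 2 ^ B := by
    intro n hn
    rw [Nat.div_lt_iff_lt_mul (by positivity), ← pow_add]
    have := D.lt n hn
    rwa [show B + (K - B) = K by omega]
  set F : ℕ → Y → ℂ := fun i y => ∑ n ∈ C, (if i = n / 2 ^ (K - B) then 1 else 0) * f n y with hF
  have hFm : ∀ i, Measurable (F i) := fun i =>
    Finset.measurable_sum _ fun n _ => (D.meas_f n).const_mul _
  have e1 : ∀ t y, pairSum C (fun n m y => f n y * starRingEnd ℂ (f m y)) (blockCoef K B t) y =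
      F t.1 y * starRingEnd ℂ (F t.2 y) := by
    intro t y
    simp only [hF, map_sum, Finset.sum_mul_sum, pairSum]
    refine Finset.sum_congr rfl fun n _ => Finset.sum_congr rfl fun m _ => ?_
    obtain ⟨i, i'⟩ := t
    simp only [blockCoef, Prod.mk.injEq, map_mul]
    by_cases h1 : i = n / 2 ^ (K - B) <;> by_cases h2 : i' = m / 2 ^ (K - B) <;> simp [h1, h2]
  set T := (Finset.range (2 ^ B)).filter fun i => i / 2 ^ (B - a) = j with hT
  have e2 : ∀ y, pairSum C (fun n m y => f n y * starRingEnd ℂ (f m y)) (diagCoef K B a j) y =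
      ∑ i ∈ T, F i y * starRingEnd ℂ (F i y) := by
    intro y
    rw [← Finset.sum_congr rfl fun i _ => e1 (i, i) y, ← pairSum_sum]
    refine pairSum_congr fun n hn m hm _ => ?_
    simp only [diagCoef, blockCoef, Prod.mk.injEq]
    by_cases h : n / 2 ^ (K - B) = m / 2 ^ (K - B)
    · simp only [h, true_and, and_self]
      rw [Finset.sum_ite_eq']
      simp only [hT, Finset.mem_filter, Finset.mem_range, ltB m hm, true_and]
      rw [← h, div_two_pow_div haB hBK]
    · rw [if_neg (fun hh => h hh.1), Finset.sum_eq_zero]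
      intro i _
      rw [if_neg]
      rintro ⟨rfl, h'⟩
      exact h h'
  simp_rw [D.norm, e1, e2, sum_enorm_sq_eq, enorm_mul, mul_pow]
  rw [← Finset.mul_sum, ← lintegral_finsetSum']
  · gcongr with y
    rw [sq (∑ i ∈ T, ‖F i y‖ₑ ^ 2), Finset.sum_mul_sum, ← Finset.sum_product']
    have hc : ∀ z : ℂ, ‖starRingEnd ℂ z‖ₑ = ‖z‖ₑ := fun z => by
      rw [← ofReal_norm, Complex.norm_conj, ofReal_norm]
    simp_rw [hc]
    refine Finset.sum_le_sum_of_subset fun t ht => ?_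
    simp only [siblingPairs, Finset.mem_filter, Finset.mem_product, Finset.mem_range] at ht
    obtain ⟨⟨h1, h2⟩, h3, -, h4⟩ := ht
    simp only [hT, Finset.mem_product, Finset.mem_filter, Finset.mem_range]
    refine ⟨⟨h1, h4⟩, h2, ?_⟩
    rw [← h4, ← div_two_pow_div ha hB0B, ← h3, div_two_pow_div ha hB0B]
  · intro t _
    have : Measurable fun y => starRingEnd ℂ (F t.2 y) :=
      Complex.continuous_conj.measurable.comp (hFm t.2)
    exact (((hFm t.1).enorm.pow_const 2).mul (this.enorm.pow_const 2)).aemeasurable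

/-- Passing to a finer scale of diagonal blocks. -/
theorem IsMultiscale.lintegral_diag_le (D : IsMultiscale μ ν κ₀ k N C f H P) {b a j : ℕ}
    (hb : b < N) (ha : a ≤ k * b) (hj : j < 2 ^ a) :
    ∫⁻ x in smallSet P (k * b) a j, ‖pairSum C H (diagCoef (k * N) (k * b) a j) x‖ₑ ^ 2 ∂μ ≤
      20 * ∫⁻ x, ‖pairSum C H (diagCoef (k * N) (k * (b + 1)) a j) x‖ₑ ^ 2 ∂μ := by
  have hBK : k * (b + 1) ≤ k * N := Nat.mul_le_mul_left k hb
  have hB0B : k * b ≤ k * (b + 1) := Nat.mul_le_mul_left k (Nat.le_succ b)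
  have split : ∀ x, pairSum C H (diagCoef (k * N) (k * b) a j) x =
      pairSum C H (diagCoef (k * N) (k * (b + 1)) a j) x +
      pairSum C H (offCoef (k * N) (k * b) (k * (b + 1)) a j) x := by
    intro x
    rw [← pairSum_add]
    congr 1
    funext n m
    exact diagCoef_eq_add hB0B hBK a j n m
  set I := ∫⁻ x, ‖pairSum C H (diagCoef (k * N) (k * (b + 1)) a j) x‖ₑ ^ 2 ∂μ with hI
  rcases lt_or_ge (404 * 2 ^ k * 2 ^ a) (2 ^ (k * b)) with h | h
  · calc _ = ∫⁻ x in smallSet P (k * b) a j,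
          ‖pairSum C H (diagCoef (k * N) (k * (b + 1)) a j) x‖ₑ ^ 2 ∂μ := by
          refine setLIntegral_congr_fun (measurableSet_smallSet D.meas_P _ _ _) fun x hx => ?_
          simp only [split, D.off_eq_zero hb ha hj h hx, add_zero]
      _ ≤ I := setLIntegral_le_lintegral _ _
      _ ≤ 20 * I := le_mul_of_one_le_left' (by norm_num)
  · have off : ∫⁻ x, ‖pairSum C H (offCoef (k * N) (k * b) (k * (b + 1)) a j) x‖ₑ ^ 2 ∂μ ≤
        9 * I := by
      calc _ ≤ ∫⁻ x, 9 * ∑ t ∈ siblingPairs (k * b) (k * (b + 1)) a j,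
            ‖pairSum C H (blockCoef (k * N) (k * (b + 1)) t) x‖ₑ ^ 2 ∂μ :=
            lintegral_mono fun x => D.off_pointwise hb ha hj h x
        _ = 9 * ∑ t ∈ siblingPairs (k * b) (k * (b + 1)) a j,
            ∫⁻ x, ‖pairSum C H (blockCoef (k * N) (k * (b + 1)) t) x‖ₑ ^ 2 ∂μ := by
            rw [lintegral_const_mul, lintegral_finsetSum]
            · exact fun t _ => (measurable_pairSum D.meas_H _).enorm.pow_const 2
            · exact Finset.measurable_sum _ fun t _ =>
                (measurable_pairSum D.meas_H _).enorm.pow_const 2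
        _ ≤ _ := by gcongr; exact D.sum_block_le hb ha
    calc _ ≤ ∫⁻ x, ‖pairSum C H (diagCoef (k * N) (k * b) a j) x‖ₑ ^ 2 ∂μ :=
          setLIntegral_le_lintegral _ _
      _ ≤ ∫⁻ x, 2 * ‖pairSum C H (diagCoef (k * N) (k * (b + 1)) a j) x‖ₑ ^ 2 +
          2 * ‖pairSum C H (offCoef (k * N) (k * b) (k * (b + 1)) a j) x‖ₑ ^ 2 ∂μ := by
          refine lintegral_mono fun x => ?_
          simp only [split]
          exact enorm_add_sq_le _ _
      _ ≤ 2 * I + 2 * (9 * I) := by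
          have m1 := fun c => (measurable_pairSum D.meas_H c (C := C)).enorm.pow_const 2
          rw [lintegral_add_left ((m1 _).const_mul 2), lintegral_const_mul _ (m1 _),
            lintegral_const_mul _ (m1 _)]
          gcongr
      _ = 20 * I := by ring

/-- The total mass at scale `b` of the diagonal parts restricted to dyadic pieces. -/
def scaleMass (μ : Measure X) (k N : ℕ) (C : Finset ℕ) (H : ℕ → ℕ → X → ℂ)
    (P : X → ℝ × ℝ × ℝ) (b a : ℕ) : ℝ≥0∞ :=
  ∑ j ∈ Finset.range (2 ^ a), ∫⁻ x in smallSet P (k * b) a j,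
    ‖pairSum C H (diagCoef (k * N) (k * b) a j) x‖ₑ ^ 2 ∂μ

theorem IsMultiscale.scaleMass_le (D : IsMultiscale μ ν κ₀ k N C f H P) {b a : ℕ}
    (hb : b < N) (ha : a ≤ k * b) :
    scaleMass μ k N C H P b a ≤
      80 * ∑ a' ∈ Finset.Icc a (k * (b + 1)), scaleMass μ k N C H P (b + 1) a' := by
  classical
  have hB0B : k * b ≤ k * (b + 1) := Nat.mul_le_mul_left k (Nat.le_succ b)
  have step : ∀ j ∈ Finset.range (2 ^ a), ∫⁻ x in smallSet P (k * b) a j,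
      ‖pairSum C H (diagCoef (k * N) (k * b) a j) x‖ₑ ^ 2 ∂μ ≤
      80 * ∑ a' ∈ Finset.Icc a (k * (b + 1)),
        ∑ j' ∈ (Finset.range (2 ^ a')).filter (fun j' => j' / 2 ^ (a' - a) = j),
        ∫⁻ x in smallSet P (k * (b + 1)) a' j',
          ‖pairSum C H (diagCoef (k * N) (k * (b + 1)) a' j') x‖ₑ ^ 2 ∂μ := by
    intro j hj
    refine (D.lintegral_diag_le hb ha (Finset.mem_range.1 hj)).trans ?_
    have hm : ∀ a' j', Measurable ((smallSet P (k * (b + 1)) a' j').indicator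
          (fun x => ‖pairSum C H (diagCoef (k * N) (k * (b + 1)) a' j') x‖ₑ ^ 2)) := fun a' j' =>
      ((measurable_pairSum D.meas_H _).enorm.pow_const 2).indicator
        (measurableSet_smallSet D.meas_P _ _ _)
    calc _ ≤ 20 * ∫⁻ x, 4 * ∑ a' ∈ Finset.Icc a (k * (b + 1)),
          ∑ j' ∈ (Finset.range (2 ^ a')).filter (fun j' => j' / 2 ^ (a' - a) = j),
          (smallSet P (k * (b + 1)) a' j').indicator
          (fun x => ‖pairSum C H (diagCoef (k * N) (k * (b + 1)) a' j') x‖ₑ ^ 2) x ∂μ := by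
          gcongr with x
          exact D.pointwise_kakeya hb (ha.trans hB0B) x
      _ = _ := by
          rw [lintegral_const_mul, ← mul_assoc, lintegral_finsetSum]
          · norm_num
            refine congrArg _ (Finset.sum_congr rfl fun a' _ => ?_)
            rw [lintegral_finsetSum _ fun j' _ => hm a' j']
            refine Finset.sum_congr rfl fun j' _ => ?_
            rw [lintegral_indicator (measurableSet_smallSet D.meas_P _ _ _)]
          · exact fun a' _ => Finset.measurable_sum _ fun j' _ => hm a' j'
          · exact Finset.measurable_sum _ fun a' _ => Finset.measurable_sum _ fun j' _ => hm a' j'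
  refine (Finset.sum_le_sum step).trans (le_of_eq ?_)
  rw [← Finset.mul_sum, Finset.sum_comm]
  refine congrArg _ (Finset.sum_congr rfl fun a' ha' => ?_)
  unfold scaleMass
  rw [Finset.sum_fiberwise_of_maps_to]
  intro j' hj'
  rw [Finset.mem_Icc] at ha'
  rw [Finset.mem_range] at *
  rw [Nat.div_lt_iff_lt_mul (by positivity), ← pow_add, show a + (a' - a) = a' by omega]
  exact hj'

theorem sum_Icc_pow_le {y : ℝ} {k K a B : ℕ} (hk : 0 < k) (hy : y = 1 + 1 / k) (haB : a ≤ B)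
    (hB : B ≤ K) : ∑ a' ∈ Finset.Icc a B, y ^ (K - a') ≤ (k + 1) * y ^ (K - a) := by
  have hk' : (0 : ℝ) < k := by exact_mod_cast hk
  have hy0 : 0 < y := by rw [hy]; positivity
  have key : ∑ a' ∈ Finset.Icc a B, y ^ (K - a') + k * y ^ (K - B) ≤ (k + 1) * y ^ (K - a) := by
    induction B, haB using Nat.le_induction with
    | base => simp; linarith
    | succ B hB' ih =>
      have := ih (by omega)
      rw [Finset.sum_Icc_succ_top (by omega)]
      have e : y ^ (K - B) = y * y ^ (K - (B + 1)) := by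
        rw [← pow_succ']; congr 1; omega
      rw [e] at this
      have : k * (y * y ^ (K - (B + 1))) = (k + 1) * y ^ (K - (B + 1)) := by
        rw [hy]; field_simp
      linarith
  have : 0 ≤ k * y ^ (K - B) := by positivity
  linarith

/-- The multiscale inequality: the full sum is controlled by the finest-scale diagonal masses. -/
theorem IsMultiscale.lintegral_le (D : IsMultiscale μ ν κ₀ k N C f H P) (hk : 0 < k)
    (Z : ℝ≥0∞) (hZ : ∀ a ≤ k * N, scaleMass μ k N C H P N a ≤ Z) :
    ∫⁻ x, ‖pairSum C H (fun _ _ => 1) x‖ₑ ^ 2 ∂μ ≤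
      ENNReal.ofReal ((240 * ((k : ℝ) + 1)) ^ N) * Z := by
  set y : ℝ := 1 + 1 / k with hy
  have hk' : (0 : ℝ) < k := by exact_mod_cast hk
  have hy0 : 0 < y := by rw [hy]; positivity
  have hy1 : 1 ≤ y := by rw [hy]; simp
  have ind : ∀ i ≤ N, ∀ a ≤ k * (N - i), scaleMass μ k N C H P (N - i) a ≤
      ENNReal.ofReal ((80 * ((k : ℝ) + 1)) ^ i * y ^ (k * N - a)) * Z := by
    intro i
    induction i with
    | zero =>
      intro _ a ha
      refine (hZ a ha).trans (le_mul_of_one_le_left' ?_)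
      rw [ENNReal.one_le_ofReal, pow_zero, one_mul]
      exact one_le_pow₀ hy1
    | succ i ih =>
      intro hi a ha
      have e : N - (i + 1) + 1 = N - i := by omega
      refine (D.scaleMass_le (by omega) ha).trans ?_
      rw [e]
      have hle : k * (N - i) ≤ k * N := Nat.mul_le_mul_left k (Nat.sub_le _ _)
      calc _ ≤ 80 * ∑ a' ∈ Finset.Icc a (k * (N - i)),
            ENNReal.ofReal ((80 * ((k : ℝ) + 1)) ^ i * y ^ (k * N - a')) * Z := by
            gcongr with a' ha'
            exact ih (by omega) a' (Finset.mem_Icc.1 ha').2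
        _ = ENNReal.ofReal (80 * ((80 * ((k : ℝ) + 1)) ^ i *
            ∑ a' ∈ Finset.Icc a (k * (N - i)), y ^ (k * N - a'))) * Z := by
            rw [← Finset.sum_mul, ← ENNReal.ofReal_sum_of_nonneg (fun _ _ => by positivity),
              ← Finset.mul_sum, ENNReal.ofReal_mul (p := 80) (by norm_num), mul_assoc]
            norm_num
        _ ≤ _ := by
            refine mul_le_mul' (ENNReal.ofReal_le_ofReal ?_) le_rfl
            have := sum_Icc_pow_le (K := k * N) hk hy
              (ha.trans (Nat.mul_le_mul_left k (by omega))) hle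
            calc _ ≤ 80 * ((80 * ((k : ℝ) + 1)) ^ i * ((k + 1) * y ^ (k * N - a))) := by
                  have h8 : (0 : ℝ) ≤ (80 * ((k : ℝ) + 1)) ^ i := by positivity
                  exact mul_le_mul_of_nonneg_left (mul_le_mul_of_nonneg_left this h8) (by norm_num)
              _ = _ := by ring
  have h0 := ind N le_rfl 0 (Nat.zero_le _)
  have e0 : scaleMass μ k N C H P 0 0 = ∫⁻ x, ‖pairSum C H (fun _ _ => 1) x‖ₑ ^ 2 ∂μ := by
    unfold scaleMass
    simp only [pow_zero, Finset.range_one, Finset.sum_singleton, mul_zero]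
    have hc : ∀ x, pairSum C H (diagCoef (k * N) 0 0 0) x = pairSum C H (fun _ _ => 1) x := by
      intro x
      refine pairSum_congr fun n hn m hm _ => ?_
      have h1 := Nat.div_eq_of_lt (D.lt n hn)
      have h2 := Nat.div_eq_of_lt (D.lt m hm)
      simp [diagCoef, h1, h2]
    simp only [hc]
    rw [← lintegral_indicator (measurableSet_smallSet D.meas_P _ _ _)]
    refine lintegral_congr fun x => ?_
    by_cases hx : x ∈ smallSet P 0 0 0
    · rw [indicator_of_mem hx]
    · rw [indicator_of_notMem hx]
      symm
      suffices hs : pairSum C H (fun _ _ => 1) x = 0 by simp [hs]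
      rw [pairSum_congr (c' := fun _ _ => 0)]
      · simp [pairSum]
      intro n hn m hm hne
      exfalso
      refine hx fun v hv => ?_
      simp only [Nat.cast_zero, pow_zero, zero_add, div_one] at hv
      obtain ⟨h, hh, h', hh', w, hw, w', hw', hP⟩ := D.loc n hn m hm x hne
      have hKpos : (0 : ℝ) < 2 ^ (k * N) := by positivity
      have u1 : ((n : ℝ) + 1) / 2 ^ (k * N) ≤ 1 := by
        rw [div_le_one hKpos]; exact_mod_cast D.lt n hn
      have u2 : ((m : ℝ) + 1) / 2 ^ (k * N) ≤ 1 := by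
        rw [div_le_one hKpos]; exact_mod_cast D.lt m hm
      have w0 : 0 ≤ w := le_trans (by positivity) hw.1
      have w0' : 0 ≤ w' := le_trans (by positivity) hw'.1
      have w1 := hw.2.trans u1
      have w1' := hw'.2.trans u2
      have hκ : (1 : ℝ) / (10 ^ 8 * (2 ^ k) ^ 4) ≤ 1 / 2 := by
        apply one_div_le_one_div_of_le (by norm_num)
        have : (1 : ℝ) ≤ (2 ^ k) ^ 4 := one_le_pow₀ (one_le_pow₀ one_le_two)
        nlinarith
      have q1 : (v - w) ^ 2 ≤ 1 := by nlinarith [hv.1, hv.2]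
      have q2 : (v - w') ^ 2 ≤ 1 := by nlinarith [hv.1, hv.2]
      have q3 : (1 / 2 ^ (k * N) : ℝ) ^ 2 ≤ 1 := by
        apply pow_le_one₀ (by positivity)
        rw [div_le_one hKpos]
        exact one_le_pow₀ one_le_two
      have a1 : h * (v - w) ^ 2 ≤ 3 / 2 * 1 :=
        mul_le_mul (by linarith [hh.2]) q1 (sq_nonneg _) (by norm_num)
      have a2 : h' * (v - w') ^ 2 ≤ 3 / 2 * 1 :=
        mul_le_mul (by linarith [hh'.2]) q2 (sq_nonneg _) (by norm_num)
      have a3 : 0 ≤ h * (v - w) ^ 2 := mul_nonneg (by linarith [hh.1]) (sq_nonneg _)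
      have a4 : 0 ≤ h' * (v - w') ^ 2 := mul_nonneg (by linarith [hh'.1]) (sq_nonneg _)
      have := abs_le.1 (hP v hv)
      rw [pow_zero, one_pow, div_one, abs_le]
      constructor <;> linarith [this.1, this.2]
  rw [Nat.sub_self, e0] at h0
  refine h0.trans ?_
  gcongr
  have hyk : y ^ k ≤ 3 := by
    calc y ^ k ≤ (Real.exp (1 / k)) ^ k := by
          gcongr
          rw [hy, add_comm]; exact Real.add_one_le_exp _
      _ = Real.exp 1 := by rw [← Real.exp_nat_mul]; congr 1; field_simp
      _ ≤ 3 := by linarith [Real.exp_one_lt_d9]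
  calc (80 * ((k : ℝ) + 1)) ^ N * y ^ (k * N - 0) = (80 * ((k : ℝ) + 1) * y ^ k) ^ N := by
        rw [Nat.sub_zero, pow_mul, mul_pow (80 * ((k : ℝ) + 1))]
    _ ≤ (80 * ((k : ℝ) + 1) * 3) ^ N := by gcongr
    _ = _ := by ring

end

section

/-- The correlation of two functions on `ℝ² × ℝ`. -/
def corr (g g' : (ℝ × ℝ) × ℝ → ℂ) (η : (ℝ × ℝ) × ℝ) : ℂ :=
  ∫ ζ, g (ζ + η) * starRingEnd ℂ (g' ζ)

variable {g g' : (ℝ × ℝ) × ℝ → ℂ}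

theorem integrable_corr_integrand (hg : Integrable g) (hg' : Integrable g') :
    Integrable (fun p : ((ℝ × ℝ) × ℝ) × ((ℝ × ℝ) × ℝ) => g (p.1 + p.2) * starRingEnd ℂ (g' p.1)) := by
  have hc : Integrable (fun ζ => starRingEnd ℂ (g' ζ)) :=
    (Complex.conjLIE.toContinuousLinearEquiv.toContinuousLinearMap).integrable_comp hg'
  have h := (hc.mul_prod hg)
  have mp := measurePreserving_prod_add (volume : Measure ((ℝ × ℝ) × ℝ))
    (volume : Measure ((ℝ × ℝ) × ℝ))
  have := mp.integrable_comp_of_integrable h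
  refine this.congr (Filter.Eventually.of_forall fun p => ?_)
  simp [mul_comm]

theorem integrable_corr (hg : Integrable g) (hg' : Integrable g') : Integrable (corr g g') :=
  (integrable_corr_integrand hg hg').integral_prod_right

theorem norm_exp_neg_I_mul (x : ℝ) : ‖Complex.exp (-Complex.I * (x : ℂ))‖ = 1 := by
  rw [show -Complex.I * (x : ℂ) = ((-x : ℝ) : ℂ) * Complex.I by push_cast; ring,
    Complex.norm_exp_ofReal_mul_I]

theorem conj_exp_neg_I_mul (x : ℝ) : starRingEnd ℂ (Complex.exp (-Complex.I * (x : ℂ))) =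
    Complex.exp (Complex.I * (x : ℂ)) := by
  rw [← Complex.exp_conj]; simp

theorem dot3_add_right (y ζ η : (ℝ × ℝ) × ℝ) : dot3 y (ζ + η) = dot3 y ζ + dot3 y η := by
  simp [dot3, dot2]; ring

theorem dot3_comm (y η : (ℝ × ℝ) × ℝ) : dot3 y η = dot3 η y := by
  simp [dot3, dot2, mul_comm]

theorem continuous_dot3 (y : (ℝ × ℝ) × ℝ) : Continuous (dot3 y) := by
  unfold dot3 dot2; fun_prop

theorem ft3_corr (hg : Integrable g) (hg' : Integrable g') (y : (ℝ × ℝ) × ℝ) :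
    ft3 (corr g g') y = ft3 g y * starRingEnd ℂ (ft3 g' y) := by
  have hi := integrable_corr_integrand hg hg'
  have hi2 : Integrable (fun p : ((ℝ × ℝ) × ℝ) × ((ℝ × ℝ) × ℝ) =>
      Complex.exp (-Complex.I * (dot3 y p.2 : ℂ)) * (g (p.1 + p.2) * starRingEnd ℂ (g' p.1))) := by
    refine hi.bdd_mul (c := 1) ?_ (Filter.Eventually.of_forall fun p => ?_)
    · have := continuous_dot3 y
      exact Continuous.aestronglyMeasurable (by fun_prop)
    · rw [norm_exp_neg_I_mul]
  calc ft3 (corr g g') y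
      = ∫ η, ∫ ζ, Complex.exp (-Complex.I * (dot3 y η : ℂ)) *
          (g (ζ + η) * starRingEnd ℂ (g' ζ)) := by
        rw [ft3]
        refine integral_congr_ae (Filter.Eventually.of_forall fun η => ?_)
        simp only [corr]
        rw [integral_const_mul, dot3_comm]
    _ = ∫ ζ, ∫ η, Complex.exp (-Complex.I * (dot3 y η : ℂ)) *
          (g (ζ + η) * starRingEnd ℂ (g' ζ)) := by
        rw [integral_integral_swap]
        exact hi2.swap
    _ = ∫ ζ, ft3 g y * starRingEnd ℂ (Complex.exp (-Complex.I * (dot3 ζ y : ℂ)) * g' ζ) := by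
        refine integral_congr_ae (Filter.Eventually.of_forall fun ζ => ?_)
        have e : ft3 g y = ∫ η, Complex.exp (-Complex.I * (dot3 y (ζ + η) : ℂ)) * g (ζ + η) := by
          rw [integral_add_left_eq_self
            (fun η => Complex.exp (-Complex.I * (dot3 y η : ℂ)) * g η) ζ, ft3]
          simp only [dot3_comm]
        simp only [e, map_mul, conj_exp_neg_I_mul]
        rw [← integral_mul_const]
        refine integral_congr_ae (Filter.Eventually.of_forall fun η => ?_)
        simp only [dot3_add_right, dot3_comm ζ y]
        rw [show -Complex.I * ((dot3 y ζ + dot3 y η : ℝ) : ℂ) =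
          -Complex.I * (dot3 y η : ℂ) + -(Complex.I * (dot3 y ζ : ℂ)) by push_cast; ring,
          Complex.exp_add, Complex.exp_neg]
        field_simp [Complex.exp_ne_zero]
    _ = _ := by
        rw [integral_const_mul, integral_conj]
        rfl

theorem norm_corr_le {M : ℝ} (hM : ∀ x, ‖g x‖ ≤ M) (hg' : Integrable g') (η : (ℝ × ℝ) × ℝ) :
    ‖corr g g' η‖ ≤ M * ∫ ζ, ‖g' ζ‖ := by
  rw [← integral_const_mul]
  refine norm_integral_le_of_norm_le (hg'.norm.const_mul M)
    (Filter.Eventually.of_forall fun ζ => ?_)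
  rw [norm_mul, RCLike.norm_conj]
  exact mul_le_mul_of_nonneg_right (hM _) (norm_nonneg _)

theorem memLp_two_of_bound {X : Type*} [MeasurableSpace X] {μ : Measure X} {f : X → ℂ}
    (hf : Integrable f μ) {M : ℝ} (hM : ∀ x, ‖f x‖ ≤ M) : MemLp f 2 μ := by
  rw [memLp_two_iff_integrable_sq_norm hf.1]
  refine (hf.norm.const_mul M).mono (hf.1.norm.pow 2) (Filter.Eventually.of_forall fun x => ?_)
  have h0 : 0 ≤ M := (norm_nonneg _).trans (hM x)
  simp only [norm_mul, Real.norm_eq_abs, abs_of_nonneg h0, pow_two]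
  exact mul_le_mul_of_nonneg_right (by simpa using hM x) (abs_nonneg _)

theorem measurable_corr (hg : Measurable g) (hg' : Measurable g') : Measurable (corr g g') := by
  have : StronglyMeasurable (fun p : ((ℝ × ℝ) × ℝ) × ((ℝ × ℝ) × ℝ) =>
      g (p.2 + p.1) * starRingEnd ℂ (g' p.2)) := by
    refine Measurable.stronglyMeasurable ?_
    exact (hg.comp (measurable_snd.add measurable_fst)).mul
      (Complex.continuous_conj.measurable.comp (hg'.comp measurable_snd))
  exact this.integral_prod_right'.measurable

theorem ft3_sum {ι : Type*} (s : Finset ι) {G : ι → (ℝ × ℝ) × ℝ → ℂ}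
    (h : ∀ i ∈ s, Integrable (G i)) (y : (ℝ × ℝ) × ℝ) :
    ft3 (fun x => ∑ i ∈ s, G i x) y = ∑ i ∈ s, ft3 (G i) y := by
  simp only [ft3, Finset.mul_sum]
  refine integral_finsetSum _ fun i hi => ?_
  refine (h i hi).bdd_mul (c := 1) ?_ (Filter.Eventually.of_forall fun p => ?_)
  · have : Continuous fun z => dot3 z y := by unfold dot3 dot2; fun_prop
    exact Continuous.aestronglyMeasurable (by fun_prop)
  · rw [norm_exp_neg_I_mul]

theorem ft3_const_mul (c : ℂ) (y : (ℝ × ℝ) × ℝ) :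
    ft3 (fun x => c * g x) y = c * ft3 g y := by
  simp only [ft3, ← integral_const_mul]
  refine integral_congr_ae (Filter.Eventually.of_forall fun η => ?_)
  simp only; ring

theorem continuous_ft3 (g : (ℝ × ℝ) × ℝ → ℂ) (hg : Integrable g) : Continuous (ft3 g) := by
  refine continuous_of_dominated (bound := fun x => ‖g x‖) ?_ ?_ hg.norm ?_
  · intro y
    refine AEStronglyMeasurable.mul ?_ hg.1
    have : Continuous fun z => dot3 z y := by unfold dot3 dot2; fun_prop
    exact Continuous.aestronglyMeasurable (by fun_prop)
  · intro y
    refine Filter.Eventually.of_forall fun x => ?_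
    rw [norm_mul, norm_exp_neg_I_mul, one_mul]
  · refine Filter.Eventually.of_forall fun x => ?_
    have := continuous_dot3 x
    fun_prop

/-- Plancherel for combinations of correlations. -/
theorem lintegral_pairSum_corr {C : Finset ℕ} {G : ℕ → (ℝ × ℝ) × ℝ → ℂ}
    (hi : ∀ n, Integrable (G n)) (hb : ∀ n, ∃ M, ∀ x, ‖G n x‖ ≤ M) (c : ℕ → ℕ → ℂ) :
    ∫⁻ x, ‖pairSum C (fun n m => corr (G n) (G m)) c x‖ₑ ^ 2 =
      (ENNReal.ofReal ((2 * π) ^ 3))⁻¹ *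
        ∫⁻ y, ‖pairSum C (fun n m y => ft3 (G n) y * starRingEnd ℂ (ft3 (G m) y)) c y‖ₑ ^ 2 := by
  choose M hM using hb
  have hM0 : ∀ n, 0 ≤ M n := fun n => (norm_nonneg _).trans (hM n 0)
  have int : Integrable (pairSum C (fun n m => corr (G n) (G m)) c) :=
    integrable_finsetSum _ fun n _ => integrable_finsetSum _ fun m _ =>
      (integrable_corr (hi n) (hi m)).const_mul _
  have mem : MemLp (pairSum C (fun n m => corr (G n) (G m)) c) 2 := by
    refine memLp_two_of_bound int
      (M := ∑ n ∈ C, ∑ m ∈ C, ‖c n m‖ * (M n * ∫ ζ, ‖G m ζ‖)) fun x => ?_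
    refine (norm_sum_le _ _).trans (Finset.sum_le_sum fun n _ => (norm_sum_le _ _).trans
      (Finset.sum_le_sum fun m _ => ?_))
    rw [norm_mul]
    gcongr
    exact norm_corr_le (hM n) (hi m) x
  have h := lintegral_enorm_sq_ft3 int mem
  have e : ∀ y, ft3 (pairSum C (fun n m => corr (G n) (G m)) c) y =
      pairSum C (fun n m y => ft3 (G n) y * starRingEnd ℂ (ft3 (G m) y)) c y := by
    intro y
    unfold pairSum
    rw [ft3_sum _ fun n _ => integrable_finsetSum _ fun m _ =>
      (integrable_corr (hi n) (hi m)).const_mul _]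
    refine Finset.sum_congr rfl fun n _ => ?_
    rw [ft3_sum _ fun m _ => (integrable_corr (hi n) (hi m)).const_mul _]
    refine Finset.sum_congr rfl fun m _ => ?_
    rw [ft3_const_mul, ft3_corr (hi n) (hi m)]
  simp only [e] at h
  rw [h, ← mul_assoc, ENNReal.inv_mul_cancel (by simp; positivity) ENNReal.ofReal_ne_top, one_mul]

/-- Dyadic colour classes: all ancestors at the given levels have prescribed parity. -/
def colourClass (k N : ℕ) (c : Fin N → Fin 2) : Finset ℕ :=
  (Finset.range (2 ^ (k * N))).filter
    fun n => ∀ b : Fin N, n / 2 ^ (k * N - k * (b + 1)) % 2 = c b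

theorem sum_range_eq_sum_colourClass {E : Type*} [AddCommMonoid E] (k N : ℕ) (F : ℕ → E) :
    ∑ n ∈ Finset.range (2 ^ (k * N)), F n = ∑ c : Fin N → Fin 2, ∑ n ∈ colourClass k N c, F n := by
  have := Finset.sum_fiberwise (Finset.range (2 ^ (k * N)))
    (fun n => fun b : Fin N =>
      (⟨n / 2 ^ (k * N - k * (b + 1)) % 2, Nat.mod_lt _ two_pos⟩ : Fin 2)) F
  rw [← this]
  refine Finset.sum_congr rfl fun c _ => Finset.sum_congr ?_ fun _ _ => rfl
  ext n
  simp only [Finset.mem_filter, colourClass, funext_iff, Fin.ext_iff]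

theorem colourClass_sep {k N : ℕ} (c : Fin N → Fin 2) {n m : ℕ} (hn : n ∈ colourClass k N c)
    (hm : m ∈ colourClass k N c) {b : ℕ} (hb : b < N)
    (hne : n / 2 ^ (k * N - k * (b + 1)) ≠ m / 2 ^ (k * N - k * (b + 1))) :
    n / 2 ^ (k * N - k * (b + 1)) + 2 ≤ m / 2 ^ (k * N - k * (b + 1)) ∨
    m / 2 ^ (k * N - k * (b + 1)) + 2 ≤ n / 2 ^ (k * N - k * (b + 1)) := by
  have h1 := (Finset.mem_filter.1 hn).2 ⟨b, hb⟩
  have h2 := (Finset.mem_filter.1 hm).2 ⟨b, hb⟩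
  simp only at h1 h2
  omega

/-- Fourth moments of sums of functions with Fourier support near sectors of a cone are
controlled by the finest-scale diagonal masses. -/
theorem lintegral_sum_ft3_le {k N : ℕ} (hk : 0 < k) (c : Fin N → Fin 2)
    {G : ℕ → (ℝ × ℝ) × ℝ → ℂ} {P : (ℝ × ℝ) × ℝ → ℝ × ℝ × ℝ}
    (hm : ∀ n, Measurable (G n)) (hi : ∀ n, Integrable (G n))
    (hb : ∀ n, ∃ M, ∀ x, ‖G n x‖ ≤ M) (hP : Measurable P)
    (loc : ∀ n < 2 ^ (k * N), ∀ m < 2 ^ (k * N), ∀ ζ ζ', G n ζ ≠ 0 → G m ζ' ≠ 0 →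
      ∃ h ∈ Icc (1 : ℝ) (1 + 1 / (10 ^ 8 * (2 ^ k) ^ 4)),
      ∃ h' ∈ Icc (1 : ℝ) (1 + 1 / (10 ^ 8 * (2 ^ k) ^ 4)),
      ∃ w ∈ Icc ((n : ℝ) / 2 ^ (k * N)) (((n : ℝ) + 1) / 2 ^ (k * N)),
      ∃ w' ∈ Icc ((m : ℝ) / 2 ^ (k * N)) (((m : ℝ) + 1) / 2 ^ (k * N)),
      ∀ v ∈ Icc (0 : ℝ) 1, |quad (P (ζ - ζ')) v - (h * (v - w) ^ 2 - h' * (v - w') ^ 2)| ≤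
        (1 / 2 ^ (k * N)) ^ 2 / 8)
    {Z : ℝ≥0∞} (hZ : ∀ a ≤ k * N, ∑ j ∈ Finset.range (2 ^ a), ∫⁻ η in smallSet P (k * N) a j,
      ‖∑ n ∈ (colourClass k N c).filter (fun n => n / 2 ^ (k * N - a) = j),
        corr (G n) (G n) η‖ₑ ^ 2 ≤ Z) :
    ∫⁻ y, ‖∑ n ∈ colourClass k N c, ft3 (G n) y‖ₑ ^ 4 ≤
      ENNReal.ofReal ((2 * π) ^ 3) * (ENNReal.ofReal ((240 * ((k : ℝ) + 1)) ^ N) * Z) := by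
  have lt : ∀ n ∈ colourClass k N c, n < 2 ^ (k * N) := fun n hn =>
    Finset.mem_range.1 (Finset.mem_filter.1 hn).1
  have D : IsMultiscale volume volume (ENNReal.ofReal ((2 * π) ^ 3))⁻¹ k N (colourClass k N c)
      (fun n => ft3 (G n)) (fun n m => corr (G n) (G m)) P :=
    { lt := lt
      sep := fun n hn m hm b hb _ hne => colourClass_sep c hn hm hb hne
      meas_f := fun n => (continuous_ft3 _ (hi n)).measurable
      meas_H := fun n m => measurable_corr (hm n) (hm m)
      meas_P := hP
      norm := fun c => lintegral_pairSum_corr hi hb c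
      loc := by
        intro n hn m hm η hne
        obtain ⟨ζ, hζ⟩ : ∃ ζ, G n (ζ + η) * starRingEnd ℂ (G m ζ) ≠ 0 := by
          by_contra hcon
          push Not at hcon
          exact hne (by simp [corr, hcon])
        have h1 : G n (ζ + η) ≠ 0 := left_ne_zero_of_mul hζ
        have h2 : G m ζ ≠ 0 := by
          intro h0; simp [h0] at hζ
        have := loc n (lt n hn) m (lt m hm) _ _ h1 h2
        rwa [add_sub_cancel_left] at this }
  have key := D.lintegral_le hk Z (by
    intro a ha
    refine le_trans (le_of_eq ?_) (hZ a ha)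
    unfold scaleMass
    refine Finset.sum_congr rfl fun j _ => lintegral_congr fun η => ?_
    congr 2
    unfold pairSum
    rw [Finset.sum_filter]
    refine Finset.sum_congr rfl fun n hn => ?_
    rw [Finset.sum_eq_single n]
    · simp [diagCoef]
    · intro m _ hmn
      simp [diagCoef, Ne.symm hmn]
    · exact fun h => (h hn).elim)
  rw [D.norm] at key
  have e : ∀ y, ‖pairSum (colourClass k N c)
      (fun n m y => ft3 (G n) y * starRingEnd ℂ (ft3 (G m) y)) (fun _ _ => 1) y‖ₑ ^ 2 =
      ‖∑ n ∈ colourClass k N c, ft3 (G n) y‖ₑ ^ 4 := by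
    intro y
    have : pairSum (colourClass k N c)
      (fun n m y => ft3 (G n) y * starRingEnd ℂ (ft3 (G m) y)) (fun _ _ => 1) y =
      (∑ n ∈ colourClass k N c, ft3 (G n) y) *
        starRingEnd ℂ (∑ n ∈ colourClass k N c, ft3 (G n) y) := by
      simp only [pairSum, one_mul, map_sum, Finset.sum_mul_sum]
    rw [this, enorm_mul]
    have h2 : ‖starRingEnd ℂ (∑ n ∈ colourClass k N c, ft3 (G n) y)‖ₑ =
        ‖∑ n ∈ colourClass k N c, ft3 (G n) y‖ₑ := by
      rw [← ofReal_norm, RCLike.norm_conj, ofReal_norm]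
    rw [h2]; ring
  simp only [e] at key
  have h0 : ENNReal.ofReal ((2 * π) ^ 3) ≠ 0 := by simp; positivity
  calc ∫⁻ y, ‖∑ n ∈ colourClass k N c, ft3 (G n) y‖ₑ ^ 4
      = ENNReal.ofReal ((2 * π) ^ 3) * ((ENNReal.ofReal ((2 * π) ^ 3))⁻¹ *
          ∫⁻ y, ‖∑ n ∈ colourClass k N c, ft3 (G n) y‖ₑ ^ 4) := by
        rw [← mul_assoc, ENNReal.mul_inv_cancel h0 ENNReal.ofReal_ne_top, one_mul]
    _ ≤ _ := by gcongr

end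

section

theorem continuous_enorm2 : Continuous enorm2 := by unfold enorm2; fun_prop

theorem enorm2_nonneg (ξ : ℝ × ℝ) : 0 ≤ enorm2 ξ := Real.sqrt_nonneg _

theorem enorm2_sq (ξ : ℝ × ℝ) : enorm2 ξ ^ 2 = ξ.1 ^ 2 + ξ.2 ^ 2 :=
  Real.sq_sqrt (by positivity)

/-- The bump used to thicken the light cone. -/
def coneBump : ContDiffBump (0 : ℝ) := ⟨1 / 2, 1, by norm_num, by norm_num⟩

/-- The thickening profile, supported in `[-1, 1]` with integral one. -/
def lam (s : ℝ) : ℝ := coneBump.normed volume s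

theorem contDiff_lam : ContDiff ℝ (⊤ : ℕ∞) lam := coneBump.contDiff_normed

theorem continuous_lam : Continuous lam := contDiff_lam.continuous

theorem lam_nonneg (s : ℝ) : 0 ≤ lam s := coneBump.nonneg_normed _

theorem hasCompactSupport_lam : HasCompactSupport lam := coneBump.hasCompactSupport_normed

theorem integral_lam : ∫ s, lam s = 1 := coneBump.integral_normed

theorem integrable_lam : Integrable lam := coneBump.integrable_normed

theorem abs_le_one_of_lam_ne_zero {s : ℝ} (hs : lam s ≠ 0) : |s| ≤ 1 := by
  have : s ∈ Function.support (coneBump.normed volume) := hs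
  rw [ContDiffBump.support_normed_eq] at this
  have h2 : dist s 0 < 1 := this
  rw [Real.dist_eq, sub_zero] at h2
  exact h2.le

/-- The Fourier transform of the thickening profile. -/
def psi (t : ℝ) : ℂ := ∫ s, (lam s : ℂ) * Complex.exp (-Complex.I * ((t * s : ℝ) : ℂ))

theorem exists_psi_decay : ∃ C, 0 < C ∧ ∀ t, ‖psi t‖ * (1 + |t|) ^ 2 ≤ C := by
  obtain ⟨C, hC⟩ := exists_decay_fourier_bump (a := fun s => (lam s : ℂ))
    ((Complex.ofRealCLM : ℝ →L[ℝ] ℂ).contDiff.comp contDiff_lam)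
    (hasCompactSupport_lam.comp_left (g := fun x : ℝ => (x : ℂ)) (by simp))
  refine ⟨max C 1, by positivity, fun t => le_trans ?_ (le_max_left _ _)⟩
  have := hC (-t)
  rw [abs_neg] at this
  have e : psi t = ∫ s, (lam s : ℂ) * Complex.exp (Complex.I * ((-t * s : ℝ) : ℂ)) :=
    integral_congr_ae (Filter.Eventually.of_forall fun s => by simp)
  rwa [e]

theorem norm_psi_ge {t : ℝ} (ht : |t| ≤ 1) : Real.cos 1 ≤ ‖psi t‖ := by
  refine le_trans ?_ (Complex.re_le_norm _)
  have hInt : Integrable (fun s => (lam s : ℂ) * Complex.exp (-Complex.I * ((t * s : ℝ) : ℂ))) := by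
    refine integrable_lam.ofReal.mul_bdd (c := 1) (Continuous.aestronglyMeasurable (by fun_prop))
      (Filter.Eventually.of_forall fun s => ?_)
    rw [norm_exp_neg_I_mul]
  have e : (psi t).re = ∫ s, lam s * Real.cos (t * s) := by
    rw [psi, ← RCLike.re_eq_complex_re, ← integral_re hInt]
    refine integral_congr_ae (Filter.Eventually.of_forall fun s => ?_)
    simp only [RCLike.re_eq_complex_re, Complex.re_ofReal_mul]
    rw [show -Complex.I * ((t * s : ℝ) : ℂ) = ((-(t * s) : ℝ) : ℂ) * Complex.I by push_cast; ring,
      Complex.exp_ofReal_mul_I_re, Real.cos_neg]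
  rw [e]
  calc Real.cos 1 = ∫ s, lam s * Real.cos 1 := by rw [integral_mul_const, integral_lam, one_mul]
    _ ≤ _ := by
      refine integral_mono (integrable_lam.mul_const _) ?_ fun s => ?_
      · refine integrable_lam.mul_bdd (c := 1) (Continuous.aestronglyMeasurable (by fun_prop))
          (Filter.Eventually.of_forall fun s => ?_)
        rw [Real.norm_eq_abs]; exact Real.abs_cos_le_one _
      · by_cases hs : lam s = 0
        · simp [hs]
        · have h1 := abs_le_one_of_lam_ne_zero hs
          refine mul_le_mul_of_nonneg_left ?_ (lam_nonneg s)
          rw [← Real.cos_abs (t * s)]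
          refine Real.cos_le_cos_of_nonneg_of_le_pi (abs_nonneg _) (by linarith [Real.pi_gt_three]) ?_
          rw [abs_mul]
          nlinarith [abs_nonneg t, abs_nonneg s]

/-- A function on the plane lifted to an `R⁻¹`-neighbourhood of the light cone. -/
def coneLift (R : ℝ) (b : ℝ × ℝ → ℂ) (ζ : (ℝ × ℝ) × ℝ) : ℂ :=
  ((R * lam (R * (ζ.2 - enorm2 ζ.1)) : ℝ) : ℂ) * b ζ.1

/-- The wave extension `∫ e^{-i(x·ξ+t|ξ|)} b(ξ) dξ`. -/
def waveExt (b : ℝ × ℝ → ℂ) (y : (ℝ × ℝ) × ℝ) : ℂ :=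
  ∫ ξ, Complex.exp (-Complex.I * ((dot2 y.1 ξ + y.2 * enorm2 ξ : ℝ) : ℂ)) * b ξ

theorem measurePreserving_coneShear : MeasurePreserving
    (fun p : (ℝ × ℝ) × ℝ => (p.1, p.2 + enorm2 p.1)) := by
  refine (MeasurePreserving.id (volume : Measure (ℝ × ℝ))).skew_product
    (g := fun ξ τ => τ + enorm2 ξ) ?_ ?_
  · exact (measurable_snd.add (continuous_enorm2.measurable.comp measurable_fst))
  · exact Filter.Eventually.of_forall fun ξ => map_add_right_eq_self _ _

theorem measurableEmbedding_coneShear : MeasurableEmbedding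
    (fun p : (ℝ × ℝ) × ℝ => (p.1, p.2 + enorm2 p.1)) := by
  refine Continuous.measurableEmbedding ?_ ?_
  · have := continuous_enorm2; fun_prop
  · rintro ⟨a, b⟩ ⟨c, d⟩ h
    simp only [Prod.mk.injEq] at h
    obtain ⟨rfl, h⟩ := h
    simpa using h

variable {R : ℝ} {b : ℝ × ℝ → ℂ}

theorem measurable_coneLift (hb : Measurable b) : Measurable (coneLift R b) := by
  refine Measurable.mul ?_ (hb.comp measurable_fst)
  have := continuous_enorm2
  have := continuous_lam
  exact Continuous.measurable (by fun_prop)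

theorem coneLift_ne_zero {ζ : (ℝ × ℝ) × ℝ} (hR : 0 < R) (h : coneLift R b ζ ≠ 0) :
    |ζ.2 - enorm2 ζ.1| ≤ 1 / R ∧ b ζ.1 ≠ 0 := by
  have h1 := left_ne_zero_of_mul h
  have h2 := right_ne_zero_of_mul h
  refine ⟨?_, h2⟩
  have h3 : lam (R * (ζ.2 - enorm2 ζ.1)) ≠ 0 := by
    intro h0; simp [h0] at h1
  have := abs_le_one_of_lam_ne_zero h3
  rw [abs_mul, abs_of_pos hR] at this
  rwa [le_div_iff₀ hR, mul_comm]

theorem exists_lam_le : ∃ M, ∀ s, lam s ≤ M := by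
  obtain ⟨M, hM⟩ := hasCompactSupport_lam.exists_bound_of_continuous continuous_lam
  exact ⟨M, fun s => (le_abs_self _).trans (hM s)⟩

theorem exists_coneLift_le (hR : 0 < R) (hb : ∃ M, ∀ ξ, ‖b ξ‖ ≤ M) :
    ∃ M, ∀ ζ, ‖coneLift R b ζ‖ ≤ M := by
  obtain ⟨M, hM⟩ := hb
  obtain ⟨L, hL⟩ := exists_lam_le
  refine ⟨(R * L) * M, fun ζ => ?_⟩
  rw [coneLift, norm_mul, Complex.norm_real, Real.norm_eq_abs,
    abs_of_nonneg (mul_nonneg hR.le (lam_nonneg _))]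
  have := lam_nonneg (R * (ζ.2 - enorm2 ζ.1))
  have hL' := hL (R * (ζ.2 - enorm2 ζ.1))
  have h0 : 0 ≤ L := this.trans hL'
  exact mul_le_mul (by gcongr) (hM _) (norm_nonneg _) (by positivity)

theorem integrable_coneLift_shear (hR : 0 < R) (hb : Integrable b) :
    Integrable (fun p : (ℝ × ℝ) × ℝ => coneLift R b (p.1, p.2 + enorm2 p.1)) := by
  have h1 : Integrable (fun τ : ℝ => ((R * lam (R * τ) : ℝ) : ℂ)) :=
    ((integrable_lam.comp_mul_left' hR.ne').const_mul R).ofReal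
  refine (hb.mul_prod h1).congr (Filter.Eventually.of_forall fun p => ?_)
  simp [coneLift, mul_comm]

theorem integrable_coneLift (hR : 0 < R) (hb : Integrable b) : Integrable (coneLift R b) := by
  rw [← measurePreserving_coneShear.integrable_comp_emb measurableEmbedding_coneShear]
  exact integrable_coneLift_shear hR hb

theorem ft3_coneLift (hR : 0 < R) (hb : Integrable b) (y : (ℝ × ℝ) × ℝ) :
    ft3 (coneLift R b) y = psi (y.2 / R) * waveExt b y := by
  rw [ft3, ← measurePreserving_coneShear.integral_comp measurableEmbedding_coneShear,
    Measure.volume_eq_prod, integral_prod]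
  · rw [waveExt, ← integral_const_mul]
    refine integral_congr_ae (Filter.Eventually.of_forall fun ξ => ?_)
    have e : psi (y.2 / R) = ∫ τ, ((R * lam (R * τ) : ℝ) : ℂ) *
        Complex.exp (-Complex.I * ((y.2 * τ : ℝ) : ℂ)) := by
      have := Measure.integral_comp_mul_left (fun s => (lam s : ℂ) *
        Complex.exp (-Complex.I * ((y.2 / R * s : ℝ) : ℂ))) R
      rw [abs_of_pos (inv_pos.2 hR)] at this
      rw [psi]
      have h2 : (R : ℂ) * ∫ τ, (lam (R * τ) : ℂ) *
        Complex.exp (-Complex.I * ((y.2 / R * (R * τ) : ℝ) : ℂ)) = ∫ s, (lam s : ℂ) *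
        Complex.exp (-Complex.I * ((y.2 / R * s : ℝ) : ℂ)) := by
        rw [this, Complex.real_smul, ← mul_assoc, ← Complex.ofReal_mul, mul_inv_cancel₀ hR.ne']
        simp
      rw [← h2, ← integral_const_mul]
      refine integral_congr_ae (Filter.Eventually.of_forall fun τ => ?_)
      have e3 : y.2 / R * (R * τ) = y.2 * τ := by field_simp
      simp only [e3]; push_cast; ring
    simp only [e]
    rw [← integral_mul_const]
    refine integral_congr_ae (Filter.Eventually.of_forall fun τ => ?_)
    simp only [coneLift, add_sub_cancel_right, dot3]
    rw [dot2_comm ξ y.1, show -Complex.I * ((dot2 y.1 ξ + (τ + enorm2 ξ) * y.2 : ℝ) : ℂ) =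
      -Complex.I * ((y.2 * τ : ℝ) : ℂ) + -Complex.I * ((dot2 y.1 ξ + y.2 * enorm2 ξ : ℝ) : ℂ) by
      push_cast; ring, Complex.exp_add]
    ring
  · refine (integrable_coneLift_shear hR hb).bdd_mul (c := 1) ?_
      (Filter.Eventually.of_forall fun p => ?_)
    · have := continuous_enorm2
      refine Continuous.aestronglyMeasurable ?_
      unfold dot3 dot2
      fun_prop
    · rw [norm_exp_neg_I_mul]

/-- The null coordinate `|ξ| + ξ₁`. -/
def nullCoord (ξ : ℝ × ℝ) : ℝ := enorm2 ξ + ξ.1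

/-- The projective angular coordinate `ξ₂ / (|ξ| + ξ₁)`, the tangent of the half angle. -/
def angCoord (ξ : ℝ × ℝ) : ℝ := ξ.2 / nullCoord ξ

/-- The normalised quadratic polynomial `v ↦ ((τ-ξ₁) - 2(v+w)ξ₂ + (v+w)²(τ+ξ₁)) / h₀`. -/
def conePoly (h₀ w : ℝ) (η : (ℝ × ℝ) × ℝ) : ℝ × ℝ × ℝ :=
  (((η.2 - η.1.1) - 2 * w * η.1.2 + w ^ 2 * (η.2 + η.1.1)) / h₀,
    (-2 * η.1.2 + 2 * w * (η.2 + η.1.1)) / h₀, (η.2 + η.1.1) / h₀)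

theorem continuous_conePoly (h₀ w : ℝ) : Continuous (conePoly h₀ w) := by
  unfold conePoly; fun_prop

theorem quad_conePoly_sub (h₀ w : ℝ) (ζ ζ' : (ℝ × ℝ) × ℝ) (v : ℝ) :
    quad (conePoly h₀ w (ζ - ζ')) v = quad (conePoly h₀ w ζ) v - quad (conePoly h₀ w ζ') v := by
  simp [quad, conePoly]; ring

theorem quad_conePoly (h₀ w : ℝ) (ζ : (ℝ × ℝ) × ℝ) (hζ : 0 < nullCoord ζ.1) (v : ℝ) :
    quad (conePoly h₀ w ζ) v = (nullCoord ζ.1 / h₀) * (v - (angCoord ζ.1 - w)) ^ 2 +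
      (ζ.2 - enorm2 ζ.1) * (1 + (v + w) ^ 2) / h₀ := by
  obtain ⟨⟨x, y⟩, τ⟩ := ζ
  have h1 := enorm2_sq (x, y)
  have h2 : y = angCoord (x, y) * nullCoord (x, y) := by
    rw [angCoord]; field_simp
  have h3 : nullCoord (x, y) * angCoord (x, y) ^ 2 = enorm2 (x, y) - x := by
    have h4 : y ^ 2 = nullCoord (x, y) * (enorm2 (x, y) - x) := by
      simp only [nullCoord]; simp only at h1; linarith
    have h5 : nullCoord (x, y) * (nullCoord (x, y) * angCoord (x, y) ^ 2) =
        nullCoord (x, y) * (enorm2 (x, y) - x) := by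
      rw [← h4]; conv_rhs => rw [h2]
      ring
    exact mul_left_cancel₀ (ne_of_gt hζ) h5
  have h6 : nullCoord (x, y) = enorm2 (x, y) + x := rfl
  simp only [quad, conePoly]
  simp only [div_mul_eq_mul_div, ← add_div]
  congr 1
  generalize angCoord (x, y) = o at *
  generalize nullCoord (x, y) = m at *
  generalize enorm2 (x, y) = r at *
  subst h6
  linear_combination (-1) * h3 + (-2 * v - 2 * w) * h2

end

theorem dot2_add_left (x y ξ : ℝ × ℝ) : dot2 (x + y) ξ = dot2 x ξ + dot2 y ξ := by
  simp [dot2]; ring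

theorem continuous_dot2 : Continuous (fun p : (ℝ × ℝ) × (ℝ × ℝ) => dot2 p.1 p.2) := by
  unfold dot2; fun_prop

theorem integrable_exp_dot2_mul {B : ℝ × ℝ → ℂ} (hB : Integrable B) (s : ℝ × ℝ) :
    Integrable (fun ξ => Complex.exp (-Complex.I * (dot2 ξ s : ℂ)) * B ξ) := by
  refine hB.bdd_mul (c := 1) ?_ (Filter.Eventually.of_forall fun p => ?_)
  · have := continuous_dot2
    exact Continuous.aestronglyMeasurable (by fun_prop)
  · rw [norm_exp_neg_I_mul]

theorem continuous_ft2 {B : ℝ × ℝ → ℂ} (hB : Integrable B) : Continuous (ft2 B) := by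
  have hd := continuous_dot2
  refine continuous_of_dominated (F := fun s ξ => Complex.exp (-Complex.I * (dot2 ξ s : ℂ)) * B ξ)
    (bound := fun x => ‖B x‖) ?_ ?_ hB.norm ?_
  · exact fun y => (integrable_exp_dot2_mul hB y).1
  · intro y
    refine Filter.Eventually.of_forall fun x => ?_
    rw [norm_mul, norm_exp_neg_I_mul, one_mul]
  · refine Filter.Eventually.of_forall fun x => ?_
    fun_prop

theorem norm_ft2_le (B : ℝ × ℝ → ℂ) (s : ℝ × ℝ) : ‖ft2 B s‖ ≤ ∫ ξ, ‖B ξ‖ := by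
  rw [ft2_eq]
  refine (norm_integral_le_integral_norm _).trans (le_of_eq ?_)
  refine integral_congr_ae (Filter.Eventually.of_forall fun x => ?_)
  simp only [norm_mul, norm_exp_neg_I_mul, one_mul]

/-- A Fourier multiplier applied to `F` is convolution with the transform of the symbol. -/
theorem ft2_mul_ft2 {B F : ℝ × ℝ → ℂ} (hB : Integrable B) (hF : Integrable F) (s : ℝ × ℝ) :
    ft2 (fun ξ => B ξ * ft2 F ξ) s = ∫ z, ft2 B (s + z) * F z := by
  have hd := continuous_dot2
  have hi : Integrable (fun p : (ℝ × ℝ) × (ℝ × ℝ) =>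
      Complex.exp (-Complex.I * (dot2 p.1 (s + p.2) : ℂ)) * (B p.1 * F p.2)) := by
    refine (hB.mul_prod hF).bdd_mul (c := 1) ?_ (Filter.Eventually.of_forall fun p => ?_)
    · exact Continuous.aestronglyMeasurable (by fun_prop)
    · rw [norm_exp_neg_I_mul]
  calc ft2 (fun ξ => B ξ * ft2 F ξ) s
      = ∫ ξ, ∫ z, Complex.exp (-Complex.I * (dot2 ξ (s + z) : ℂ)) * (B ξ * F z) := by
        rw [ft2_eq]
        refine integral_congr_ae (Filter.Eventually.of_forall fun ξ => ?_)
        simp only [ft2_eq F]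
        rw [← integral_const_mul, ← integral_const_mul]
        refine integral_congr_ae (Filter.Eventually.of_forall fun z => ?_)
        simp only
        rw [dot2_comm ξ (s + z), dot2_add_left, dot2_comm s ξ, Complex.ofReal_add, mul_add,
          Complex.exp_add]
        ring
    _ = ∫ z, ∫ ξ, Complex.exp (-Complex.I * (dot2 ξ (s + z) : ℂ)) * (B ξ * F z) :=
        integral_integral_swap hi
    _ = _ := by
        refine integral_congr_ae (Filter.Eventually.of_forall fun z => ?_)
        simp only [ft2_eq]
        rw [← integral_mul_const]
        refine integral_congr_ae (Filter.Eventually.of_forall fun ξ => ?_)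
        simp only; ring

/-- Directional derivative. -/
def pderiv (v : ℝ × ℝ) (B : ℝ × ℝ → ℂ) (ξ : ℝ × ℝ) : ℂ := fderiv ℝ B ξ v

theorem contDiff_pderiv {v : ℝ × ℝ} {B : ℝ × ℝ → ℂ} (hB : ContDiff ℝ (⊤ : ℕ∞) B) :
    ContDiff ℝ (⊤ : ℕ∞) (pderiv v B) :=
  (hB.fderiv_right (m := (⊤ : ℕ∞)) (by simp)).clm_apply contDiff_const

theorem hasCompactSupport_pderiv {v : ℝ × ℝ} {B : ℝ × ℝ → ℂ} (hB : HasCompactSupport B) :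
    HasCompactSupport (pderiv v B) :=
  hB.fderiv_apply ℝ v

theorem ft2_pderiv {v : ℝ × ℝ} {B : ℝ × ℝ → ℂ} (hB : ContDiff ℝ (⊤ : ℕ∞) B)
    (hs : HasCompactSupport B) (u : ℝ × ℝ) :
    ft2 (pderiv v B) u = Complex.I * (dot2 u v : ℂ) * ft2 B u := by
  have hc : Continuous B := hB.continuous
  have hd := continuous_dot2
  have hE : ∀ ξ, HasFDerivAt (fun ξ : ℝ × ℝ => Complex.exp (-Complex.I * (dot2 ξ u : ℂ)))
      (Complex.exp (-Complex.I * (dot2 ξ u : ℂ)) • (-Complex.I) •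
        Complex.ofRealCLM.comp (u.1 • ContinuousLinearMap.fst ℝ ℝ ℝ +
          u.2 • ContinuousLinearMap.snd ℝ ℝ ℝ)) ξ := by
    intro ξ
    refine HasFDerivAt.cexp ?_
    refine HasFDerivAt.const_mul ?_ _
    refine Complex.ofRealCLM.hasFDerivAt.comp ξ ?_
    have h1 := (hasFDerivAt_fst (𝕜 := ℝ) (p := ξ)).mul_const u.1
    have h2 := (hasFDerivAt_snd (𝕜 := ℝ) (p := ξ)).mul_const u.2
    exact h1.add h2
  have hi1 : Integrable (pderiv v B) :=
    (contDiff_pderiv hB).continuous.integrable_of_hasCompactSupport (hasCompactSupport_pderiv hs)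
  have hi0 : Integrable B := hc.integrable_of_hasCompactSupport hs
  have e1 : ∀ ξ, fderiv ℝ (fun ξ : ℝ × ℝ => Complex.exp (-Complex.I * (dot2 ξ u : ℂ))) ξ v =
      -(Complex.I * (dot2 u v : ℂ)) * Complex.exp (-Complex.I * (dot2 ξ u : ℂ)) := by
    intro ξ
    rw [(hE ξ).fderiv]
    simp [dot2]
    ring
  have key := integral_mul_fderiv_eq_neg_fderiv_mul_of_integrable (μ := (volume : Measure (ℝ × ℝ)))
    (f := fun ξ : ℝ × ℝ => Complex.exp (-Complex.I * (dot2 ξ u : ℂ))) (g := B) (v := v) ?_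
    (integrable_exp_dot2_mul hi1 u) (integrable_exp_dot2_mul hi0 u)
    (fun ξ _ => (hE ξ).differentiableAt) (fun ξ _ => (hB.differentiable (by simp)) ξ)
  · rw [ft2_eq, ft2_eq]
    refine key.trans ?_
    simp only [e1, mul_assoc]
    rw [integral_const_mul]
    ring
  · simp only [e1, mul_assoc]
    exact (integrable_exp_dot2_mul hi0 u).const_mul _

/-- The standard Gaussian measure on the line. -/
def gauss : Measure ℝ := ProbabilityTheory.gaussianReal 0 1

instance : IsProbabilityMeasure gauss := by unfold gauss; infer_instance

theorem gauss_eq : gauss = volume.withDensity (ProbabilityTheory.gaussianPDF 0 1) :=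
  ProbabilityTheory.gaussianReal_of_var_ne_zero 0 one_ne_zero

theorem gaussianPDF_mul_le (s : ℝ) :
    ProbabilityTheory.gaussianPDF 0 1 s * ENNReal.ofReal (1 + s ^ 2) ≤ 1 := by
  rw [ProbabilityTheory.gaussianPDF, ← ENNReal.ofReal_mul
    (ProbabilityTheory.gaussianPDFReal_nonneg _ _ _), ← ENNReal.ofReal_one]
  refine ENNReal.ofReal_le_ofReal ?_
  rw [ProbabilityTheory.gaussianPDFReal]
  simp only [NNReal.coe_one, mul_one, sub_zero]
  have h1 : Real.exp (-s ^ 2 / 2) * (1 + s ^ 2 / 2) ≤ 1 := by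
    have := Real.add_one_le_exp (s ^ 2 / 2)
    rw [neg_div, Real.exp_neg, inv_mul_le_iff₀ (Real.exp_pos _)]
    linarith
  have h2 : (√(2 * π))⁻¹ ≤ 1 / 2 := by
    rw [inv_le_comm₀ (by positivity) (by norm_num)]
    refine Real.le_sqrt_of_sq_le ?_
    norm_num
    linarith [Real.pi_gt_three]
  have h3 : 0 < Real.exp (-s ^ 2 / 2) := Real.exp_pos _
  calc (√(2 * π))⁻¹ * Real.exp (-s ^ 2 / 2) * (1 + s ^ 2)
      ≤ (1 / 2) * Real.exp (-s ^ 2 / 2) * (1 + s ^ 2) := by gcongr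
    _ ≤ (1 / 2) * (2 * (Real.exp (-s ^ 2 / 2) * (1 + s ^ 2 / 2))) := by nlinarith
    _ ≤ 1 := by linarith

theorem lintegral_gauss_prod {f : ℝ × ℝ → ℝ≥0∞} (hf : Measurable f) :
    ∫⁻ s, f s ∂(gauss.prod gauss) = ∫⁻ s, ProbabilityTheory.gaussianPDF 0 1 s.1 *
      ProbabilityTheory.gaussianPDF 0 1 s.2 * f s := by
  have hm := ProbabilityTheory.measurable_gaussianPDF 0 1
  rw [gauss_eq, prod_withDensity hm hm, lintegral_withDensity_eq_lintegral_mul _ (by fun_prop) hf]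
  rfl

theorem lintegral_enorm_sq_weight_le {F : ℝ × ℝ → ℂ} {lm : ℝ} (hb : ∀ z, ‖F z‖ ≤ lm) :
    ∫⁻ z : ℝ × ℝ, ‖F z / ((1 + Complex.I * (z.1 : ℂ)) * (1 + Complex.I * (z.2 : ℂ)))‖ₑ ^ 2 ≤
      ENNReal.ofReal (lm ^ 2 * π ^ 2) := by
  have hn : ∀ x : ℝ, ‖(1 + Complex.I * (x : ℂ))‖ ^ 2 = 1 + x ^ 2 := by
    intro x
    rw [← Complex.normSq_eq_norm_sq, Complex.normSq_apply]
    simp; ring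
  have hone : ∫⁻ x : ℝ, ENNReal.ofReal ((1 + x ^ 2)⁻¹) = ENNReal.ofReal π := by
    rw [← ofReal_integral_eq_lintegral_ofReal integrable_inv_one_add_sq
      (Filter.Eventually.of_forall fun x => by positivity), integral_univ_inv_one_add_sq]
  calc _ ≤ ∫⁻ z : ℝ × ℝ, ENNReal.ofReal (lm ^ 2) *
        (ENNReal.ofReal ((1 + z.1 ^ 2)⁻¹) * ENNReal.ofReal ((1 + z.2 ^ 2)⁻¹)) := by
        refine lintegral_mono fun z => ?_
        rw [← ENNReal.ofReal_mul (by positivity), ← ENNReal.ofReal_mul (by positivity),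
          ← ofReal_norm, ← ENNReal.ofReal_pow (norm_nonneg _)]
        refine ENNReal.ofReal_le_ofReal ?_
        rw [norm_div, norm_mul, div_pow, mul_pow, hn, hn, div_eq_mul_inv, mul_inv]
        have := norm_nonneg (F z)
        gcongr
        exact hb z
    _ = _ := by
        rw [lintegral_const_mul _ (by fun_prop), Measure.volume_eq_prod,
          lintegral_prod_mul (f := fun x : ℝ => ENNReal.ofReal ((1 + x ^ 2)⁻¹))
            (g := fun x : ℝ => ENNReal.ofReal ((1 + x ^ 2)⁻¹)) (by fun_prop) (by fun_prop), hone,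
          ← ENNReal.ofReal_mul Real.pi_pos.le, ← ENNReal.ofReal_mul (by positivity), sq π]

theorem norm_four_sq_le (a b c d : ℂ) :
    ‖a + b + c + d‖ ^ 2 ≤ 4 * (‖a‖ ^ 2 + ‖b‖ ^ 2 + ‖c‖ ^ 2 + ‖d‖ ^ 2) := by
  have h : ‖a + b + c + d‖ ≤ ‖a‖ + ‖b‖ + ‖c‖ + ‖d‖ :=
    (norm_add_le _ _).trans (by gcongr; exact norm_add₃_le)
  have h0 := norm_nonneg (a + b + c + d)
  have : ‖a + b + c + d‖ ^ 2 ≤ (‖a‖ + ‖b‖ + ‖c‖ + ‖d‖) ^ 2 := by gcongr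
  nlinarith [sq_nonneg (‖a‖ - ‖b‖), sq_nonneg (‖a‖ - ‖c‖), sq_nonneg (‖a‖ - ‖d‖),
    sq_nonneg (‖b‖ - ‖c‖), sq_nonneg (‖b‖ - ‖d‖), sq_nonneg (‖c‖ - ‖d‖)]

/-- The squared size of the mixed first-order jet. -/
def jetSq (B : ℝ × ℝ → ℂ) (ξ : ℝ × ℝ) : ℝ :=
  ‖B ξ‖ ^ 2 + ‖pderiv (1, 0) B ξ‖ ^ 2 + ‖pderiv (0, 1) B ξ‖ ^ 2 +
    ‖pderiv (1, 0) (pderiv (0, 1) B) ξ‖ ^ 2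

theorem integrable_weight {F : ℝ × ℝ → ℂ} (hF : Integrable F) : Integrable
    (fun z : ℝ × ℝ => F z / ((1 + Complex.I * (z.1 : ℂ)) * (1 + Complex.I * (z.2 : ℂ)))) := by
  have hn : ∀ x : ℝ, 1 ≤ ‖(1 + Complex.I * (x : ℂ))‖ := by
    intro x
    refine le_trans ?_ (Complex.re_le_norm _)
    simp
  have h0 : ∀ x : ℝ, (1 + Complex.I * (x : ℂ)) ≠ 0 := fun x h => by
    have := hn x; rw [h] at this; norm_num at this
  simp only [div_eq_mul_inv]
  refine hF.mul_bdd (c := 1) ?_ (Filter.Eventually.of_forall fun z => ?_)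
  · refine Continuous.aestronglyMeasurable (Continuous.inv₀ (by fun_prop) fun z => ?_)
    exact mul_ne_zero (h0 _) (h0 _)
  · rw [norm_inv, norm_mul]
    exact inv_le_one_of_one_le₀ (one_le_mul_of_one_le_of_one_le (hn _) (hn _))

theorem integrable_ft2_add_mul {B G : ℝ × ℝ → ℂ} (hB : Integrable B) (hG : Integrable G)
    (s : ℝ × ℝ) : Integrable (fun z => ft2 B (s + z) * G z) := by
  refine hG.bdd_mul (c := ∫ ξ, ‖B ξ‖) ?_ (Filter.Eventually.of_forall fun z => norm_ft2_le _ _)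
  have := continuous_ft2 hB
  exact Continuous.aestronglyMeasurable (by fun_prop)

theorem norm_multiplier_sq_le {B F : ℝ × ℝ → ℂ} (hB : ContDiff ℝ (⊤ : ℕ∞) B)
    (hs : HasCompactSupport B) (hF : Integrable F) (s : ℝ × ℝ) {G : ℝ × ℝ → ℂ}
    (hG : G = fun z : ℝ × ℝ => F z / ((1 + Complex.I * (z.1 : ℂ)) * (1 + Complex.I * (z.2 : ℂ)))) :
    ‖ft2 (fun ξ => B ξ * ft2 F ξ) s‖ ^ 2 ≤ 4 * ((1 + s.1 ^ 2) * (1 + s.2 ^ 2)) *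
      (‖ft2 (fun ξ => B ξ * ft2 G ξ) s‖ ^ 2 +
        ‖ft2 (fun ξ => pderiv (1, 0) B ξ * ft2 G ξ) s‖ ^ 2 +
        ‖ft2 (fun ξ => pderiv (0, 1) B ξ * ft2 G ξ) s‖ ^ 2 +
        ‖ft2 (fun ξ => pderiv (1, 0) (pderiv (0, 1) B) ξ * ft2 G ξ) s‖ ^ 2) := by
  have hn : ∀ x : ℝ, ‖(1 - Complex.I * (x : ℂ))‖ ^ 2 = 1 + x ^ 2 := by
    intro x
    rw [← Complex.normSq_eq_norm_sq, Complex.normSq_apply]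
    simp; ring
  have h0 : ∀ x : ℝ, (1 + Complex.I * (x : ℂ)) ≠ 0 := by
    intro x h
    have := congrArg Complex.re h
    simp at this
  have hGi : Integrable G := hG ▸ integrable_weight hF
  have hB1 := contDiff_pderiv (v := (1, 0)) hB
  have hB2 := contDiff_pderiv (v := (0, 1)) hB
  have hB12 := contDiff_pderiv (v := (1, 0)) hB2
  have hs1 := hasCompactSupport_pderiv (v := (1, 0)) hs
  have hs2 := hasCompactSupport_pderiv (v := (0, 1)) hs
  have hs12 := hasCompactSupport_pderiv (v := (1, 0)) hs2
  have i0 := hB.continuous.integrable_of_hasCompactSupport (μ := volume) hs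
  have i1 := hB1.continuous.integrable_of_hasCompactSupport (μ := volume) hs1
  have i2 := hB2.continuous.integrable_of_hasCompactSupport (μ := volume) hs2
  have i12 := hB12.continuous.integrable_of_hasCompactSupport (μ := volume) hs12
  have e : ft2 (fun ξ => B ξ * ft2 F ξ) s =
      (1 - Complex.I * (s.1 : ℂ)) * (1 - Complex.I * (s.2 : ℂ)) *
        ft2 (fun ξ => B ξ * ft2 G ξ) s +
      (1 - Complex.I * (s.2 : ℂ)) * ft2 (fun ξ => pderiv (1, 0) B ξ * ft2 G ξ) s +
      (1 - Complex.I * (s.1 : ℂ)) * ft2 (fun ξ => pderiv (0, 1) B ξ * ft2 G ξ) s +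
      ft2 (fun ξ => pderiv (1, 0) (pderiv (0, 1) B) ξ * ft2 G ξ) s := by
    rw [ft2_mul_ft2 i0 hF, ft2_mul_ft2 i0 hGi, ft2_mul_ft2 i1 hGi, ft2_mul_ft2 i2 hGi,
      ft2_mul_ft2 i12 hGi]
    have j0 := (integrable_ft2_add_mul i0 hGi s).const_mul
      ((1 - Complex.I * (s.1 : ℂ)) * (1 - Complex.I * (s.2 : ℂ)))
    have j1 := (integrable_ft2_add_mul i1 hGi s).const_mul (1 - Complex.I * (s.2 : ℂ))
    have j2 := (integrable_ft2_add_mul i2 hGi s).const_mul (1 - Complex.I * (s.1 : ℂ))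
    have j12 := integrable_ft2_add_mul i12 hGi s
    simp only [← integral_const_mul]
    rw [← integral_add j0 j1, ← integral_add (by exact j0.add j1) j2,
      ← integral_add (by exact (j0.add j1).add j2) j12]
    refine integral_congr_ae (Filter.Eventually.of_forall fun z => ?_)
    have hz : F z = (1 + Complex.I * (z.1 : ℂ)) * (1 + Complex.I * (z.2 : ℂ)) * G z := by
      rw [hG]; simp only
      rw [mul_div_cancel₀ _ (mul_ne_zero (h0 _) (h0 _))]
    simp only [ft2_pderiv hB2 hs2, ft2_pderiv hB hs, hz]
    simp only [dot2, Prod.fst_add, Prod.snd_add]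
    push_cast
    ring_nf
  rw [e]
  refine (norm_four_sq_le _ _ _ _).trans ?_
  simp only [norm_mul, mul_pow, hn]
  have a1 : 0 ≤ s.1 ^ 2 := sq_nonneg _
  have a2 : 0 ≤ s.2 ^ 2 := sq_nonneg _
  have x1 := sq_nonneg ‖ft2 (fun ξ => pderiv (1, 0) B ξ * ft2 G ξ) s‖
  have x2 := sq_nonneg ‖ft2 (fun ξ => pderiv (0, 1) B ξ * ft2 G ξ) s‖
  have x3 := sq_nonneg ‖ft2 (fun ξ => pderiv (1, 0) (pderiv (0, 1) B) ξ * ft2 G ξ) s‖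
  nlinarith [mul_nonneg a1 x1, mul_nonneg a2 x1, mul_nonneg (mul_nonneg a1 a2) x1,
    mul_nonneg a1 x2, mul_nonneg a2 x2, mul_nonneg (mul_nonneg a1 a2) x2,
    mul_nonneg a1 x3, mul_nonneg a2 x3, mul_nonneg (mul_nonneg a1 a2) x3]

theorem lintegral_enorm_sq_ft2_mul_ft2_le {B G : ℝ × ℝ → ℂ} (hB : Continuous B)
    (hs : HasCompactSupport B) (hG : Integrable G) :
    ∫⁻ s, ‖ft2 (fun ξ => B ξ * ft2 G ξ) s‖ₑ ^ 2 =
      ENNReal.ofReal ((2 * π) ^ 2) * ∫⁻ ξ, ‖B ξ‖ₑ ^ 2 * ‖ft2 G ξ‖ₑ ^ 2 := by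
  have hc : Continuous (fun ξ => B ξ * ft2 G ξ) := hB.mul (continuous_ft2 hG)
  have hcs : HasCompactSupport (fun ξ => B ξ * ft2 G ξ) := hs.mul_right
  rw [lintegral_enorm_sq_ft2 (hc.integrable_of_hasCompactSupport hcs)
    (hc.memLp_of_hasCompactSupport hcs)]
  simp only [enorm_mul, mul_pow]

theorem ofReal_jetSq (B : ℝ × ℝ → ℂ) (ξ : ℝ × ℝ) : ENNReal.ofReal (jetSq B ξ) =
    ‖B ξ‖ₑ ^ 2 + ‖pderiv (1, 0) B ξ‖ₑ ^ 2 + ‖pderiv (0, 1) B ξ‖ₑ ^ 2 +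
      ‖pderiv (1, 0) (pderiv (0, 1) B) ξ‖ₑ ^ 2 := by
  unfold jetSq
  rw [ENNReal.ofReal_add (by positivity) (by positivity),
    ENNReal.ofReal_add (by positivity) (by positivity),
    ENNReal.ofReal_add (by positivity) (by positivity)]
  simp only [ENNReal.ofReal_pow (norm_nonneg _), ofReal_norm]

theorem lintegral_gauss_multiplier_le {ι : Type*} (S : Finset ι) {B : ι → ℝ × ℝ → ℂ}
    (hB : ∀ n ∈ S, ContDiff ℝ (⊤ : ℕ∞) (B n)) (hs : ∀ n ∈ S, HasCompactSupport (B n))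
    {A lm : ℝ} (hA : ∀ ξ, ∑ n ∈ S, jetSq (B n) ξ ≤ A)
    {F : ℝ × ℝ → ℂ} (hF : Integrable F) (hlm : ∀ z, ‖F z‖ ≤ lm) :
    ∫⁻ s, ∑ n ∈ S, ‖ft2 (fun ξ => B n ξ * ft2 F ξ) s‖ₑ ^ 2 ∂(gauss.prod gauss) ≤
      ENNReal.ofReal (4 * (2 * π) ^ 4 * π ^ 2 * A * lm ^ 2) := by
  have hA0 : 0 ≤ A := le_trans (Finset.sum_nonneg fun n _ => by unfold jetSq; positivity) (hA 0)
  set G : ℝ × ℝ → ℂ :=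
    fun z => F z / ((1 + Complex.I * (z.1 : ℂ)) * (1 + Complex.I * (z.2 : ℂ))) with hG
  have hGi : Integrable G := integrable_weight hF
  have hcont : ∀ {b : ℝ × ℝ → ℂ} {H : ℝ × ℝ → ℂ}, Continuous b → HasCompactSupport b →
      Integrable H → Continuous (ft2 fun ξ => b ξ * ft2 H ξ) := fun hb hbs hH =>
    continuous_ft2 ((hb.mul (continuous_ft2 hH)).integrable_of_hasCompactSupport hbs.mul_right)
  have hmeas : Measurable fun s => ∑ n ∈ S, ‖ft2 (fun ξ => B n ξ * ft2 F ξ) s‖ₑ ^ 2 :=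
    Finset.measurable_sum _ fun n hn =>
      ((hcont (hB n hn).continuous (hs n hn) hF).measurable.enorm.pow_const 2)
  have hsplit : ∀ (x y : ℝ) (a b c d : ℂ), 0 ≤ x → 0 ≤ y →
      ENNReal.ofReal (4 * (x * y) * (‖a‖ ^ 2 + ‖b‖ ^ 2 + ‖c‖ ^ 2 + ‖d‖ ^ 2)) =
      4 * (ENNReal.ofReal x * ENNReal.ofReal y) *
        (‖a‖ₑ ^ 2 + ‖b‖ₑ ^ 2 + ‖c‖ₑ ^ 2 + ‖d‖ₑ ^ 2) := by
    intro x y a b c d hx hy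
    rw [ENNReal.ofReal_mul (by positivity), ENNReal.ofReal_mul (by norm_num),
      ENNReal.ofReal_mul hx, ENNReal.ofReal_add (by positivity) (by positivity),
      ENNReal.ofReal_add (by positivity) (by positivity),
      ENNReal.ofReal_add (by positivity) (by positivity)]
    simp only [ENNReal.ofReal_pow (norm_nonneg _), ofReal_norm]
    norm_num
  rw [lintegral_gauss_prod hmeas]
  calc _ ≤ ∫⁻ s : ℝ × ℝ, 4 * ∑ n ∈ S, (‖ft2 (fun ξ => B n ξ * ft2 G ξ) s‖ₑ ^ 2 +
        ‖ft2 (fun ξ => pderiv (1, 0) (B n) ξ * ft2 G ξ) s‖ₑ ^ 2 +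
        ‖ft2 (fun ξ => pderiv (0, 1) (B n) ξ * ft2 G ξ) s‖ₑ ^ 2 +
        ‖ft2 (fun ξ => pderiv (1, 0) (pderiv (0, 1) (B n)) ξ * ft2 G ξ) s‖ₑ ^ 2) := by
        refine lintegral_mono fun s => ?_
        simp only
        rw [Finset.mul_sum, Finset.mul_sum]
        refine Finset.sum_le_sum fun n hn => ?_
        have h := ENNReal.ofReal_le_ofReal
          (norm_multiplier_sq_le (hB n hn) (hs n hn) hF s (G := G) rfl)
        rw [hsplit _ _ _ _ _ _ (add_nonneg one_pos.le (sq_nonneg _))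
          (add_nonneg one_pos.le (sq_nonneg _)), ENNReal.ofReal_pow (norm_nonneg _), ofReal_norm] at h
        set X := ‖ft2 (fun ξ => B n ξ * ft2 G ξ) s‖ₑ ^ 2 +
          ‖ft2 (fun ξ => pderiv (1, 0) (B n) ξ * ft2 G ξ) s‖ₑ ^ 2 +
          ‖ft2 (fun ξ => pderiv (0, 1) (B n) ξ * ft2 G ξ) s‖ₑ ^ 2 +
          ‖ft2 (fun ξ => pderiv (1, 0) (pderiv (0, 1) (B n)) ξ * ft2 G ξ) s‖ₑ ^ 2
        have g1 := gaussianPDF_mul_le s.1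
        have g2 := gaussianPDF_mul_le s.2
        calc _ ≤ _ := mul_le_mul_right h (ProbabilityTheory.gaussianPDF 0 1 s.1 *
              ProbabilityTheory.gaussianPDF 0 1 s.2)
          _ = 4 * ((ProbabilityTheory.gaussianPDF 0 1 s.1 * ENNReal.ofReal (1 + s.1 ^ 2)) *
              (ProbabilityTheory.gaussianPDF 0 1 s.2 * ENNReal.ofReal (1 + s.2 ^ 2)) * X) := by
              ring
          _ ≤ 4 * (1 * 1 * X) := by gcongr
          _ = _ := by ring
    _ = 4 * ∑ n ∈ S, (ENNReal.ofReal ((2 * π) ^ 2) *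
          ∫⁻ ξ, ENNReal.ofReal (jetSq (B n) ξ) * ‖ft2 G ξ‖ₑ ^ 2) := by
        have mft := (continuous_ft2 hGi).measurable.enorm.pow_const 2
        have meas : ∀ {b : ℝ × ℝ → ℂ}, Continuous b → HasCompactSupport b →
            Measurable fun s => ‖ft2 (fun ξ => b ξ * ft2 G ξ) s‖ₑ ^ 2 := fun hb hbs =>
          (hcont hb hbs hGi).measurable.enorm.pow_const 2
        have hm : ∀ n ∈ S, Continuous (pderiv (1, 0) (B n)) ∧ Continuous (pderiv (0, 1) (B n)) ∧
            Continuous (pderiv (1, 0) (pderiv (0, 1) (B n))) := fun n hn =>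
          ⟨(contDiff_pderiv (hB n hn)).continuous, (contDiff_pderiv (hB n hn)).continuous,
            (contDiff_pderiv (contDiff_pderiv (hB n hn))).continuous⟩
        rw [lintegral_const_mul' _ _ (by norm_num), lintegral_finsetSum' _ fun n hn => ?_]
        · congr 1
          refine Finset.sum_congr rfl fun n hn => ?_
          obtain ⟨c1, c2, c3⟩ := hm n hn
          have c0 := (hB n hn).continuous
          have s0 := hs n hn
          have s1 := hasCompactSupport_pderiv (v := (1, 0)) s0
          have s2 := hasCompactSupport_pderiv (v := (0, 1)) s0
          have s3 := hasCompactSupport_pderiv (v := (1, 0)) s2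
          rw [lintegral_add_right _ (meas c3 s3), lintegral_add_right _ (meas c2 s2),
            lintegral_add_right _ (meas c1 s1), lintegral_enorm_sq_ft2_mul_ft2_le c0 s0 hGi,
            lintegral_enorm_sq_ft2_mul_ft2_le c1 s1 hGi,
            lintegral_enorm_sq_ft2_mul_ft2_le c2 s2 hGi,
            lintegral_enorm_sq_ft2_mul_ft2_le c3 s3 hGi, ← mul_add, ← mul_add, ← mul_add]
          congr 1
          have m : ∀ {b : ℝ × ℝ → ℂ}, Continuous b →
            Measurable fun ξ => ‖b ξ‖ₑ ^ 2 * ‖ft2 G ξ‖ₑ ^ 2 := fun hb =>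
              (hb.measurable.enorm.pow_const 2).mul mft
          rw [← lintegral_add_right _ (m c1), ← lintegral_add_right _ (m c2),
            ← lintegral_add_right _ (m c3)]
          refine lintegral_congr fun ξ => ?_
          rw [ofReal_jetSq]; ring
        · obtain ⟨c1, c2, c3⟩ := hm n hn
          have s0 := hs n hn
          have s1 := hasCompactSupport_pderiv (v := (1, 0)) s0
          have s2 := hasCompactSupport_pderiv (v := (0, 1)) s0
          have s3 := hasCompactSupport_pderiv (v := (1, 0)) s2
          exact ((((meas (hB n hn).continuous s0).add (meas c1 s1)).add (meas c2 s2)).add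
            (meas c3 s3)).aemeasurable
    _ = 4 * (ENNReal.ofReal ((2 * π) ^ 2) *
          ∫⁻ ξ, ENNReal.ofReal (∑ n ∈ S, jetSq (B n) ξ) * ‖ft2 G ξ‖ₑ ^ 2) := by
        rw [← Finset.mul_sum, ← lintegral_finsetSum' _ fun n hn => ?_]
        · congr 2
          refine lintegral_congr fun ξ => ?_
          rw [ENNReal.ofReal_sum_of_nonneg fun n _ => by unfold jetSq; positivity, Finset.sum_mul]
        · have c0 := (hB n hn).continuous
          have c1 : Continuous (pderiv (1, 0) (B n)) := (contDiff_pderiv (hB n hn)).continuous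
          have c2 : Continuous (pderiv (0, 1) (B n)) := (contDiff_pderiv (hB n hn)).continuous
          have c3 : Continuous (pderiv (1, 0) (pderiv (0, 1) (B n))) :=
            (contDiff_pderiv (contDiff_pderiv (hB n hn))).continuous
          have : Continuous (jetSq (B n)) := by unfold jetSq; fun_prop
          exact (this.measurable.ennreal_ofReal.mul
            ((continuous_ft2 hGi).measurable.enorm.pow_const 2)).aemeasurable
    _ ≤ 4 * (ENNReal.ofReal ((2 * π) ^ 2) * (ENNReal.ofReal A *
          (ENNReal.ofReal ((2 * π) ^ 2) * ENNReal.ofReal (lm ^ 2 * π ^ 2)))) := by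
        gcongr
        calc _ ≤ ∫⁻ ξ, ENNReal.ofReal A * ‖ft2 G ξ‖ₑ ^ 2 := by
              gcongr with ξ
              exact hA ξ
          _ = ENNReal.ofReal A * ∫⁻ ξ, ‖ft2 G ξ‖ₑ ^ 2 :=
              lintegral_const_mul' _ _ ENNReal.ofReal_ne_top
          _ ≤ _ := by
              have hG2 : ∀ z, ‖G z‖ ≤ lm := fun z => by
                refine le_trans ?_ (hlm z)
                have hn : ∀ x : ℝ, 1 ≤ ‖(1 + Complex.I * (x : ℂ))‖ := fun x =>
                  le_trans (by simp) (Complex.re_le_norm _)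
                rw [hG]
                simp only [norm_div, norm_mul]
                exact div_le_self (norm_nonneg _) (one_le_mul_of_one_le_of_one_le (hn _) (hn _))
              rw [lintegral_enorm_sq_ft2 hGi (memLp_two_of_bound hGi hG2)]
              gcongr
              exact lintegral_enorm_sq_weight_le hlm
    _ = _ := by
        rw [show (4 : ℝ≥0∞) = ENNReal.ofReal 4 by norm_num, ← ENNReal.ofReal_mul (by positivity),
          ← ENNReal.ofReal_mul (by positivity), ← ENNReal.ofReal_mul (by positivity),
          ← ENNReal.ofReal_mul (by positivity)]
        congr 1; ring

/-- The linear map of `ℝ²` sending the standard basis to `u`, `v`. -/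
def lin2 (u v ρ : ℝ × ℝ) : ℝ × ℝ := (ρ.1 * u.1 + ρ.2 * v.1, ρ.1 * u.2 + ρ.2 * v.2)

/-- The determinant of `lin2`. -/
def det2 (u v : ℝ × ℝ) : ℝ := u.1 * v.2 - u.2 * v.1

theorem lin2_eq_toLin (u v : ℝ × ℝ) : lin2 u v = Matrix.toLin (Module.Basis.finTwoProd ℝ)
    (Module.Basis.finTwoProd ℝ) !![u.1, v.1; u.2, v.2] := by
  ext ρ <;> simp [lin2, Matrix.toLin_finTwoProd_apply] <;> ring

theorem continuous_lin2 (u v : ℝ × ℝ) : Continuous (lin2 u v) := by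
  unfold lin2; fun_prop

theorem map_lin2_volume {u v : ℝ × ℝ} (h : det2 u v ≠ 0) :
    (volume : Measure (ℝ × ℝ)).map (lin2 u v) = ENNReal.ofReal |(det2 u v)⁻¹| • volume := by
  have hd : LinearMap.det (Matrix.toLin (Module.Basis.finTwoProd ℝ)
      (Module.Basis.finTwoProd ℝ) !![u.1, v.1; u.2, v.2]) = det2 u v := by
    rw [LinearMap.det_toLin, Matrix.det_fin_two_of, det2]; ring
  rw [lin2_eq_toLin, Measure.map_linearMap_addHaar_eq_smul_addHaar _ (hd ▸ h), hd]

theorem measurableEmbedding_lin2 {u v : ℝ × ℝ} (h : det2 u v ≠ 0) :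
    MeasurableEmbedding (lin2 u v) := by
  refine (continuous_lin2 u v).measurableEmbedding fun a b hab => ?_
  simp only [lin2, Prod.mk.injEq] at hab
  unfold det2 at h
  have h1 : (a.1 - b.1) * (u.1 * v.2 - u.2 * v.1) = 0 := by
    linear_combination v.2 * hab.1 - v.1 * hab.2
  have h2 : (a.2 - b.2) * (u.1 * v.2 - u.2 * v.1) = 0 := by
    linear_combination u.1 * hab.2 - u.2 * hab.1
  exact Prod.ext (sub_eq_zero.1 ((mul_eq_zero.1 h1).resolve_right h))
    (sub_eq_zero.1 ((mul_eq_zero.1 h2).resolve_right h))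

theorem integral_comp_lin2 {u v : ℝ × ℝ} (h : det2 u v ≠ 0) (g : ℝ × ℝ → ℂ) :
    ∫ ρ, g (lin2 u v ρ) = (|(det2 u v)⁻¹| : ℝ) * ∫ ξ, g ξ := by
  rw [← (measurableEmbedding_lin2 h).integral_map (μ := volume) g, map_lin2_volume h,
    integral_smul_measure, ENNReal.toReal_ofReal (abs_nonneg _), Complex.real_smul]

theorem integrable_comp_lin2 {u v : ℝ × ℝ} (h : det2 u v ≠ 0) {g : ℝ × ℝ → ℂ}
    (hg : Integrable g) : Integrable (fun ρ => g (lin2 u v ρ)) := by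
  refine ((measurableEmbedding_lin2 h).integrable_map_iff (μ := volume) (g := g)).1 ?_
  rw [map_lin2_volume h]
  exact hg.smul_measure ENNReal.ofReal_ne_top

theorem ft2_mul_ft2_comp_lin2 {u v u' v' : ℝ × ℝ} (huu : dot2 u' u = 1) (hvv : dot2 v' v = 1)
    (huv : dot2 u' v = 0) (hvu : dot2 v' u = 0) (B F : ℝ × ℝ → ℂ) (c s : ℝ × ℝ) :
    ft2 (fun ξ => B ξ * ft2 F ξ) (c + lin2 u' v' s) =
      ft2 (fun ρ => B (lin2 u v ρ) * ft2 (fun σ => F (lin2 u' v' σ - c)) ρ) s := by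
  have hdet : det2 u v * det2 u' v' = 1 := by
    simp only [dot2, det2] at *
    have e : (u.1 * v.2 - u.2 * v.1) * (u'.1 * v'.2 - u'.2 * v'.1) =
        (u'.1 * u.1 + u'.2 * u.2) * (v'.1 * v.1 + v'.2 * v.2) -
        (u'.1 * v.1 + u'.2 * v.2) * (v'.1 * u.1 + v'.2 * u.2) := by ring
    rw [e, huu, hvv, huv]; ring
  have hd : det2 u v ≠ 0 := left_ne_zero_of_mul_eq_one hdet
  have hd' : det2 u' v' ≠ 0 := right_ne_zero_of_mul_eq_one hdet
  have hdot : ∀ σ ρ, dot2 (lin2 u' v' σ) (lin2 u v ρ) = dot2 σ ρ := by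
    intro σ ρ
    simp only [dot2, lin2] at *
    linear_combination σ.1 * ρ.1 * huu + σ.1 * ρ.2 * huv + σ.2 * ρ.1 * hvu + σ.2 * ρ.2 * hvv
  have hF : ∀ ρ, ft2 (fun σ => F (lin2 u' v' σ - c)) ρ = (|(det2 u' v')⁻¹| : ℝ) *
      (Complex.exp (-Complex.I * (dot2 c (lin2 u v ρ) : ℝ)) * ft2 F (lin2 u v ρ)) := by
    intro ρ
    simp only [ft2_eq]
    have := integral_comp_lin2 hd'
      (fun x => Complex.exp (-Complex.I * (dot2 x (lin2 u v ρ) : ℝ)) * F (x - c))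
    simp only [hdot] at this
    rw [this, ← integral_const_mul (Complex.exp _)]
    congr 1
    rw [← integral_sub_right_eq_self (fun x => Complex.exp (-Complex.I *
        (dot2 c (lin2 u v ρ) : ℝ)) * (Complex.exp (-Complex.I * (dot2 x (lin2 u v ρ) : ℝ)) * F x)) c]
    refine integral_congr_ae (Filter.Eventually.of_forall fun x => ?_)
    simp only [← mul_assoc, ← Complex.exp_add]
    congr 2
    simp only [dot2, Prod.fst_sub, Prod.snd_sub]
    push_cast
    ring
  have h0 := integral_comp_lin2 hd (fun ξ => Complex.exp (-Complex.I *
    (dot2 ξ (c + lin2 u' v' s) : ℝ)) * (B ξ * ft2 F ξ))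
  have h1 : ((|(det2 u v)⁻¹| : ℝ) : ℂ) * (|(det2 u' v')⁻¹| : ℝ) = 1 := by
    rw [← Complex.ofReal_mul, ← abs_mul, ← mul_inv, hdet]; simp
  refine mul_left_cancel₀ (left_ne_zero_of_mul_eq_one h1) ?_
  rw [ft2_eq, ← h0, ft2_eq, ← integral_const_mul]
  refine integral_congr_ae (Filter.Eventually.of_forall fun ρ => ?_)
  simp only [hF]
  have hd2 : dot2 (lin2 u v ρ) (c + lin2 u' v' s) = dot2 ρ s + dot2 c (lin2 u v ρ) := by
    rw [dot2_comm, dot2_add_left, hdot, dot2_comm s]; ring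
  rw [hd2, Complex.ofReal_add, mul_add, Complex.exp_add]
  linear_combination (-(Complex.exp (-Complex.I * (dot2 ρ s : ℝ)) *
    Complex.exp (-Complex.I * (dot2 c (lin2 u v ρ) : ℝ)) * B (lin2 u v ρ) *
    ft2 F (lin2 u v ρ))) * h1

/-- The size of the mixed first-order jet in the directions `u` and `v`. -/
def jetN (u v : ℝ × ℝ) (f : ℝ × ℝ → ℂ) (ξ : ℝ × ℝ) : ℝ :=
  ‖f ξ‖ + ‖pderiv u f ξ‖ + ‖pderiv v f ξ‖ + ‖pderiv u (pderiv v f) ξ‖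

theorem jetN_nonneg (u v : ℝ × ℝ) (f : ℝ × ℝ → ℂ) (ξ : ℝ × ℝ) : 0 ≤ jetN u v f ξ := by
  unfold jetN; positivity

theorem jetN_congr {u v ξ : ℝ × ℝ} {f g : ℝ × ℝ → ℂ} (h : f =ᶠ[nhds ξ] g) :
    jetN u v f ξ = jetN u v g ξ := by
  have h1 : ∀ w, pderiv w f =ᶠ[nhds ξ] pderiv w g := fun w =>
    (h.fderiv (𝕜 := ℝ)).mono fun x hx => by simp only [pderiv, hx]
  have h2 : pderiv u (pderiv v f) ξ = pderiv u (pderiv v g) ξ := by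
    rw [pderiv, (h1 v).fderiv_eq, ← pderiv]
  simp only [jetN, h.eq_of_nhds, (h1 u).eq_of_nhds, (h1 v).eq_of_nhds, h2]

theorem jetN_zero (u v ξ : ℝ × ℝ) : jetN u v (fun _ => 0) ξ = 0 := by
  have : ∀ w, pderiv w (fun _ : ℝ × ℝ => (0 : ℂ)) = fun _ => 0 := fun w => by
    funext x; simp [pderiv]
  simp [jetN, this]

theorem jetN_eq_zero {u v ξ : ℝ × ℝ} {f : ℝ × ℝ → ℂ} (h : f =ᶠ[nhds ξ] fun _ => 0) :
    jetN u v f ξ = 0 := by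
  rw [jetN_congr h, jetN_zero]

theorem differentiableAt_pderiv {f : ℝ × ℝ → ℂ} {ξ : ℝ × ℝ} (v : ℝ × ℝ)
    (hf : ContDiffAt ℝ 2 f ξ) : DifferentiableAt ℝ (pderiv v f) ξ := by
  have : ContDiffAt ℝ 1 (fderiv ℝ f) ξ := hf.fderiv_right (by norm_num)
  exact (this.differentiableAt (by norm_num)).clm_apply (differentiableAt_const v)

theorem ContDiffAt.eventually_differentiableAt {f : ℝ × ℝ → ℂ} {ξ : ℝ × ℝ}
    (hf : ContDiffAt ℝ 2 f ξ) : ∀ᶠ x in nhds ξ, DifferentiableAt ℝ f x :=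
  ((hf.of_le (m := 1) (by norm_num)).eventually (by norm_num)).mono
    fun _ hx => hx.differentiableAt (by norm_num)

theorem jetN_mul_le {f g : ℝ × ℝ → ℂ} {ξ : ℝ × ℝ} (u v : ℝ × ℝ) (hf : ContDiffAt ℝ 2 f ξ)
    (hg : ContDiffAt ℝ 2 g ξ) :
    jetN u v (fun x => f x * g x) ξ ≤ jetN u v f ξ * jetN u v g ξ := by
  have h1 : ∀ w x, DifferentiableAt ℝ f x → DifferentiableAt ℝ g x →
      pderiv w (fun x => f x * g x) x = f x * pderiv w g x + pderiv w f x * g x := by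
    intro w x hfx hgx
    simp only [pderiv]
    rw [fderiv_fun_mul hfx hgx]
    simp [mul_comm]
  have h2 : pderiv v (fun x => f x * g x) =ᶠ[nhds ξ]
      fun x => f x * pderiv v g x + pderiv v f x * g x := by
    filter_upwards [hf.eventually_differentiableAt, hg.eventually_differentiableAt]
      with x hx hx' using h1 v x hx hx'
  have df := hf.differentiableAt (by norm_num)
  have dg := hg.differentiableAt (by norm_num)
  have df' := differentiableAt_pderiv v hf
  have dg' := differentiableAt_pderiv v hg
  have h3 : pderiv u (pderiv v (fun x => f x * g x)) ξ =
      f ξ * pderiv u (pderiv v g) ξ + pderiv u f ξ * pderiv v g ξ +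
      (pderiv v f ξ * pderiv u g ξ + pderiv u (pderiv v f) ξ * g ξ) := by
    have e : HasFDerivAt (fun x => f x * pderiv v g x + pderiv v f x * g x) _ ξ :=
      (df.hasFDerivAt.mul dg'.hasFDerivAt).add (df'.hasFDerivAt.mul dg.hasFDerivAt)
    conv_lhs => rw [pderiv, h2.fderiv_eq, e.fderiv]
    simp [pderiv, mul_comm]
  have t1 := norm_add_le (f ξ * pderiv u g ξ) (pderiv u f ξ * g ξ)
  have t2 := norm_add_le (f ξ * pderiv v g ξ) (pderiv v f ξ * g ξ)
  have t3 := norm_add_le (f ξ * pderiv u (pderiv v g) ξ + pderiv u f ξ * pderiv v g ξ)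
    (pderiv v f ξ * pderiv u g ξ + pderiv u (pderiv v f) ξ * g ξ)
  have t4 := norm_add_le (f ξ * pderiv u (pderiv v g) ξ) (pderiv u f ξ * pderiv v g ξ)
  have t5 := norm_add_le (pderiv v f ξ * pderiv u g ξ) (pderiv u (pderiv v f) ξ * g ξ)
  simp only [jetN, h1 u ξ df dg, h1 v ξ df dg, h3, norm_mul] at *
  set a := ‖f ξ‖
  set b := ‖pderiv u f ξ‖
  set c := ‖pderiv v f ξ‖
  set d := ‖pderiv u (pderiv v f) ξ‖
  set a' := ‖g ξ‖
  set b' := ‖pderiv u g ξ‖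
  set c' := ‖pderiv v g ξ‖
  set d' := ‖pderiv u (pderiv v g) ξ‖
  have : 0 ≤ b * b' + b * d' + c * c' + c * d' + d * b' + d * c' + d * d' := by positivity
  linarith

theorem jetN_comp_le {q : ℝ → ℂ} (hq : ContDiff ℝ 2 q) {g : ℝ × ℝ → ℝ} {ξ : ℝ × ℝ} (u v : ℝ × ℝ)
    {g' : ℝ × ℝ → (ℝ × ℝ →L[ℝ] ℝ)} (hg : ∀ᶠ x in nhds ξ, HasFDerivAt g (g' x) x)
    {c : ℝ × ℝ →L[ℝ] ℝ} (hc : HasFDerivAt (fun x => g' x v) c ξ) :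
    jetN u v (fun x => q (g x)) ξ ≤ ‖q (g ξ)‖ + ‖deriv q (g ξ)‖ * (|g' ξ u| + |g' ξ v| + |c u|) +
      ‖deriv (deriv q) (g ξ)‖ * (|g' ξ u| * |g' ξ v|) := by
  have dq : Differentiable ℝ q := hq.differentiable (by norm_num)
  have dq' : Differentiable ℝ (deriv q) :=
    (contDiff_succ_iff_deriv.1 (show ContDiff ℝ (1 + 1) q from hq)).2.2.differentiable
      (by norm_num)
  have h1 : ∀ w x, HasFDerivAt g (g' x) x →
      pderiv w (fun x => q (g x)) x = (g' x w : ℂ) * deriv q (g x) := by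
    intro w x hx
    have : HasFDerivAt (fun x => q (g x)) _ x :=
      (dq (g x)).hasDerivAt.hasFDerivAt.comp x hx
    rw [pderiv, this.fderiv]
    simp
  have h2 : pderiv v (fun x => q (g x)) =ᶠ[nhds ξ] fun x => (g' x v : ℂ) * deriv q (g x) :=
    hg.mono fun x hx => h1 v x hx
  have hgξ := hg.self_of_nhds
  have h3 : pderiv u (pderiv v (fun x => q (g x))) ξ =
      (g' ξ v : ℂ) * ((g' ξ u : ℂ) * deriv (deriv q) (g ξ)) + (c u : ℂ) * deriv q (g ξ) := by
    have e1 : HasFDerivAt (fun x => deriv q (g x)) _ ξ :=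
      (dq' (g ξ)).hasDerivAt.hasFDerivAt.comp ξ hgξ
    have e2 : HasFDerivAt (fun x => (g' x v : ℂ)) _ ξ := Complex.ofRealCLM.hasFDerivAt.comp ξ hc
    have e3 : HasFDerivAt (fun x => (g' x v : ℂ) * deriv q (g x)) _ ξ := e2.mul e1
    conv_lhs => rw [pderiv, h2.fderiv_eq, e3.fderiv]
    simp [mul_comm]
  simp only [jetN, h1 u ξ hgξ, h1 v ξ hgξ, h3, norm_mul, Complex.norm_real, Real.norm_eq_abs]
  have := norm_add_le ((g' ξ v : ℂ) * ((g' ξ u : ℂ) * deriv (deriv q) (g ξ)))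
    ((c u : ℂ) * deriv q (g ξ))
  simp only [norm_mul, Complex.norm_real, Real.norm_eq_abs] at this
  linarith

theorem jetSq_comp_lin2_le (u v : ℝ × ℝ) {f : ℝ × ℝ → ℂ} (hf : ContDiff ℝ (⊤ : ℕ∞) f)
    (ρ : ℝ × ℝ) : jetSq (fun x => f (lin2 u v x)) ρ ≤ jetN u v f (lin2 u v ρ) ^ 2 := by
  have hL : ∀ x, HasFDerivAt (lin2 u v)
      ((ContinuousLinearMap.fst ℝ ℝ ℝ).smulRight u + (ContinuousLinearMap.snd ℝ ℝ ℝ).smulRight v)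
      x := by
    intro x
    have : lin2 u v = ⇑((ContinuousLinearMap.fst ℝ ℝ ℝ).smulRight u +
        (ContinuousLinearMap.snd ℝ ℝ ℝ).smulRight v) := by
      ext x <;> simp [lin2]
    conv => arg 1; rw [this]
    exact ContinuousLinearMap.hasFDerivAt _
  have key : ∀ (h : ℝ × ℝ → ℂ), ContDiff ℝ (⊤ : ℕ∞) h → ∀ x,
      pderiv (1, 0) (fun x => h (lin2 u v x)) x = pderiv u h (lin2 u v x) ∧
      pderiv (0, 1) (fun x => h (lin2 u v x)) x = pderiv v h (lin2 u v x) := by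
    intro h hh x
    have hd := ((hh.differentiable (by simp)) (lin2 u v x)).hasFDerivAt.comp x (hL x)
    have : fderiv ℝ (fun x => h (lin2 u v x)) x = _ := hd.fderiv
    simp only [pderiv, this]
    constructor <;> simp
  have e1 : pderiv (0, 1) (fun x => f (lin2 u v x)) = fun x => pderiv v f (lin2 u v x) :=
    funext fun x => (key f hf x).2
  unfold jetSq jetN
  rw [e1, (key f hf ρ).1, (key _ (contDiff_pderiv hf) ρ).1]
  set a := ‖f (lin2 u v ρ)‖
  set b := ‖pderiv u f (lin2 u v ρ)‖
  set c := ‖pderiv v f (lin2 u v ρ)‖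
  set d := ‖pderiv u (pderiv v f) (lin2 u v ρ)‖
  have : 0 ≤ a * b + a * c + a * d + b * c + b * d + c * d := by positivity
  nlinarith

theorem pderiv_eq_basis (w : ℝ × ℝ) (f : ℝ × ℝ → ℂ) (ξ : ℝ × ℝ) :
    pderiv w f ξ = (w.1 : ℂ) * pderiv (1, 0) f ξ + (w.2 : ℂ) * pderiv (0, 1) f ξ := by
  have : w = w.1 • ((1, 0) : ℝ × ℝ) + w.2 • ((0, 1) : ℝ × ℝ) := by ext <;> simp
  simp only [pderiv]
  conv_lhs => rw [this, map_add, map_smul, map_smul]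
  simp

theorem norm_add_mul_le {w : ℝ × ℝ} (hw : ‖w‖ ≤ 1) (a b : ℂ) :
    ‖(w.1 : ℂ) * a + (w.2 : ℂ) * b‖ ≤ ‖a‖ + ‖b‖ := by
  have h1 : |w.1| ≤ 1 := (norm_fst_le w).trans hw
  have h2 : |w.2| ≤ 1 := (norm_snd_le w).trans hw
  refine (norm_add_le _ _).trans ?_
  rw [norm_mul, norm_mul, Complex.norm_real, Complex.norm_real, Real.norm_eq_abs,
    Real.norm_eq_abs]
  have := mul_le_mul_of_nonneg_right h1 (norm_nonneg a)
  have := mul_le_mul_of_nonneg_right h2 (norm_nonneg b)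
  linarith

theorem exists_jetN_le {f : ℝ × ℝ → ℂ} (hf : ContDiff ℝ (⊤ : ℕ∞) f) (hs : HasCompactSupport f) :
    ∃ C, 0 < C ∧ ∀ u v : ℝ × ℝ, ‖u‖ ≤ 1 → ‖v‖ ≤ 1 → ∀ ξ, jetN u v f ξ ≤ C := by
  have bd : ∀ g : ℝ × ℝ → ℂ, ContDiff ℝ (⊤ : ℕ∞) g → HasCompactSupport g →
      ∃ C, 0 ≤ C ∧ ∀ w : ℝ × ℝ, ‖w‖ ≤ 1 → ∀ ξ, ‖pderiv w g ξ‖ ≤ C := by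
    intro g hg hgs
    obtain ⟨C1, h1⟩ := (hasCompactSupport_pderiv (v := (1, 0)) hgs).exists_bound_of_continuous
      (contDiff_pderiv hg).continuous
    obtain ⟨C2, h2⟩ := (hasCompactSupport_pderiv (v := (0, 1)) hgs).exists_bound_of_continuous
      (contDiff_pderiv hg).continuous
    refine ⟨C1 + C2, add_nonneg ((norm_nonneg _).trans (h1 0)) ((norm_nonneg _).trans (h2 0)),
      fun w hw ξ => ?_⟩
    rw [pderiv_eq_basis]
    exact (norm_add_mul_le hw _ _).trans (add_le_add (h1 ξ) (h2 ξ))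
  obtain ⟨C0, h0⟩ := hs.exists_bound_of_continuous hf.continuous
  obtain ⟨C1, p1, h1⟩ := bd f hf hs
  obtain ⟨C2, p2, h2⟩ := bd _ (contDiff_pderiv (v := (1, 0)) hf) (hasCompactSupport_pderiv hs)
  obtain ⟨C3, p3, h3⟩ := bd _ (contDiff_pderiv (v := (0, 1)) hf) (hasCompactSupport_pderiv hs)
  have p0 := (norm_nonneg _).trans (h0 0)
  refine ⟨C0 + C1 + C1 + (C2 + C3) + 1, by positivity, fun u v hu hv ξ => ?_⟩
  have e : pderiv u (pderiv v f) ξ =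
      (v.1 : ℂ) * pderiv u (pderiv (1, 0) f) ξ + (v.2 : ℂ) * pderiv u (pderiv (0, 1) f) ξ := by
    have d1 : DifferentiableAt ℝ (pderiv (1, 0) f) ξ :=
      (contDiff_pderiv hf).differentiable (by simp) ξ
    have d2 : DifferentiableAt ℝ (pderiv (0, 1) f) ξ :=
      (contDiff_pderiv hf).differentiable (by simp) ξ
    have hv' : pderiv v f = fun x => (v.1 : ℂ) * pderiv (1, 0) f x + (v.2 : ℂ) * pderiv (0, 1) f x :=
      funext fun x => pderiv_eq_basis v f x
    have hd : HasFDerivAt (fun x => (v.1 : ℂ) * pderiv (1, 0) f x + (v.2 : ℂ) * pderiv (0, 1) f x)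
        _ ξ := (d1.hasFDerivAt.const_mul _).add (d2.hasFDerivAt.const_mul _)
    rw [hv']
    conv_lhs => rw [pderiv, hd.fderiv]
    simp [pderiv]
  have b2 : ‖pderiv u (pderiv v f) ξ‖ ≤ C2 + C3 := by
    rw [e]
    exact (norm_add_mul_le hv _ _).trans (add_le_add (h2 u hu ξ) (h3 u hu ξ))
  have := h1 u hu ξ
  have := h1 v hv ξ
  have := h0 ξ
  unfold jetN
  linarith

/-- The continuous linear functional `dot2 v`. -/
def dotCLM (v : ℝ × ℝ) : ℝ × ℝ →L[ℝ] ℝ :=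
  v.1 • ContinuousLinearMap.fst ℝ ℝ ℝ + v.2 • ContinuousLinearMap.snd ℝ ℝ ℝ

@[simp] theorem dotCLM_apply (v x : ℝ × ℝ) : dotCLM v x = dot2 v x := by
  simp [dotCLM, dot2]

theorem hasFDerivAt_dot2 (v ξ : ℝ × ℝ) : HasFDerivAt (fun x => dot2 v x) (dotCLM v) ξ := by
  have : (fun x => dot2 v x) = ⇑(dotCLM v) := funext fun x => (dotCLM_apply v x).symm
  rw [this]
  exact (dotCLM v).hasFDerivAt

theorem fst_le_enorm2 (ξ : ℝ × ℝ) : |ξ.1| ≤ enorm2 ξ := by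
  unfold enorm2
  exact Real.le_sqrt_of_sq_le (by rw [sq_abs]; nlinarith [sq_nonneg ξ.2])

theorem enorm2_pos_of_nullCoord {ξ : ℝ × ℝ} (h : 0 < nullCoord ξ) : 0 < enorm2 ξ := by
  have := fst_le_enorm2 ξ
  have h2 : nullCoord ξ = enorm2 ξ + ξ.1 := rfl
  have := le_abs_self ξ.1
  linarith

theorem nullCoord_le (ξ : ℝ × ℝ) : nullCoord ξ ≤ 2 * enorm2 ξ := by
  have := fst_le_enorm2 ξ
  have h2 : nullCoord ξ = enorm2 ξ + ξ.1 := rfl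
  have := le_abs_self ξ.1
  linarith

theorem continuous_nullCoord : Continuous nullCoord := by
  have := continuous_enorm2
  unfold nullCoord; fun_prop

theorem contDiffAt_enorm2 {n : WithTop ℕ∞} {ξ : ℝ × ℝ} (h : 0 < enorm2 ξ) :
    ContDiffAt ℝ n enorm2 ξ := by
  unfold enorm2
  have h' : ξ.1 ^ 2 + ξ.2 ^ 2 ≠ 0 := by
    intro h0
    rw [enorm2, h0] at h; simp at h
  exact ContDiffAt.sqrt (by fun_prop) h'

theorem contDiffAt_angCoord {n : WithTop ℕ∞} {ξ : ℝ × ℝ} (h : 0 < nullCoord ξ) :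
    ContDiffAt ℝ n angCoord ξ := by
  have h1 := contDiffAt_enorm2 (n := n) (enorm2_pos_of_nullCoord h)
  have h2 : ContDiffAt ℝ n nullCoord ξ := h1.add (by fun_prop)
  exact ContDiffAt.div (by fun_prop) h2 h.ne'

theorem hasFDerivAt_enorm2 {ξ : ℝ × ℝ} (h : 0 < enorm2 ξ) :
    HasFDerivAt enorm2 ((enorm2 ξ)⁻¹ • dotCLM ξ) ξ := by
  have h1 : HasFDerivAt (fun x : ℝ × ℝ => x.1 ^ 2 + x.2 ^ 2) ((2 : ℝ) • dotCLM ξ) ξ := by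
    have := (hasFDerivAt_fst (𝕜 := ℝ) (p := ξ)).pow 2 |>.add
      ((hasFDerivAt_snd (𝕜 := ℝ) (p := ξ)).pow 2)
    refine this.congr_fderiv ?_
    ext <;> simp [dot2]
  have h' : ξ.1 ^ 2 + ξ.2 ^ 2 ≠ 0 := by
    intro h0
    rw [enorm2, h0] at h; simp at h
  refine (h1.sqrt h').congr_fderiv ?_
  have : √(ξ.1 ^ 2 + ξ.2 ^ 2) = enorm2 ξ := rfl
  rw [this, smul_smul]
  congr 1
  field_simp

/-- The unit null direction with projective coordinate `v`. -/
def nullDir (v : ℝ) : ℝ × ℝ := ((1 - v ^ 2) / (1 + v ^ 2), 2 * v / (1 + v ^ 2))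

/-- The unit vector orthogonal to `nullDir v`. -/
def nullPerp (v : ℝ) : ℝ × ℝ := (-(2 * v) / (1 + v ^ 2), (1 - v ^ 2) / (1 + v ^ 2))

theorem nullDir_sq (v : ℝ) : (nullDir v).1 ^ 2 + (nullDir v).2 ^ 2 = 1 := by
  have : (1 + v ^ 2) ≠ 0 := by positivity
  simp only [nullDir]; field_simp; ring

theorem nullPerp_eq (v : ℝ) : nullPerp v = (-(nullDir v).2, (nullDir v).1) := by
  simp [nullPerp, nullDir, neg_div]

theorem abs_nullDir_le (v : ℝ) : |(nullDir v).1| ≤ 1 ∧ |(nullDir v).2| ≤ 1 := by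
  have := nullDir_sq v
  constructor <;> rw [← sq_le_one_iff_abs_le_one] <;>
    nlinarith [sq_nonneg (nullDir v).1, sq_nonneg (nullDir v).2]

theorem dot2_nullDir_sq_add (v : ℝ) (ξ : ℝ × ℝ) :
    dot2 (nullDir v) ξ ^ 2 + dot2 (nullPerp v) ξ ^ 2 = enorm2 ξ ^ 2 := by
  have h := nullDir_sq v
  rw [nullPerp_eq, enorm2_sq]
  simp only [dot2]
  linear_combination (ξ.1 ^ 2 + ξ.2 ^ 2) * h

theorem angCoord_identities {ξ : ℝ × ℝ} (h : 0 < nullCoord ξ) :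
    ξ.1 = nullCoord ξ * (1 - angCoord ξ ^ 2) / 2 ∧ ξ.2 = nullCoord ξ * angCoord ξ ∧
      enorm2 ξ = nullCoord ξ * (1 + angCoord ξ ^ 2) / 2 := by
  have h1 := enorm2_sq ξ
  have h2 : ξ.2 = nullCoord ξ * angCoord ξ := by rw [angCoord]; field_simp
  have h3 : nullCoord ξ = enorm2 ξ + ξ.1 := rfl
  have h4 : nullCoord ξ * (nullCoord ξ * angCoord ξ ^ 2) = nullCoord ξ * (enorm2 ξ - ξ.1) := by
    have e : (nullCoord ξ * angCoord ξ) ^ 2 = nullCoord ξ * (enorm2 ξ - ξ.1) := by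
      rw [← h2, h3]; linarith
    rw [← e]; ring
  have h5 := mul_left_cancel₀ h.ne' h4
  exact ⟨by linarith, h2, by linarith⟩

theorem enorm2_sub_dot2_nullDir {ξ : ℝ × ℝ} (h : 0 < nullCoord ξ) (v : ℝ) :
    enorm2 ξ - dot2 (nullDir v) ξ = nullCoord ξ * (angCoord ξ - v) ^ 2 / (1 + v ^ 2) := by
  obtain ⟨h1, h2, h3⟩ := angCoord_identities h
  have : (1 + v ^ 2) ≠ 0 := by positivity
  simp only [dot2, nullDir]
  rw [h3, h1, h2]
  field_simp
  ring

theorem dot2_null_bounds {ξ : ℝ × ℝ} (h : 0 < nullCoord ξ) {v s : ℝ} (hs : 0 ≤ s)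
    (hv : |angCoord ξ - v| ≤ s / 2) :
    0 ≤ enorm2 ξ - dot2 (nullDir v) ξ ∧ enorm2 ξ - dot2 (nullDir v) ξ ≤ enorm2 ξ * s ^ 2 ∧
      |dot2 (nullDir v) ξ| ≤ enorm2 ξ ∧ |dot2 (nullPerp v) ξ| ≤ enorm2 ξ * s := by
  have hr := enorm2_pos_of_nullCoord h
  have hle := nullCoord_le ξ
  have e := enorm2_sub_dot2_nullDir h v
  have e2 := dot2_nullDir_sq_add v ξ
  have h0 : 0 ≤ enorm2 ξ - dot2 (nullDir v) ξ := by rw [e]; positivity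
  have hsq : (angCoord ξ - v) ^ 2 ≤ (s / 2) ^ 2 := by
    rw [← sq_abs]; gcongr
  have h1 : enorm2 ξ - dot2 (nullDir v) ξ ≤ enorm2 ξ * s ^ 2 / 2 := by
    rw [e, div_le_iff₀ (by positivity)]
    nlinarith [mul_le_mul hle hsq (sq_nonneg _) (by positivity),
      mul_nonneg (mul_nonneg hr.le (sq_nonneg s)) (sq_nonneg v)]
  have hx : |dot2 (nullDir v) ξ| ≤ enorm2 ξ :=
    abs_le_of_sq_le_sq (by nlinarith [sq_nonneg (dot2 (nullPerp v) ξ)]) hr.le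
  refine ⟨h0, by nlinarith [mul_nonneg hr.le (sq_nonneg s)], hx, ?_⟩
  refine abs_le_of_sq_le_sq ?_ (by positivity)
  have := le_abs_self (dot2 (nullDir v) ξ)
  nlinarith [mul_le_mul h1 (show enorm2 ξ + dot2 (nullDir v) ξ ≤ 2 * enorm2 ξ by linarith)
    (by have := neg_abs_le (dot2 (nullDir v) ξ); linarith) (by positivity)]

theorem jetN_phase_le' {ξ : ℝ × ℝ} (hr : 0 < enorm2 ξ) (n u v : ℝ × ℝ) (huv : dot2 v u = 0)
    (t : ℝ) {a b c : ℝ} (ha : |t * (dot2 ξ u / enorm2 ξ - dot2 n u)| ≤ a)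
    (hb : |t * (dot2 ξ v / enorm2 ξ - dot2 n v)| ≤ b)
    (hc : |t * (dot2 ξ v * dot2 ξ u / enorm2 ξ ^ 3)| ≤ c) :
    jetN u v (fun x => Complex.exp (-Complex.I * ((t * (enorm2 x - dot2 n x) : ℝ) : ℂ))) ξ ≤
      1 + (a + b + c) + a * b := by
  set q : ℝ → ℂ := fun x => Complex.exp (-Complex.I * (x : ℂ)) with hq
  have hqd : ∀ x : ℝ, HasDerivAt q (-Complex.I * q x) x := by
    intro x
    have h1 : HasDerivAt (fun x : ℝ => -Complex.I * (x : ℂ)) (-Complex.I * 1) x :=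
      (Complex.ofRealCLM.hasDerivAt (x := x)).const_mul (-Complex.I)
    simpa [hq, mul_comm] using h1.cexp
  have hq1 : deriv q = fun x => -Complex.I * q x := funext fun x => (hqd x).deriv
  have hq2 : deriv (deriv q) = fun x => -Complex.I * (-Complex.I * q x) := by
    rw [hq1]; exact funext fun x => ((hqd x).const_mul _).deriv
  have hn : ∀ x, ‖q x‖ = 1 := fun x => norm_exp_neg_I_mul x
  have hqc : ContDiff ℝ 2 q := by
    have : ContDiff ℝ 2 (fun x : ℝ => (x : ℂ)) := Complex.ofRealCLM.contDiff
    exact (contDiff_const.mul this).cexp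
  have hev : ∀ᶠ x in nhds ξ, 0 < enorm2 x :=
    continuousAt_const.eventually_lt continuous_enorm2.continuousAt hr
  have hg : ∀ᶠ x in nhds ξ, HasFDerivAt (fun x => t * (enorm2 x - dot2 n x))
      (t • ((enorm2 x)⁻¹ • dotCLM x - dotCLM n)) x := by
    filter_upwards [hev] with x hx
    exact ((hasFDerivAt_enorm2 hx).sub (hasFDerivAt_dot2 n x)).const_mul t
  have hc' : HasFDerivAt (fun x => (t • ((enorm2 x)⁻¹ • dotCLM x - dotCLM n)) v)
      (t • ((enorm2 ξ)⁻¹ • dotCLM v + dot2 v ξ • (-(enorm2 ξ ^ 2)⁻¹ • (enorm2 ξ)⁻¹ • dotCLM ξ)))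
      ξ := by
    have h1 : HasFDerivAt (fun x => (enorm2 x)⁻¹) _ ξ :=
      (hasDerivAt_inv hr.ne').comp_hasFDerivAt ξ (hasFDerivAt_enorm2 hr)
    have h2 := ((h1.mul (hasFDerivAt_dot2 v ξ)).sub_const (dot2 n v)).const_mul t
    have e : (fun x => (t • ((enorm2 x)⁻¹ • dotCLM x - dotCLM n)) v) =
        fun x => t * ((enorm2 x)⁻¹ * dot2 v x - dot2 n v) := by
      funext x; simp [dot2_comm v x]
    rw [e]
    exact h2
  have key := jetN_comp_le hqc u v hg hc'
  rw [hq2, hq1] at key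
  simp only [norm_mul, hn, norm_neg, Complex.norm_I, one_mul, mul_one] at key
  refine key.trans ?_
  have ea : |(t • ((enorm2 ξ)⁻¹ • dotCLM ξ - dotCLM n)) u| ≤ a := by
    refine le_of_eq_of_le ?_ ha
    simp [div_eq_inv_mul]
  have eb : |(t • ((enorm2 ξ)⁻¹ • dotCLM ξ - dotCLM n)) v| ≤ b := by
    refine le_of_eq_of_le ?_ hb
    simp [div_eq_inv_mul]
  have ec : |(t • ((enorm2 ξ)⁻¹ • dotCLM v + dot2 v ξ • (-(enorm2 ξ ^ 2)⁻¹ • (enorm2 ξ)⁻¹ •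
      dotCLM ξ))) u| ≤ c := by
    refine le_of_eq_of_le ?_ hc
    have : (t • ((enorm2 ξ)⁻¹ • dotCLM v + dot2 v ξ • (-(enorm2 ξ ^ 2)⁻¹ • (enorm2 ξ)⁻¹ •
      dotCLM ξ))) u = -(t * (dot2 ξ v * dot2 ξ u / enorm2 ξ ^ 3)) := by
      simp only [smul_apply, add_apply, dotCLM_apply, huv,
        dot2_comm v ξ, smul_eq_mul]
      field_simp
      ring
    rw [this, abs_neg]
  have := mul_le_mul ea eb (abs_nonneg _) ((abs_nonneg _).trans ea)
  linarith

/-- The radial dual vector of the plank at scale `s` in direction `v`. -/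
def plankU (R s v : ℝ) : ℝ × ℝ := (R * s ^ 2)⁻¹ • nullDir v

/-- The angular dual vector of the plank at scale `s` in direction `v`. -/
def plankV (R s v : ℝ) : ℝ × ℝ := (R * s)⁻¹ • nullPerp v

theorem dot2_smul_right (c : ℝ) (x y : ℝ × ℝ) : dot2 x (c • y) = c * dot2 x y := by
  simp [dot2]; ring

theorem dot2_nullDir_self (v : ℝ) : dot2 (nullDir v) (nullDir v) = 1 := by
  have := nullDir_sq v
  simp only [dot2]; linarith

theorem dot2_nullDir_nullPerp (v : ℝ) : dot2 (nullDir v) (nullPerp v) = 0 := by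
  rw [nullPerp_eq]; simp only [dot2]; ring

theorem dot2_nullPerp_self (v : ℝ) : dot2 (nullPerp v) (nullPerp v) = 1 := by
  have := nullDir_sq v
  rw [nullPerp_eq]; simp only [dot2]; linarith

theorem dot2_plankU (R s v : ℝ) (ξ : ℝ × ℝ) :
    dot2 ξ (plankU R s v) = (R * s ^ 2)⁻¹ * dot2 (nullDir v) ξ := by
  rw [plankU, dot2_smul_right, dot2_comm]

theorem dot2_plankV (R s v : ℝ) (ξ : ℝ × ℝ) :
    dot2 ξ (plankV R s v) = (R * s)⁻¹ * dot2 (nullPerp v) ξ := by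
  rw [plankV, dot2_smul_right, dot2_comm]

theorem jetN_phase_le {ξ : ℝ × ℝ} {h₀ v s R : ℝ} (hh : 0 < h₀) (h : h₀ ≤ nullCoord ξ)
    (hs : 0 < s) (hv : |angCoord ξ - v| ≤ s / 2) (hR : 0 < R) (hRs : 1 ≤ R * s ^ 2) (t : ℝ) :
    jetN (plankU R s v) (plankV R s v) (fun x => Complex.exp (-Complex.I *
      ((t * (enorm2 x - dot2 (nullDir v) x) : ℝ) : ℂ))) ξ ≤
        (1 + 2 / h₀) * (1 + |t| / R) ^ 2 := by
  have hn : 0 < nullCoord ξ := hh.trans_le h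
  have hr := enorm2_pos_of_nullCoord hn
  have hrh := nullCoord_le ξ
  obtain ⟨h1, h2, h3, h4⟩ := dot2_null_bounds hn hs.le hv
  have hT : 0 ≤ |t| / R := by positivity
  set r := enorm2 ξ
  set x := dot2 (nullDir v) ξ
  set y := dot2 (nullPerp v) ξ
  refine (jetN_phase_le' hr (nullDir v) (plankU R s v) (plankV R s v) ?_ t
    (a := |t| / R) (b := |t| / R) (c := 2 / h₀ * (|t| / R)) ?_ ?_ ?_).trans ?_
  · rw [dot2_plankU, plankV, dot2_smul_right, dot2_nullDir_nullPerp]; simp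
  · rw [dot2_plankU, dot2_plankU, dot2_nullDir_self]
    have : t * ((R * s ^ 2)⁻¹ * x / r - (R * s ^ 2)⁻¹ * 1) = -(t / R * ((r - x) / (r * s ^ 2))) := by
      field_simp; ring
    rw [this, abs_neg, abs_mul, abs_div, abs_of_pos hR]
    refine mul_le_of_le_one_right hT ?_
    rw [abs_of_nonneg (by positivity)]
    exact div_le_one_of_le₀ h2 (by positivity)
  · rw [dot2_plankV, dot2_plankV, dot2_comm _ (nullDir v), dot2_nullDir_nullPerp]
    have : t * ((R * s)⁻¹ * y / r - (R * s)⁻¹ * 0) = t / R * (y / (r * s)) := by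
      field_simp; ring
    rw [this, abs_mul, abs_div, abs_of_pos hR]
    refine mul_le_of_le_one_right hT ?_
    rw [abs_div, abs_of_pos (show 0 < r * s by positivity)]
    exact div_le_one_of_le₀ h4 (by positivity)
  · rw [dot2_plankU, dot2_plankV]
    have : t * ((R * s)⁻¹ * y * ((R * s ^ 2)⁻¹ * x) / r ^ 3) =
        (R * s ^ 2)⁻¹ * (1 / r) * (y / (r * s) * (x / r)) * (t / R) := by
      field_simp
    have e1 : 1 / r ≤ 2 / h₀ := by
      rw [div_le_div_iff₀ hr hh]; linarith
    have e2 : |y / (r * s)| ≤ 1 := by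
      rw [abs_div, abs_of_pos (show 0 < r * s by positivity)]
      exact div_le_one_of_le₀ h4 (by positivity)
    have e3 : |x / r| ≤ 1 := by
      rw [abs_div, abs_of_pos hr]; exact div_le_one_of_le₀ h3 hr.le
    rw [this, abs_mul _ (t / R), abs_div t, abs_of_pos hR]
    refine mul_le_mul_of_nonneg_right ?_ hT
    rw [abs_mul, abs_of_pos (by positivity : 0 < (R * s ^ 2)⁻¹ * (1 / r)), abs_mul]
    calc (R * s ^ 2)⁻¹ * (1 / r) * (|y / (r * s)| * |x / r|) ≤ 1 * (2 / h₀) * (1 * 1) := by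
          gcongr
          exact inv_le_one_of_one_le₀ hRs
      _ = 2 / h₀ := by ring
  · have : 0 < 2 / h₀ := by positivity
    nlinarith [mul_nonneg this.le hT, mul_nonneg this.le (sq_nonneg (|t| / R))]

/-- A smooth bump supported in `[0, 1]` whose half-integer translates form a partition of unity. -/
def chi (x : ℝ) : ℝ := smoothTransition (2 * x) - smoothTransition (2 * x - 1)

theorem contDiff_chi : ContDiff ℝ (⊤ : ℕ∞) chi := by
  have h : ContDiff ℝ (⊤ : ℕ∞) smoothTransition := smoothTransition.contDiff
  exact (h.comp (by fun_prop : ContDiff ℝ (⊤ : ℕ∞) fun x : ℝ => 2 * x)).sub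
    (h.comp (by fun_prop : ContDiff ℝ (⊤ : ℕ∞) fun x : ℝ => 2 * x - 1))

theorem chi_eq_zero {x : ℝ} (hx : x ∉ Ioo (0 : ℝ) 1) : chi x = 0 := by
  unfold chi
  rcases le_or_gt x 0 with h | h
  · rw [smoothTransition.zero_of_nonpos (by linarith),
      smoothTransition.zero_of_nonpos (by linarith), sub_zero]
  · have : 1 ≤ x := by by_contra! h'; exact hx ⟨h, h'⟩
    rw [smoothTransition.one_of_one_le (by linarith),
      smoothTransition.one_of_one_le (by linarith), sub_self]

theorem sum_chi (x : ℝ) (N : ℕ) : ∑ n ∈ Finset.range N, (chi (x - n) + chi (x - 1 / 2 - n)) =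
    smoothTransition (2 * x) - smoothTransition (2 * x - 2 * N) := by
  induction N with
  | zero => simp
  | succ N ih =>
    rw [Finset.sum_range_succ, ih]
    simp only [chi]
    push_cast
    ring_nf

theorem exists_chi_bound : ∃ C, 0 < C ∧ ∀ x, ‖(chi x : ℂ)‖ ≤ C ∧
    ‖deriv (fun y => (chi y : ℂ)) x‖ ≤ C ∧ ‖deriv (deriv fun y => (chi y : ℂ)) x‖ ≤ C := by
  have h0 : ContDiff ℝ (⊤ : ℕ∞) (fun y => (chi y : ℂ)) := Complex.ofRealCLM.contDiff.comp contDiff_chi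
  have hs : HasCompactSupport (fun y => (chi y : ℂ)) := by
    refine HasCompactSupport.intro (isCompact_Icc (a := (0 : ℝ)) (b := 1)) fun x hx => ?_
    rw [chi_eq_zero fun h => hx (Ioo_subset_Icc_self h), Complex.ofReal_zero]
  have h1 : ContDiff ℝ (⊤ : ℕ∞) (deriv fun y => (chi y : ℂ)) :=
    (contDiff_infty_iff_deriv.1 h0).2
  have h2 : ContDiff ℝ (⊤ : ℕ∞) (deriv (deriv fun y => (chi y : ℂ))) :=
    (contDiff_infty_iff_deriv.1 h1).2
  obtain ⟨A, hA⟩ := hs.exists_bound_of_continuous h0.continuous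
  obtain ⟨B, hB⟩ := hs.deriv.exists_bound_of_continuous h1.continuous
  obtain ⟨D, hD⟩ := hs.deriv.deriv.exists_bound_of_continuous h2.continuous
  have := (norm_nonneg _).trans (hA 0)
  have := (norm_nonneg _).trans (hB 0)
  have := (norm_nonneg _).trans (hD 0)
  exact ⟨A + B + D + 1, by positivity, fun x => ⟨by linarith [hA x], by linarith [hB x],
    by linarith [hD x]⟩⟩

theorem hasFDerivAt_angCoord {ξ : ℝ × ℝ} (h : 0 < nullCoord ξ) :
    HasFDerivAt angCoord ((enorm2 ξ * nullCoord ξ)⁻¹ • dotCLM (-ξ.2, ξ.1)) ξ := by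
  have hr := enorm2_pos_of_nullCoord h
  have h1 : HasFDerivAt nullCoord _ ξ := (hasFDerivAt_enorm2 hr).add (hasFDerivAt_fst (p := ξ))
  have h2 : HasFDerivAt (fun x : ℝ × ℝ => x.2 * (nullCoord x)⁻¹) _ ξ :=
    (hasFDerivAt_snd (p := ξ)).mul ((hasDerivAt_inv h.ne').comp_hasFDerivAt ξ h1)
  have e : angCoord = fun x : ℝ × ℝ => x.2 * (nullCoord x)⁻¹ :=
    funext fun x => div_eq_mul_inv _ _
  rw [e]
  refine h2.congr_fderiv ?_
  have e1 := enorm2_sq ξ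
  have e3 : nullCoord ξ = enorm2 ξ + ξ.1 := rfl
  have e4 : ξ.1 = nullCoord ξ - enorm2 ξ := by linarith
  have e5 : ξ.2 ^ 2 = nullCoord ξ * (2 * enorm2 ξ - nullCoord ξ) := by
    have : ξ.2 ^ 2 = enorm2 ξ ^ 2 - ξ.1 ^ 2 := by linarith
    rw [this, e4]; ring
  ext
  · simp [dot2]
    field_simp
    rw [e4]; ring
  · simp [dot2]
    field_simp
    rw [e5, e4]; ring

theorem jetN_angCutoff_le {Cχ : ℝ} (hC0 : 0 < Cχ) (hC : ∀ x, ‖(chi x : ℂ)‖ ≤ Cχ ∧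
    ‖deriv (fun y => (chi y : ℂ)) x‖ ≤ Cχ ∧ ‖deriv (deriv fun y => (chi y : ℂ)) x‖ ≤ Cχ)
    {ξ : ℝ × ℝ} {h₀ v s R ℓ : ℝ} (hh : 0 < h₀) (h : h₀ ≤ nullCoord ξ)
    (hv : |angCoord ξ - v| ≤ s / 2) (hl : 0 < ℓ) (hls : ℓ ≤ s) (hR : 0 < R)
    (hRl : 1 ≤ R * ℓ ^ 2) (w x₀ : ℝ) :
    jetN (plankU R s v) (plankV R s v)
      (fun x => (chi ((angCoord x - w) / ℓ - x₀) : ℂ)) ξ ≤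
        Cχ * (1 + 2 / h₀ + 6 / h₀ ^ 2 + 1 / h₀ ^ 2) := by
  have hn : 0 < nullCoord ξ := hh.trans_le h
  have hs : 0 < s := hl.trans_le hls
  have hr := enorm2_pos_of_nullCoord hn
  have hrh := nullCoord_le ξ
  obtain ⟨h1, h2, h3, h4⟩ := dot2_null_bounds hn hs.le hv
  have hev : ∀ᶠ x in nhds ξ, 0 < nullCoord x :=
    continuousAt_const.eventually_lt continuous_nullCoord.continuousAt hn
  have hg : ∀ᶠ x in nhds ξ, HasFDerivAt (fun x => (angCoord x - w) / ℓ - x₀)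
      (ℓ⁻¹ • ((enorm2 x * nullCoord x)⁻¹ • dotCLM (-x.2, x.1))) x := by
    filter_upwards [hev] with x hx
    have := (((hasFDerivAt_angCoord hx).sub_const w).const_mul ℓ⁻¹).sub_const x₀
    refine this.congr_of_eventuallyEq (Filter.Eventually.of_forall fun y => ?_)
    simp [div_eq_inv_mul]
  have eV : ∀ x, (ℓ⁻¹ • ((enorm2 x * nullCoord x)⁻¹ • dotCLM (-x.2, x.1))) (plankV R s v) =
      (ℓ⁻¹ * (R * s)⁻¹) * ((enorm2 x * nullCoord x)⁻¹ * dot2 (nullDir v) x) := by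
    intro x
    have : dot2 (-x.2, x.1) (plankV R s v) = (R * s)⁻¹ * dot2 (nullDir v) x := by
      rw [plankV, dot2_smul_right, nullPerp_eq]; simp only [dot2]; ring
    simp only [smul_apply, dotCLM_apply, this, smul_eq_mul]
    ring
  have eU : ∀ x, (ℓ⁻¹ • ((enorm2 x * nullCoord x)⁻¹ • dotCLM (-x.2, x.1))) (plankU R s v) =
      (ℓ⁻¹ * (R * s ^ 2)⁻¹) * ((enorm2 x * nullCoord x)⁻¹ * -dot2 (nullPerp v) x) := by
    intro x
    have : dot2 (-x.2, x.1) (plankU R s v) = (R * s ^ 2)⁻¹ * -dot2 (nullPerp v) x := by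
      rw [plankU, dot2_smul_right, nullPerp_eq]; simp only [dot2]; ring
    simp only [smul_apply, dotCLM_apply, this, smul_eq_mul]
    ring
  have hden : HasFDerivAt (fun x => enorm2 x * nullCoord x) _ ξ :=
    (hasFDerivAt_enorm2 hr).mul ((hasFDerivAt_enorm2 hr).add (hasFDerivAt_fst (p := ξ)))
  have hpos : 0 < enorm2 ξ * nullCoord ξ := by positivity
  have hc := (((hasDerivAt_inv hpos.ne').comp_hasFDerivAt ξ hden).mul
    (hasFDerivAt_dot2 (nullDir v) ξ)).const_mul (ℓ⁻¹ * (R * s)⁻¹)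
  obtain ⟨c, hcc, hcu⟩ : ∃ c, HasFDerivAt (fun x => (ℓ⁻¹ • ((enorm2 x * nullCoord x)⁻¹ •
      dotCLM (-x.2, x.1))) (plankV R s v)) c ξ ∧ c (plankU R s v) = (ℓ * (R * s) *
        (R * s ^ 2))⁻¹ * ((enorm2 ξ * nullCoord ξ)⁻¹ - dot2 (nullDir v) ξ * (dot2 (nullDir v) ξ *
          (nullCoord ξ / enorm2 ξ) + dot2 (nullDir v) ξ + enorm2 ξ * (nullDir v).1) /
            (enorm2 ξ * nullCoord ξ) ^ 2) := by
    refine ⟨_, HasFDerivAt.congr_of_eventuallyEq hc (Filter.Eventually.of_forall fun x => eV x),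
      ?_⟩
    have e1 : (plankU R s v).1 = (R * s ^ 2)⁻¹ * (nullDir v).1 := rfl
    simp only [smul_apply, add_apply, dotCLM_apply, dot2_plankU, dot2_nullDir_self, smul_eq_mul,
      ContinuousLinearMap.coe_fst', e1, Function.comp]
    field_simp
    ring
  have hq : ContDiff ℝ 2 (fun y => (chi y : ℂ)) :=
    mod_cast contDiff_infty.1 (Complex.ofRealCLM.contDiff.comp contDiff_chi) 2
  have key := jetN_comp_le hq (plankU R s v) (plankV R s v) hg hcc
  refine key.trans ?_
  rw [eV ξ, eU ξ]
  have hl1 : 1 ≤ ℓ * (R * s) := by nlinarith [mul_le_mul_of_nonneg_left hls (mul_pos hR hl).le]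
  set r := enorm2 ξ
  set H := nullCoord ξ
  set x := dot2 (nullDir v) ξ
  set y := dot2 (nullPerp v) ξ
  have ha : |ℓ⁻¹ * (R * s ^ 2)⁻¹ * ((r * H)⁻¹ * -y)| ≤ 1 / h₀ := by
    have : ℓ⁻¹ * (R * s ^ 2)⁻¹ * ((r * H)⁻¹ * -y) = -((ℓ * (R * s))⁻¹ * H⁻¹ * (y / (r * s))) := by
      field_simp
    rw [this, abs_neg, abs_mul, abs_of_pos (by positivity : 0 < (ℓ * (R * s))⁻¹ * H⁻¹), abs_div,
      abs_of_pos (by positivity : 0 < r * s)]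
    calc (ℓ * (R * s))⁻¹ * H⁻¹ * (|y| / (r * s)) ≤ 1 * h₀⁻¹ * 1 := by
          gcongr
          · exact inv_le_one_of_one_le₀ hl1
          · exact div_le_one_of_le₀ h4 (by positivity)
      _ = 1 / h₀ := by simp
  have hb : |ℓ⁻¹ * (R * s)⁻¹ * ((r * H)⁻¹ * x)| ≤ 1 / h₀ := by
    have : ℓ⁻¹ * (R * s)⁻¹ * ((r * H)⁻¹ * x) = (ℓ * (R * s))⁻¹ * H⁻¹ * (x / r) := by
      field_simp
    rw [this, abs_mul, abs_of_pos (by positivity : 0 < (ℓ * (R * s))⁻¹ * H⁻¹), abs_div,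
      abs_of_pos hr]
    calc (ℓ * (R * s))⁻¹ * H⁻¹ * (|x| / r) ≤ 1 * h₀⁻¹ * 1 := by
          gcongr
          · exact inv_le_one_of_one_le₀ hl1
          · exact div_le_one_of_le₀ h3 hr.le
      _ = 1 / h₀ := by simp
  have hchi := hC ((angCoord ξ - w) / ℓ - x₀)
  have hn1 := (abs_nullDir_le v).1
  have hcb : |c (plankU R s v)| ≤ 6 / h₀ ^ 2 := by
    have hα : (ℓ * (R * s) * (R * s ^ 2))⁻¹ ≤ 1 := by
      refine inv_le_one_of_one_le₀ (one_le_mul_of_one_le_of_one_le hl1 ?_)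
      nlinarith [mul_le_mul_of_nonneg_left (pow_le_pow_left₀ hl.le hls 2) hR.le]
    have hx1 : |x * (H / r) + x + r * (nullDir v).1| ≤ H + r + r := by
      have : |x * (H / r)| ≤ H := by
        rw [abs_mul, abs_of_pos (by positivity : 0 < H / r)]
        calc |x| * (H / r) ≤ r * (H / r) := by gcongr
          _ = H := by field_simp
      have h5 : |r * (nullDir v).1| ≤ r := by
        rw [abs_mul, abs_of_pos hr]; exact mul_le_of_le_one_right hr.le hn1
      calc _ ≤ |x * (H / r)| + |x| + |r * (nullDir v).1| := abs_add_three _ _ _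
        _ ≤ _ := by gcongr
    have hx2 : |x * (x * (H / r) + x + r * (nullDir v).1) / (r * H) ^ 2| ≤
        r * (H + r + r) / (r * H) ^ 2 := by
      rw [abs_div, abs_mul, abs_of_pos (by positivity : 0 < (r * H) ^ 2)]
      gcongr
    have hx3 : r * (H + r + r) / (r * H) ^ 2 + (r * H)⁻¹ ≤ 6 / H ^ 2 := by
      have : r * (H + r + r) / (r * H) ^ 2 + (r * H)⁻¹ = (2 * (H + r)) / (r * H ^ 2) := by
        field_simp; ring
      rw [this, div_le_div_iff₀ (by positivity) (by positivity)]
      nlinarith [mul_le_mul_of_nonneg_right hrh (sq_nonneg H)]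
    rw [hcu, abs_mul, abs_of_pos (by positivity)]
    calc _ ≤ 1 * (6 / H ^ 2) := by
          gcongr
          refine (abs_sub _ _).trans ?_
          rw [abs_of_pos (by positivity : 0 < (r * H)⁻¹)]
          linarith
      _ ≤ 6 / h₀ ^ 2 := by rw [one_mul]; gcongr
  have hA := mul_le_mul ha hb (abs_nonneg _) (by positivity)
  have e1 : 1 / h₀ * (1 / h₀) = 1 / h₀ ^ 2 := by field_simp
  rw [e1] at hA
  calc _ ≤ Cχ + Cχ * (1 / h₀ + 1 / h₀ + 6 / h₀ ^ 2) + Cχ * (1 / h₀ ^ 2) := by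
          gcongr
          · exact hchi.1
          · exact hchi.2.1
          · exact hchi.2.2
      _ = _ := by ring

/-- The restriction of the symbol `a` to the angular sector of width `ℓ` with index `n`. -/
def piece (a : ℝ × ℝ → ℂ) (w ℓ : ℝ) (n : ℕ) (ξ : ℝ × ℝ) : ℂ :=
  a ξ * (chi ((angCoord ξ - w) / ℓ - n) : ℂ)

/-- A sector piece with the part of the wave phase transverse to `nullDir v`. -/
def phasePiece (a : ℝ × ℝ → ℂ) (w ℓ v t : ℝ) (n : ℕ) (ξ : ℝ × ℝ) : ℂ :=
  piece a w ℓ n ξ *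
    Complex.exp (-Complex.I * ((t * (enorm2 ξ - dot2 (nullDir v) ξ) : ℝ) : ℂ))

theorem contDiff_mul_of_tsupport {n : WithTop ℕ∞} {a g : ℝ × ℝ → ℂ} (ha : ContDiff ℝ n a)
    (hg : ∀ ξ ∈ tsupport a, ContDiffAt ℝ n g ξ) : ContDiff ℝ n (fun ξ => a ξ * g ξ) := by
  refine contDiff_iff_contDiffAt.2 fun ξ => ?_
  by_cases hξ : ξ ∈ tsupport a
  · exact ha.contDiffAt.mul (hg ξ hξ)
  · have h := notMem_tsupport_iff_eventuallyEq.1 hξ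
    refine (contDiffAt_const (c := (0 : ℂ))).congr_of_eventuallyEq ?_
    filter_upwards [h] with x hx
    simp [hx]

theorem contDiffAt_angCutoff {n : WithTop ℕ∞} (hn : n ≤ (⊤ : ℕ∞)) {ξ : ℝ × ℝ} (h : 0 < nullCoord ξ) (w ℓ x₀ : ℝ) :
    ContDiffAt ℝ n (fun x => (chi ((angCoord x - w) / ℓ - x₀) : ℂ)) ξ := by
  have h1 : ContDiff ℝ n (fun y : ℝ => (chi y : ℂ)) :=
    Complex.ofRealCLM.contDiff.comp (contDiff_chi.of_le hn)
  have h2 : ContDiffAt ℝ n (fun x => (angCoord x - w) / ℓ - x₀) ξ :=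
    (((contDiffAt_angCoord h).sub contDiffAt_const).div_const _).sub contDiffAt_const
  exact h1.contDiffAt.comp ξ h2

theorem contDiffAt_phase {n : WithTop ℕ∞} {ξ : ℝ × ℝ} (h : 0 < nullCoord ξ) (v t : ℝ) :
    ContDiffAt ℝ n (fun x => Complex.exp (-Complex.I *
      ((t * (enorm2 x - dot2 (nullDir v) x) : ℝ) : ℂ))) ξ := by
  have h1 : ContDiffAt ℝ n (fun x => t * (enorm2 x - dot2 (nullDir v) x)) ξ := by
    refine contDiffAt_const.mul ((contDiffAt_enorm2 (enorm2_pos_of_nullCoord h)).sub ?_)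
    unfold dot2; fun_prop
  have h2 : ContDiff ℝ n (fun y : ℝ => (y : ℂ)) := Complex.ofRealCLM.contDiff
  exact (contDiffAt_const.mul (h2.contDiffAt.comp ξ h1)).cexp

theorem contDiff_piece {a : ℝ × ℝ → ℂ} (ha : ContDiff ℝ (⊤ : ℕ∞) a)
    (hn : ∀ ξ ∈ tsupport a, 0 < nullCoord ξ) (w ℓ : ℝ) (n : ℕ) :
    ContDiff ℝ (⊤ : ℕ∞) (piece a w ℓ n) :=
  contDiff_mul_of_tsupport ha fun ξ hξ => contDiffAt_angCutoff le_rfl (hn ξ hξ) w ℓ n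

theorem tsupport_piece_subset (a : ℝ × ℝ → ℂ) (w ℓ : ℝ) (n : ℕ) :
    tsupport (piece a w ℓ n) ⊆ tsupport a :=
  closure_mono fun ξ hξ h => hξ (by simp [piece, h])

theorem hasCompactSupport_piece {a : ℝ × ℝ → ℂ} (hs : HasCompactSupport a) (w ℓ : ℝ) (n : ℕ) :
    HasCompactSupport (piece a w ℓ n) :=
  hs.mul_right

theorem contDiff_phasePiece {a : ℝ × ℝ → ℂ} (ha : ContDiff ℝ (⊤ : ℕ∞) a)
    (hn : ∀ ξ ∈ tsupport a, 0 < nullCoord ξ) (w ℓ v t : ℝ) (n : ℕ) :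
    ContDiff ℝ (⊤ : ℕ∞) (phasePiece a w ℓ v t n) :=
  contDiff_mul_of_tsupport (contDiff_piece ha hn w ℓ n) fun ξ hξ =>
    contDiffAt_phase (hn ξ (tsupport_piece_subset a w ℓ n hξ)) v t

theorem hasCompactSupport_phasePiece {a : ℝ × ℝ → ℂ} (hs : HasCompactSupport a)
    (w ℓ v t : ℝ) (n : ℕ) : HasCompactSupport (phasePiece a w ℓ v t n) :=
  (hasCompactSupport_piece hs w ℓ n).mul_right

/-- Outside the closed sector the jet of a piece vanishes. -/
theorem jetN_phasePiece_eq_zero {a : ℝ × ℝ → ℂ} (hn : ∀ ξ ∈ tsupport a, 0 < nullCoord ξ)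
    {w ℓ : ℝ} {n : ℕ} {ξ : ℝ × ℝ}
    (h : ¬ (ξ ∈ tsupport a ∧ (angCoord ξ - w) / ℓ - n ∈ Icc (0 : ℝ) 1)) (u u' : ℝ × ℝ) (v t : ℝ) :
    jetN u u' (phasePiece a w ℓ v t n) ξ = 0 := by
  refine jetN_eq_zero ?_
  by_cases hξ : ξ ∈ tsupport a
  · have h' : (angCoord ξ - w) / ℓ - n ∈ (Icc (0 : ℝ) 1)ᶜ := fun h2 => h ⟨hξ, h2⟩
    have hc : ContinuousAt (fun x => (angCoord x - w) / ℓ - n) ξ :=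
      (((contDiffAt_angCoord (n := 0) (hn ξ hξ)).continuousAt.sub continuousAt_const).div_const
        _).sub continuousAt_const
    filter_upwards [hc.eventually (isClosed_Icc.isOpen_compl.mem_nhds h')] with x hx
    have : chi ((angCoord x - w) / ℓ - n) = 0 :=
      chi_eq_zero fun h2 => hx (Ioo_subset_Icc_self h2)
    simp [phasePiece, piece, this]
  · filter_upwards [notMem_tsupport_iff_eventuallyEq.1 hξ] with x hx
    simp [phasePiece, piece, hx]

theorem exists_sum_jetSq_phasePiece_le {a : ℝ × ℝ → ℂ} (ha : ContDiff ℝ (⊤ : ℕ∞) a)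
    (hs : HasCompactSupport a) {h₀ : ℝ} (hh : 0 < h₀) (hn : ∀ ξ ∈ tsupport a, h₀ ≤ nullCoord ξ) :
    ∃ A, 0 < A ∧ ∀ (w R : ℝ) (K b j : ℕ) (S : Finset ℕ) (t : ℝ), b ≤ K →
      1 ≤ R * (1 / 2 ^ K) ^ 2 → 0 < R → (∀ n ∈ S, n / 2 ^ (K - b) = j) → ∀ ρ,
      ∑ n ∈ S, jetSq (fun x => phasePiece a w (1 / 2 ^ K) (w + (j + 1 / 2) * (1 / 2 ^ b)) t n
        (lin2 (plankU R (1 / 2 ^ b) (w + (j + 1 / 2) * (1 / 2 ^ b)))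
          (plankV R (1 / 2 ^ b) (w + (j + 1 / 2) * (1 / 2 ^ b))) x)) ρ ≤
        A * (1 + |t| / R) ^ 4 := by
  obtain ⟨Ca, hCa, hCa'⟩ := exists_jetN_le ha hs
  obtain ⟨Cχ, hχ, hχ'⟩ := exists_chi_bound
  have hn' : ∀ ξ ∈ tsupport a, 0 < nullCoord ξ := fun ξ h => hh.trans_le (hn ξ h)
  set D := Ca * (Cχ * (1 + 2 / h₀ + 6 / h₀ ^ 2 + 1 / h₀ ^ 2)) * (1 + 2 / h₀) with hD
  have hD0 : 0 < D := by positivity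
  refine ⟨2 * D ^ 2, by positivity, fun w R K b j S t hb hR hR0 hS ρ => ?_⟩
  have hls : (1 : ℝ) / 2 ^ K ≤ 1 / 2 ^ b := by
    gcongr; norm_num
  have hl : (0 : ℝ) < 1 / 2 ^ K := by positivity
  have hs1 : (1 : ℝ) / 2 ^ b ≤ 1 := div_le_one_of_le₀ (one_le_pow₀ (by norm_num)) (by positivity)
  have hKb : (2 : ℝ) ^ K = 2 ^ (K - b) * 2 ^ b := by rw [← pow_add]; congr 1; omega
  set ℓ : ℝ := 1 / 2 ^ K with hℓ
  set s : ℝ := 1 / 2 ^ b with hsd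
  set v := w + (j + 1 / 2) * s with hv
  have hs0 : 0 < s := hl.trans_le hls
  have hRs : 1 ≤ R * s ^ 2 := hR.trans (by gcongr)
  set ξ := lin2 (plankU R s v) (plankV R s v) ρ
  have hU : ‖plankU R s v‖ ≤ 1 := by
    have h1 := abs_nullDir_le v
    rw [plankU, norm_smul, Real.norm_of_nonneg (by positivity)]
    exact mul_le_one₀ (inv_le_one_of_one_le₀ hRs) (norm_nonneg _) (max_le h1.1 h1.2)
  have hV : ‖plankV R s v‖ ≤ 1 := by
    have h1 := abs_nullDir_le v
    rw [plankV, norm_smul, Real.norm_of_nonneg (by positivity), nullPerp_eq]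
    refine mul_le_one₀ (inv_le_one_of_one_le₀ (hRs.trans ?_)) (norm_nonneg _)
      (max_le ?_ h1.1)
    · gcongr
      exact pow_le_of_le_one hs0.le hs1 two_ne_zero
    · simpa using h1.2
  have hjet : ∀ n ∈ S, jetN (plankU R s v) (plankV R s v) (phasePiece a w ℓ v t n) ξ ≤
      D * (1 + |t| / R) ^ 2 := by
    intro n hnS
    by_cases hin : ξ ∈ tsupport a ∧ (angCoord ξ - w) / ℓ - n ∈ Icc (0 : ℝ) 1
    · obtain ⟨hξ, h0, h1⟩ := hin
      have hξ' := hn ξ hξ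
      have hang : |angCoord ξ - v| ≤ s / 2 := by
        have e1 : ℓ * n ≤ angCoord ξ - w := by
          rw [sub_nonneg, le_div_iff₀ hl] at h0; linarith
        have e2 : angCoord ξ - w ≤ ℓ * (n + 1) := by
          rw [sub_le_iff_le_add, div_le_iff₀ hl] at h1; linarith
        have hq := hS n hnS
        have q1 : (2 ^ (K - b) * j : ℕ) ≤ n := by rw [← hq]; exact Nat.mul_div_le _ _
        have q2 : n + 1 ≤ (2 ^ (K - b) * (j + 1) : ℕ) := by
          rw [← hq]; exact Nat.lt_mul_div_succ _ (by positivity)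
        have hls' : ℓ * 2 ^ (K - b) = s := by rw [hℓ, hsd, hKb]; field_simp
        have q1' : s * j ≤ ℓ * n := by
          rw [← hls', mul_assoc]; gcongr; exact_mod_cast q1
        have q2' : ℓ * (n + 1) ≤ s * (j + 1) := by
          rw [← hls', mul_assoc]; gcongr; exact_mod_cast q2
        rw [abs_le, hv]
        constructor <;> linarith
      have f1 := jetN_phase_le hh hξ' hs0 hang hR0 hRs t
      have f2 := jetN_angCutoff_le hχ hχ' hh hξ' hang hl hls hR0 hR w n
      have f3 := hCa' _ _ hU hV ξ
      have c1 := contDiffAt_angCutoff (n := 2) (by exact WithTop.coe_le_coe.2 (le_top : (2 : ℕ∞) ≤ ⊤)) (hn' ξ hξ) w ℓ n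
      have c2 := contDiffAt_phase (n := 2) (hn' ξ hξ) v t
      have ca : ContDiffAt ℝ 2 a ξ := (mod_cast contDiff_infty.1 ha 2 : ContDiff ℝ 2 a).contDiffAt
      have g1 := jetN_mul_le (plankU R s v) (plankV R s v) ca c1
      have g2 := jetN_mul_le (plankU R s v) (plankV R s v) (ca.mul c1) c2
      refine g2.trans ?_
      calc _ ≤ (Ca * (Cχ * (1 + 2 / h₀ + 6 / h₀ ^ 2 + 1 / h₀ ^ 2))) *
            ((1 + 2 / h₀) * (1 + |t| / R) ^ 2) := by
            gcongr
            · exact jetN_nonneg _ _ _ _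
            · refine g1.trans ?_
              gcongr
              exact jetN_nonneg _ _ _ _
        _ = _ := by rw [hD]; ring
    · rw [jetN_phasePiece_eq_zero hn' hin]; positivity
  have hsq : ∀ n ∈ S, jetSq (fun x => phasePiece a w ℓ v t n
      (lin2 (plankU R s v) (plankV R s v) x)) ρ ≤
      if (angCoord ξ - w) / ℓ - n ∈ Icc (0 : ℝ) 1 then (D * (1 + |t| / R) ^ 2) ^ 2 else 0 := by
    intro n hnS
    refine (jetSq_comp_lin2_le _ _ (contDiff_phasePiece ha hn' w ℓ v t n) ρ).trans ?_
    split_ifs with hif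
    · exact pow_le_pow_left₀ (jetN_nonneg _ _ _ _) (hjet n hnS) 2
    · rw [jetN_phasePiece_eq_zero hn' (fun h => hif h.2)]; simp
  refine (Finset.sum_le_sum hsq).trans ?_
  rw [← Finset.sum_filter, Finset.sum_const, nsmul_eq_mul]
  set y := (angCoord ξ - w) / ℓ
  have hcard : (S.filter fun n : ℕ => y - n ∈ Icc (0 : ℝ) 1).card ≤ 2 := by
    refine (Finset.card_le_card (t := {⌊y⌋₊, ⌊y⌋₊ - 1}) fun n hn => ?_).trans Finset.card_le_two
    obtain ⟨-, h0, h1⟩ := Finset.mem_filter.1 hn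
    have h2 : n ≤ ⌊y⌋₊ := Nat.le_floor (by linarith)
    have h3 : (⌊y⌋₊ : ℝ) ≤ n + 1 := (Nat.floor_le (by linarith [Nat.cast_nonneg (α := ℝ) n])).trans (by linarith)
    have h4 : ⌊y⌋₊ ≤ n + 1 := by exact_mod_cast h3
    simp only [Finset.mem_insert, Finset.mem_singleton]
    omega
  calc _ ≤ (2 : ℝ) * (D * (1 + |t| / R) ^ 2) ^ 2 := by
        gcongr; exact_mod_cast hcard
    _ = _ := by ring

/-- The linear parametrisation of the plank dual to the sector of width `s` around `nullDir v`. -/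
def plankMap (R s v : ℝ) (σ : (ℝ × ℝ) × ℝ) : (ℝ × ℝ) × ℝ :=
  (lin2 ((R * s ^ 2) • nullDir v) ((R * s) • nullPerp v) σ.1 - (R * σ.2) • nullDir v, R * σ.2)

/-- The standard Gaussian measure on `ℝ² × ℝ`. -/
def gauss3 : Measure ((ℝ × ℝ) × ℝ) := (gauss.prod gauss).prod gauss

instance : IsProbabilityMeasure gauss3 := by unfold gauss3; infer_instance

theorem continuous_plankMap (R s v : ℝ) : Continuous (plankMap R s v) := by
  unfold plankMap lin2; fun_prop

theorem waveExt_piece (a F : ℝ × ℝ → ℂ) (w ℓ v : ℝ) (n : ℕ) (y : (ℝ × ℝ) × ℝ) :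
    waveExt (fun ξ => piece a w ℓ n ξ * ft2 F ξ) y =
      ft2 (fun ξ => phasePiece a w ℓ v y.2 n ξ * ft2 F ξ) (y.1 + y.2 • nullDir v) := by
  rw [waveExt, ft2_eq]
  congr 1
  funext ξ
  have : Complex.exp (-Complex.I * ((dot2 y.1 ξ + y.2 * enorm2 ξ : ℝ) : ℂ)) =
      Complex.exp (-Complex.I * ((dot2 ξ (y.1 + y.2 • nullDir v) : ℝ) : ℂ)) *
      Complex.exp (-Complex.I * ((y.2 * (enorm2 ξ - dot2 (nullDir v) ξ) : ℝ) : ℂ)) := by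
    rw [← Complex.exp_add, ← mul_add, ← Complex.ofReal_add]
    congr 3
    simp [dot2]; ring
  rw [this, phasePiece]
  ring

theorem integrable_piece_mul {a F : ℝ × ℝ → ℂ} (ha : ContDiff ℝ (⊤ : ℕ∞) a)
    (hs : HasCompactSupport a) (hn : ∀ ξ ∈ tsupport a, 0 < nullCoord ξ) (hF : Integrable F)
    (w ℓ : ℝ) (n : ℕ) : Integrable (fun ξ => piece a w ℓ n ξ * ft2 F ξ) :=
  ((contDiff_piece ha hn w ℓ n).continuous.mul (continuous_ft2 hF)).integrable_of_hasCompactSupport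
    (hasCompactSupport_piece hs w ℓ n).mul_right

theorem exists_plank_average_le {a : ℝ × ℝ → ℂ} (ha : ContDiff ℝ (⊤ : ℕ∞) a)
    (hs : HasCompactSupport a) {h₀ : ℝ} (hh : 0 < h₀) (hn : ∀ ξ ∈ tsupport a, h₀ ≤ nullCoord ξ) :
    ∃ C, 0 < C ∧ ∀ (w R : ℝ) (K b j : ℕ) (S : Finset ℕ), b ≤ K →
      1 ≤ R * (1 / 2 ^ K) ^ 2 → 0 < R → (∀ n ∈ S, n / 2 ^ (K - b) = j) →
      ∀ (F : ℝ × ℝ → ℂ) (m : ℝ), Integrable F → (∀ x, ‖F x‖ ≤ m) → ∀ y,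
      ∫⁻ σ, ∑ n ∈ S, ‖ft3 (coneLift R fun ξ => piece a w (1 / 2 ^ K) n ξ * ft2 F ξ)
        (y + plankMap R (1 / 2 ^ b) (w + (j + 1 / 2) * (1 / 2 ^ b)) σ)‖ₑ ^ 2 ∂gauss3 ≤
        ENNReal.ofReal (C * m ^ 2) := by
  obtain ⟨A, hA, hA'⟩ := exists_sum_jetSq_phasePiece_le ha hs hh hn
  obtain ⟨D, hD, hD'⟩ := exists_psi_decay
  have hn' : ∀ ξ ∈ tsupport a, 0 < nullCoord ξ := fun ξ h => hh.trans_le (hn ξ h)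
  refine ⟨D ^ 2 * (4 * (2 * π) ^ 4 * π ^ 2 * A), by positivity,
    fun w R K b j S hb hR hR0 hS F m hF hm y => ?_⟩
  set ℓ : ℝ := 1 / 2 ^ K
  set s : ℝ := 1 / 2 ^ b with hsd
  have hs0 : 0 < s := by positivity
  set v := w + (j + 1 / 2) * s with hv
  have hi := fun n => integrable_piece_mul ha hs hn' hF w ℓ n
  have hmeas : Measurable fun σ : (ℝ × ℝ) × ℝ =>
      ∑ n ∈ S, ‖ft3 (coneLift R fun ξ => piece a w ℓ n ξ * ft2 F ξ) (y + plankMap R s v σ)‖ₑ ^ 2 := by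
    refine Finset.measurable_sum _ fun n _ => ?_
    have h1 := continuous_ft3 _ (integrable_coneLift hR0 (hi n))
    have h2 := continuous_plankMap R s v
    exact (h1.comp (continuous_const.add h2)).measurable.enorm.pow_const _
  rw [gauss3, lintegral_prod_symm _ hmeas.aemeasurable]
  refine (lintegral_mono (g := fun _ => ENNReal.ofReal
    (D ^ 2 * (4 * (2 * π) ^ 4 * π ^ 2 * A) * m ^ 2)) fun σ₃ => ?_).trans (by simp)
  set t := y.2 + R * σ₃ with ht
  set c := y.1 + y.2 • nullDir v with hc
  set u' := (R * s ^ 2) • nullDir v with hu'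
  set v' := (R * s) • nullPerp v with hv'
  have huu : dot2 u' (plankU R s v) = 1 := by
    rw [dot2_plankU, hu', dot2_smul_right, dot2_nullDir_self]; field_simp
  have hvv : dot2 v' (plankV R s v) = 1 := by
    rw [dot2_plankV, hv', dot2_smul_right, dot2_nullPerp_self]; field_simp
  have huv : dot2 u' (plankV R s v) = 0 := by
    rw [dot2_plankV, hu', dot2_smul_right, dot2_comm, dot2_nullDir_nullPerp]; simp
  have hvu : dot2 v' (plankU R s v) = 0 := by
    rw [dot2_plankU, hv', dot2_smul_right, dot2_nullDir_nullPerp]; simp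
  have hpt : ∀ (σ : ℝ × ℝ) (n : ℕ),
      ft3 (coneLift R fun ξ => piece a w ℓ n ξ * ft2 F ξ) (y + plankMap R s v (σ, σ₃)) =
        psi (t / R) * ft2 (fun ρ => phasePiece a w ℓ v t n (lin2 (plankU R s v) (plankV R s v) ρ) *
          ft2 (fun τ => F (lin2 u' v' τ - c)) ρ) σ := by
    intro σ n
    rw [ft3_coneLift hR0 (hi n), waveExt_piece a F w ℓ v n, ← ft2_mul_ft2_comp_lin2 huu hvv huv hvu]
    have e1 : (y + plankMap R s v (σ, σ₃)).2 = t := rfl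
    have e2 : (y + plankMap R s v (σ, σ₃)).1 + t • nullDir v = c + lin2 u' v' σ := by
      simp only [plankMap, Prod.fst_add, ht, hc, add_smul]
      abel
    rw [e1, e2]
  have hdet : det2 u' v' ≠ 0 := by
    have : det2 u' v' = R ^ 2 * s ^ 3 := by
      have := nullDir_sq v
      simp only [hu', hv', det2, nullPerp_eq, Prod.smul_fst, Prod.smul_snd, smul_eq_mul]
      linear_combination (R ^ 2 * s ^ 3) * this
    rw [this]; positivity
  have hFi : Integrable (fun τ => F (lin2 u' v' τ - c)) :=
    integrable_comp_lin2 hdet (hF.comp_sub_right c)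
  have hlin : ∀ n, ContDiff ℝ (⊤ : ℕ∞) fun ρ =>
      phasePiece a w ℓ v t n (lin2 (plankU R s v) (plankV R s v) ρ) := by
    intro n
    have : ContDiff ℝ (⊤ : ℕ∞) (lin2 (plankU R s v) (plankV R s v)) := by unfold lin2; fun_prop
    exact (contDiff_phasePiece ha hn' w ℓ v t n).comp this
  have hcs : ∀ n, HasCompactSupport fun ρ =>
      phasePiece a w ℓ v t n (lin2 (plankU R s v) (plankV R s v) ρ) := by
    intro n
    have hK := (hasCompactSupport_phasePiece hs w ℓ v t n).isCompact.image
      (f := fun x => (dot2 u' x, dot2 v' x)) (by unfold dot2; fun_prop)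
    refine HasCompactSupport.intro hK fun ρ hρ => ?_
    by_contra h0
    refine hρ ⟨lin2 (plankU R s v) (plankV R s v) ρ, subset_tsupport _ h0, ?_⟩
    have e : ∀ z, dot2 z (lin2 (plankU R s v) (plankV R s v) ρ) =
        ρ.1 * dot2 z (plankU R s v) + ρ.2 * dot2 z (plankV R s v) := by
      intro z; simp [dot2, lin2]; ring
    simp [e, huu, hvv, huv, hvu]
  have key := lintegral_gauss_multiplier_le S
    (B := fun n ρ => phasePiece a w ℓ v t n (lin2 (plankU R s v) (plankV R s v) ρ))
    (fun n _ => hlin n) (fun n _ => hcs n) (hA' w R K b j S t hb hR hR0 hS) hFi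
    (fun z => hm _)
  simp only [hpt, enorm_mul, mul_pow, ← Finset.mul_sum]
  rw [lintegral_const_mul' _ _ (by simp)]
  refine (mul_le_mul_right key _).trans ?_
  rw [← ofReal_norm, ← ENNReal.ofReal_pow (norm_nonneg _), ← ENNReal.ofReal_mul (by positivity)]
  refine ENNReal.ofReal_le_ofReal ?_
  have h1 := hD' (t / R)
  rw [abs_div, abs_of_pos hR0] at h1
  calc _ = (‖psi (t / R)‖ * (1 + |t| / R) ^ 2) ^ 2 * (4 * (2 * π) ^ 4 * π ^ 2 * A) * m ^ 2 := by ring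
    _ ≤ D ^ 2 * (4 * (2 * π) ^ 4 * π ^ 2 * A) * m ^ 2 :=
        mul_le_mul_of_nonneg_right (mul_le_mul_of_nonneg_right
          (pow_le_pow_left₀ (by positivity) h1 2) (by positivity)) (sq_nonneg m)
    _ = _ := by ring

theorem integral_exp_gauss (x : ℝ) :
    ∫ s, Complex.exp (-Complex.I * ((s * x : ℝ) : ℂ)) ∂gauss = (Real.exp (-(x ^ 2 / 2)) : ℂ) := by
  have h := ProbabilityTheory.charFun_gaussianReal (μ := 0) (v := 1) (-x)
  rw [charFun_apply_real] at h
  rw [gauss]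
  convert h using 2
  · funext s; congr 1; push_cast; ring
  · push_cast; congr 1; simp

/-- The characteristic function of the Gaussian plank measure. -/
def plankHat (R s v : ℝ) (η : (ℝ × ℝ) × ℝ) : ℂ :=
  ∫ σ, Complex.exp (-Complex.I * (dot3 η (plankMap R s v σ) : ℂ)) ∂gauss3

theorem plankHat_eq (R s v : ℝ) (η : (ℝ × ℝ) × ℝ) : plankHat R s v η =
    (Real.exp (-((R * s ^ 2 * dot2 (nullDir v) η.1) ^ 2 / 2)) : ℂ) *
      (Real.exp (-((R * s * dot2 (nullPerp v) η.1) ^ 2 / 2)) : ℂ) *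
      (Real.exp (-((R * (η.2 - dot2 (nullDir v) η.1)) ^ 2 / 2)) : ℂ) := by
  rw [← integral_exp_gauss, ← integral_exp_gauss, ← integral_exp_gauss, ← integral_prod_mul,
    ← integral_prod_mul, plankHat, gauss3]
  congr 1
  funext σ
  rw [← Complex.exp_add, ← mul_add, ← Complex.ofReal_add, ← Complex.exp_add, ← mul_add,
    ← Complex.ofReal_add]
  congr 3
  simp [dot3, plankMap, lin2, dot2]
  ring

theorem norm_plankHat_ge {R s v M : ℝ} {η : (ℝ × ℝ) × ℝ}
    (h1 : |R * s ^ 2 * dot2 (nullDir v) η.1| ≤ M) (h2 : |R * s * dot2 (nullPerp v) η.1| ≤ M)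
    (h3 : |R * (η.2 - dot2 (nullDir v) η.1)| ≤ M) :
    Real.exp (-(3 * M ^ 2 / 2)) ≤ ‖plankHat R s v η‖ := by
  rw [plankHat_eq]
  simp only [norm_mul, Complex.norm_real, Real.norm_eq_abs, Real.abs_exp, ← Real.exp_add]
  refine Real.exp_le_exp.2 ?_
  have e : ∀ {x : ℝ}, |x| ≤ M → x ^ 2 ≤ M ^ 2 := fun h => by
    rw [← sq_abs]; exact pow_le_pow_left₀ (abs_nonneg _) h 2
  have := e h1; have := e h2; have := e h3
  linarith

theorem norm_plankHat_le (R s v : ℝ) (η : (ℝ × ℝ) × ℝ) : ‖plankHat R s v η‖ ≤ 1 := by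
  refine (norm_integral_le_integral_norm _).trans ?_
  simp only [norm_exp_neg_I_mul]
  simp

theorem continuous_plankHat (R s v : ℝ) : Continuous (plankHat R s v) := by
  have := funext (plankHat_eq R s v)
  rw [this]
  unfold dot2; fun_prop

theorem ft3_mul_plankHat {H : (ℝ × ℝ) × ℝ → ℂ} (hH : Integrable H) (R s v : ℝ)
    (y : (ℝ × ℝ) × ℝ) : ft3 (fun η => H η * plankHat R s v η) y =
      ∫ σ, ft3 H (y + plankMap R s v σ) ∂gauss3 := by
  have hc := continuous_plankMap R s v
  have hd : Continuous fun p : ((ℝ × ℝ) × ℝ) × ((ℝ × ℝ) × ℝ) =>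
      Complex.exp (-Complex.I * (dot3 p.1 (y + plankMap R s v p.2) : ℂ)) := by
    unfold dot3 dot2; fun_prop
  have hi : Integrable (fun p : ((ℝ × ℝ) × ℝ) × ((ℝ × ℝ) × ℝ) =>
      Complex.exp (-Complex.I * (dot3 p.1 (y + plankMap R s v p.2) : ℂ)) * H p.1)
      (volume.prod gauss3) := by
    have h1 : Integrable (fun p : ((ℝ × ℝ) × ℝ) × ((ℝ × ℝ) × ℝ) => H p.1)
      (volume.prod gauss3) := hH.comp_fst gauss3
    refine h1.bdd_mul (c := 1) hd.aestronglyMeasurable (Filter.Eventually.of_forall fun p => ?_)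
    rw [norm_exp_neg_I_mul]
  rw [ft3]
  simp only [ft3]
  rw [← integral_integral_swap hi]
  congr 1
  funext η
  rw [plankHat, mul_left_comm, ← integral_const_mul, ← integral_const_mul]
  congr 1
  funext σ
  rw [dot3_comm η (y + _), dot3_comm η (plankMap _ _ _ _), dot3_comm η y]
  have : dot3 (y + plankMap R s v σ) η = dot3 y η + dot3 (plankMap R s v σ) η := by
    simp [dot3, dot2]; ring
  rw [this, Complex.ofReal_add, mul_add, Complex.exp_add]
  ring

theorem plank_coords_le {v s M : ℝ} (hs0 : 0 < s) (hs1 : s ≤ 1) {η : (ℝ × ℝ) × ℝ}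
    (h : ∀ u ∈ Icc (v - s / 2) (v + s / 2),
      |(η.2 - η.1.1) - 2 * u * η.1.2 + u ^ 2 * (η.2 + η.1.1)| ≤ M) :
    |s ^ 2 * dot2 (nullDir v) η.1| ≤ 12 * (1 + |v|) ^ 2 * M ∧
      |s * dot2 (nullPerp v) η.1| ≤ 12 * (1 + |v|) ^ 2 * M ∧
      |η.2 - dot2 (nullDir v) η.1| ≤ 12 * (1 + |v|) ^ 2 * M := by
  have h0 := h v ⟨by linarith, by linarith⟩
  have h1 := h (v - s / 2) ⟨by linarith, by linarith⟩
  have h2 := h (v + s / 2) ⟨by linarith, by linarith⟩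
  set D := η.2 + η.1.1 with hD
  set B := -2 * η.1.2 + 2 * v * D with hB
  set P := (η.2 - η.1.1) - 2 * v * η.1.2 + v ^ 2 * D with hP
  have hM : 0 ≤ M := (abs_nonneg _).trans h0
  have eD : |D * s ^ 2| ≤ 8 * M := by
    rw [abs_le] at *
    constructor <;> nlinarith
  have eB : |B * s| ≤ 2 * M := by
    rw [abs_le] at *
    constructor <;> nlinarith
  have hv1 : (0:ℝ) < 1 + v ^ 2 := by positivity
  have hvv : 1 ≤ (1 + |v|) ^ 2 := one_le_pow₀ (by linarith [abs_nonneg v])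
  have hv3 : 1 + v ^ 2 ≤ (1 + |v|) ^ 2 := by nlinarith [abs_nonneg v, sq_abs v]
  have hv2 : |v| ≤ (1 + |v|) ^ 2 := by nlinarith [abs_nonneg v]
  have e3 : η.2 - dot2 (nullDir v) η.1 = P / (1 + v ^ 2) := by
    simp only [dot2, nullDir, hP, hD]; field_simp; ring
  have eP3 : |P / (1 + v ^ 2)| ≤ M := by
    rw [abs_div, abs_of_pos hv1]
    exact (div_le_self (abs_nonneg _) (by nlinarith [sq_nonneg v])).trans h0
  have hMv : M ≤ (1 + |v|) ^ 2 * M := le_mul_of_one_le_left hM hvv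
  have hs2 : s ^ 2 ≤ 1 := pow_le_one₀ hs0.le hs1
  refine ⟨?_, ?_, ?_⟩
  · have e1 : s ^ 2 * dot2 (nullDir v) η.1 = s ^ 2 * (P / 2) + (1 + v ^ 2) * (D * s ^ 2) / 2 -
        v * s * (B * s) / 2 - s ^ 2 * (P / (1 + v ^ 2)) := by
      rw [← e3]; simp only [hP, hB]; rw [hD]; ring
    have b1 : |s ^ 2 * (P / 2)| ≤ M / 2 := by
      rw [abs_mul, abs_of_pos (by positivity : 0 < s ^ 2), abs_div, abs_two]
      calc s ^ 2 * (|P| / 2) ≤ 1 * (M / 2) := by gcongr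
        _ = M / 2 := one_mul _
    have b2 : |(1 + v ^ 2) * (D * s ^ 2) / 2| ≤ (1 + |v|) ^ 2 * (8 * M) / 2 := by
      rw [abs_div, abs_mul, abs_of_pos hv1, abs_two]; gcongr
    have b3 : |v * s * (B * s) / 2| ≤ (1 + |v|) ^ 2 * 1 * (2 * M) / 2 := by
      rw [abs_div, abs_mul, abs_mul, abs_two, abs_of_pos hs0]; gcongr
    have b4 : |s ^ 2 * (P / (1 + v ^ 2))| ≤ 1 * M := by
      rw [abs_mul, abs_of_pos (by positivity : 0 < s ^ 2)]; gcongr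
    rw [e1]
    have t1 := abs_sub (s ^ 2 * (P / 2) + (1 + v ^ 2) * (D * s ^ 2) / 2 - v * s * (B * s) / 2)
      (s ^ 2 * (P / (1 + v ^ 2)))
    have t2 := abs_sub (s ^ 2 * (P / 2) + (1 + v ^ 2) * (D * s ^ 2) / 2) (v * s * (B * s) / 2)
    have t3 := abs_add_le (s ^ 2 * (P / 2)) ((1 + v ^ 2) * (D * s ^ 2) / 2)
    linarith
  · have e2 : s * dot2 (nullPerp v) η.1 = v * s * (P / (1 + v ^ 2)) - B * s / 2 := by
      simp only [dot2, nullPerp, hP, hB, hD]; field_simp; ring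
    have b1 : |v * s * (P / (1 + v ^ 2))| ≤ (1 + |v|) ^ 2 * 1 * M := by
      rw [abs_mul, abs_mul, abs_of_pos hs0]; gcongr
    have b2 : |B * s / 2| ≤ M := by rw [abs_div, abs_two]; linarith
    rw [e2]
    have := abs_sub (v * s * (P / (1 + v ^ 2))) (B * s / 2)
    linarith
  · rw [e3]; linarith

theorem exists_lintegral_smallSet_le {h₀ W C₀ : ℝ} (hh : 0 < h₀) (hC₀ : 0 < C₀) :
    ∃ C, 0 < C ∧ ∀ (w : ℝ) (K b j : ℕ), |w| ≤ W → j < 2 ^ b → ∀ H : (ℝ × ℝ) × ℝ → ℂ,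
      Integrable H → MemLp H 2 →
      ∫⁻ η in smallSet (conePoly h₀ w) K b j, ‖H η‖ₑ ^ 2 ≤ ENNReal.ofReal C *
        ∫⁻ y, (∫⁻ σ, ‖ft3 H (y + plankMap (C₀ * 4 ^ K) (1 / 2 ^ b)
          (w + (j + 1 / 2) * (1 / 2 ^ b)) σ)‖ₑ ∂gauss3) ^ 2 := by
  set M := C₀ * (12 * (1 + (W + 1)) ^ 2 * (100 * h₀)) with hM
  set κ := Real.exp (-(3 * M ^ 2 / 2)) with hκ
  refine ⟨(κ ^ 2)⁻¹, by positivity, fun w K b j hw hj H hH hH2 => ?_⟩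
  set R := C₀ * 4 ^ K with hR
  set s : ℝ := 1 / 2 ^ b with hsd
  set v := w + (j + 1 / 2) * s with hv
  have hR0 : 0 < R := by positivity
  have hs0 : 0 < s := by positivity
  have hs1 : s ≤ 1 := div_le_one_of_le₀ (one_le_pow₀ (by norm_num)) (by positivity)
  have hjs : (j + 1) * s ≤ 1 := by
    rw [hsd, mul_one_div, div_le_one (by positivity)]; exact_mod_cast hj
  have hvW : |v| ≤ W + 1 := by
    have : |(j + 1 / 2) * s| ≤ 1 := by
      rw [abs_of_pos (by positivity)]; linarith
    exact (abs_add_le _ _).trans (by linarith)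
  have hlow : ∀ η ∈ smallSet (conePoly h₀ w) K b j, κ ≤ ‖plankHat R s v η‖ := by
    intro η hη
    have hb := plank_coords_le (v := v) (M := 100 * h₀ / 4 ^ K) (η := η) hs0 hs1 fun u hu => by
      have h1 := hη (u - w) ⟨by
        rw [div_eq_mul_one_div, ← hsd]; linarith [hu.1], by
        rw [div_eq_mul_one_div, ← hsd]; linarith [hu.2]⟩
      have e : quad (conePoly h₀ w η) (u - w) =
          ((η.2 - η.1.1) - 2 * u * η.1.2 + u ^ 2 * (η.2 + η.1.1)) / h₀ := by
        simp only [quad, conePoly]; field_simp; ring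
      rw [e, abs_div, abs_of_pos hh, div_le_iff₀ hh] at h1
      refine h1.trans (le_of_eq ?_)
      rw [← pow_mul, mul_comm K 2, pow_mul]; norm_num; ring
    have hle : R * (12 * (1 + |v|) ^ 2 * (100 * h₀ / 4 ^ K)) ≤ M := by
      have : R * (12 * (1 + |v|) ^ 2 * (100 * h₀ / 4 ^ K)) =
          C₀ * (12 * (1 + |v|) ^ 2 * (100 * h₀)) := by rw [hR]; field_simp
      rw [this, hM]; gcongr
    obtain ⟨h1, h2, h3⟩ := hb
    refine norm_plankHat_ge ?_ ?_ ?_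
    · rw [mul_assoc, abs_mul, abs_of_pos hR0]; exact (by gcongr : _ ≤ _).trans hle
    · rw [mul_assoc, abs_mul, abs_of_pos hR0]; exact (by gcongr : _ ≤ _).trans hle
    · rw [abs_mul, abs_of_pos hR0]; exact (by gcongr : _ ≤ _).trans hle
  have hms : MeasurableSet (smallSet (conePoly h₀ w) K b j) :=
    measurableSet_smallSet (continuous_conePoly h₀ w).measurable K b j
  have hcont := continuous_plankHat R s v
  have hbd : ∀ᵐ η, ‖plankHat R s v η‖ ≤ 1 := Filter.Eventually.of_forall (norm_plankHat_le R s v)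
  have hi : Integrable (fun η => H η * plankHat R s v η) :=
    hH.mul_bdd hcont.aestronglyMeasurable hbd
  have hi2 : MemLp (fun η => H η * plankHat R s v η) 2 := by
    refine hH2.mono hi.1 (Filter.Eventually.of_forall fun η => ?_)
    rw [norm_mul]
    exact mul_le_of_le_one_right (norm_nonneg _) (norm_plankHat_le R s v η)
  have hpl := lintegral_enorm_sq_ft3 hi hi2
  have step1 : ∫⁻ η in smallSet (conePoly h₀ w) K b j, ‖H η‖ₑ ^ 2 ≤
      ENNReal.ofReal (κ ^ 2)⁻¹ * ∫⁻ η, ‖H η * plankHat R s v η‖ₑ ^ 2 := by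
    rw [← lintegral_const_mul' _ _ ENNReal.ofReal_ne_top]
    refine (setLIntegral_mono' hms fun η hη => ?_).trans (setLIntegral_le_lintegral _ _)
    have h1 := hlow η hη
    have hκ0 : 0 < κ := Real.exp_pos _
    rw [← ofReal_norm, ← ofReal_norm, ← ENNReal.ofReal_pow (norm_nonneg _),
      ← ENNReal.ofReal_pow (norm_nonneg _), ← ENNReal.ofReal_mul (by positivity)]
    refine ENNReal.ofReal_le_ofReal ?_
    rw [norm_mul, mul_pow, inv_mul_eq_div, le_div_iff₀ (by positivity)]
    gcongr
  have step2 : ∫⁻ η, ‖H η * plankHat R s v η‖ₑ ^ 2 ≤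
      ∫⁻ y, ‖ft3 (fun η => H η * plankHat R s v η) y‖ₑ ^ 2 := by
    rw [hpl]
    refine le_mul_of_one_le_left (by positivity) ?_
    rw [← ENNReal.ofReal_one]
    exact ENNReal.ofReal_le_ofReal (one_le_pow₀ (by nlinarith [pi_gt_three]))
  refine step1.trans (mul_le_mul_right (step2.trans (lintegral_mono fun y => ?_)) _)
  rw [ft3_mul_plankHat hH]
  exact pow_le_pow_left' (enorm_integral_le_lintegral_enorm _) 2

/-- A sublinear operator that is quadratically bounded on `L^∞` and maps `L²` into `L¹` maps
`L⁴` into `L²`. -/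
theorem sum_lintegral_sq_le_of_bounds {X Y : Type*} [MeasurableSpace X] [MeasurableSpace Y]
    {μ : Measure X} [SFinite μ] {ν : Measure Y} {A : (X → ℂ) → ℕ → Y → ℝ≥0∞} {J : Finset ℕ}
    {B C : ℝ} (hC : 0 < C)
    (hmeas : ∀ F, Integrable F μ → ∀ j ∈ J, Measurable (A F j))
    (hadd : ∀ F₁ F₂, Integrable F₁ μ → Integrable F₂ μ → ∀ j ∈ J, ∀ y,
      A (F₁ + F₂) j y ≤ 2 * A F₁ j y + 2 * A F₂ j y)
    (hinf : ∀ F m, Integrable F μ → (∀ x, ‖F x‖ ≤ m) → ∀ j ∈ J, ∀ y,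
      A F j y ≤ ENNReal.ofReal (C * m ^ 2))
    (hone : ∀ F, Integrable F μ → (∃ m, ∀ x, ‖F x‖ ≤ m) →
      ∑ j ∈ J, ∫⁻ y, A F j y ∂ν ≤ ENNReal.ofReal B * ∫⁻ x, ‖F x‖ₑ ^ 2 ∂μ)
    {F : X → ℂ} (hF : Integrable F μ) (hFm : Measurable F) {m : ℝ} (hm : ∀ x, ‖F x‖ ≤ m) :
    ∑ j ∈ J, ∫⁻ y, A F j y ^ 2 ∂ν ≤ ENNReal.ofReal (32 * C) * ENNReal.ofReal B *
      ∫⁻ x, ‖F x‖ₑ ^ 4 ∂μ := by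
  have hfin : ∀ j ∈ J, ∀ y, A F j y ≠ ∞ := fun j hj y =>
    ((hinf F m hF hm j hj y).trans_lt ENNReal.ofReal_lt_top).ne
  set E : ℝ → Set X := fun t => {x | t < 4 * C * ‖F x‖ ^ 2} with hE
  have hEm : ∀ t, MeasurableSet (E t) := fun t =>
    measurableSet_lt measurable_const ((hFm.norm.pow_const 2).const_mul _)
  have hlayer : ∀ j ∈ J, ∫⁻ y, A F j y ^ 2 ∂ν =
      ∫⁻ t in Ioi (0:ℝ), ν {y | t < (A F j y).toReal} * ENNReal.ofReal (2 * t) := by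
    intro j hj
    rw [← lintegral_comp_eq_lintegral_meas_lt_mul ν
      (Filter.Eventually.of_forall fun _ => ENNReal.toReal_nonneg)
      (hmeas F hF j hj).ennreal_toReal.aemeasurable
      (fun t _ => (by fun_prop : Continuous fun t : ℝ => 2 * t).intervalIntegrable _ _)
      ((ae_restrict_iff' measurableSet_Ioi).2 (Filter.Eventually.of_forall fun t ht => by
        have : (0:ℝ) < t := ht
        positivity))]
    refine lintegral_congr fun y => ?_
    rw [intervalIntegral.integral_const_mul, integral_id, ← ENNReal.ofReal_toReal (hfin j hj y),
      ← ENNReal.ofReal_pow ENNReal.toReal_nonneg]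
    simp only [ENNReal.ofReal_toReal (hfin j hj y)]
    congr 1
    ring
  have hlevel : ∀ t ∈ Ioi (0:ℝ), ∑ j ∈ J, ν {y | t < (A F j y).toReal} * ENNReal.ofReal (2 * t) ≤
      8 * ENNReal.ofReal B * ∫⁻ x, (E t).indicator (fun x => ‖F x‖ₑ ^ 2) x ∂μ := by
    intro t ht
    have ht0 : (0:ℝ) < t := ht
    set F₂ := (E t).indicator F with hF₂
    set F₁ := (E t)ᶜ.indicator F with hF₁
    have hi₂ : Integrable F₂ μ := hF.indicator (hEm t)
    have hi₁ : Integrable F₁ μ := hF.indicator (hEm t).compl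
    have hsum : F = F₁ + F₂ := (indicator_compl_add_self (E t) F).symm
    have hb₁ : ∀ x, ‖F₁ x‖ ≤ √(t / (4 * C)) := by
      intro x
      by_cases hx : x ∈ E t
      · simp [hF₁, hx]
      · have hx' : ¬ t < 4 * C * ‖F x‖ ^ 2 := hx
        rw [hF₁, indicator_of_mem (show x ∈ (E t)ᶜ from hx)]
        refine Real.le_sqrt_of_sq_le ?_
        rw [le_div_iff₀ (by positivity)]
        linarith
    have hb₂ : ∃ m, ∀ x, ‖F₂ x‖ ≤ m := ⟨m, fun x => (norm_indicator_le_norm_self _ _).trans (hm x)⟩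
    have hsub : ∀ j ∈ J, {y | t < (A F j y).toReal} ⊆ {y | ENNReal.ofReal (t / 4) ≤ A F₂ j y} := by
      intro j hj y hy
      have h1 : A F j y ≤ 2 * ENNReal.ofReal (t / 4) + 2 * A F₂ j y := by
        have h2 := hinf F₁ _ hi₁ hb₁ j hj y
        rw [Real.sq_sqrt (by positivity), show C * (t / (4 * C)) = t / 4 by field_simp] at h2
        have h3 := hadd F₁ F₂ hi₁ hi₂ j hj y
        rw [← hsum] at h3
        exact h3.trans (by gcongr)
      by_contra h4
      have h5 : A F₂ j y < ENNReal.ofReal (t / 4) := not_le.1 h4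
      have h6 : A F j y ≤ ENNReal.ofReal t := by
        calc A F j y ≤ 2 * ENNReal.ofReal (t / 4) + 2 * ENNReal.ofReal (t / 4) := by
              refine h1.trans ?_
              gcongr
          _ = ENNReal.ofReal t := by
              rw [show (2:ℝ≥0∞) = ENNReal.ofReal 2 by simp, ← ENNReal.ofReal_mul (by norm_num),
                ← ENNReal.ofReal_add (by positivity) (by positivity)]
              congr 1; ring
      have h7 := ENNReal.toReal_mono ENNReal.ofReal_ne_top h6
      rw [ENNReal.toReal_ofReal ht0.le] at h7
      exact absurd hy (not_lt.2 h7)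
    calc ∑ j ∈ J, ν {y | t < (A F j y).toReal} * ENNReal.ofReal (2 * t)
        ≤ ∑ j ∈ J, 8 * ∫⁻ y, A F₂ j y ∂ν := by
          refine Finset.sum_le_sum fun j hj => ?_
          have h1 := mul_meas_ge_le_lintegral (μ := ν) (hmeas F₂ hi₂ j hj) (ENNReal.ofReal (t / 4))
          rw [show (2 * t) = 8 * (t / 4) by ring, ENNReal.ofReal_mul (by norm_num),
            show ENNReal.ofReal 8 = 8 by simp, mul_left_comm]
          refine mul_le_mul_right ?_ _
          rw [mul_comm]
          exact (mul_le_mul_right (measure_mono (hsub j hj)) _).trans h1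
      _ ≤ 8 * (ENNReal.ofReal B * ∫⁻ x, ‖F₂ x‖ₑ ^ 2 ∂μ) := by
          rw [← Finset.mul_sum]
          exact mul_le_mul_right (hone F₂ hi₂ hb₂) _
      _ = _ := by
          rw [mul_assoc]
          congr 3
          funext x
          by_cases hx : x ∈ E t <;> simp [hF₂, hx]
  have hmE : Measurable fun z : ℝ × X => (E z.1).indicator (fun x => ‖F x‖ₑ ^ 2) z.2 := by
    have h1 : MeasurableSet {z : ℝ × X | z.1 < 4 * C * ‖F z.2‖ ^ 2} :=
      measurableSet_lt measurable_fst (((hFm.comp measurable_snd).norm.pow_const 2).const_mul _)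
    exact ((hFm.comp measurable_snd).enorm.pow_const 2).indicator h1
  calc ∑ j ∈ J, ∫⁻ y, A F j y ^ 2 ∂ν
      = ∫⁻ t in Ioi (0:ℝ), ∑ j ∈ J, ν {y | t < (A F j y).toReal} * ENNReal.ofReal (2 * t) := by
        rw [Finset.sum_congr rfl hlayer, lintegral_finsetSum]
        intro j hj
        refine Measurable.mul ?_ (by fun_prop)
        refine Antitone.measurable fun t t' h => measure_mono fun y hy => ?_
        exact lt_of_le_of_lt h hy
    _ ≤ ∫⁻ t in Ioi (0:ℝ), 8 * ENNReal.ofReal B *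
          ∫⁻ x, (E t).indicator (fun x => ‖F x‖ₑ ^ 2) x ∂μ :=
        setLIntegral_mono' measurableSet_Ioi hlevel
    _ = 8 * ENNReal.ofReal B * ∫⁻ x, ENNReal.ofReal (4 * C * ‖F x‖ ^ 2) * ‖F x‖ₑ ^ 2 ∂μ := by
        rw [lintegral_const_mul' _ _ (ENNReal.mul_ne_top (by simp) ENNReal.ofReal_ne_top),
          lintegral_lintegral_swap hmE.aemeasurable]
        congr 2
        funext x
        have h1 : ∀ t, (E t).indicator (fun x => ‖F x‖ₑ ^ 2) x =
            (Iio (4 * C * ‖F x‖ ^ 2)).indicator (fun _ => ‖F x‖ₑ ^ 2) t := by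
          intro t
          by_cases h : t < 4 * C * ‖F x‖ ^ 2 <;> simp [hE, h, indicator]
        simp only [h1]
        rw [lintegral_indicator_const measurableSet_Iio, Measure.restrict_apply measurableSet_Iio,
          Iio_inter_Ioi, Real.volume_Ioo, sub_zero, mul_comm]
    _ = ENNReal.ofReal (32 * C) * ENNReal.ofReal B * ∫⁻ x, ‖F x‖ₑ ^ 4 ∂μ := by
        have h1 : ∀ x, ENNReal.ofReal (4 * C * ‖F x‖ ^ 2) * ‖F x‖ₑ ^ 2 =
            ENNReal.ofReal (4 * C) * ‖F x‖ₑ ^ 4 := by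
          intro x
          rw [ENNReal.ofReal_mul (by positivity), ENNReal.ofReal_pow (norm_nonneg _),
            ofReal_norm, mul_assoc, ← pow_add]
        simp only [h1]
        rw [lintegral_const_mul' _ _ ENNReal.ofReal_ne_top, ← mul_assoc,
          show 32 * C = 8 * (4 * C) by ring, ENNReal.ofReal_mul (p := 8) (by norm_num),
          show ENNReal.ofReal 8 = 8 by simp]
        ring

theorem exists_lintegral_coneLift_sq_le : ∃ L, 0 < L ∧ ∀ (R : ℝ) (b : ℝ × ℝ → ℂ), 0 < R →
    Measurable b → ∫⁻ ζ, ‖coneLift R b ζ‖ₑ ^ 2 ≤ ENNReal.ofReal (L * R) * ∫⁻ ξ, ‖b ξ‖ₑ ^ 2 := by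
  obtain ⟨L, hL⟩ := exists_lam_le
  have hL0 : 0 ≤ L := (lam_nonneg 0).trans (hL 0)
  refine ⟨L + 1, by positivity, fun R b hR hb => ?_⟩
  have hone : ∫⁻ τ : ℝ, ENNReal.ofReal (R * lam (R * τ)) = 1 := by
    rw [← ofReal_integral_eq_lintegral_ofReal
      ((integrable_lam.comp_mul_left' hR.ne').const_mul R)
      (Filter.Eventually.of_forall fun τ => mul_nonneg hR.le (lam_nonneg _)),
      integral_const_mul, Measure.integral_comp_mul_left, integral_lam]
    rw [abs_of_pos (inv_pos.2 hR), smul_eq_mul, mul_one, mul_inv_cancel₀ hR.ne',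
      ENNReal.ofReal_one]
  have hlam : Measurable fun τ : ℝ => ENNReal.ofReal (R * lam (R * τ)) := by
    have := continuous_lam
    exact ENNReal.measurable_ofReal.comp (Continuous.measurable (by fun_prop))
  rw [← measurePreserving_coneShear.lintegral_comp_emb measurableEmbedding_coneShear]
  calc ∫⁻ p : (ℝ × ℝ) × ℝ, ‖coneLift R b (p.1, p.2 + enorm2 p.1)‖ₑ ^ 2
      ≤ ∫⁻ p : (ℝ × ℝ) × ℝ, ENNReal.ofReal ((L + 1) * R) *
          (‖b p.1‖ₑ ^ 2 * ENNReal.ofReal (R * lam (R * p.2))) := by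
        refine lintegral_mono fun p => ?_
        have h1 : ‖coneLift R b (p.1, p.2 + enorm2 p.1)‖ₑ =
            ENNReal.ofReal (R * lam (R * p.2)) * ‖b p.1‖ₑ := by
          rw [coneLift, enorm_mul, add_sub_cancel_right, ← ofReal_norm, Complex.norm_real,
            Real.norm_of_nonneg (mul_nonneg hR.le (lam_nonneg _))]
        rw [h1, mul_pow, sq (ENNReal.ofReal _), mul_assoc, mul_comm (‖b p.1‖ₑ ^ 2)]
        refine mul_le_mul_left (ENNReal.ofReal_le_ofReal ?_) _
        rw [mul_comm]
        exact mul_le_mul_of_nonneg_right ((hL _).trans (by linarith)) hR.le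
    _ = _ := by
        rw [lintegral_const_mul' _ _ ENNReal.ofReal_ne_top]
        have hpm := lintegral_prod_mul (μ := (volume : Measure (ℝ × ℝ)))
          (ν := (volume : Measure ℝ)) (hb.enorm.pow_const 2).aemeasurable hlam.aemeasurable
        rw [hone, mul_one] at hpm
        rw [← hpm]
        rfl

theorem exists_sum_enorm_piece_sq_le {a : ℝ × ℝ → ℂ} (ha : Continuous a)
    (hs : HasCompactSupport a) : ∃ C, 0 < C ∧ ∀ (w ℓ : ℝ) (S : Finset ℕ) (ξ : ℝ × ℝ),
      ∑ n ∈ S, ‖piece a w ℓ n ξ‖ₑ ^ 2 ≤ ENNReal.ofReal C := by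
  obtain ⟨M, hM⟩ := hs.exists_bound_of_continuous ha
  obtain ⟨Cχ, hC, hC'⟩ := exists_chi_bound
  have hM0 : 0 ≤ M := (norm_nonneg _).trans (hM 0)
  refine ⟨(M * Cχ) ^ 2 + 1, by positivity, fun w ℓ S ξ => ?_⟩
  have hbd : ∀ n, ‖piece a w ℓ n ξ‖ₑ ^ 2 ≤ ENNReal.ofReal ((M * Cχ) ^ 2 + 1) := by
    intro n
    rw [← ofReal_norm, ← ENNReal.ofReal_pow (norm_nonneg _)]
    refine ENNReal.ofReal_le_ofReal ?_
    have : ‖piece a w ℓ n ξ‖ ≤ M * Cχ := by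
      rw [piece, norm_mul]
      exact mul_le_mul (hM ξ) (hC' _).1 (norm_nonneg _) hM0
    have := pow_le_pow_left₀ (norm_nonneg _) this 2
    linarith
  by_cases h : ∃ n ∈ S, piece a w ℓ n ξ ≠ 0
  · obtain ⟨n, hn, hne⟩ := h
    rw [Finset.sum_eq_single_of_mem n hn]
    · exact hbd n
    · intro m _ hmn
      have hmem : ∀ i, piece a w ℓ i ξ ≠ 0 → (angCoord ξ - w) / ℓ - i ∈ Ioo (0 : ℝ) 1 := by
        intro i hi
        by_contra h0
        exact hi (by simp [piece, chi_eq_zero h0])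
      have : piece a w ℓ m ξ = 0 := by
        by_contra h0
        obtain ⟨h1, h2⟩ := hmem n hne
        obtain ⟨h3, h4⟩ := hmem m h0
        have h5 : (m : ℝ) < n + 1 := by linarith
        have h6 : (n : ℝ) < m + 1 := by linarith
        norm_cast at h5 h6
        omega
      simp [this]
  · push Not at h
    rw [Finset.sum_eq_zero fun n hn => by simp [h n hn]]
    exact zero_le

/-- The lifted frequency-localised piece of `F`. -/
def pieceLift (a : ℝ × ℝ → ℂ) (w R : ℝ) (K : ℕ) (F : ℝ × ℝ → ℂ) (n : ℕ) : (ℝ × ℝ) × ℝ → ℂ :=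
  coneLift R fun ξ => piece a w (1 / 2 ^ K) n ξ * ft2 F ξ

section
variable {a : ℝ × ℝ → ℂ} (ha : ContDiff ℝ (⊤ : ℕ∞) a) (hs : HasCompactSupport a)
  (hn : ∀ ξ ∈ tsupport a, 0 < nullCoord ξ) {F : ℝ × ℝ → ℂ} (hF : Integrable F) {R : ℝ} (hR : 0 < R)
include ha hn hF

theorem continuous_piece_mul (w : ℝ) (K n : ℕ) :
    Continuous fun ξ => piece a w (1 / 2 ^ K) n ξ * ft2 F ξ :=
  (contDiff_piece ha hn w _ n).continuous.mul (continuous_ft2 hF)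

theorem measurable_pieceLift (w : ℝ) (K n : ℕ) : Measurable (pieceLift a w R K F n) :=
  measurable_coneLift (continuous_piece_mul ha hn hF w K n).measurable

include hs hR

theorem integrable_pieceLift (w : ℝ) (K n : ℕ) : Integrable (pieceLift a w R K F n) :=
  integrable_coneLift hR (integrable_piece_mul ha hs hn hF w _ n)

theorem exists_norm_pieceLift_le (w : ℝ) (K n : ℕ) : ∃ M, ∀ ζ, ‖pieceLift a w R K F n ζ‖ ≤ M := by
  refine exists_coneLift_le hR ?_
  exact (hasCompactSupport_piece hs w (1 / 2 ^ K) n).mul_right.exists_bound_of_continuous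
    (continuous_piece_mul ha hn hF w K n)

theorem memLp_pieceLift (w : ℝ) (K n : ℕ) : MemLp (pieceLift a w R K F n) 2 :=
  memLp_two_of_bound (integrable_pieceLift ha hs hn hF hR w K n)
    (exists_norm_pieceLift_le ha hs hn hF hR w K n).choose_spec

end

theorem exists_sum_lintegral_pieceLift_le {a : ℝ × ℝ → ℂ} (ha : ContDiff ℝ (⊤ : ℕ∞) a)
    (hs : HasCompactSupport a) (hn : ∀ ξ ∈ tsupport a, 0 < nullCoord ξ) :
    ∃ C, 0 < C ∧ ∀ (w R : ℝ) (K : ℕ) (S : Finset ℕ), 0 < R → ∀ F : ℝ × ℝ → ℂ, Integrable F →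
      (∃ m, ∀ x, ‖F x‖ ≤ m) →
      ∑ n ∈ S, ∫⁻ y, ‖ft3 (pieceLift a w R K F n) y‖ₑ ^ 2 ≤
        ENNReal.ofReal (C * R) * ∫⁻ x, ‖F x‖ₑ ^ 2 := by
  obtain ⟨L, hL, hL'⟩ := exists_lintegral_coneLift_sq_le
  obtain ⟨A, hA, hA'⟩ := exists_sum_enorm_piece_sq_le ha.continuous hs
  refine ⟨(2 * π) ^ 3 * L * A * (2 * π) ^ 2, by positivity, fun w R K S hR F hF hFb => ?_⟩
  obtain ⟨m, hm⟩ := hFb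
  have hpm : ∀ n, Measurable fun ξ => ‖piece a w (1 / 2 ^ K) n ξ * ft2 F ξ‖ₑ ^ 2 := fun n =>
    (continuous_piece_mul ha hn hF w K n).measurable.enorm.pow_const 2
  calc ∑ n ∈ S, ∫⁻ y, ‖ft3 (pieceLift a w R K F n) y‖ₑ ^ 2
      = ∑ n ∈ S, ENNReal.ofReal ((2 * π) ^ 3) * ∫⁻ ζ, ‖pieceLift a w R K F n ζ‖ₑ ^ 2 :=
        Finset.sum_congr rfl fun n _ => lintegral_enorm_sq_ft3
          (integrable_pieceLift ha hs hn hF hR w K n) (memLp_pieceLift ha hs hn hF hR w K n)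
    _ ≤ ∑ n ∈ S, ENNReal.ofReal ((2 * π) ^ 3) * (ENNReal.ofReal (L * R) *
          ∫⁻ ξ, ‖piece a w (1 / 2 ^ K) n ξ * ft2 F ξ‖ₑ ^ 2) := by
        gcongr with n
        exact hL' R _ hR (continuous_piece_mul ha hn hF w K n).measurable
    _ = ENNReal.ofReal ((2 * π) ^ 3) * (ENNReal.ofReal (L * R) *
          ∫⁻ ξ, (∑ n ∈ S, ‖piece a w (1 / 2 ^ K) n ξ‖ₑ ^ 2) * ‖ft2 F ξ‖ₑ ^ 2) := by
        rw [← Finset.mul_sum, ← Finset.mul_sum, ← lintegral_finsetSum _ fun n _ => hpm n]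
        simp only [enorm_mul, mul_pow, Finset.sum_mul]
    _ ≤ ENNReal.ofReal ((2 * π) ^ 3) * (ENNReal.ofReal (L * R) *
          ∫⁻ ξ, ENNReal.ofReal A * ‖ft2 F ξ‖ₑ ^ 2) := by
        gcongr with ξ
        exact hA' w _ S ξ
    _ = _ := by
        rw [lintegral_const_mul' _ _ ENNReal.ofReal_ne_top,
          lintegral_enorm_sq_ft2 hF (memLp_two_of_bound hF hm)]
        simp only [← mul_assoc]
        rw [← ENNReal.ofReal_mul (by positivity), ← ENNReal.ofReal_mul (by positivity),
          ← ENNReal.ofReal_mul (by positivity)]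
        congr 2
        ring

theorem ft2_add {F₁ F₂ : ℝ × ℝ → ℂ} (h₁ : Integrable F₁) (h₂ : Integrable F₂) (ξ : ℝ × ℝ) :
    ft2 (F₁ + F₂) ξ = ft2 F₁ ξ + ft2 F₂ ξ := by
  simp only [ft2_eq]
  rw [← integral_add (integrable_exp_dot2_mul h₁ ξ) (integrable_exp_dot2_mul h₂ ξ)]
  congr 1
  funext y
  simp [mul_add]

theorem ft3_add {g₁ g₂ : (ℝ × ℝ) × ℝ → ℂ} (h₁ : Integrable g₁) (h₂ : Integrable g₂)
    (y : (ℝ × ℝ) × ℝ) : ft3 (fun x => g₁ x + g₂ x) y = ft3 g₁ y + ft3 g₂ y := by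
  have := ft3_sum (Finset.univ : Finset (Fin 2)) (G := ![g₁, g₂])
    (fun i _ => by fin_cases i <;> simpa) y
  simpa using this

theorem pieceLift_add {F₁ F₂ : ℝ × ℝ → ℂ} (h₁ : Integrable F₁) (h₂ : Integrable F₂)
    (a : ℝ × ℝ → ℂ) (w R : ℝ) (K n : ℕ) : pieceLift a w R K (F₁ + F₂) n = fun x =>
      pieceLift a w R K F₁ n x + pieceLift a w R K F₂ n x := by
  funext ζ
  simp only [pieceLift, coneLift, ft2_add h₁ h₂]
  ring

/-- On every scale, the diagonal masses of the pieces of `F` over the small sets are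
controlled by the fourth moment of `F`. -/
theorem exists_sum_smallSet_le {a : ℝ × ℝ → ℂ} (ha : ContDiff ℝ (⊤ : ℕ∞) a)
    (hs : HasCompactSupport a) {h₀ W C₀ : ℝ} (hh : 0 < h₀) (hC₀ : 1 ≤ C₀)
    (hn : ∀ ξ ∈ tsupport a, h₀ ≤ nullCoord ξ) :
    ∃ C, 0 < C ∧ ∀ (w : ℝ) (K b : ℕ) (T : Finset ℕ), |w| ≤ W → b ≤ K →
      ∀ F : ℝ × ℝ → ℂ, Integrable F → Measurable F → (∃ m, ∀ x, ‖F x‖ ≤ m) →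
      ∑ j ∈ Finset.range (2 ^ b), ∫⁻ η in smallSet (conePoly h₀ w) K b j,
        ‖∑ n ∈ T.filter (fun n => n / 2 ^ (K - b) = j),
          corr (pieceLift a w (C₀ * 4 ^ K) K F n) (pieceLift a w (C₀ * 4 ^ K) K F n) η‖ₑ ^ 2 ≤
        ENNReal.ofReal (C * 4 ^ K) * ∫⁻ x, ‖F x‖ₑ ^ 4 := by
  have hn' : ∀ ξ ∈ tsupport a, 0 < nullCoord ξ := fun ξ h => hh.trans_le (hn ξ h)
  obtain ⟨C₁, hC₁, h₁⟩ := exists_plank_average_le ha hs hh hn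
  obtain ⟨C₂, hC₂, h₂⟩ := exists_lintegral_smallSet_le (W := W) hh (zero_lt_one.trans_le hC₀)
  obtain ⟨C₃, hC₃, h₃⟩ := exists_sum_lintegral_pieceLift_le ha hs hn'
  have hC₀' : 0 < C₀ := zero_lt_one.trans_le hC₀
  refine ⟨C₂ * (32 * C₁ * (C₃ * C₀)), by positivity, fun w K b T hw hb F hF hFm hFb => ?_⟩
  set R := C₀ * 4 ^ K with hRd
  have hR : 0 < R := by positivity
  have hRK : 1 ≤ R * (1 / 2 ^ K) ^ 2 := by
    have : R * (1 / 2 ^ K) ^ 2 = C₀ := by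
      rw [hRd, div_pow, ← pow_mul, mul_comm K 2, pow_mul]; norm_num
    rw [this]; exact hC₀
  set S : ℕ → Finset ℕ := fun j => T.filter fun n => n / 2 ^ (K - b) = j with hS
  set A : (ℝ × ℝ → ℂ) → ℕ → (ℝ × ℝ) × ℝ → ℝ≥0∞ := fun F j y =>
    ∫⁻ σ, ∑ n ∈ S j, ‖ft3 (pieceLift a w R K F n)
      (y + plankMap R (1 / 2 ^ b) (w + (j + 1 / 2) * (1 / 2 ^ b)) σ)‖ₑ ^ 2 ∂gauss3 with hA
  have hmeas2 : ∀ F : ℝ × ℝ → ℂ, Integrable F → ∀ (n j : ℕ),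
      Measurable fun z : ((ℝ × ℝ) × ℝ) × ((ℝ × ℝ) × ℝ) => ‖ft3 (pieceLift a w R K F n)
        (z.1 + plankMap R (1 / 2 ^ b) (w + (j + 1 / 2) * (1 / 2 ^ b)) z.2)‖ₑ ^ 2 := by
    intro F hF n j
    have h1 := continuous_ft3 _ (integrable_pieceLift ha hs hn' hF hR w K n)
    have h2 := continuous_plankMap R (1 / 2 ^ b) (w + (j + 1 / 2) * (1 / 2 ^ b))
    exact (h1.comp (continuous_fst.add (h2.comp continuous_snd))).measurable.enorm.pow_const 2
  have hmeasS : ∀ F : ℝ × ℝ → ℂ, Integrable F → ∀ j : ℕ,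
      Measurable fun z : ((ℝ × ℝ) × ℝ) × ((ℝ × ℝ) × ℝ) => ∑ n ∈ S j, ‖ft3 (pieceLift a w R K F n)
        (z.1 + plankMap R (1 / 2 ^ b) (w + (j + 1 / 2) * (1 / 2 ^ b)) z.2)‖ₑ ^ 2 :=
    fun F hF j => Finset.measurable_sum (S j) fun n _ => hmeas2 F hF n j
  have hmeasA : ∀ F : ℝ × ℝ → ℂ, Integrable F → ∀ j, Measurable (A F j) := fun F hF j =>
    (hmeasS F hF j).lintegral_prod_right'
  have hadd : ∀ F₁ F₂ : ℝ × ℝ → ℂ, Integrable F₁ → Integrable F₂ → ∀ j y,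
      A (F₁ + F₂) j y ≤ 2 * A F₁ j y + 2 * A F₂ j y := by
    intro F₁ F₂ i₁ i₂ j y
    have hsec : ∀ F : ℝ × ℝ → ℂ, Integrable F → Measurable fun σ => ∑ n ∈ S j,
        ‖ft3 (pieceLift a w R K F n)
          (y + plankMap R (1 / 2 ^ b) (w + (j + 1 / 2) * (1 / 2 ^ b)) σ)‖ₑ ^ 2 := by
      intro F hF
      refine Finset.measurable_sum _ fun n _ => ?_
      have h1 := continuous_ft3 _ (integrable_pieceLift ha hs hn' hF hR w K n)
      have h2 := continuous_plankMap R (1 / 2 ^ b) (w + (j + 1 / 2) * (1 / 2 ^ b))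
      exact (h1.comp (continuous_const.add h2)).measurable.enorm.pow_const 2
    rw [hA]
    simp only
    rw [← lintegral_const_mul' _ _ (by simp), ← lintegral_const_mul' _ _ (by simp),
      ← lintegral_add_left ((hsec F₁ i₁).const_mul 2)]
    refine lintegral_mono fun σ => ?_
    rw [Finset.mul_sum, Finset.mul_sum, ← Finset.sum_add_distrib]
    refine Finset.sum_le_sum fun n _ => ?_
    rw [pieceLift_add i₁ i₂, ft3_add (integrable_pieceLift ha hs hn' i₁ hR w K n)
      (integrable_pieceLift ha hs hn' i₂ hR w K n)]
    exact enorm_add_sq_le _ _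
  have hA1 : ∀ F : ℝ × ℝ → ℂ, Integrable F → ∀ j, ∫⁻ y, A F j y =
      ∑ n ∈ S j, ∫⁻ y, ‖ft3 (pieceLift a w R K F n) y‖ₑ ^ 2 := by
    intro F hF j
    rw [hA]
    simp only
    rw [lintegral_lintegral_swap
      (hmeasS F hF j).aemeasurable]
    have : ∀ σ, ∫⁻ y, ∑ n ∈ S j, ‖ft3 (pieceLift a w R K F n)
        (y + plankMap R (1 / 2 ^ b) (w + (j + 1 / 2) * (1 / 2 ^ b)) σ)‖ₑ ^ 2 =
        ∑ n ∈ S j, ∫⁻ y, ‖ft3 (pieceLift a w R K F n) y‖ₑ ^ 2 := by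
      intro σ
      rw [lintegral_add_right_eq_self (μ := (volume : Measure ((ℝ × ℝ) × ℝ)))
        (fun y => ∑ n ∈ S j, ‖ft3 (pieceLift a w R K F n) y‖ₑ ^ 2)]
      refine lintegral_finsetSum _ fun n _ => ?_
      exact (continuous_ft3 _ (integrable_pieceLift ha hs hn' hF hR w K n)).measurable.enorm.pow_const 2
    simp only [this]
    simp
  have hdisj : ∀ f : ℕ → ℝ≥0∞, ∑ j ∈ Finset.range (2 ^ b), ∑ n ∈ S j, f n ≤ ∑ n ∈ T, f n := by
    intro f
    rw [← Finset.sum_biUnion]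
    · exact Finset.sum_le_sum_of_subset
        (Finset.biUnion_subset.2 fun j _ => Finset.filter_subset _ _)
    · intro j _ j' _ hjj
      refine Finset.disjoint_left.2 fun n h h' => hjj ?_
      rw [← (Finset.mem_filter.1 h).2, ← (Finset.mem_filter.1 h').2]
  obtain ⟨m, hm⟩ := hFb
  have marc := sum_lintegral_sq_le_of_bounds (ν := volume) (A := A) (J := Finset.range (2 ^ b))
    (B := C₃ * R) hC₁ (fun F hF j _ => hmeasA F hF j)
    (fun F₁ F₂ i₁ i₂ j _ => hadd F₁ F₂ i₁ i₂ j)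
    (fun F m hF hm j _ y => h₁ w R K b j (S j) hb hRK hR
      (fun n hn => (Finset.mem_filter.1 hn).2) F m hF hm y)
    (fun F hF hFb => by
      rw [Finset.sum_congr rfl fun j _ => hA1 F hF j]
      exact (hdisj _).trans (h₃ w R K T hR F hF hFb)) hF hFm hm
  have hInt := fun n => integrable_pieceLift ha hs hn' hF hR w K n
  have step : ∀ j ∈ Finset.range (2 ^ b), ∫⁻ η in smallSet (conePoly h₀ w) K b j,
        ‖∑ n ∈ S j, corr (pieceLift a w R K F n) (pieceLift a w R K F n) η‖ₑ ^ 2 ≤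
      ENNReal.ofReal C₂ * ∫⁻ y, A F j y ^ 2 := by
    intro j hj
    have hci : ∀ n, Integrable (corr (pieceLift a w R K F n) (pieceLift a w R K F n)) := fun n =>
      integrable_corr (hInt n) (hInt n)
    have hi : Integrable fun η =>
        ∑ n ∈ S j, corr (pieceLift a w R K F n) (pieceLift a w R K F n) η :=
      integrable_finsetSum _ fun n _ => hci n
    choose M hM using fun n => exists_norm_pieceLift_le ha hs hn' hF hR w K n
    have hb2 : ∀ η, ‖∑ n ∈ S j, corr (pieceLift a w R K F n) (pieceLift a w R K F n) η‖ ≤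
        ∑ n ∈ S j, M n * ∫ ζ, ‖pieceLift a w R K F n ζ‖ := fun η =>
      (norm_sum_le _ _).trans (Finset.sum_le_sum fun n _ => norm_corr_le (hM n) (hInt n) η)
    refine (h₂ w K b j hw (Finset.mem_range.1 hj) _ hi (memLp_two_of_bound hi hb2)).trans ?_
    refine mul_le_mul_right (lintegral_mono fun y => ?_) _
    refine pow_le_pow_left' (lintegral_mono fun σ => ?_) 2
    rw [ft3_sum _ fun n _ => hci n]
    refine (enorm_sum_le _ _).trans (Finset.sum_le_sum fun n _ => ?_)
    rw [ft3_corr (hInt n) (hInt n), enorm_mul, sq, RCLike.enorm_conj]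
  calc _ ≤ ∑ j ∈ Finset.range (2 ^ b), ENNReal.ofReal C₂ * ∫⁻ y, A F j y ^ 2 :=
        Finset.sum_le_sum step
    _ ≤ ENNReal.ofReal C₂ * (ENNReal.ofReal (32 * C₁) * ENNReal.ofReal (C₃ * R) *
          ∫⁻ x, ‖F x‖ₑ ^ 4) := by
        rw [← Finset.mul_sum]
        exact mul_le_mul_right marc _
    _ = _ := by
        rw [← ENNReal.ofReal_mul (by positivity), ← mul_assoc, ← ENNReal.ofReal_mul (by positivity)]
        congr 2
        rw [hRd]; ring

theorem enorm_sum_pow_four_le {ι : Type*} (T : Finset ι) (g : ι → ℂ) :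
    ‖∑ t ∈ T, g t‖ₑ ^ 4 ≤ (T.card : ℝ≥0∞) ^ 3 * ∑ t ∈ T, ‖g t‖ₑ ^ 4 := by
  have key : ‖∑ t ∈ T, g t‖ ^ 4 ≤ (T.card : ℝ) ^ 3 * ∑ t ∈ T, ‖g t‖ ^ 4 :=
    calc ‖∑ t ∈ T, g t‖ ^ 4 ≤ ((∑ t ∈ T, ‖g t‖) ^ 2) ^ 2 := by
          rw [← pow_mul]; exact pow_le_pow_left₀ (norm_nonneg _) (norm_sum_le _ _) 4
      _ ≤ ((T.card : ℝ) * ∑ t ∈ T, ‖g t‖ ^ 2) ^ 2 :=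
          pow_le_pow_left₀ (by positivity) sq_sum_le_card_mul_sum_sq 2
      _ = (T.card : ℝ) ^ 2 * (∑ t ∈ T, ‖g t‖ ^ 2) ^ 2 := by ring
      _ ≤ (T.card : ℝ) ^ 2 * ((T.card : ℝ) * ∑ t ∈ T, (‖g t‖ ^ 2) ^ 2) := by
          gcongr; exact sq_sum_le_card_mul_sum_sq
      _ = (T.card : ℝ) ^ 3 * ∑ t ∈ T, ‖g t‖ ^ 4 := by simp only [← pow_mul]; ring
  have h := ENNReal.ofReal_le_ofReal key
  rw [ENNReal.ofReal_mul (by positivity), ENNReal.ofReal_sum_of_nonneg fun _ _ => by positivity,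
    ENNReal.ofReal_pow (by positivity), ENNReal.ofReal_pow (by positivity),
    ENNReal.ofReal_natCast, ofReal_norm] at h
  simpa only [ENNReal.ofReal_pow (norm_nonneg _), ofReal_norm] using h

/-- A symbol supported in a thin piece of a cone of directions. -/
structure IsNarrow (a : ℝ × ℝ → ℂ) (h₀ w κ : ℝ) : Prop where
  contDiff : ContDiff ℝ (⊤ : ℕ∞) a
  hasCompactSupport : HasCompactSupport a
  pos : 0 < h₀
  nullCoord_mem : ∀ ξ ∈ tsupport a, nullCoord ξ ∈ Icc h₀ ((1 + κ) * h₀)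
  angCoord_mem : ∀ ξ ∈ tsupport a, angCoord ξ ∈ Icc (w + 1 / 4) (w + 3 / 4)

theorem pieceLift_ne_zero {a F : ℝ × ℝ → ℂ} {w R : ℝ} {K n : ℕ} {ζ : (ℝ × ℝ) × ℝ} (hR : 0 < R)
    (h : pieceLift a w R K F n ζ ≠ 0) : |ζ.2 - enorm2 ζ.1| ≤ 1 / R ∧ ζ.1 ∈ tsupport a ∧
      angCoord ζ.1 - w ∈ Icc ((n : ℝ) / 2 ^ K) (((n : ℝ) + 1) / 2 ^ K) := by
  obtain ⟨h1, h2⟩ := coneLift_ne_zero hR h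
  have h3 := left_ne_zero_of_mul h2
  refine ⟨h1, subset_tsupport _ (left_ne_zero_of_mul h3), ?_⟩
  have h4 : (angCoord ζ.1 - w) / (1 / 2 ^ K) - n ∈ Ioo (0 : ℝ) 1 := by
    by_contra h0
    exact h3 (by rw [piece, chi_eq_zero h0]; simp)
  rw [div_div_eq_mul_div, div_one] at h4
  constructor
  · rw [div_le_iff₀ (by positivity)]; linarith [h4.1]
  · rw [le_div_iff₀ (by positivity)]; linarith [h4.2]

/-- Each colour class of the pieces of a narrow symbol satisfies the fourth moment bound. -/
theorem IsNarrow.exists_lintegral_colourClass_le {a : ℝ × ℝ → ℂ} {h₀ w₁ : ℝ} {k : ℕ} (hk : 0 < k)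
    (D : IsNarrow a h₀ w₁ (1 / (10 ^ 8 * (2 ^ k) ^ 4))) {C₀ : ℝ} (hC₁ : 1 ≤ C₀)
    (hC₀ : 16 * (1 + (|w₁| + 2) ^ 2) / h₀ ≤ C₀) :
    ∃ C, 0 < C ∧ ∀ (w : ℝ) (N : ℕ) (c : Fin N → Fin 2), |w| ≤ |w₁| + 1 →
      ∀ F : ℝ × ℝ → ℂ, Integrable F → Measurable F → (∃ m, ∀ x, ‖F x‖ ≤ m) →
      ∫⁻ y, ‖∑ n ∈ colourClass k N c,
        ft3 (pieceLift a w (C₀ * 4 ^ (k * N)) (k * N) F n) y‖ₑ ^ 4 ≤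
        ENNReal.ofReal (C * (240 * ((k : ℝ) + 1)) ^ N * 4 ^ (k * N)) * ∫⁻ x, ‖F x‖ₑ ^ 4 := by
  have hn : ∀ ξ ∈ tsupport a, h₀ ≤ nullCoord ξ := fun ξ h => (D.nullCoord_mem ξ h).1
  have hn' : ∀ ξ ∈ tsupport a, 0 < nullCoord ξ := fun ξ h => D.pos.trans_le (hn ξ h)
  obtain ⟨C, hC, hC'⟩ := exists_sum_smallSet_le (W := |w₁| + 1) D.contDiff D.hasCompactSupport D.pos hC₁ hn
  refine ⟨(2 * π) ^ 3 * C, by positivity, fun w N c hw F hF hFm hFb => ?_⟩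
  set K := k * N with hK
  set R := C₀ * 4 ^ K with hRd
  have hR : 0 < R := by positivity
  have hpos := D.pos
  have h4 : (4 : ℝ) ^ K = (2 ^ K) ^ 2 := by
    rw [show (4 : ℝ) = 2 ^ 2 by norm_num, ← pow_mul, ← pow_mul, mul_comm]
  have err : ∀ ζ : (ℝ × ℝ) × ℝ, |ζ.2 - enorm2 ζ.1| ≤ 1 / R → ∀ v ∈ Icc (0 : ℝ) 1,
      |(ζ.2 - enorm2 ζ.1) * (1 + (v + w) ^ 2) / h₀| ≤ (1 / 2 ^ K) ^ 2 / 16 := by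
    intro ζ hζ v hv
    have h1 : |v + w| ≤ |w₁| + 2 := by
      refine (abs_add_le _ _).trans ?_
      rw [abs_of_nonneg hv.1]; linarith [hv.2]
    have h2 : (v + w) ^ 2 ≤ (|w₁| + 2) ^ 2 := by
      rw [← sq_abs]; exact pow_le_pow_left₀ (abs_nonneg _) h1 2
    rw [abs_div, abs_mul, abs_of_pos hpos, abs_of_pos (by positivity : 0 < 1 + (v + w) ^ 2),
      div_le_iff₀ hpos]
    calc |ζ.2 - enorm2 ζ.1| * (1 + (v + w) ^ 2) ≤ 1 / R * (1 + (|w₁| + 2) ^ 2) := by gcongr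
      _ ≤ 1 / R * (C₀ * h₀ / 16) := by
          gcongr
          rw [div_le_iff₀ hpos] at hC₀
          linarith
      _ = (1 / 2 ^ K) ^ 2 / 16 * h₀ := by
          rw [hRd, h4]
          have : C₀ ≠ 0 := by positivity
          field_simp
  have hnull : ∀ ξ ∈ tsupport a,
      nullCoord ξ / h₀ ∈ Icc (1 : ℝ) (1 + 1 / (10 ^ 8 * (2 ^ k) ^ 4)) := by
    intro ξ hξ
    have := D.nullCoord_mem ξ hξ
    exact ⟨(one_le_div hpos).2 this.1, (div_le_iff₀ hpos).2 this.2⟩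
  have key := lintegral_sum_ft3_le hk c (G := pieceLift a w R K F) (P := conePoly h₀ w)
    (fun n => measurable_pieceLift D.contDiff hn' hF w K n)
    (fun n => integrable_pieceLift D.contDiff D.hasCompactSupport hn' hF hR w K n)
    (fun n => exists_norm_pieceLift_le D.contDiff D.hasCompactSupport hn' hF hR w K n)
    (continuous_conePoly h₀ w).measurable
    (fun n _ m _ ζ ζ' hζ hζ' => by
      obtain ⟨e1, s1, t1⟩ := pieceLift_ne_zero hR hζ
      obtain ⟨e2, s2, t2⟩ := pieceLift_ne_zero hR hζ'
      refine ⟨_, hnull _ s1, _, hnull _ s2, _, t1, _, t2, fun v hv => ?_⟩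
      rw [quad_conePoly_sub, quad_conePoly _ _ _ (hn' _ s1), quad_conePoly _ _ _ (hn' _ s2)]
      have b1 := abs_le.1 (err ζ e1 v hv)
      have b2 := abs_le.1 (err ζ' e2 v hv)
      rw [abs_le]
      constructor <;> linarith [b1.1, b1.2, b2.1, b2.2])
    (Z := ENNReal.ofReal (C * 4 ^ K) * ∫⁻ x, ‖F x‖ₑ ^ 4)
    (fun b hb => hC' w K b (colourClass k N c) hw hb F hF hFm hFb)
  refine key.trans (le_of_eq ?_)
  rw [← mul_assoc, ← mul_assoc, ← ENNReal.ofReal_mul (by positivity),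
    ← ENNReal.ofReal_mul (by positivity)]
  congr 2
  ring

theorem IsNarrow.sum_piece {a : ℝ × ℝ → ℂ} {h₀ w₁ κ : ℝ} (D : IsNarrow a h₀ w₁ κ) {K : ℕ}
    (hK : 0 < K) (ξ : ℝ × ℝ) : ∑ c : Fin 2, ∑ n ∈ Finset.range (2 ^ K),
      piece a (w₁ + (c : ℕ) * (1 / 2 ^ K / 2)) (1 / 2 ^ K) n ξ = a ξ := by
  by_cases hξ : ξ ∈ tsupport a
  · have hang := D.angCoord_mem ξ hξ
    set x := (angCoord ξ - w₁) / (1 / 2 ^ K) with hx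
    have h2 : (2 : ℝ) ≤ 2 ^ K := le_self_pow₀ one_le_two hK.ne'
    have hx' : x = (angCoord ξ - w₁) * 2 ^ K := by rw [hx]; field_simp
    have hs := sum_chi x (2 ^ K)
    rw [Real.smoothTransition.one_of_one_le, Real.smoothTransition.zero_of_nonpos, sub_zero] at hs
    · have e : ∀ n : ℕ, (angCoord ξ - (w₁ + 1 / 2 ^ K / 2)) / (1 / 2 ^ K) - n = x - 1 / 2 - n := by
        intro n; rw [hx]; field_simp; ring
      simp only [Fin.sum_univ_two, piece]
      simp only [Fin.val_zero, Fin.val_one, Nat.cast_zero, zero_mul, add_zero, Nat.cast_one,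
        one_mul, e]
      rw [← Finset.sum_add_distrib]
      simp only [← mul_add, ← Finset.mul_sum, ← Complex.ofReal_add, ← Complex.ofReal_sum]
      rw [hs]; simp
    · push_cast; rw [hx']; nlinarith [hang.2]
    · rw [hx']; nlinarith [hang.1]
  · simp [piece, image_eq_zero_of_notMem_tsupport hξ]

theorem waveExt_sum {ι : Type*} (s : Finset ι) {b : ι → ℝ × ℝ → ℂ}
    (h : ∀ i ∈ s, Integrable (b i)) (y : (ℝ × ℝ) × ℝ) :
    waveExt (fun ξ => ∑ i ∈ s, b i ξ) y = ∑ i ∈ s, waveExt (b i) y := by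
  simp only [waveExt, Finset.mul_sum]
  refine integral_finsetSum _ fun i hi => ?_
  refine (h i hi).bdd_mul (c := 1) ?_ (Filter.Eventually.of_forall fun ξ => ?_)
  · have := continuous_enorm2
    have h2 : Continuous fun ξ => dot2 y.1 ξ := by unfold dot2; fun_prop
    exact Continuous.aestronglyMeasurable (by fun_prop)
  · rw [norm_exp_neg_I_mul]

/-- The fourth moment bound for a narrow symbol on the time scale `4 ^ (k * N)`. -/
theorem IsNarrow.exists_lintegral_waveExt_le {a : ℝ × ℝ → ℂ} {h₀ w₁ : ℝ} {k : ℕ} (hk : 0 < k)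
    (D : IsNarrow a h₀ w₁ (1 / (10 ^ 8 * (2 ^ k) ^ 4))) :
    ∃ C, 0 < C ∧ ∀ N : ℕ, 0 < N → ∀ F : ℝ × ℝ → ℂ, Integrable F → Measurable F →
      (∃ m, ∀ x, ‖F x‖ ≤ m) →
      ∫⁻ y in {y : (ℝ × ℝ) × ℝ | |y.2| ≤ 4 ^ (k * N)}, ‖waveExt (fun ξ => a ξ * ft2 F ξ) y‖ₑ ^ 4 ≤
        ENNReal.ofReal (C * (3840 * ((k : ℝ) + 1)) ^ N * 4 ^ (k * N)) * ∫⁻ x, ‖F x‖ₑ ^ 4 := by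
  set C₀ := max 1 (16 * (1 + (|w₁| + 2) ^ 2) / h₀) with hC₀
  have hC₁ : 1 ≤ C₀ := le_max_left _ _
  obtain ⟨C, hC, hC'⟩ := D.exists_lintegral_colourClass_le hk hC₁ (le_max_right _ _)
  have hcos : 0 < Real.cos 1 := Real.cos_one_pos
  have hn' : ∀ ξ ∈ tsupport a, 0 < nullCoord ξ :=
    fun ξ h => D.pos.trans_le (D.nullCoord_mem ξ h).1
  refine ⟨(Real.cos 1 ^ 4)⁻¹ * 16 * C, by positivity, fun N hN F hF hFm hFb => ?_⟩
  set K := k * N with hK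
  set R := C₀ * 4 ^ K with hRd
  have hR : 0 < R := by positivity
  set W : Fin 2 → ℝ := fun c => w₁ + (c : ℕ) * (1 / 2 ^ K / 2) with hW
  have hWle : ∀ c, |W c| ≤ |w₁| + 1 := by
    intro c
    refine (abs_add_le _ _).trans (add_le_add le_rfl ?_)
    have h1 : ((c : ℕ) : ℝ) ≤ 1 := by
      have := c.is_lt
      exact_mod_cast Nat.lt_succ_iff.1 this
    have h2 : (1 : ℝ) / 2 ^ K ≤ 1 := div_le_one_of_le₀ (one_le_pow₀ one_le_two) (by positivity)
    rw [abs_of_nonneg (by positivity)]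
    calc ((c : ℕ) : ℝ) * (1 / 2 ^ K / 2) ≤ 1 * (1 / 2) := by gcongr
      _ ≤ 1 := by norm_num
  set T : Finset (Fin 2 × (Fin N → Fin 2)) := Finset.univ
  set g : Fin 2 × (Fin N → Fin 2) → (ℝ × ℝ) × ℝ → ℂ := fun p y =>
    ∑ n ∈ colourClass k N p.2, ft3 (pieceLift a (W p.1) R K F n) y with hg
  have hpi : ∀ (c : Fin 2) (n : ℕ), Integrable fun ξ => piece a (W c) (1 / 2 ^ K) n ξ * ft2 F ξ :=
    fun c n => integrable_piece_mul D.contDiff D.hasCompactSupport hn' hF (W c) _ n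
  have hgm : ∀ p, Measurable fun y => ‖g p y‖ₑ ^ 4 := by
    intro p
    refine (Measurable.enorm ?_).pow_const 4
    refine Finset.measurable_fun_sum _ fun n _ => (continuous_ft3 _ ?_).measurable
    exact integrable_pieceLift D.contDiff D.hasCompactSupport hn' hF hR (W p.1) K n
  have hdec : ∀ y, psi (y.2 / R) * waveExt (fun ξ => a ξ * ft2 F ξ) y = ∑ p ∈ T, g p y := by
    intro y
    have e1 : (fun ξ => a ξ * ft2 F ξ) = fun ξ => ∑ q ∈ (Finset.univ : Finset (Fin 2)) ×ˢ
        Finset.range (2 ^ K), piece a (W q.1) (1 / 2 ^ K) q.2 ξ * ft2 F ξ := by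
      funext ξ
      rw [← Finset.sum_mul, Finset.sum_product, D.sum_piece (Nat.mul_pos hk hN) ξ]
    rw [e1, waveExt_sum _ fun q _ => hpi q.1 q.2, Finset.mul_sum, Finset.sum_product]
    simp only [T, ← Finset.univ_product_univ]
    rw [Finset.sum_product]
    refine Finset.sum_congr rfl fun c _ => ?_
    rw [sum_range_eq_sum_colourClass]
    refine Finset.sum_congr rfl fun d _ => Finset.sum_congr rfl fun n _ => ?_
    rw [pieceLift, ft3_coneLift hR (hpi c n)]
  have hpt : ∀ y ∈ {y : (ℝ × ℝ) × ℝ | |y.2| ≤ 4 ^ K},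
      ‖waveExt (fun ξ => a ξ * ft2 F ξ) y‖ₑ ^ 4 ≤ ENNReal.ofReal (Real.cos 1 ^ 4)⁻¹ *
        ((T.card : ℝ≥0∞) ^ 3 * ∑ p ∈ T, ‖g p y‖ₑ ^ 4) := by
    intro y hy
    have hy' : |y.2 / R| ≤ 1 := by
      rw [abs_div, abs_of_pos hR, div_le_one hR]
      exact le_trans hy (le_mul_of_one_le_left (by positivity) hC₁)
    refine le_trans ?_ (mul_le_mul_right (enorm_sum_pow_four_le T fun p => g p y) _)
    rw [← hdec, enorm_mul, mul_pow, ← mul_assoc]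
    refine le_mul_of_one_le_left' ?_
    rw [← ofReal_norm, ← ENNReal.ofReal_pow (norm_nonneg _), ← ENNReal.ofReal_mul (by positivity)]
    refine ENNReal.one_le_ofReal.2 ?_
    rw [inv_mul_eq_div, one_le_div (by positivity)]
    exact pow_le_pow_left₀ hcos.le (norm_psi_ge hy') 4
  have hmS : MeasurableSet {y : (ℝ × ℝ) × ℝ | |y.2| ≤ (4 : ℝ) ^ K} :=
    measurableSet_le (by fun_prop) measurable_const
  have hcard : (T.card : ℝ) = 2 * 2 ^ N := by simp [T]
  calc ∫⁻ y in {y : (ℝ × ℝ) × ℝ | |y.2| ≤ 4 ^ K}, ‖waveExt (fun ξ => a ξ * ft2 F ξ) y‖ₑ ^ 4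
      ≤ ∫⁻ y, ENNReal.ofReal (Real.cos 1 ^ 4)⁻¹ *
        ((T.card : ℝ≥0∞) ^ 3 * ∑ p ∈ T, ‖g p y‖ₑ ^ 4) :=
        (setLIntegral_mono' hmS hpt).trans (setLIntegral_le_lintegral _ _)
    _ = ENNReal.ofReal (Real.cos 1 ^ 4)⁻¹ *
        ((T.card : ℝ≥0∞) ^ 3 * ∑ p ∈ T, ∫⁻ y, ‖g p y‖ₑ ^ 4) := by
        rw [lintegral_const_mul' _ _ ENNReal.ofReal_ne_top, lintegral_const_mul' _ _ (by simp),
          lintegral_finsetSum _ fun p _ => hgm p]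
    _ ≤ ENNReal.ofReal (Real.cos 1 ^ 4)⁻¹ * ((T.card : ℝ≥0∞) ^ 3 * ∑ p ∈ T,
          ENNReal.ofReal (C * (240 * ((k : ℝ) + 1)) ^ N * 4 ^ K) * ∫⁻ x, ‖F x‖ₑ ^ 4) := by
        refine mul_le_mul_right (mul_le_mul_right (Finset.sum_le_sum fun p _ => ?_) _) _
        exact hC' (W p.1) N p.2 (hWle p.1) F hF hFm hFb
    _ = _ := by
        rw [Finset.sum_const, nsmul_eq_mul, ← ENNReal.ofReal_natCast T.card, hcard,
          ← ENNReal.ofReal_pow (by positivity)]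
        simp only [← mul_assoc]
        rw [← ENNReal.ofReal_mul (by positivity), ← ENNReal.ofReal_mul (by positivity),
          ← ENNReal.ofReal_mul (by positivity)]
        congr 2
        have : (3840 * ((k : ℝ) + 1)) ^ N = (2 ^ N) ^ 4 * (240 * ((k : ℝ) + 1)) ^ N := by
          rw [← pow_mul, mul_comm N 4, pow_mul, ← mul_pow]; norm_num; ring
        rw [this]; ring

/-- The local smoothing estimate in `L⁴` with a loss of `T ^ ε` for the symbol `a`. -/
def FourthMomentBound (ε : ℝ) (a : ℝ × ℝ → ℂ) : Prop :=
  ∃ C, 0 < C ∧ ∀ T : ℝ, 1 ≤ T → ∀ F : ℝ × ℝ → ℂ, Integrable F → Measurable F →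
    (∃ m, ∀ x, ‖F x‖ ≤ m) →
    ∫⁻ y in {y : (ℝ × ℝ) × ℝ | |y.2| ≤ T}, ‖waveExt (fun ξ => a ξ * ft2 F ξ) y‖ₑ ^ 4 ≤
      ENNReal.ofReal (C * T ^ (1 + ε)) * ∫⁻ x, ‖F x‖ₑ ^ 4

theorem exists_linear_le_rpow {ε : ℝ} (hε : 0 < ε) :
    ∃ k : ℕ, 0 < k ∧ 3840 * ((k : ℝ) + 1) ≤ ((4 : ℝ) ^ k) ^ ε := by
  have h4 : (1 : ℝ) < 4 ^ ε := Real.one_lt_rpow (by norm_num) hε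
  have h := tendsto_pow_const_div_const_pow_of_one_lt 1 h4
  have h' := h.eventually (gt_mem_nhds (show (0 : ℝ) < 1 / 7680 by norm_num))
  obtain ⟨k, hk, hk'⟩ := (h'.and (Filter.eventually_gt_atTop 0)).exists
  refine ⟨k, hk', ?_⟩
  have e : ((4 : ℝ) ^ k) ^ ε = (4 ^ ε) ^ k := by
    rw [← Real.rpow_natCast, ← Real.rpow_natCast, ← Real.rpow_mul (by norm_num),
      ← Real.rpow_mul (by norm_num), mul_comm]
  rw [e]
  rw [pow_one, div_lt_iff₀ (by positivity)] at hk
  have : (1 : ℝ) ≤ k := by exact_mod_cast hk'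
  linarith

theorem IsNarrow.fourthMomentBound {ε : ℝ} {k : ℕ} (hk : 0 < k)
    (hkε : 3840 * ((k : ℝ) + 1) ≤ ((4 : ℝ) ^ k) ^ ε) {a : ℝ × ℝ → ℂ} {h₀ w₁ : ℝ}
    (hε : 0 < ε) (D : IsNarrow a h₀ w₁ (1 / (10 ^ 8 * (2 ^ k) ^ 4))) : FourthMomentBound ε a := by
  obtain ⟨C, hC, hC'⟩ := D.exists_lintegral_waveExt_le hk
  set X : ℝ := 4 ^ k with hX
  have hX1 : 1 < X := one_lt_pow₀ (by norm_num) hk.ne'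
  have hX0 : 0 < X := by positivity
  refine ⟨C * X ^ (1 + ε), by positivity, fun T hT F hF hFm hFb => ?_⟩
  obtain ⟨n, hn, hn'⟩ := exists_nat_pow_near hT hX1
  refine (lintegral_mono_set ?_).trans ((hC' (n + 1) n.succ_pos F hF hFm hFb).trans ?_)
  · intro y hy
    change |y.2| ≤ 4 ^ (k * (n + 1))
    rw [pow_mul, ← hX]
    exact le_trans hy hn'.le
  · refine mul_le_mul_left (ENNReal.ofReal_le_ofReal ?_) _
    rw [pow_mul, ← hX, mul_assoc, mul_assoc]
    refine mul_le_mul_of_nonneg_left ?_ hC.le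
    calc (3840 * ((k : ℝ) + 1)) ^ (n + 1) * X ^ (n + 1)
        ≤ (X ^ ε) ^ (n + 1) * X ^ (n + 1) := by gcongr
      _ = X ^ (1 + ε) * (X ^ n) ^ (1 + ε) := by
          rw [← mul_pow, ← Real.rpow_add_one hX0.ne', ← Real.rpow_natCast (X ^ (ε + 1)),
            ← Real.rpow_natCast X n, ← Real.rpow_mul hX0.le, ← Real.rpow_mul hX0.le,
            ← Real.rpow_add hX0]
          congr 1
          push_cast; ring
      _ ≤ X ^ (1 + ε) * T ^ (1 + ε) := by gcongr

theorem continuous_waveExt {b : ℝ × ℝ → ℂ} (hb : Integrable b) : Continuous (waveExt b) := by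
  have h1 := continuous_enorm2
  unfold waveExt
  refine continuous_of_dominated (bound := fun ξ => ‖b ξ‖) (fun y => ?_)
    (fun y => Filter.Eventually.of_forall fun ξ => ?_) hb.norm
    (Filter.Eventually.of_forall fun ξ => ?_)
  · refine AEStronglyMeasurable.mul (Continuous.aestronglyMeasurable ?_) hb.1
    unfold dot2; fun_prop
  · rw [norm_mul, norm_exp_neg_I_mul, one_mul]
  · unfold dot2; fun_prop

theorem FourthMomentBound.sum {ε : ℝ} {ι : Type*} (s : Finset ι) {a : ι → ℝ × ℝ → ℂ}
    (hc : ∀ i ∈ s, Continuous (a i)) (hs : ∀ i ∈ s, HasCompactSupport (a i))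
    (h : ∀ i ∈ s, FourthMomentBound ε (a i)) :
    FourthMomentBound ε fun ξ => ∑ i ∈ s, a i ξ := by
  choose! C hC hC' using h
  have hC0 : 0 ≤ ∑ i ∈ s, C i := Finset.sum_nonneg fun i hi => (hC i hi).le
  refine ⟨((s.card : ℝ) ^ 3 * ∑ i ∈ s, C i) + 1, by positivity, fun T hT F hF hFm hFb => ?_⟩
  have hcF := continuous_ft2 hF
  have hInt : ∀ i ∈ s, Integrable fun ξ => a i ξ * ft2 F ξ := fun i hi =>
    ((hc i hi).mul hcF).integrable_of_hasCompactSupport (hs i hi).mul_right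
  have hm : ∀ i ∈ s, Measurable fun y => ‖waveExt (fun ξ => a i ξ * ft2 F ξ) y‖ₑ ^ 4 := by
    intro i hi
    exact ((continuous_waveExt (hInt i hi)).measurable.enorm).pow_const 4
  have hT0 : 0 < T := by linarith
  calc ∫⁻ y in {y : (ℝ × ℝ) × ℝ | |y.2| ≤ T}, ‖waveExt (fun ξ => (∑ i ∈ s, a i ξ) * ft2 F ξ) y‖ₑ ^ 4
      ≤ ∫⁻ y in {y : (ℝ × ℝ) × ℝ | |y.2| ≤ T},
        (s.card : ℝ≥0∞) ^ 3 * ∑ i ∈ s, ‖waveExt (fun ξ => a i ξ * ft2 F ξ) y‖ₑ ^ 4 := by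
        refine lintegral_mono fun y => ?_
        simp only [Finset.sum_mul]
        rw [waveExt_sum s hInt]
        exact enorm_sum_pow_four_le s _
    _ = (s.card : ℝ≥0∞) ^ 3 * ∑ i ∈ s, ∫⁻ y in {y : (ℝ × ℝ) × ℝ | |y.2| ≤ T},
          ‖waveExt (fun ξ => a i ξ * ft2 F ξ) y‖ₑ ^ 4 := by
        rw [lintegral_const_mul' _ _ (by simp), lintegral_finsetSum' _ fun i hi => (hm i hi).aemeasurable]
    _ ≤ (s.card : ℝ≥0∞) ^ 3 * ∑ i ∈ s, ENNReal.ofReal (C i * T ^ (1 + ε)) * ∫⁻ x, ‖F x‖ₑ ^ 4 := by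
        refine mul_le_mul_right (Finset.sum_le_sum fun i hi => ?_) _
        exact hC' i hi T hT F hF hFm hFb
    _ ≤ _ := by
        rw [← Finset.sum_mul, ← ENNReal.ofReal_sum_of_nonneg fun i hi => by
          have := hC i hi; positivity]
        rw [← mul_assoc, ← ENNReal.ofReal_natCast, ← ENNReal.ofReal_pow (by positivity),
          ← ENNReal.ofReal_mul (by positivity), ← Finset.sum_mul]
        refine mul_le_mul_left (ENNReal.ofReal_le_ofReal ?_) _
        have := Real.rpow_nonneg hT0.le (1 + ε)
        linarith

theorem enorm2_neg (ξ : ℝ × ℝ) : enorm2 (-ξ) = enorm2 ξ := by simp [enorm2]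

theorem ft2_comp_neg (F : ℝ × ℝ → ℂ) (ξ : ℝ × ℝ) : ft2 (fun x => F (-x)) ξ = ft2 F (-ξ) := by
  rw [ft2_eq, ft2_eq, ← integral_neg_eq_self]
  congr 1 with y
  rw [neg_neg, dot2_neg_left, dot2_comm y (-ξ), dot2_neg_left, dot2_comm y ξ]

theorem waveExt_comp_neg (b : ℝ × ℝ → ℂ) (y : (ℝ × ℝ) × ℝ) :
    waveExt (fun ξ => b (-ξ)) y = waveExt b (-y.1, y.2) := by
  rw [waveExt, waveExt, ← integral_neg_eq_self]
  congr 1 with ξ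
  rw [neg_neg, enorm2_neg, dot2_neg_left, dot2_comm y.1 (-ξ), dot2_neg_left, dot2_comm y.1 ξ]

theorem FourthMomentBound.of_comp_neg {ε : ℝ} {a : ℝ × ℝ → ℂ}
    (h : FourthMomentBound ε fun ξ => a (-ξ)) : FourthMomentBound ε a := by
  obtain ⟨C, hC, hC'⟩ := h
  refine ⟨C, hC, fun T hT F hF hFm ⟨m, hm⟩ => ?_⟩
  have h1 := hC' T hT (fun x => F (-x)) hF.comp_neg (hFm.comp measurable_neg) ⟨m, fun x => hm _⟩
  have e1 : ∫⁻ x : ℝ × ℝ, ‖F (-x)‖ₑ ^ 4 = ∫⁻ x, ‖F x‖ₑ ^ 4 :=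
    lintegral_neg_eq_self fun x : ℝ × ℝ => ‖F x‖ₑ ^ 4
  rw [e1] at h1
  refine le_trans (le_of_eq ?_) h1
  have hS : MeasurableSet {y : (ℝ × ℝ) × ℝ | |y.2| ≤ T} :=
    measurableSet_le (by fun_prop) measurable_const
  have hmp : MeasurePreserving (fun y : (ℝ × ℝ) × ℝ => (-y.1, y.2)) volume volume :=
    (Measure.measurePreserving_neg (volume : Measure (ℝ × ℝ))).prod (MeasurePreserving.id volume)
  have hemb : MeasurableEmbedding (fun y : (ℝ × ℝ) × ℝ => (-y.1, y.2)) :=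
    ((MeasurableEquiv.neg (ℝ × ℝ)).prodCongr (MeasurableEquiv.refl ℝ)).measurableEmbedding
  have := hmp.setLIntegral_comp_preimage_emb hemb
    (fun y => ‖waveExt (fun ξ => a ξ * ft2 F ξ) y‖ₑ ^ 4) {y : (ℝ × ℝ) × ℝ | |y.2| ≤ T}
  rw [← this]
  refine lintegral_congr fun y => ?_
  rw [← waveExt_comp_neg]
  simp only [ft2_comp_neg]

theorem exists_nhds_fourthMomentBound_of_pos {ε : ℝ} (hε : 0 < ε) {ξ₀ : ℝ × ℝ}
    (h0 : 0 < nullCoord ξ₀) : ∃ U ∈ nhds ξ₀, ∀ a : ℝ × ℝ → ℂ, ContDiff ℝ (⊤ : ℕ∞) a →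
      HasCompactSupport a → tsupport a ⊆ U → FourthMomentBound ε a := by
  obtain ⟨k, hk, hkε⟩ := exists_linear_le_rpow hε
  set κ : ℝ := 1 / (10 ^ 8 * (2 ^ k) ^ 4) with hκ
  have hκ0 : 0 < κ := by positivity
  set h₀ := nullCoord ξ₀ / (1 + κ / 2) with hh
  have hh0 : 0 < h₀ := by positivity
  have he : nullCoord ξ₀ = (1 + κ / 2) * h₀ := by rw [hh]; field_simp
  have n1 : Icc h₀ ((1 + κ) * h₀) ∈ nhds (nullCoord ξ₀) :=
    Icc_mem_nhds (by rw [he]; nlinarith) (by rw [he]; nlinarith)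
  have n2 : Icc (angCoord ξ₀ - 1 / 2 + 1 / 4) (angCoord ξ₀ - 1 / 2 + 3 / 4) ∈
      nhds (angCoord ξ₀) := Icc_mem_nhds (by linarith) (by linarith)
  have c1 := continuous_nullCoord.continuousAt.preimage_mem_nhds n1
  have c2 := (contDiffAt_angCoord (n := 0) h0).continuousAt.preimage_mem_nhds n2
  refine ⟨_, Filter.inter_mem c1 c2, fun a ha hs hsub => ?_⟩
  exact IsNarrow.fourthMomentBound hk hkε hε (h₀ := h₀) (w₁ := angCoord ξ₀ - 1 / 2)
    ⟨ha, hs, hh0, fun ξ h => (hsub h).1, fun ξ h => (hsub h).2⟩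

theorem exists_nhds_fourthMomentBound {ε : ℝ} (hε : 0 < ε) {ξ₀ : ℝ × ℝ} (h0 : ξ₀ ≠ 0) :
    ∃ U ∈ nhds ξ₀, ∀ a : ℝ × ℝ → ℂ, ContDiff ℝ (⊤ : ℕ∞) a →
      HasCompactSupport a → tsupport a ⊆ U → FourthMomentBound ε a := by
  by_cases hpos : 0 < nullCoord ξ₀
  · exact exists_nhds_fourthMomentBound_of_pos hε hpos
  have hn : 0 < enorm2 ξ₀ := by
    refine lt_of_le_of_ne (enorm2_nonneg _) fun h => h0 ?_
    have := enorm2_sq ξ₀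
    rw [← h] at this
    refine Prod.ext ?_ ?_ <;> simp only [Prod.fst_zero, Prod.snd_zero] <;> nlinarith
  have hneg : 0 < nullCoord (-ξ₀) := by
    have h1 : nullCoord ξ₀ = enorm2 ξ₀ + ξ₀.1 := rfl
    have h2 : nullCoord (-ξ₀) = enorm2 ξ₀ - ξ₀.1 := by rw [nullCoord, enorm2_neg]; rfl
    linarith
  obtain ⟨U, hU, hU'⟩ := exists_nhds_fourthMomentBound_of_pos hε hneg
  refine ⟨(fun ξ => -ξ) ⁻¹' U, continuous_neg.continuousAt.preimage_mem_nhds hU,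
    fun a ha hs hsub => FourthMomentBound.of_comp_neg ?_⟩
  refine hU' _ (ha.comp contDiff_neg) (hs.comp_homeomorph (Homeomorph.neg _)) ?_
  have := tsupport_comp_eq_preimage a (Homeomorph.neg (ℝ × ℝ))
  intro ξ hξ
  have h3 : ξ ∈ tsupport (a ∘ Homeomorph.neg (ℝ × ℝ)) := hξ
  rw [this] at h3
  have := hsub h3
  simpa using this

/-- The `L⁴` local smoothing estimate for symbols supported away from the origin. -/
theorem fourthMomentBound_of_zero_notMem {ε : ℝ} (hε : 0 < ε) {a : ℝ × ℝ → ℂ}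
    (ha : ContDiff ℝ (⊤ : ℕ∞) a) (hs : HasCompactSupport a) (h0 : (0 : ℝ × ℝ) ∉ tsupport a) :
    FourthMomentBound ε a := by
  have key : ∀ ξ ∈ tsupport a, ∃ U, ξ ∈ U ∧ IsOpen U ∧ ∀ b : ℝ × ℝ → ℂ, ContDiff ℝ (⊤ : ℕ∞) b →
      HasCompactSupport b → tsupport b ⊆ U → FourthMomentBound ε b := by
    intro ξ hξ
    obtain ⟨U, hU, hU'⟩ := exists_nhds_fourthMomentBound hε (ξ₀ := ξ) fun h => h0 (h ▸ hξ)
    exact ⟨interior U, mem_interior_iff_mem_nhds.2 hU, isOpen_interior, fun b hb hbs hsub =>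
      hU' b hb hbs (hsub.trans interior_subset)⟩
  choose! U hU hUo hU' using key
  obtain ⟨t, ht, hcov⟩ := hs.isCompact.elim_nhds_subcover U fun ξ hξ => (hUo ξ hξ).mem_nhds (hU ξ hξ)
  obtain ⟨f, hf⟩ := SmoothPartitionOfUnity.exists_isSubordinate (modelWithCornersSelf ℝ (ℝ × ℝ))
    (isClosed_tsupport a) (fun i : t => U i) (fun i => hUo i (ht i i.2)) (by
      intro ξ hξ
      obtain ⟨i, hi, h⟩ := mem_iUnion₂.1 (hcov hξ)
      exact mem_iUnion.2 ⟨⟨i, hi⟩, h⟩)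
  have hfs : ∀ i, ContDiff ℝ (⊤ : ℕ∞) fun ξ => (f i ξ : ℂ) := fun i =>
    Complex.ofRealCLM.contDiff.comp (f i).contMDiff.contDiff
  have e : a = fun ξ => ∑ i : t, (f i ξ : ℂ) * a ξ := by
    funext ξ
    rw [← Finset.sum_mul, ← Complex.ofReal_sum]
    by_cases hξ : ξ ∈ tsupport a
    · have := f.sum_eq_one hξ
      rw [finsum_eq_sum_of_fintype] at this
      rw [this]; simp
    · simp [image_eq_zero_of_notMem_tsupport hξ]
  rw [e]
  refine FourthMomentBound.sum _ (fun i _ => (hfs i).continuous.mul ha.continuous)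
    (fun i _ => hs.mul_left) fun i _ => hU' i (ht i i.2) _ ((hfs i).mul ha) hs.mul_left ?_
  refine (tsupport_mul_subset_left).trans (subset_trans ?_ (hf i))
  refine closure_mono fun ξ hξ => ?_
  simpa using hξ

section
variable {ι κ : Type*} (s : Finset ι) (t : Finset κ) (M : ι → κ → ℂ) (m : ι → ℝ) (n : κ → ℝ)

/-- The bilinear form with matrix `M` is bounded by `A` with respect to the weighted `ℓ^{1/a}` and
`ℓ^{1/b}` norms. -/
def BilinBound (a b A : ℝ) : Prop :=
  ∀ (x : ι → ℂ) (y : κ → ℂ), ‖∑ i ∈ s, ∑ k ∈ t, x i * y k * M i k‖ ≤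
    A * (∑ i ∈ s, ‖x i‖ ^ (1 / a) * m i) ^ a * (∑ k ∈ t, ‖y k‖ ^ (1 / b) * n k) ^ b

/-- The analytic family `|x|^{w/a} sgn x`. -/
def rieszFamily (a : ℝ) (w x : ℂ) : ℂ := x / ‖x‖ * Complex.exp (w / a * (Real.log ‖x‖ : ℝ))

theorem rieszFamily_self {a : ℝ} (ha : a ≠ 0) (x : ℂ) : rieszFamily a a x = x := by
  by_cases hx : x = 0
  · simp [rieszFamily, hx]
  have : (a : ℂ) ≠ 0 := by exact_mod_cast ha
  rw [rieszFamily, div_self this, one_mul, ← Complex.ofReal_exp, Real.exp_log (norm_pos_iff.2 hx),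
    div_mul_cancel₀]
  exact_mod_cast norm_ne_zero_iff.2 hx

theorem norm_rieszFamily {a : ℝ} {w x : ℂ} (hx : x ≠ 0) :
    ‖rieszFamily a w x‖ = ‖x‖ ^ (w.re / a) := by
  have h : (w / a * (Real.log ‖x‖ : ℝ)).re = Real.log ‖x‖ * (w.re / a) := by
    rw [Complex.re_mul_ofReal, Complex.div_ofReal_re, mul_comm]
  rw [rieszFamily, norm_mul, Complex.norm_exp, h, norm_div, Complex.norm_real, norm_norm,
    div_self (norm_ne_zero_iff.2 hx), one_mul, Real.rpow_def_of_pos (norm_pos_iff.2 hx)]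

theorem norm_rieszFamily_rpow {a : ℝ} {w x : ℂ} (ha : a ≠ 0) (hw : w.re ≠ 0) :
    ‖rieszFamily a w x‖ ^ (1 / w.re) = ‖x‖ ^ (1 / a) := by
  by_cases hx : x = 0
  · have h1 : 1 / w.re ≠ 0 := one_div_ne_zero hw
    have h2 : 1 / a ≠ 0 := one_div_ne_zero ha
    simp only [rieszFamily, hx, zero_div, zero_mul, norm_zero, Real.zero_rpow h1,
      Real.zero_rpow h2]
  rw [norm_rieszFamily hx, ← Real.rpow_mul (norm_nonneg _)]
  congr 1
  field_simp

theorem differentiable_rieszFamily (a : ℝ) (x : ℂ) {g : ℂ → ℂ} (hg : Differentiable ℂ g) :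
    Differentiable ℂ fun z => rieszFamily a (g z) x := by
  unfold rieszFamily; fun_prop

variable {s t M m n}

/-- **Riesz–Thorin interpolation** for bilinear forms on weighted finite `ℓ^p` spaces. -/
theorem BilinBound.interpolate {a₀ b₀ A₀ a₁ b₁ A₁ θ : ℝ} (hm : ∀ i ∈ s, 0 ≤ m i)
    (hn : ∀ k ∈ t, 0 ≤ n k) (ha₀ : 0 < a₀) (hb₀ : 0 < b₀) (ha₁ : 0 < a₁) (hb₁ : 0 < b₁)
    (hA₀ : 0 ≤ A₀) (hA₁ : 0 ≤ A₁)
    (h₀ : BilinBound s t M m n a₀ b₀ A₀) (h₁ : BilinBound s t M m n a₁ b₁ A₁)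
    (hθ : θ ∈ Icc (0 : ℝ) 1) :
    BilinBound s t M m n ((1 - θ) * a₀ + θ * a₁) ((1 - θ) * b₀ + θ * b₁)
      (A₀ ^ (1 - θ) * A₁ ^ θ) := by
  intro x y
  have conv : ∀ {u v r : ℝ}, 0 < u → 0 < v → r ∈ Icc (0 : ℝ) 1 → 0 < (1 - r) * u + r * v := by
    intro u v r hu hv hr
    rcases eq_or_lt_of_le hr.1 with h | h
    · rw [← h]; simpa using hu
    · have := mul_nonneg (sub_nonneg.2 hr.2) hu.le
      have := mul_pos h hv
      linarith
  set a := (1 - θ) * a₀ + θ * a₁ with ha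
  set b := (1 - θ) * b₀ + θ * b₁ with hb
  have ha' : 0 < a := conv ha₀ ha₁ hθ
  have hb' : 0 < b := conv hb₀ hb₁ hθ
  set α : ℂ → ℂ := fun z => (1 - z) * a₀ + z * a₁ with hα
  set β : ℂ → ℂ := fun z => (1 - z) * b₀ + z * b₁ with hβ
  have reα : ∀ z, (α z).re = (1 - z.re) * a₀ + z.re * a₁ := fun z => by
    simp [hα]
  have reβ : ∀ z, (β z).re = (1 - z.re) * b₀ + z.re * b₁ := fun z => by
    simp [hβ]
  have dα : Differentiable ℂ α := by fun_prop
  have dβ : Differentiable ℂ β := by fun_prop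
  set f : ℂ → ℂ := fun z => ∑ i ∈ s, ∑ k ∈ t,
    rieszFamily a (α z) (x i) * rieszFamily b (β z) (y k) * M i k with hf
  have df : Differentiable ℂ f := by
    refine Differentiable.fun_sum fun i _ => Differentiable.fun_sum fun k _ => ?_
    exact ((differentiable_rieszFamily a _ dα).mul (differentiable_rieszFamily b _ dβ)).mul_const _
  set X := ∑ i ∈ s, ‖x i‖ ^ (1 / a) * m i with hX
  set Y := ∑ k ∈ t, ‖y k‖ ^ (1 / b) * n k with hY
  have hX0 : 0 ≤ X := Finset.sum_nonneg fun i hi =>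
    mul_nonneg (Real.rpow_nonneg (norm_nonneg _) _) (hm i hi)
  have hY0 : 0 ≤ Y := Finset.sum_nonneg fun i hi =>
    mul_nonneg (Real.rpow_nonneg (norm_nonneg _) _) (hn i hi)
  have edge : ∀ {a' b' A' : ℝ}, 0 < a' → 0 < b' → BilinBound s t M m n a' b' A' → ∀ z : ℂ,
      (α z).re = a' → (β z).re = b' → ‖f z‖ ≤ A' * X ^ a' * Y ^ b' := by
    intro a' b' A' hpa hpb hB z hza hzb
    refine (hB _ _).trans (le_of_eq ?_)
    subst hza hzb
    simp only [norm_rieszFamily_rpow ha'.ne' hpa.ne', norm_rieszFamily_rpow hb'.ne' hpb.ne', hX, hY]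
  have bdd : ∀ {c c₀ c₁ : ℝ} (hc : 0 < c) (h0 : 0 < c₀) (h1 : 0 < c₁) (u z : ℂ),
      z.re ∈ Icc (0 : ℝ) 1 → ‖rieszFamily c ((1 - z) * c₀ + z * c₁) u‖ ≤
        (1 + ‖u‖) ^ ((c₀ + c₁) / c) := by
    intro c c₀ c₁ hc h0 h1 u z hz
    by_cases hu : u = 0
    · simp [rieszFamily, hu]
    have hre : ((1 - z) * (c₀ : ℂ) + z * c₁).re = (1 - z.re) * c₀ + z.re * c₁ := by simp
    rw [norm_rieszFamily hu, hre]
    have hle : (1 - z.re) * c₀ + z.re * c₁ ≤ c₀ + c₁ := by nlinarith [hz.1, hz.2]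
    have hge := conv h0 h1 hz
    calc ‖u‖ ^ (((1 - z.re) * c₀ + z.re * c₁) / c)
        ≤ (1 + ‖u‖) ^ (((1 - z.re) * c₀ + z.re * c₁) / c) := by
          gcongr; linarith
      _ ≤ (1 + ‖u‖) ^ ((c₀ + c₁) / c) := by
          refine Real.rpow_le_rpow_of_exponent_le (by linarith [norm_nonneg u]) ?_
          gcongr
  have hbdd : BddAbove ((norm ∘ f) '' Complex.HadamardThreeLines.verticalClosedStrip 0 1) := by
    refine ⟨∑ i ∈ s, ∑ k ∈ t, (1 + ‖x i‖) ^ ((a₀ + a₁) / a) * (1 + ‖y k‖) ^ ((b₀ + b₁) / b) *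
      ‖M i k‖, ?_⟩
    rintro _ ⟨z, hz, rfl⟩
    refine (norm_sum_le _ _).trans (Finset.sum_le_sum fun i _ => (norm_sum_le _ _).trans
      (Finset.sum_le_sum fun k _ => ?_))
    rw [norm_mul, norm_mul]
    have h1 := bdd ha' ha₀ ha₁ (x i) z hz
    have h2 := bdd hb' hb₀ hb₁ (y k) z hz
    gcongr
  have h3 := Complex.HadamardThreeLines.norm_le_interp_of_mem_verticalClosedStrip'
    (f := f) (z := (θ : ℂ)) (a := A₀ * X ^ a₀ * Y ^ b₀) (b := A₁ * X ^ a₁ * Y ^ b₁)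
    zero_lt_one (by simpa [Complex.HadamardThreeLines.verticalClosedStrip] using hθ)
    df.diffContOnCl hbdd
    (fun z hz => edge ha₀ hb₀ h₀ z (by rw [reα, mem_singleton_iff.1 hz]; ring)
      (by rw [reβ, mem_singleton_iff.1 hz]; ring))
    (fun z hz => edge ha₁ hb₁ h₁ z (by rw [reα, mem_singleton_iff.1 hz]; ring)
      (by rw [reβ, mem_singleton_iff.1 hz]; ring))
  have eα : α θ = (a : ℝ) := by rw [hα, ha]; push_cast; ring
  have eβ : β θ = (b : ℝ) := by rw [hβ, hb]; push_cast; ring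
  have e : f θ = ∑ i ∈ s, ∑ k ∈ t, x i * y k * M i k := by
    rw [hf]
    simp only [eα, eβ, rieszFamily_self ha'.ne', rieszFamily_self hb'.ne']
  rw [e] at h3
  refine h3.trans (le_of_eq ?_)
  have hX1 := Real.rpow_nonneg hX0
  have hY1 := Real.rpow_nonneg hY0
  simp only [Complex.ofReal_re, sub_zero, div_one]
  rw [Real.mul_rpow (mul_nonneg hA₀ (hX1 _)) (hY1 _), Real.mul_rpow hA₀ (hX1 _),
    Real.mul_rpow (mul_nonneg hA₁ (hX1 _)) (hY1 _), Real.mul_rpow hA₁ (hX1 _),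
    ← Real.rpow_mul hX0, ← Real.rpow_mul hX0, ← Real.rpow_mul hY0, ← Real.rpow_mul hY0]
  have pX : X ^ a = X ^ (a₀ * (1 - θ)) * X ^ (a₁ * θ) := by
    rw [← Real.rpow_add_of_nonneg hX0 (mul_nonneg ha₀.le (sub_nonneg.2 hθ.2))
      (mul_nonneg ha₁.le hθ.1), ha]
    congr 1; ring
  have pY : Y ^ b = Y ^ (b₀ * (1 - θ)) * Y ^ (b₁ * θ) := by
    rw [← Real.rpow_add_of_nonneg hY0 (mul_nonneg hb₀.le (sub_nonneg.2 hθ.2))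
      (mul_nonneg hb₁.le hθ.1), hb]
    congr 1; ring
  rw [pX, pY]; ring

/-- Two-fold interpolation between three vertices. -/
theorem BilinBound.interpolate₃ {a₀ b₀ A₀ a₁ b₁ A₁ a₂ b₂ A₂ u v w : ℝ} (hm : ∀ i ∈ s, 0 ≤ m i)
    (hn : ∀ k ∈ t, 0 ≤ n k) (ha₀ : 0 < a₀) (hb₀ : 0 < b₀) (ha₁ : 0 < a₁) (hb₁ : 0 < b₁)
    (ha₂ : 0 < a₂) (hb₂ : 0 < b₂) (hA₀ : 0 ≤ A₀) (hA₁ : 0 ≤ A₁) (hA₂ : 0 ≤ A₂)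
    (h₀ : BilinBound s t M m n a₀ b₀ A₀) (h₁ : BilinBound s t M m n a₁ b₁ A₁)
    (h₂ : BilinBound s t M m n a₂ b₂ A₂) (hu : 0 ≤ u) (hv : 0 ≤ v) (hw : 0 ≤ w)
    (huvw : u + v + w = 1) :
    BilinBound s t M m n (u * a₀ + v * a₁ + w * a₂) (u * b₀ + v * b₁ + w * b₂)
      (A₀ ^ u * A₁ ^ v * A₂ ^ w) := by
  rcases eq_or_lt_of_le (add_nonneg hu hv) with h | h
  · have hu0 : u = 0 := by linarith
    have hv0 : v = 0 := by linarith
    have hw1 : w = 1 := by linarith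
    simpa [hu0, hv0, hw1] using h₂
  have hθ : v / (u + v) ∈ Icc (0 : ℝ) 1 := ⟨by positivity, div_le_one_of_le₀ (by linarith) h.le⟩
  have e : 1 - v / (u + v) = u / (u + v) := by field_simp; ring
  have k1 := h₀.interpolate hm hn ha₀ hb₀ ha₁ hb₁ hA₀ hA₁ h₁ hθ
  rw [e] at k1
  have pos : ∀ {c d : ℝ}, 0 < c → 0 < d → 0 < u / (u + v) * c + v / (u + v) * d := by
    intro c d hc hd
    have : u / (u + v) * c + v / (u + v) * d = (u * c + v * d) / (u + v) := by field_simp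
    rw [this]
    refine div_pos ?_ h
    rcases eq_or_lt_of_le hu with h' | h'
    · have : 0 < v := by linarith
      rw [← h']; nlinarith
    · have := mul_nonneg hv hd.le
      nlinarith
  have k2 := k1.interpolate hm hn (pos ha₀ ha₁) (pos hb₀ hb₁) ha₂ hb₂ (by positivity) hA₂ h₂
    (θ := w) ⟨hw, by linarith⟩
  have e2 : 1 - w = u + v := by linarith
  rw [e2] at k2
  have ex : ∀ c d e : ℝ, (u + v) * (u / (u + v) * c + v / (u + v) * d) + w * e =
      u * c + v * d + w * e := fun c d e => by field_simp
  rw [ex, ex, Real.mul_rpow (by positivity) (by positivity), ← Real.rpow_mul hA₀,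
    ← Real.rpow_mul hA₁, div_mul_cancel₀ _ h.ne', div_mul_cancel₀ _ h.ne'] at k2
  exact k2

end

section
variable {X Y : Type*} [MeasurableSpace X] [MeasurableSpace Y]

/-- The bilinear form of `U` is bounded on `L^{1/a} × L^{1/b}`. -/
def DualBound (μ : Measure X) (ν : Measure Y) (U : (X → ℂ) → Y → ℂ) (a b A : ℝ) : Prop :=
  ∀ F : X → ℂ, Integrable F μ → Measurable F → (∃ m, ∀ x, ‖F x‖ ≤ m) → ∀ G : Y → ℂ, Measurable G →
    ∫⁻ y, ‖U F y‖ₑ * ‖G y‖ₑ ∂ν ≤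
      ENNReal.ofReal A * (∫⁻ x, ‖F x‖ₑ ^ (1 / a) ∂μ) ^ a * (∫⁻ y, ‖G y‖ₑ ^ (1 / b) ∂ν) ^ b

theorem lintegral_enorm_sum_rpow_le {ι : Type*} {s : Finset ι} {μ : Measure X} {r c : ℝ}
    (hr : 0 < r) (hc : 0 ≤ c) {A : ι → Set X} (hA : ∀ i ∈ s, MeasurableSet (A i))
    (hfin : ∀ i ∈ s, μ (A i) ≠ ∞)
    (hd : ∀ i ∈ s, ∀ j ∈ s, i ≠ j → Disjoint (A i) (A j)) {φ : ι → X → ℂ}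
    (hφ : ∀ i ∈ s, ∀ z, ‖φ i z‖ ≤ (A i).indicator (fun _ => c) z) (x : ι → ℂ) :
    ∫⁻ z, ‖∑ i ∈ s, x i * φ i z‖ₑ ^ r ∂μ ≤
      ENNReal.ofReal (c ^ r * ∑ i ∈ s, ‖x i‖ ^ r * μ.real (A i)) := by
  have h0 : ∀ i ∈ s, ∀ z, z ∉ A i → φ i z = 0 := by
    intro i hi z hz
    have := hφ i hi z
    rw [indicator_of_notMem hz] at this
    exact norm_le_zero_iff.1 this
  calc ∫⁻ z, ‖∑ i ∈ s, x i * φ i z‖ₑ ^ r ∂μ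
      ≤ ∫⁻ z, ∑ i ∈ s, (A i).indicator (fun _ => ENNReal.ofReal (c ^ r * ‖x i‖ ^ r)) z ∂μ := by
        refine lintegral_mono fun z => ?_
        by_cases h : ∃ i ∈ s, z ∈ A i
        · obtain ⟨i, hi, hz⟩ := h
          rw [Finset.sum_eq_single_of_mem i hi fun j hj hji => by
            rw [h0 j hj z fun hzj => (disjoint_left.1 (hd j hj i hi hji)) hzj hz, mul_zero]]
          refine le_trans ?_ (Finset.single_le_sum (f := fun i => (A i).indicator
            (fun _ => ENNReal.ofReal (c ^ r * ‖x i‖ ^ r)) z) (fun _ _ => zero_le) hi)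
          simp only [indicator_of_mem hz]
          have h1 := hφ i hi z
          rw [indicator_of_mem hz] at h1
          rw [← ofReal_norm, ENNReal.ofReal_rpow_of_nonneg (norm_nonneg _) hr.le, norm_mul,
            Real.mul_rpow (norm_nonneg _) (norm_nonneg _), mul_comm]
          gcongr
        · push Not at h
          rw [Finset.sum_eq_zero fun i hi => by rw [h0 i hi z (h i hi), mul_zero]]
          simp [hr]
    _ = ∑ i ∈ s, ENNReal.ofReal (c ^ r * ‖x i‖ ^ r) * μ (A i) := by
        rw [lintegral_finsetSum' _ fun i hi => (measurable_const.indicator (hA i hi)).aemeasurable]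
        exact Finset.sum_congr rfl fun i hi => lintegral_indicator_const (hA i hi) _
    _ = _ := by
        rw [Finset.mul_sum, ENNReal.ofReal_sum_of_nonneg fun i _ => by positivity]
        refine Finset.sum_congr rfl fun i hi => ?_
        rw [← mul_assoc, ENNReal.ofReal_mul (p := c ^ r * ‖x i‖ ^ r) (by positivity), Measure.real,
          ENNReal.ofReal_toReal (hfin i hi)]

variable {μ : Measure X} {ν : Measure Y} {U : (X → ℂ) → Y → ℂ}

/-- The pairings of a dual bound with functions bounded on sets of finite measure converge. -/
theorem DualBound.integrable_mul {a b A : ℝ} (h : DualBound μ ν U a b A) (ha : 0 < a) (hb : 0 < b)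
    {φ : X → ℂ} {ψ : Y → ℂ} {A' : Set X} {B' : Set Y} (hφm : Measurable φ) (hψm : Measurable ψ)
    (hUm : Measurable (U φ)) (hA : MeasurableSet A') (hAfin : μ A' ≠ ∞)
    (hφ : ∀ z, ‖φ z‖ ≤ A'.indicator (fun _ => 2) z) (hB : MeasurableSet B') (hBfin : ν B' ≠ ∞)
    (hψ : ∀ z, ‖ψ z‖ ≤ B'.indicator (fun _ => 1) z) : Integrable (fun z => U φ z * ψ z) ν := by
  refine ⟨(hUm.mul hψm).aestronglyMeasurable, ?_⟩
  have h1 := h φ (((integrable_indicator_iff hA).2 (integrableOn_const hAfin)).mono'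
    hφm.aestronglyMeasurable (Filter.Eventually.of_forall hφ)) hφm ⟨2, fun z => (hφ z).trans
      (indicator_apply_le' (fun _ => le_rfl) fun _ => by norm_num)⟩ ψ hψm
  have n1 := lintegral_enorm_sum_rpow_le (s := {0}) (r := 1 / a) (μ := μ) (A := fun _ => A')
    (φ := fun _ => φ) (by positivity) zero_le_two (by simpa using hA) (by simpa using hAfin)
    (by simp) (by simpa using hφ) 1
  have n2 := lintegral_enorm_sum_rpow_le (s := {0}) (r := 1 / b) (μ := ν) (A := fun _ => B')
    (φ := fun _ => ψ) (by positivity) zero_le_one (by simpa using hB) (by simpa using hBfin)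
    (by simp) (by simpa using hψ) 1
  simp only [Finset.sum_singleton, Pi.one_apply, one_mul] at n1 n2
  simp only [HasFiniteIntegral, enorm_mul]
  refine h1.trans_lt (ENNReal.mul_lt_top (ENNReal.mul_lt_top ENNReal.ofReal_lt_top ?_) ?_)
  · exact ENNReal.rpow_lt_top_of_nonneg ha.le (n1.trans_lt ENNReal.ofReal_lt_top).ne
  · exact ENNReal.rpow_lt_top_of_nonneg hb.le (n2.trans_lt ENNReal.ofReal_lt_top).ne

theorem DualBound.bilinBound {a b A : ℝ} (h : DualBound μ ν U a b A) (ha : 0 < a) (hb : 0 < b)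
    (hA0 : 0 ≤ A) {s t : Finset ℤ} {φ : ℤ → X → ℂ} {ψ : ℤ → Y → ℂ} {A' : ℤ → Set X}
    {B' : ℤ → Set Y} (hφm : ∀ i, Measurable (φ i)) (hψm : ∀ i, Measurable (ψ i))
    (hUm : ∀ i, Measurable (U (φ i)))
    (hA : ∀ i ∈ s, MeasurableSet (A' i)) (hAfin : ∀ i ∈ s, μ (A' i) ≠ ∞)
    (hAd : ∀ i ∈ s, ∀ j ∈ s, i ≠ j → Disjoint (A' i) (A' j))
    (hφ : ∀ i ∈ s, ∀ z, ‖φ i z‖ ≤ (A' i).indicator (fun _ => 2) z)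
    (hB : ∀ i ∈ t, MeasurableSet (B' i)) (hBfin : ∀ i ∈ t, ν (B' i) ≠ ∞)
    (hBd : ∀ i ∈ t, ∀ j ∈ t, i ≠ j → Disjoint (B' i) (B' j))
    (hψ : ∀ i ∈ t, ∀ z, ‖ψ i z‖ ≤ (B' i).indicator (fun _ => 1) z)
    (hlin : ∀ x : ℤ → ℂ, U (fun z => ∑ i ∈ s, x i * φ i z) = fun y => ∑ i ∈ s, x i * U (φ i) y) :
    BilinBound s t (fun i k => ∫ y, U (φ i) y * ψ k y ∂ν) (fun i => μ.real (A' i))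
      (fun k => ν.real (B' k)) a b (2 * A) := by
  have hbd : ∀ i ∈ s, ∀ z, ‖φ i z‖ ≤ 2 := fun i hi z => (hφ i hi z).trans
    (indicator_apply_le' (fun _ => le_rfl) fun _ => by norm_num)
  have hφi : ∀ i ∈ s, Integrable (φ i) μ := fun i hi =>
    ((integrable_indicator_iff (hA i hi)).2 (integrableOn_const (hAfin i hi))).mono'
      (hφm i).aestronglyMeasurable (Filter.Eventually.of_forall (hφ i hi))
  intro x y
  set F : X → ℂ := fun z => ∑ i ∈ s, x i * φ i z with hF
  set G : Y → ℂ := fun z => ∑ k ∈ t, y k * ψ k z with hG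
  have hGm : Measurable G := Finset.measurable_fun_sum _ fun k _ => (hψm k).const_mul _
  have hFm : Measurable F := Finset.measurable_fun_sum _ fun k _ => (hφm k).const_mul _
  have hFi : Integrable F μ := integrable_finsetSum _ fun i hi => (hφi i hi).const_mul _
  have hFb : ∃ m, ∀ z, ‖F z‖ ≤ m := ⟨∑ i ∈ s, ‖x i‖ * 2, fun z => (norm_sum_le _ _).trans
    (Finset.sum_le_sum fun i hi => by
      rw [norm_mul]; exact mul_le_mul_of_nonneg_left (hbd i hi z) (norm_nonneg _))⟩
  have hN := lintegral_enorm_sum_rpow_le (r := 1 / a) (by positivity) zero_le_two hA hAfin hAd hφ x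
  have hN' := lintegral_enorm_sum_rpow_le (r := 1 / b) (by positivity) zero_le_one hB hBfin hBd hψ y
  have hInt : ∀ i ∈ s, ∀ k ∈ t, Integrable (fun z => U (φ i) z * ψ k z) ν := fun i hi k hk =>
    h.integrable_mul ha hb (hφm i) (hψm k) (hUm i) (hA i hi) (hAfin i hi) (hφ i hi) (hB k hk)
      (hBfin k hk) (hψ k hk)
  have e : ∑ i ∈ s, ∑ k ∈ t, x i * y k * ∫ z, U (φ i) z * ψ k z ∂ν = ∫ z, U F z * G z ∂ν := by
    rw [hlin x]
    simp only [hG, Finset.sum_mul_sum]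
    rw [integral_finsetSum _ fun i hi => integrable_finsetSum _ fun k hk => by
      have := (hInt i hi k hk).const_mul (x i * y k)
      refine this.congr (Filter.Eventually.of_forall fun z => ?_)
      simp only; ring]
    refine Finset.sum_congr rfl fun i hi => ?_
    rw [integral_finsetSum _ fun k hk => by
      have := (hInt i hi k hk).const_mul (x i * y k)
      refine this.congr (Filter.Eventually.of_forall fun z => ?_)
      simp only; ring]
    refine Finset.sum_congr rfl fun k hk => ?_
    rw [← integral_const_mul]
    congr 1 with z
    ring
  rw [e]
  have h1 := h F hFi hFm hFb G hGm
  have hX0 : 0 ≤ ∑ i ∈ s, ‖x i‖ ^ (1 / a) * μ.real (A' i) :=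
    Finset.sum_nonneg fun i _ => by positivity
  have hY0 : 0 ≤ ∑ i ∈ t, ‖y i‖ ^ (1 / b) * ν.real (B' i) :=
    Finset.sum_nonneg fun i _ => by positivity
  have h2 : ENNReal.ofReal ‖∫ z, U F z * G z ∂ν‖ ≤ ENNReal.ofReal (2 * A *
      (∑ i ∈ s, ‖x i‖ ^ (1 / a) * μ.real (A' i)) ^ a *
      (∑ i ∈ t, ‖y i‖ ^ (1 / b) * ν.real (B' i)) ^ b) := by
    rw [ofReal_norm]
    refine (enorm_integral_le_lintegral_enorm _).trans ?_
    simp only [enorm_mul]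
    refine h1.trans ((mul_le_mul' (mul_le_mul' le_rfl (ENNReal.rpow_le_rpow hN ha.le))
      (ENNReal.rpow_le_rpow hN' hb.le)).trans (le_of_eq ?_))
    rw [ENNReal.ofReal_rpow_of_nonneg (by positivity) ha.le,
      ENNReal.ofReal_rpow_of_nonneg (by positivity) hb.le, ← ENNReal.ofReal_mul hA0,
      ← ENNReal.ofReal_mul (by positivity), Real.mul_rpow (by positivity) hX0,
      Real.mul_rpow (by positivity) hY0, ← Real.rpow_mul zero_le_two, one_div_mul_cancel ha.ne']
    simp only [Real.one_rpow, Real.rpow_one, one_mul]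
    congr 1
    ring
  exact (ENNReal.ofReal_le_ofReal_iff (by positivity)).1 h2

/-- The part of the domain where `f` has size comparable to `2 ^ i`. -/
def dyadicSet (f : X → ℂ) (i : ℤ) : Set X := {z | ‖f z‖ ∈ Ico ((2 : ℝ) ^ i) (2 ^ (i + 1))}

theorem measurableSet_dyadicSet {f : X → ℂ} (hf : Measurable f) (i : ℤ) :
    MeasurableSet (dyadicSet f i) := hf.norm measurableSet_Ico

theorem disjoint_dyadicSet {Z : Type*} (f : Z → ℂ) {i j : ℤ} (h : i ≠ j) :
    Disjoint (dyadicSet f i) (dyadicSet f j) := by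
  rw [disjoint_left]
  intro z hi hj
  have h1 : (2 : ℝ) ^ i < 2 ^ (j + 1) := hi.1.trans_lt hj.2
  have h2 : (2 : ℝ) ^ j < 2 ^ (i + 1) := hj.1.trans_lt hi.2
  rw [zpow_lt_zpow_iff_right₀ one_lt_two] at h1 h2
  omega

theorem exists_mem_dyadicSet {Z : Type*} {f : Z → ℂ} {z : Z} (h : f z ≠ 0) : ∃ i, z ∈ dyadicSet f i :=
  exists_mem_Ico_zpow (norm_pos_iff.2 h) one_lt_two

theorem measure_dyadicSet_ne_top {f : X → ℂ} (hf : Integrable f μ) (i : ℤ) :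
    μ (dyadicSet f i) ≠ ∞ :=
  ((measure_mono fun _ hz => hz.1).trans_lt
    (hf.measure_norm_ge_lt_top (zpow_pos two_pos i))).ne

end

section
variable {X Y : Type*} [MeasurableSpace X] [MeasurableSpace Y]
  {μ : Measure X} {ν : Measure Y} {U : (X → ℂ) → Y → ℂ}

theorem rpow_le_of_le_mul_rpow {J P A a q : ℝ} (hq : 1 < q) (hJ : 0 ≤ J) (hP : 0 ≤ P) (hA : 0 ≤ A)
    (h : J ≤ A * P ^ a * J ^ (1 - 1 / q)) : J ≤ (A * P ^ a) ^ q := by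
  rcases eq_or_lt_of_le hJ with h0 | h0
  · rw [← h0]; positivity
  have hq0 : 0 < q := by linarith
  have h1 : J ^ (1 / q) ≤ A * P ^ a := by
    have e : J = J ^ (1 / q) * J ^ (1 - 1 / q) := by
      rw [← Real.rpow_add h0]; simp
    refine le_of_mul_le_mul_right (a := J ^ (1 - 1 / q)) ?_ (by positivity)
    rw [← e]; exact h
  calc J = (J ^ (1 / q)) ^ q := by rw [← Real.rpow_mul hJ, one_div_mul_cancel hq0.ne', Real.rpow_one]
    _ ≤ _ := by gcongr

/-- The truncation of `F` to finitely many dyadic sizes. -/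
def dyadicTrunc (s : Finset ℤ) (F : X → ℂ) (z : X) : ℂ :=
  ∑ i ∈ s, ((2 : ℝ) ^ i : ℂ) * (dyadicSet F i).indicator (fun z => F z / ((2 : ℝ) ^ i : ℂ)) z

theorem dyadicTrunc_eq {Z : Type*} (s : Finset ℤ) (F : Z → ℂ) (z : Z) :
    dyadicTrunc s F z = (⋃ i ∈ s, dyadicSet F i).indicator F z := by
  have e : ∀ i : ℤ, ((2 : ℝ) ^ i : ℂ) * (dyadicSet F i).indicator
      (fun z => F z / ((2 : ℝ) ^ i : ℂ)) z = (dyadicSet F i).indicator F z := by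
    intro i
    by_cases h : z ∈ dyadicSet F i
    · rw [indicator_of_mem h, indicator_of_mem h, mul_div_cancel₀]
      exact zpow_ne_zero _ (by norm_num)
    · rw [indicator_of_notMem h, indicator_of_notMem h, mul_zero]
  unfold dyadicTrunc
  simp only [e]
  rw [Finset.indicator_biUnion_apply]
  exact fun i _ j _ hij => disjoint_dyadicSet F hij

theorem lintegral_rpow_dyadic_le {g : Y → ℂ} (hg : Measurable g) {q : ℝ} (hq : 0 < q) {D : ℝ≥0∞}
    (h : ∀ t : Finset ℤ, ∑ k ∈ t, ENNReal.ofReal (((2 : ℝ) ^ k) ^ q) * ν (dyadicSet g k) ≤ D) :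
    ∫⁻ y, ‖g y‖ₑ ^ q ∂ν ≤ ENNReal.ofReal (2 ^ q) * D := by
  have hpt : ∀ y, ‖g y‖ₑ ^ q ≤ ∑' k : ℤ, (dyadicSet g k).indicator
      (fun _ => ENNReal.ofReal (2 ^ q) * ENNReal.ofReal (((2 : ℝ) ^ k) ^ q)) y := by
    intro y
    by_cases hy : g y = 0
    · simp [hy, hq]
    obtain ⟨k, hk⟩ := exists_mem_dyadicSet hy
    refine le_trans ?_ (ENNReal.le_tsum k)
    rw [indicator_of_mem hk, ← ENNReal.ofReal_mul (by positivity), ← Real.mul_rpow (by positivity)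
      (by positivity), ← ofReal_norm, ENNReal.ofReal_rpow_of_nonneg (norm_nonneg _) hq.le]
    have h2 := hk.2.le
    rw [zpow_add_one₀ two_ne_zero, mul_comm] at h2
    gcongr
  refine (lintegral_mono hpt).trans ?_
  rw [lintegral_tsum fun k => (measurable_const.indicator (measurableSet_dyadicSet hg k)).aemeasurable]
  simp only [lintegral_indicator_const (measurableSet_dyadicSet hg _), mul_assoc]
  rw [ENNReal.tsum_mul_left]
  gcongr
  rw [ENNReal.tsum_eq_iSup_sum]
  exact iSup_le h

/-- Interpolation of three bounds for an operator, on a dyadically truncated function. -/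
theorem lintegral_rpow_dyadicTrunc_le {a₀ b₀ A₀ a₁ b₁ A₁ a₂ b₂ A₂ u v w q : ℝ}
    (h₀ : DualBound μ ν U a₀ b₀ A₀) (h₁ : DualBound μ ν U a₁ b₁ A₁) (h₂ : DualBound μ ν U a₂ b₂ A₂)
    (ha₀ : 0 < a₀) (hb₀ : 0 < b₀) (ha₁ : 0 < a₁) (hb₁ : 0 < b₁)
    (ha₂ : 0 < a₂) (hb₂ : 0 < b₂) (hA₀ : 0 ≤ A₀) (hA₁ : 0 ≤ A₁) (hA₂ : 0 ≤ A₂)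
    (hu : 0 ≤ u) (hv : 0 ≤ v) (hw : 0 ≤ w) (huvw : u + v + w = 1) (hq : 1 < q)
    (hb : u * b₀ + v * b₁ + w * b₂ = 1 - 1 / q)
    (hlin : ∀ (s : Finset ℤ) (φ : ℤ → X → ℂ) (x : ℤ → ℂ), (∀ i ∈ s, Integrable (φ i) μ) →
      U (fun z => ∑ i ∈ s, x i * φ i z) = fun y => ∑ i ∈ s, x i * U (φ i) y)
    (hmeas : ∀ F, Integrable F μ → Measurable (U F))
    (hfin : ∀ F, Integrable F μ → Measurable F → (∃ m, ∀ x, ‖F x‖ ≤ m) →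
      ∀ k : ℤ, ν (dyadicSet (U F) k) ≠ ∞)
    {F : X → ℂ} (hF : Integrable F μ) (hFm : Measurable F) (s : Finset ℤ) :
    ∫⁻ y, ‖U (dyadicTrunc s F) y‖ₑ ^ q ∂ν ≤
      ENNReal.ofReal (2 ^ q * (2 * A₀) ^ (u * q) * (2 * A₁) ^ (v * q) * (2 * A₂) ^ (w * q)) *
        (∫⁻ x, ‖F x‖ₑ ^ (1 / (u * a₀ + v * a₁ + w * a₂)) ∂μ) ^ ((u * a₀ + v * a₁ + w * a₂) * q) := by
  have hq0 : 0 < q := by linarith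
  set a := u * a₀ + v * a₁ + w * a₂ with ha
  set A := (2 * A₀) ^ u * (2 * A₁) ^ v * (2 * A₂) ^ w with hA
  have ha' : 0 < a := by
    rcases eq_or_lt_of_le hu with h | h
    · rcases eq_or_lt_of_le hv with h' | h'
      · have : w = 1 := by linarith
        rw [ha, ← h, ← h', this]; simpa using ha₂
      · rw [ha]; have := mul_pos h' ha₁; positivity
    · rw [ha]; have := mul_pos h ha₀; positivity
  set φ : ℤ → X → ℂ := fun i => (dyadicSet F i).indicator fun z => F z / ((2 : ℝ) ^ i : ℂ) with hφ
  have hφm : ∀ i, Measurable (φ i) := fun i =>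
    (hFm.div_const _).indicator (measurableSet_dyadicSet hFm i)
  have hφi : ∀ i, Integrable (φ i) μ := fun i =>
    (hF.div_const _).indicator (measurableSet_dyadicSet hFm i)
  have h2n : ∀ i : ℤ, ‖((2 : ℝ) ^ i : ℂ)‖ = 2 ^ i := fun i => by
    rw [norm_zpow, Complex.norm_real, Real.norm_of_nonneg zero_le_two]
  have hφb : ∀ i z, ‖φ i z‖ ≤ (dyadicSet F i).indicator (fun _ => 2) z := by
    intro i z
    by_cases hz : z ∈ dyadicSet F i
    · rw [hφ]
      simp only [indicator_of_mem hz]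
      rw [norm_div, h2n, div_le_iff₀ (by positivity)]
      have := hz.2.le
      rwa [zpow_add_one₀ two_ne_zero, mul_comm] at this
    · rw [hφ]
      simp only [indicator_of_notMem hz, norm_zero, le_refl]
  set g := U (dyadicTrunc s F) with hg
  have hTm : Measurable (dyadicTrunc s F) :=
    Finset.measurable_fun_sum _ fun i _ => (hφm i).const_mul _
  have hTi : Integrable (dyadicTrunc s F) μ :=
    integrable_finsetSum _ fun i _ => (hφi i).const_mul _
  have hTb : ∃ m, ∀ z, ‖dyadicTrunc s F z‖ ≤ m := ⟨∑ i ∈ s, 2 ^ i * 2, fun z =>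
    (norm_sum_le _ _).trans (Finset.sum_le_sum fun i _ => by
      rw [norm_mul, h2n]
      refine mul_le_mul_of_nonneg_left ((hφb i z).trans ?_) (by positivity)
      exact indicator_apply_le' (fun _ => le_rfl) fun _ => by norm_num)⟩
  have hgm : Measurable g := hmeas _ hTi
  have hgl : g = fun y => ∑ i ∈ s, ((2 : ℝ) ^ i : ℂ) * U (φ i) y :=
    hlin s φ (fun i => ((2 : ℝ) ^ i : ℂ)) fun i _ => hφi i
  have hgfin := hfin _ hTi hTm hTb
  set ψ : ℤ → Y → ℂ := fun k => (dyadicSet g k).indicator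
    fun y => starRingEnd ℂ (g y) / (‖g y‖ : ℂ) with hψ
  have hψm : ∀ k, Measurable (ψ k) := fun k =>
    ((Complex.continuous_conj.measurable.comp hgm).div
      (Complex.measurable_ofReal.comp hgm.norm)).indicator (measurableSet_dyadicSet hgm k)
  have hψb : ∀ k y, ‖ψ k y‖ ≤ (dyadicSet g k).indicator (fun _ => 1) y := by
    intro k y
    by_cases hz : y ∈ dyadicSet g k
    · rw [hψ]
      simp only [indicator_of_mem hz]
      rw [norm_div, RCLike.norm_conj, Complex.norm_real, norm_norm]
      exact div_self_le_one _
    · rw [hψ]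
      simp only [indicator_of_notMem hz, norm_zero, le_refl]
  set P := ∑ i ∈ s, ‖((2 : ℝ) ^ i : ℂ)‖ ^ (1 / a) * μ.real (dyadicSet F i) with hP
  have hP0 : 0 ≤ P := Finset.sum_nonneg fun i _ => by positivity
  have key : ∀ t : Finset ℤ, ∑ k ∈ t, ((2 : ℝ) ^ k) ^ q * ν.real (dyadicSet g k) ≤
      (A * P ^ a) ^ q := by
    intro t
    have B : ∀ {a' b' A' : ℝ}, DualBound μ ν U a' b' A' → 0 < a' → 0 < b' → 0 ≤ A' →
        BilinBound s t (fun i k => ∫ y, U (φ i) y * ψ k y ∂ν) (fun i => μ.real (dyadicSet F i))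
          (fun k => ν.real (dyadicSet g k)) a' b' (2 * A') := fun h p1 p2 p3 =>
      h.bilinBound p1 p2 p3 hφm hψm (fun i => hmeas _ (hφi i))
        (fun i _ => measurableSet_dyadicSet hFm i) (fun i _ => measure_dyadicSet_ne_top hF i)
        (fun i _ j _ hij => disjoint_dyadicSet F hij) (fun i _ => hφb i)
        (fun i _ => measurableSet_dyadicSet hgm i) (fun i _ => hgfin i)
        (fun i _ j _ hij => disjoint_dyadicSet g hij) (fun i _ => hψb i)
        fun x => hlin s φ x fun i _ => hφi i
    have hI := (B h₀ ha₀ hb₀ hA₀).interpolate₃ (fun _ _ => measureReal_nonneg)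
      (fun _ _ => measureReal_nonneg) ha₀ hb₀ ha₁ hb₁ ha₂ hb₂ (by positivity) (by positivity)
      (by positivity) (B h₁ ha₁ hb₁ hA₁) (B h₂ ha₂ hb₂ hA₂) hu hv hw huvw
      (fun i => ((2 : ℝ) ^ i : ℂ)) (fun k => ((((2 : ℝ) ^ k) ^ (q - 1) : ℝ) : ℂ))
    rw [hb, ← ha, ← hA, ← hP] at hI
    set J := ∑ k ∈ t, ((2 : ℝ) ^ k) ^ q * ν.real (dyadicSet g k) with hJ
    have hJ0 : 0 ≤ J := Finset.sum_nonneg fun i _ => by positivity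
    have eJ : ∑ k ∈ t, ‖((((2 : ℝ) ^ k) ^ (q - 1) : ℝ) : ℂ)‖ ^ (1 / (1 - 1 / q)) *
        ν.real (dyadicSet g k) = J := by
      refine Finset.sum_congr rfl fun k _ => ?_
      rw [Complex.norm_real, Real.norm_of_nonneg (by positivity), ← Real.rpow_mul (by positivity)]
      congr 2
      have : q - 1 ≠ 0 := by linarith
      field_simp
    rw [eJ] at hI
    refine rpow_le_of_le_mul_rpow hq hJ0 hP0 (by positivity) (le_trans ?_ hI)
    have hgi : ∀ k, ∫ y, g y * ψ k y ∂ν = ((∫ y in dyadicSet g k, ‖g y‖ ∂ν : ℝ) : ℂ) := by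
      intro k
      rw [← integral_complex_ofReal, ← integral_indicator (measurableSet_dyadicSet hgm k)]
      congr 1 with y
      by_cases hz : y ∈ dyadicSet g k
      · rw [hψ]
        simp only [indicator_of_mem hz]
        have h0 : (‖g y‖ : ℂ) ≠ 0 := by
          have h3 : (0 : ℝ) < ‖g y‖ := lt_of_lt_of_le (by positivity) hz.1
          exact_mod_cast h3.ne'
        rw [mul_div_assoc', Complex.mul_conj, Complex.normSq_eq_norm_sq, div_eq_iff h0]
        push_cast; ring
      · rw [hψ]
        simp only [indicator_of_notMem hz, mul_zero]
    have hUψ : ∀ i ∈ s, ∀ k ∈ t, Integrable (fun y => U (φ i) y * ψ k y) ν :=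
      fun i _ k _ => h₀.integrable_mul ha₀ hb₀ (hφm i) (hψm k) (hmeas _ (hφi i))
        (measurableSet_dyadicSet hFm i) (measure_dyadicSet_ne_top hF i) (hφb i)
        (measurableSet_dyadicSet hgm k) (hgfin k) (hψb k)
    have eS : ∑ i ∈ s, ∑ k ∈ t, ((2 : ℝ) ^ i : ℂ) * ((((2 : ℝ) ^ k) ^ (q - 1) : ℝ) : ℂ) *
        (∫ y, U (φ i) y * ψ k y ∂ν) = ((∑ k ∈ t, ((2 : ℝ) ^ k) ^ (q - 1) *
          ∫ y in dyadicSet g k, ‖g y‖ ∂ν : ℝ) : ℂ) := by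
      rw [Finset.sum_comm, Complex.ofReal_sum]
      refine Finset.sum_congr rfl fun k hk => ?_
      rw [Complex.ofReal_mul, ← hgi, hgl]
      simp only [Finset.sum_mul, mul_assoc]
      rw [integral_finsetSum _ fun i hi => (hUψ i hi k hk).const_mul _, Finset.mul_sum]
      refine Finset.sum_congr rfl fun i hi => ?_
      rw [integral_const_mul]; ring
    rw [eS, Complex.norm_real]
    refine le_trans ?_ (le_abs_self _)
    refine Finset.sum_le_sum fun k _ => ?_
    have : (2 : ℝ) ^ k * ν.real (dyadicSet g k) ≤ ∫ y in dyadicSet g k, ‖g y‖ ∂ν := by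
      have h1 := setIntegral_ge_of_const_le_real (μ := ν) (measurableSet_dyadicSet hgm k) (hgfin k)
        (f := fun y => ‖g y‖) (c := 2 ^ k) (fun y hy => hy.1) (by
          refine Measure.integrableOn_of_bounded (M := 2 ^ (k + 1)) (hgfin k) hgm.norm.aestronglyMeasurable ?_
          refine (ae_restrict_iff' (measurableSet_dyadicSet hgm k)).2 (Filter.Eventually.of_forall fun y hy => ?_)
          rw [norm_norm]; exact hy.2.le)
      exact h1
    calc ((2 : ℝ) ^ k) ^ q * ν.real (dyadicSet g k)
        = ((2 : ℝ) ^ k) ^ (q - 1) * ((2 : ℝ) ^ k * ν.real (dyadicSet g k)) := by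
          rw [Real.rpow_sub_one (by positivity)]; field_simp
      _ ≤ _ := by gcongr
  refine (lintegral_rpow_dyadic_le hgm hq0 (D := ENNReal.ofReal ((A * P ^ a) ^ q)) ?_).trans ?_
  · intro t
    refine le_trans (le_of_eq ?_) (ENNReal.ofReal_le_ofReal (key t))
    rw [ENNReal.ofReal_sum_of_nonneg fun i _ => by positivity]
    refine Finset.sum_congr rfl fun k _ => ?_
    rw [ENNReal.ofReal_mul (by positivity), Measure.real, ENNReal.ofReal_toReal (hgfin k)]
  · have hPle : ENNReal.ofReal P ≤ ∫⁻ x, ‖F x‖ₑ ^ (1 / a) ∂μ := by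
      rw [hP, ENNReal.ofReal_sum_of_nonneg fun i _ => by positivity]
      calc ∑ i ∈ s, ENNReal.ofReal (‖((2 : ℝ) ^ i : ℂ)‖ ^ (1 / a) * μ.real (dyadicSet F i))
          = ∫⁻ z, ∑ i ∈ s, (dyadicSet F i).indicator
              (fun _ => ENNReal.ofReal (((2 : ℝ) ^ i) ^ (1 / a))) z ∂μ := by
            rw [lintegral_finsetSum' _ fun i _ =>
              (measurable_const.indicator (measurableSet_dyadicSet hFm i)).aemeasurable]
            refine Finset.sum_congr rfl fun i _ => ?_
            rw [lintegral_indicator_const (measurableSet_dyadicSet hFm i), h2n,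
              ENNReal.ofReal_mul (by positivity), Measure.real,
              ENNReal.ofReal_toReal (measure_dyadicSet_ne_top hF i)]
        _ ≤ ∫⁻ x, ‖F x‖ₑ ^ (1 / a) ∂μ := by
            refine lintegral_mono fun z => ?_
            by_cases h : ∃ i ∈ s, z ∈ dyadicSet F i
            · obtain ⟨i, hi, hz⟩ := h
              rw [Finset.sum_eq_single_of_mem i hi fun j _ hji => by
                rw [indicator_of_notMem]
                exact fun hzj => disjoint_left.1 (disjoint_dyadicSet F hji) hzj hz]
              rw [indicator_of_mem hz, ← ofReal_norm,
                ENNReal.ofReal_rpow_of_nonneg (norm_nonneg _) (by positivity)]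
              refine ENNReal.ofReal_le_ofReal ?_
              exact Real.rpow_le_rpow (by positivity) hz.1 (by positivity)
            · push Not at h
              rw [Finset.sum_eq_zero fun i hi => indicator_of_notMem (h i hi) _]
              exact zero_le
    have e : ENNReal.ofReal ((A * P ^ a) ^ q) =
        ENNReal.ofReal (A ^ q) * (ENNReal.ofReal P) ^ (a * q) := by
      rw [Real.mul_rpow (by positivity) (by positivity), ENNReal.ofReal_mul (by positivity),
        ← Real.rpow_mul hP0, ENNReal.ofReal_rpow_of_nonneg hP0 (by positivity)]
    rw [e, ← mul_assoc, ← ENNReal.ofReal_mul (by positivity)]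
    have eA : 2 ^ q * A ^ q = 2 ^ q * (2 * A₀) ^ (u * q) * (2 * A₁) ^ (v * q) * (2 * A₂) ^ (w * q) := by
      rw [hA, Real.mul_rpow (by positivity) (by positivity),
        Real.mul_rpow (by positivity) (by positivity), ← Real.rpow_mul (by positivity),
        ← Real.rpow_mul (by positivity), ← Real.rpow_mul (by positivity)]
      ring
    rw [eA]
    gcongr


theorem tendsto_lintegral_dyadicTrunc {F : X → ℂ} (hF : Integrable F μ) (hFm : Measurable F) :
    Filter.Tendsto (fun n : ℕ => ∫⁻ x, ‖dyadicTrunc (Finset.Icc (-n : ℤ) n) F x - F x‖ₑ ∂μ)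
      Filter.atTop (nhds 0) := by
  have hm : ∀ n : ℕ, MeasurableSet (⋃ i ∈ Finset.Icc (-n : ℤ) n, dyadicSet F i) := fun n =>
    Finset.measurableSet_biUnion _ fun i _ => measurableSet_dyadicSet hFm i
  have hT : ∀ n : ℕ, dyadicTrunc (Finset.Icc (-n : ℤ) n) F =
      (⋃ i ∈ Finset.Icc (-n : ℤ) n, dyadicSet F i).indicator F := fun n =>
    funext fun z => dyadicTrunc_eq _ _ _
  simp only [hT]
  have h := tendsto_lintegral_of_dominated_convergence' (μ := μ) (fun x => ‖F x‖ₑ)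
    (F := fun (n : ℕ) x => ‖(⋃ i ∈ Finset.Icc (-n : ℤ) n, dyadicSet F i).indicator F x - F x‖ₑ)
    (f := fun _ => 0) (fun n => ((hFm.indicator (hm n)).sub hFm).enorm.aemeasurable)
    (fun n => Filter.Eventually.of_forall fun x => ?_) hF.hasFiniteIntegral.ne
    (Filter.Eventually.of_forall fun x => ?_)
  · simpa using h
  · rcases indicator_eq_zero_or_self (⋃ i ∈ Finset.Icc (-n : ℤ) n, dyadicSet F i) F x with h | h <;>
      simp only [h] <;> simp
  · refine tendsto_const_nhds.congr' ?_
    by_cases h0 : F x = 0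
    · exact Filter.Eventually.of_forall fun n => by
        rcases indicator_eq_zero_or_self (⋃ i ∈ Finset.Icc (-n : ℤ) n, dyadicSet F i) F x with h | h <;>
          simp only [h, h0] <;> simp
    · obtain ⟨i, hi⟩ := exists_mem_dyadicSet h0
      filter_upwards [Filter.eventually_ge_atTop i.natAbs] with n hn
      have hx : x ∈ ⋃ i ∈ Finset.Icc (-n : ℤ) n, dyadicSet F i :=
        mem_iUnion₂.2 ⟨i, Finset.mem_Icc.2 (by omega), hi⟩
      simp only [indicator_of_mem hx, sub_self, enorm_zero]

/-- Interpolation of three bounds for an operator which is continuous from `L¹` to `L^∞`. -/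
theorem DualBound.lintegral_rpow_le {a₀ b₀ A₀ a₁ b₁ A₁ a₂ b₂ A₂ u v w q : ℝ}
    (h₀ : DualBound μ ν U a₀ b₀ A₀) (h₁ : DualBound μ ν U a₁ b₁ A₁) (h₂ : DualBound μ ν U a₂ b₂ A₂)
    (ha₀ : 0 < a₀) (hb₀ : 0 < b₀) (ha₁ : 0 < a₁) (hb₁ : 0 < b₁)
    (ha₂ : 0 < a₂) (hb₂ : 0 < b₂) (hA₀ : 0 ≤ A₀) (hA₁ : 0 ≤ A₁) (hA₂ : 0 ≤ A₂)
    (hu : 0 ≤ u) (hv : 0 ≤ v) (hw : 0 ≤ w) (huvw : u + v + w = 1) (hq : 1 < q)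
    (hb : u * b₀ + v * b₁ + w * b₂ = 1 - 1 / q)
    (hlin : ∀ (s : Finset ℤ) (φ : ℤ → X → ℂ) (x : ℤ → ℂ), (∀ i ∈ s, Integrable (φ i) μ) →
      U (fun z => ∑ i ∈ s, x i * φ i z) = fun y => ∑ i ∈ s, x i * U (φ i) y)
    (hmeas : ∀ F, Integrable F μ → Measurable (U F))
    (hfin : ∀ F, Integrable F μ → Measurable F → (∃ m, ∀ x, ‖F x‖ ≤ m) →
      ∀ k : ℤ, ν (dyadicSet (U F) k) ≠ ∞) {K : ℝ≥0∞} (hK : K ≠ ∞)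
    (hL1 : ∀ F G, Integrable F μ → Integrable G μ → ∀ y, ‖U F y - U G y‖ₑ ≤ K * ∫⁻ x, ‖F x - G x‖ₑ ∂μ)
    {F : X → ℂ} (hF : Integrable F μ) (hFm : Measurable F) :
    ∫⁻ y, ‖U F y‖ₑ ^ q ∂ν ≤
      ENNReal.ofReal (2 ^ q * (2 * A₀) ^ (u * q) * (2 * A₁) ^ (v * q) * (2 * A₂) ^ (w * q)) *
        (∫⁻ x, ‖F x‖ₑ ^ (1 / (u * a₀ + v * a₁ + w * a₂)) ∂μ) ^ ((u * a₀ + v * a₁ + w * a₂) * q) := by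
  have hTi : ∀ s, Integrable (dyadicTrunc s F) μ := fun s =>
    integrable_finsetSum _ fun i _ =>
      ((hF.div_const _).indicator (measurableSet_dyadicSet hFm i)).const_mul _
  have hlim : ∀ y, Filter.Tendsto (fun n : ℕ => ‖U (dyadicTrunc (Finset.Icc (-n : ℤ) n) F) y‖ₑ ^ q)
      Filter.atTop (nhds (‖U F y‖ₑ ^ q)) := by
    intro y
    refine ((ENNReal.continuous_rpow_const.tendsto _).comp ?_)
    refine (continuous_enorm.tendsto _).comp ?_
    rw [tendsto_iff_edist_tendsto_0]
    refine tendsto_of_tendsto_of_tendsto_of_le_of_le tendsto_const_nhds ?_ (fun _ => zero_le)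
      (fun n => (edist_eq_enorm_sub _ _).trans_le (hL1 _ _ (hTi _) hF y))
    simpa using ENNReal.Tendsto.const_mul (tendsto_lintegral_dyadicTrunc hF hFm) (Or.inr hK)
  calc ∫⁻ y, ‖U F y‖ₑ ^ q ∂ν
      = ∫⁻ y, Filter.liminf (fun n : ℕ => ‖U (dyadicTrunc (Finset.Icc (-n : ℤ) n) F) y‖ₑ ^ q)
          Filter.atTop ∂ν := lintegral_congr fun y => (hlim y).liminf_eq.symm
    _ ≤ Filter.liminf (fun n : ℕ => ∫⁻ y, ‖U (dyadicTrunc (Finset.Icc (-n : ℤ) n) F) y‖ₑ ^ q ∂ν)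
          Filter.atTop := lintegral_liminf_le fun n => (hmeas _ (hTi _)).enorm.pow_const _
    _ ≤ _ := (Filter.liminf_le_liminf (Filter.Eventually.of_forall fun n =>
        lintegral_rpow_dyadicTrunc_le h₀ h₁ h₂ ha₀ hb₀ ha₁ hb₁ ha₂ hb₂ hA₀ hA₁ hA₂ hu hv hw huvw hq
          hb hlin hmeas hfin hF hFm _)).trans (Filter.liminf_const _).le

end

/-- The van der Corput estimate for a phase with derivative `g`. -/
theorem norm_integral_exp_mul_le_of_deriv {f g g' : ℝ → ℝ} {a a' : ℝ → ℂ} {R M M' l : ℝ}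
    (hf : ∀ s, HasDerivAt f (g s) s) (hg : ∀ s, HasDerivAt g (g' s) s) (hg' : Continuous g')
    (hg0 : ∀ s, 0 ≤ g' s) (ha : ∀ s, HasDerivAt a (a' s) s) (ha' : Continuous a') (hR : 0 ≤ R)
    (hl : 0 < l) (haR : a R = 0) (haR' : a (-R) = 0) (hM : ∀ s, ‖a s‖ ≤ M) (hM' : ∀ s, ‖a' s‖ ≤ M')
    (hag : ∀ s, a s ≠ 0 → l ≤ g' s) :
    ‖∫ s in (-R)..R, Complex.exp (Complex.I * (f s : ℂ)) * a s‖ ≤ (2 * π * M + R * M') / √l := by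
  have hM0 : 0 ≤ M := (norm_nonneg _).trans (hM 0)
  have cf : Continuous f := continuous_iff_continuousAt.2 fun s => (hf s).continuousAt
  have cg : Continuous g := continuous_iff_continuousAt.2 fun s => (hg s).continuousAt
  have ca : Continuous a := continuous_iff_continuousAt.2 fun s => (ha s).continuousAt
  have hp : ∀ s, 0 < g s ^ 2 + l := fun s => by positivity
  have hpC : ∀ s, ((g s : ℂ) ^ 2 + l) ≠ 0 := fun s => by exact_mod_cast (hp s).ne'
  set e : ℝ → ℂ := fun s => Complex.exp (Complex.I * (f s : ℂ)) with he
  have ce : Continuous e := by fun_prop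
  have hn : ∀ s, ‖e s‖ = 1 := fun s => by
    rw [he]; simp only; rw [mul_comm, Complex.norm_exp_ofReal_mul_I]
  set h : ℝ → ℝ := fun s => g s / (g s ^ 2 + l) with hh
  set h' : ℝ → ℝ := fun s => g' s * (l - g s ^ 2) / (g s ^ 2 + l) ^ 2 with hh'
  have ch : Continuous h := cg.div (by fun_prop) fun s => (hp s).ne'
  have ch' : Continuous h' := Continuous.div (by fun_prop) (by fun_prop) fun s => by
    have := hp s; positivity
  have dh : ∀ s, HasDerivAt h (h' s) s := fun s => by
    have := (hg s).fun_div (((hg s).fun_pow 2).add_const l) (hp s).ne'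
    refine this.congr_deriv ?_
    rw [hh']; simp only; congr 1; simp; ring
  have de : ∀ s, HasDerivAt e (e s * (Complex.I * (g s : ℂ))) s := fun s =>
    ((hf s).ofReal_comp.const_mul Complex.I).cexp
  set H' : ℝ → ℂ := fun s => (e s * (Complex.I * (g s : ℂ)) * (h s : ℂ) + e s * (h' s : ℂ)) * a s +
    e s * (h s : ℂ) * a' s with hH'
  have dH : ∀ s, HasDerivAt (fun s => e s * (h s : ℂ) * a s) (H' s) s := fun s =>
    ((de s).fun_mul (dh s).ofReal_comp).fun_mul (ha s)
  have cH' : Continuous H' := by fun_prop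
  have hI0 : ∫ s in (-R)..R, H' s = 0 := by
    rw [intervalIntegral.integral_eq_sub_of_hasDerivAt (fun s _ => dH s)
      (cH'.intervalIntegrable _ _), haR, haR']
    simp
  have cI : Continuous fun s => Complex.I * (e s * a s) := by fun_prop
  have e1 : ‖∫ s in (-R)..R, e s * a s‖ = ‖∫ s in (-R)..R, (Complex.I * (e s * a s) - H' s)‖ := by
    rw [intervalIntegral.integral_sub (cI.intervalIntegrable _ _) (cH'.intervalIntegrable _ _),
      hI0, sub_zero, intervalIntegral.integral_const_mul, norm_mul, Complex.norm_I, one_mul]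
  have hsl : 0 < √l := Real.sqrt_pos.2 hl
  have hll : √l ^ 2 = l := Real.sq_sqrt hl.le
  have hpt : ∀ s, ‖Complex.I * (e s * a s) - H' s‖ ≤
      2 * M * (g' s / (g s ^ 2 + l)) + M' / (2 * √l) := by
    intro s
    have e2 : Complex.I * (e s * a s) - H' s = e s * (((l / (g s ^ 2 + l) : ℝ) : ℂ) * Complex.I * a s -
        ((h' s : ℝ) : ℂ) * a s - ((h s : ℝ) : ℂ) * a' s) := by
      have e3 : Complex.I = ((l / (g s ^ 2 + l) : ℝ) : ℂ) * Complex.I +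
          Complex.I * (g s : ℂ) * (h s : ℂ) := by
        rw [hh]; push_cast
        field_simp [hpC s]
        ring
      rw [hH']
      simp only
      linear_combination (e s * a s) * e3
    rw [e2, norm_mul, hn, one_mul]
    have n1 : ‖((l / (g s ^ 2 + l) : ℝ) : ℂ) * Complex.I * a s‖ ≤ M * (g' s / (g s ^ 2 + l)) := by
      by_cases h0 : a s = 0
      · rw [h0, mul_zero, norm_zero]; have := hp s; have := hg0 s; positivity
      · rw [norm_mul, norm_mul, Complex.norm_I, mul_one, Complex.norm_real, Real.norm_of_nonneg
          (by have := hp s; positivity), mul_comm]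
        have := hag s h0
        have := hp s
        gcongr
        exact hM s
    have n2 : ‖((h' s : ℝ) : ℂ) * a s‖ ≤ M * (g' s / (g s ^ 2 + l)) := by
      rw [norm_mul, Complex.norm_real, mul_comm]
      refine mul_le_mul (hM s) ?_ (norm_nonneg _) hM0
      rw [hh', Real.norm_eq_abs]
      simp only
      rw [abs_div, abs_mul, abs_of_nonneg (hg0 s), abs_of_pos (by have := hp s; positivity :
        0 < (g s ^ 2 + l) ^ 2), div_le_div_iff₀ (by have := hp s; positivity) (hp s)]
      have : |l - g s ^ 2| ≤ g s ^ 2 + l := by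
        rw [abs_le]; constructor <;> nlinarith [sq_nonneg (g s)]
      have h4 := mul_le_mul_of_nonneg_left this (hg0 s)
      have h5 := mul_le_mul_of_nonneg_right h4 (hp s).le
      linarith
    have n3 : ‖((h s : ℝ) : ℂ) * a' s‖ ≤ M' / (2 * √l) := by
      rw [norm_mul, Complex.norm_real, Real.norm_eq_abs]
      have : |h s| ≤ 1 / (2 * √l) := by
        rw [hh]
        simp only
        rw [abs_div, abs_of_pos (hp s), div_le_div_iff₀ (hp s) (by positivity), one_mul]
        nlinarith [sq_nonneg (|g s| - √l), sq_abs (g s)]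
      calc _ ≤ 1 / (2 * √l) * M' := mul_le_mul this (hM' s) (norm_nonneg _) (by positivity)
        _ = _ := by ring
    calc _ ≤ _ := norm_sub_le _ _
      _ ≤ _ := add_le_add_left (norm_sub_le _ _) _
      _ ≤ _ := add_le_add (add_le_add n1 n2) n3
      _ = _ := by ring
  have cB : Continuous fun s => g' s / (g s ^ 2 + l) :=
    hg'.div (by fun_prop) fun s => (hp s).ne'
  have eB : ∫ s in (-R)..R, g' s / (g s ^ 2 + l) = (arctan (g R / √l) - arctan (g (-R) / √l)) / √l := by
    have d : ∀ s, HasDerivAt (fun s => arctan (g s / √l) / √l) (g' s / (g s ^ 2 + l)) s := fun s => by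
      refine (((hg s).div_const (√l)).arctan.div_const (√l)).congr_deriv ?_
      have := (hp s).ne'
      have e5 : 1 + (g s / √l) ^ 2 = (g s ^ 2 + l) / l := by
        rw [div_pow, hll]; field_simp; ring
      rw [e5]
      have : √l * √l = l := by rw [← sq, hll]
      field_simp
      rw [hll]
      ring
    rw [intervalIntegral.integral_eq_sub_of_hasDerivAt (fun s _ => d s)
      (cB.intervalIntegrable _ _)]
    ring
  rw [e1]
  refine (intervalIntegral.norm_integral_le_of_norm_le (by linarith)
    (Filter.Eventually.of_forall fun s _ => hpt s)
    ((by fun_prop : Continuous fun s => 2 * M * (g' s / (g s ^ 2 + l)) +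
      M' / (2 * √l)).intervalIntegrable _ _)).trans ?_
  rw [intervalIntegral.integral_add ((cB.const_mul _).intervalIntegrable _ _)
    intervalIntegrable_const, intervalIntegral.integral_const_mul, eB,
    intervalIntegral.integral_const, smul_eq_mul]
  have h1 := arctan_lt_pi_div_two (g R / √l)
  have h2 := neg_pi_div_two_lt_arctan (g (-R) / √l)
  have h3 : 2 * M * ((arctan (g R / √l) - arctan (g (-R) / √l)) / √l) ≤ 2 * M * (π / √l) := by
    gcongr; linarith
  calc _ ≤ 2 * M * (π / √l) + (R - -R) * (M' / (2 * √l)) := by gcongr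
    _ = _ := by field_simp; ring


theorem exists_norm_waveExt_le_of_snd {a : ℝ × ℝ → ℂ} (ha : ContDiff ℝ (⊤ : ℕ∞) a)
    (hs : HasCompactSupport a) {c : ℝ} (hc : 0 < c) (h : ∀ ξ, a ξ ≠ 0 → c ≤ |ξ.2|) :
    ∃ C > 0, ∀ y : (ℝ × ℝ) × ℝ, y.2 < 0 → ‖waveExt a y‖ ≤ C / √(-y.2) := by
  have ha1 : ContDiff ℝ 1 a := mod_cast contDiff_infty.1 ha 1
  obtain ⟨M, hM⟩ := hs.exists_bound_of_continuous ha.continuous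
  obtain ⟨M', hM'⟩ := (hs.fderiv ℝ).exists_bound_of_continuous (ha1.continuous_fderiv one_ne_zero)
  obtain ⟨R₀, hR₀⟩ := hs.isBounded.exists_norm_le
  set R := |R₀| + 1 with hR
  have hR0 : 0 < R := by positivity
  have hRa : ∀ ξ, a ξ ≠ 0 → |ξ.1| < R ∧ |ξ.2| < R := by
    intro ξ h0
    have h1 := hR₀ ξ (subset_tsupport _ h0)
    have h2 := norm_fst_le ξ
    have h3 := norm_snd_le ξ
    rw [Real.norm_eq_abs] at h2 h3
    have := le_abs_self R₀
    constructor <;> linarith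
  have hM0 : 0 ≤ M := (norm_nonneg _).trans (hM 0)
  have hM0' : 0 ≤ M' := (norm_nonneg _).trans (hM' 0)
  set k := c ^ 2 / (2 * R) ^ 3 with hk
  have hk0 : 0 < k := by positivity
  refine ⟨2 * R * ((2 * π * M + R * M') / √k) + 1, by positivity, fun y hy => ?_⟩
  have hy' : 0 < √(-y.2) := Real.sqrt_pos.2 (by linarith)
  have hInt : Integrable fun ξ : ℝ × ℝ =>
      Complex.exp (-Complex.I * ((dot2 y.1 ξ + y.2 * enorm2 ξ : ℝ) : ℂ)) * a ξ := by
    have := continuous_enorm2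
    have := ha.continuous
    refine Continuous.integrable_of_hasCompactSupport ?_ hs.mul_left
    unfold dot2
    fun_prop
  have hin : ∀ r : ℝ, ‖∫ s : ℝ, Complex.exp (-Complex.I *
      ((dot2 y.1 (s, r) + y.2 * enorm2 (s, r) : ℝ) : ℂ)) * a (s, r)‖ ≤
      (Icc (-R) R).indicator (fun _ => (2 * π * M + R * M') / √(-y.2 * k)) r := by
    intro r
    by_cases hz : ∀ s, a (s, r) = 0
    · simp only [hz, mul_zero, integral_zero, norm_zero]
      exact indicator_nonneg (fun _ _ => by positivity) _
    push Not at hz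
    obtain ⟨s₀, hs₀⟩ := hz
    have hr := (hRa _ hs₀).2
    have hcr := h _ hs₀
    simp only at hr hcr
    rw [indicator_of_mem (show r ∈ Icc (-R) R from abs_le.1 hr.le)]
    have hr2 : c ^ 2 ≤ r ^ 2 := by rw [← sq_abs r]; gcongr
    have hpos : ∀ s : ℝ, 0 < s ^ 2 + r ^ 2 := fun s => by
      linarith [sq_nonneg s, pow_pos hc 2]
    have hq : ∀ s : ℝ, 0 < √(s ^ 2 + r ^ 2) := fun s => Real.sqrt_pos.2 (hpos s)
    have dq : ∀ s : ℝ, HasDerivAt (fun s => √(s ^ 2 + r ^ 2)) (s / √(s ^ 2 + r ^ 2)) s := fun s => by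
      refine (((hasDerivAt_pow 2 s).add_const (r ^ 2)).sqrt (hpos s).ne').congr_deriv ?_
      have := hq s
      field_simp
      simp
    have e1 : ∀ s : ℝ, -Complex.I * ((dot2 y.1 (s, r) + y.2 * enorm2 (s, r) : ℝ) : ℂ) =
        Complex.I * ((-(y.1.1 * s + y.1.2 * r + y.2 * √(s ^ 2 + r ^ 2)) : ℝ) : ℂ) := fun s => by
      unfold dot2 enorm2
      push_cast; ring
    simp only [e1]
    rw [← intervalIntegral.integral_eq_integral_of_support_subset (a := -R) (b := R) fun s h0 => by
      have := abs_lt.1 (hRa (s, r) (right_ne_zero_of_mul h0)).1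
      exact ⟨this.1, this.2.le⟩]
    refine norm_integral_exp_mul_le_of_deriv (g := fun s => -(y.1.1 + y.2 * (s / √(s ^ 2 + r ^ 2))))
      (g' := fun s => -y.2 * (r ^ 2 / √(s ^ 2 + r ^ 2) ^ 3)) (a' := fun s => fderiv ℝ a (s, r) (1, 0))
      (fun s => ?_) (fun s => ?_) ?_ (fun s => ?_) (fun s => ?_) ?_ hR0.le
      (mul_pos (by linarith) hk0) ?_ ?_ (fun s => hM _) (fun s => ?_) fun s h0 => ?_
    · refine ((((hasDerivAt_id s).const_mul y.1.1).add_const (y.1.2 * r)).add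
        ((dq s).const_mul y.2)).neg.congr_deriv ?_
      ring
    · refine (((((hasDerivAt_id s).div (dq s) (hq s).ne').const_mul y.2).const_add y.1.1).neg).congr_deriv ?_
      have e2 := Real.sq_sqrt (hpos s).le
      have := hq s
      field_simp
      simp only [id, neg_inj]
      rw [e2]
      ring
    · exact continuous_const.mul (continuous_const.div (by fun_prop) fun s => by
        have := hq s; positivity)
    · have := hq s
      have : 0 ≤ -y.2 := by linarith
      positivity
    · exact (ha1.differentiable one_ne_zero (s, r)).hasFDerivAt.comp_hasDerivAt s
        ((hasDerivAt_id s).prodMk (hasDerivAt_const s r))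
    · have := ha1.continuous_fderiv one_ne_zero
      fun_prop
    · by_contra h0
      have := (hRa _ h0).1
      simp only [abs_of_pos hR0, lt_irrefl] at this
    · by_contra h0
      have := (hRa _ h0).1
      simp only [abs_neg, abs_of_pos hR0, lt_irrefl] at this
    · refine ((fderiv ℝ a (s, r)).le_opNorm _).trans ?_
      have : ‖((1 : ℝ), (0 : ℝ))‖ = 1 := by simp [Prod.norm_def]
      rw [this, mul_one]
      exact hM' _
    · obtain ⟨h1, h2⟩ := hRa _ h0
      simp only at h1 h2
      have : 0 ≤ -y.2 := by linarith
      have := hq s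
      have : √(s ^ 2 + r ^ 2) ≤ 2 * R := by
        rw [Real.sqrt_le_iff]
        refine ⟨by positivity, ?_⟩
        have := sq_le_sq' (abs_lt.1 h1).1.le (abs_lt.1 h1).2.le
        have := sq_le_sq' (abs_lt.1 h2).1.le (abs_lt.1 h2).2.le
        nlinarith
      rw [hk]
      gcongr
  have e : waveExt a y = ∫ r : ℝ, ∫ s : ℝ, Complex.exp (-Complex.I *
      ((dot2 y.1 (s, r) + y.2 * enorm2 (s, r) : ℝ) : ℂ)) * a (s, r) := by
    unfold waveExt
    rw [Measure.volume_eq_prod] at hInt ⊢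
    exact integral_prod_symm _ hInt
  rw [e]
  refine (norm_integral_le_of_norm_le ((integrable_indicator_iff measurableSet_Icc).2
    (integrableOn_const (by simp))) (Filter.Eventually.of_forall hin)).trans ?_
  rw [integral_indicator measurableSet_Icc, setIntegral_const, smul_eq_mul, Measure.real,
    Real.volume_Icc, ENNReal.toReal_ofReal (by linarith), Real.sqrt_mul (by linarith)]
  rw [le_div_iff₀ hy']
  have := Real.sqrt_pos.2 hk0
  field_simp
  nlinarith


theorem waveExt_swap (a : ℝ × ℝ → ℂ) (y : (ℝ × ℝ) × ℝ) :
    waveExt (fun ξ => a ξ.swap) (y.1.swap, y.2) = waveExt a y := by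
  unfold waveExt
  rw [Measure.volume_eq_prod, ← integral_prod_swap]
  congr 1 with ξ
  simp only [dot2, enorm2, Prod.fst_swap, Prod.snd_swap, Prod.swap_swap, add_comm]

/-- The decay of the kernel of the frequency localised wave propagator. -/
theorem exists_norm_waveExt_le {a : ℝ × ℝ → ℂ} (ha : ContDiff ℝ (⊤ : ℕ∞) a)
    (hs : HasCompactSupport a) (h0 : (0 : ℝ × ℝ) ∉ tsupport a) :
    ∃ C > 0, ∀ y : (ℝ × ℝ) × ℝ, y.2 < 0 → ‖waveExt a y‖ ≤ C / √(-y.2) := by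
  obtain ⟨r, hr, hball⟩ := Metric.isOpen_iff.1 (isClosed_tsupport a).isOpen_compl 0 h0
  have hra : ∀ ξ, a ξ ≠ 0 → r ≤ ‖ξ‖ := fun ξ h => by
    by_contra! hlt
    exact hball (by simpa using hlt) (subset_tsupport _ h)
  set χ : ℝ × ℝ → ℝ := fun ξ => Real.smoothTransition ((ξ.2 ^ 2 - r ^ 2 / 4) / (3 * r ^ 2 / 4)) with hχ
  have hχc : ContDiff ℝ (⊤ : ℕ∞) χ := Real.smoothTransition.contDiff.comp (by fun_prop)
  have hχC : ContDiff ℝ (⊤ : ℕ∞) fun ξ => (χ ξ : ℂ) := Complex.ofRealCLM.contDiff.comp hχc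
  obtain ⟨C₁, hC₁, h₁⟩ := exists_norm_waveExt_le_of_snd (a := fun ξ => a ξ * (χ ξ : ℂ))
    (ha.mul hχC) hs.mul_right (half_pos hr) fun ξ h => by
      by_contra! hlt
      refine right_ne_zero_of_mul h ?_
      rw [hχ, Complex.ofReal_eq_zero]
      refine Real.smoothTransition.zero_of_nonpos (div_nonpos_of_nonpos_of_nonneg ?_ (by positivity))
      rw [← sq_abs]
      nlinarith [abs_nonneg ξ.2]
  have hb : ContDiff ℝ (⊤ : ℕ∞) fun ξ => a ξ * (1 - (χ ξ : ℂ)) := ha.mul (contDiff_const.sub hχC)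
  have hbs : HasCompactSupport fun ξ => a ξ * (1 - (χ ξ : ℂ)) := hs.mul_right
  obtain ⟨C₂, hC₂, h₂⟩ := exists_norm_waveExt_le_of_snd
    (a := fun ξ => (fun ξ => a ξ * (1 - (χ ξ : ℂ))) ξ.swap)
    (hb.comp (contDiff_snd.prodMk contDiff_fst))
    (hbs.comp_homeomorph (Homeomorph.prodComm ℝ ℝ)) hr fun ξ h => by
      by_contra! hlt
      simp only at h
      have h3 := hra _ (left_ne_zero_of_mul h)
      have h4 : r ≤ |ξ.1| := by
        rw [Prod.norm_def, le_max_iff] at h3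
        exact (h3.resolve_left fun h5 => by
          rw [Real.norm_eq_abs] at h5; exact hlt.not_ge h5)
      refine right_ne_zero_of_mul h ?_
      have : χ ξ.swap = 1 := by
        refine Real.smoothTransition.one_of_one_le ((one_le_div (by positivity)).2 ?_)
        rw [Prod.snd_swap, ← sq_abs ξ.1]
        nlinarith
      rw [this]; simp
  refine ⟨C₁ + C₂, by positivity, fun y hy => ?_⟩
  have hI₁ : Integrable fun ξ => a ξ * (χ ξ : ℂ) :=
    (ha.mul hχC).continuous.integrable_of_hasCompactSupport hs.mul_right
  have hI₂ : Integrable fun ξ => a ξ * (1 - (χ ξ : ℂ)) :=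
    hb.continuous.integrable_of_hasCompactSupport hbs
  have e := waveExt_sum (s := Finset.univ) (b := fun (i : Bool) ξ =>
    if i then a ξ * (χ ξ : ℂ) else a ξ * (1 - (χ ξ : ℂ))) (fun i _ => by
      cases i
      · simpa using hI₂
      · simpa using hI₁) y
  simp only [Fintype.sum_bool, if_true, if_false, Bool.false_eq_true, ← mul_add,
    add_sub_cancel, mul_one] at e
  rw [e, add_div]
  refine (norm_add_le _ _).trans (add_le_add (h₁ y hy) ?_)
  have := h₂ (y.1.swap, y.2) hy
  rwa [waveExt_swap (fun ξ => a ξ * (1 - (χ ξ : ℂ)))] at this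

/-- The frequency localised wave extension of the Fourier transform of `F`. -/
def waveOp (a F : ℝ × ℝ → ℂ) (y : (ℝ × ℝ) × ℝ) : ℂ := waveExt (fun ξ => a ξ * ft2 F ξ) y

theorem norm_waveExt_le (b : ℝ × ℝ → ℂ) (y : (ℝ × ℝ) × ℝ) : ‖waveExt b y‖ ≤ ∫ ξ, ‖b ξ‖ := by
  refine (norm_integral_le_integral_norm _).trans (le_of_eq ?_)
  simp only [norm_mul, norm_exp_neg_I_mul, one_mul]

/-- The slab of times comparable to `-T`. -/
def timeSlab (T : ℝ) : Set ((ℝ × ℝ) × ℝ) := univ ×ˢ Icc (-(2 * T)) (-T)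

theorem measurableSet_timeSlab (T : ℝ) : MeasurableSet (timeSlab T) :=
  MeasurableSet.univ.prod measurableSet_Icc

section
variable {a F : ℝ × ℝ → ℂ}

theorem integrable_mul_ft2 (ha : Continuous a) (hs : HasCompactSupport a) (hF : Integrable F) :
    Integrable fun ξ => a ξ * ft2 F ξ :=
  (ha.mul (continuous_ft2 hF)).integrable_of_hasCompactSupport hs.mul_right

theorem waveOp_eq_integral (ha : Continuous a) (hs : HasCompactSupport a) (hF : Integrable F)
    (y : (ℝ × ℝ) × ℝ) : waveOp a F y = ∫ z, waveExt a (y.1 + z, y.2) * F z := by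
  have hai := ha.integrable_of_hasCompactSupport (μ := volume) hs
  have h1 := continuous_enorm2
  have h2 := continuous_dot2
  have hInt : Integrable (fun p : (ℝ × ℝ) × (ℝ × ℝ) =>
      Complex.exp (-Complex.I * ((dot2 (y.1 + p.2) p.1 + y.2 * enorm2 p.1 : ℝ) : ℂ)) *
        (a p.1 * F p.2)) (volume.prod volume) := by
    refine (hai.mul_prod hF).bdd_mul (c := 1) (Continuous.aestronglyMeasurable ?_)
      (Filter.Eventually.of_forall fun p => (norm_exp_neg_I_mul _).le)
    unfold dot2
    fun_prop
  calc waveOp a F y = ∫ ξ, ∫ z, Complex.exp (-Complex.I *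
        ((dot2 (y.1 + z) ξ + y.2 * enorm2 ξ : ℝ) : ℂ)) * (a ξ * F z) := by
        refine integral_congr_ae (Filter.Eventually.of_forall fun ξ => ?_)
        simp only
        rw [ft2_eq, ← integral_const_mul, ← integral_const_mul]
        congr 1 with z
        rw [dot2_add_left, show -Complex.I * ((dot2 y.1 ξ + dot2 z ξ + y.2 * enorm2 ξ : ℝ) : ℂ) =
          -Complex.I * ((dot2 y.1 ξ + y.2 * enorm2 ξ : ℝ) : ℂ) + -Complex.I * (dot2 z ξ : ℂ) by
            push_cast; ring, Complex.exp_add]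
        ring
    _ = ∫ z, ∫ ξ, Complex.exp (-Complex.I *
        ((dot2 (y.1 + z) ξ + y.2 * enorm2 ξ : ℝ) : ℂ)) * (a ξ * F z) := integral_integral_swap hInt
    _ = _ := by
        congr 1 with z
        unfold waveExt
        rw [← integral_mul_const]
        congr 1 with ξ
        ring

theorem integrable_waveExt_mul (ha : Continuous a) (hs : HasCompactSupport a) (hF : Integrable F)
    (y : (ℝ × ℝ) × ℝ) : Integrable fun z => waveExt a (y.1 + z, y.2) * F z :=
  hF.bdd_mul (c := ∫ ξ, ‖a ξ‖) ((continuous_waveExt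
    (ha.integrable_of_hasCompactSupport hs)).comp (by fun_prop)).aestronglyMeasurable
      (Filter.Eventually.of_forall fun z => norm_waveExt_le _ _)

theorem enorm_waveOp_le (ha : Continuous a) (hs : HasCompactSupport a) (hF : Integrable F)
    (y : (ℝ × ℝ) × ℝ) {M : ℝ} (hM : ∀ x, ‖waveExt a (x, y.2)‖ ≤ M) :
    ‖waveOp a F y‖ₑ ≤ ENNReal.ofReal M * ∫⁻ z, ‖F z‖ₑ := by
  rw [waveOp_eq_integral ha hs hF, ← lintegral_const_mul' _ _ ENNReal.ofReal_ne_top]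
  refine (enorm_integral_le_lintegral_enorm _).trans (lintegral_mono fun z => ?_)
  rw [enorm_mul, ← ofReal_norm]
  gcongr
  exact hM _

theorem waveOp_sub (ha : Continuous a) (hs : HasCompactSupport a) (hF : Integrable F)
    {G : ℝ × ℝ → ℂ} (hG : Integrable G) (y : (ℝ × ℝ) × ℝ) :
    waveOp a F y - waveOp a G y = waveOp a (fun z => F z - G z) y := by
  rw [waveOp_eq_integral ha hs hF, waveOp_eq_integral ha hs hG,
    waveOp_eq_integral (F := fun z => F z - G z) ha hs (hF.sub hG), ← integral_sub (integrable_waveExt_mul ha hs hF y)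
      (integrable_waveExt_mul ha hs hG y)]
  simp only [mul_sub]

theorem waveOp_sum (ha : Continuous a) (hs : HasCompactSupport a) {ι : Type*} (s : Finset ι)
    (φ : ι → ℝ × ℝ → ℂ) (x : ι → ℂ) (hφ : ∀ i ∈ s, Integrable (φ i)) :
    waveOp a (fun z => ∑ i ∈ s, x i * φ i z) = fun y => ∑ i ∈ s, x i * waveOp a (φ i) y := by
  funext y
  rw [waveOp_eq_integral ha hs (integrable_finsetSum _ fun i hi => (hφ i hi).const_mul _)]
  simp only [Finset.mul_sum]
  rw [integral_finsetSum _ fun i hi => integrable_waveExt_mul ha hs ((hφ i hi).const_mul _) y]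
  refine Finset.sum_congr rfl fun i hi => ?_
  rw [waveOp_eq_integral ha hs (hφ i hi), ← integral_const_mul]
  congr 1 with z
  ring

theorem continuous_waveOp (ha : Continuous a) (hs : HasCompactSupport a) (hF : Integrable F) :
    Continuous (waveOp a F) := continuous_waveExt (integrable_mul_ft2 ha hs hF)

theorem exists_lintegral_waveOp_sq_le (ha : Continuous a) (hs : HasCompactSupport a) :
    ∃ C > 0, ∀ T : ℝ, 0 ≤ T → ∀ F, Integrable F → Measurable F → (∃ m, ∀ x, ‖F x‖ ≤ m) →
      ∫⁻ y in timeSlab T, ‖waveOp a F y‖ₑ ^ 2 ≤ ENNReal.ofReal (C * T) * ∫⁻ x, ‖F x‖ₑ ^ 2 := by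
  obtain ⟨M, hM⟩ := hs.exists_bound_of_continuous ha
  have hM0 : 0 ≤ M := (norm_nonneg _).trans (hM 0)
  refine ⟨(2 * π) ^ 2 * M ^ 2 * (2 * π) ^ 2 + 1, by positivity, fun T hT F hF hFm hFb => ?_⟩
  obtain ⟨m, hm⟩ := hFb
  have e := continuous_enorm2
  have hsl : ∀ t : ℝ, ∫⁻ x, ‖waveOp a F (x, t)‖ₑ ^ 2 ≤
      ENNReal.ofReal ((2 * π) ^ 2 * M ^ 2 * (2 * π) ^ 2) * ∫⁻ x, ‖F x‖ₑ ^ 2 := by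
    intro t
    set B : ℝ × ℝ → ℂ := fun ξ => Complex.exp (-Complex.I * ((t * enorm2 ξ : ℝ) : ℂ)) * a ξ with hB
    have e1 : ∀ x, waveOp a F (x, t) = ft2 (fun ξ => B ξ * ft2 F ξ) x := fun x => by
      rw [ft2_eq]
      unfold waveOp waveExt
      congr 1 with ξ
      rw [hB]
      simp only
      rw [dot2_comm ξ x, ← mul_assoc, ← mul_assoc, ← mul_assoc, ← Complex.exp_add]
      congr 3
      push_cast; ring
    simp only [e1]
    have hBc : Continuous B := by fun_prop
    have hBs : HasCompactSupport B := hs.mul_left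
    rw [lintegral_enorm_sq_ft2_mul_ft2_le hBc hBs hF]
    have hn : ∀ ξ, ‖B ξ‖ₑ ^ 2 ≤ ENNReal.ofReal (M ^ 2) := fun ξ => by
      rw [← ofReal_norm, ENNReal.ofReal_pow hM0]
      gcongr
      rw [hB]; simp only
      rw [norm_mul, norm_exp_neg_I_mul, one_mul]
      exact hM ξ
    calc _ ≤ ENNReal.ofReal ((2 * π) ^ 2) * ∫⁻ ξ, ENNReal.ofReal (M ^ 2) * ‖ft2 F ξ‖ₑ ^ 2 := by
          gcongr with ξ; exact hn ξ
      _ = _ := by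
          rw [lintegral_const_mul' _ _ ENNReal.ofReal_ne_top,
            lintegral_enorm_sq_ft2 hF (memLp_two_of_bound hF hm),
            ENNReal.ofReal_mul (p := (2 * π) ^ 2 * M ^ 2) (by positivity),
            ENNReal.ofReal_mul (p := (2 * π) ^ 2) (by positivity)]
          ring
  have hmeas : Measurable fun y => ‖waveOp a F y‖ₑ ^ 2 :=
    (continuous_waveOp ha hs hF).measurable.enorm.pow_const 2
  rw [timeSlab, Measure.volume_eq_prod, ← Measure.prod_restrict, lintegral_prod_symm' _ hmeas,
    Measure.restrict_univ]
  refine (lintegral_mono hsl).trans ?_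
  rw [lintegral_const, Measure.restrict_apply_univ, Real.volume_Icc, mul_right_comm,
    ← ENNReal.ofReal_mul (by positivity), show -T - -(2 * T) = T by ring]
  gcongr
  linarith

theorem dualBound_of_lintegral_le {X Y : Type*} [MeasurableSpace X] [MeasurableSpace Y]
    {μ : Measure X} {ν : Measure Y} {U : (X → ℂ) → Y → ℂ} {r B : ℝ} (hr : 1 < r) (hB : 0 ≤ B)
    (hmeas : ∀ F, Integrable F μ → Measurable (U F))
    (h : ∀ F, Integrable F μ → Measurable F → (∃ m, ∀ x, ‖F x‖ ≤ m) →
      ∫⁻ y, ‖U F y‖ₑ ^ r ∂ν ≤ ENNReal.ofReal B * ∫⁻ x, ‖F x‖ₑ ^ r ∂μ) :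
    DualBound μ ν U (1 / r) (1 - 1 / r) (B ^ (1 / r)) := by
  intro F hF hFm hFb G hG
  have hr0 : 0 < r := by linarith
  have hc : r.HolderConjugate (1 / (1 - 1 / r)) := by
    rw [Real.holderConjugate_iff]
    refine ⟨hr, ?_⟩
    simp
  have := ENNReal.lintegral_mul_le_Lp_mul_Lq ν hc (hmeas F hF).enorm.aemeasurable
    hG.enorm.aemeasurable
  refine this.trans ?_
  simp only [one_div_one_div]
  gcongr
  rw [← ENNReal.ofReal_rpow_of_nonneg hB (by positivity), ← ENNReal.mul_rpow_of_nonneg _ _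
    (by positivity)]
  gcongr
  exact h F hF hFm hFb


/-- Local smoothing for the frequency localised wave extension, at unit frequency. -/
theorem exists_lintegral_waveOp_rpow_le (ha : ContDiff ℝ (⊤ : ℕ∞) a) (hs : HasCompactSupport a)
    (h0 : (0 : ℝ × ℝ) ∉ tsupport a) {α β ε : ℝ} (hε : 0 < ε) (hβ : 0 < β) (hαβ : β ≤ α)
    (h1 : α + β ≤ 1) (h3 : 1 ≤ α + 3 * β) :
    ∃ C > 0, ∀ T : ℝ, 1 ≤ T → ∀ F, Integrable F → Measurable F →
      ∫⁻ y in timeSlab T, ‖waveOp a F y‖ₑ ^ (1 / β) ≤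
        ENNReal.ofReal (C * T ^ ((3 / 2 * β - α / 2 + ε) / β)) *
          (∫⁻ x, ‖F x‖ₑ ^ (1 / α)) ^ (α / β) := by
  have hac := ha.continuous
  obtain ⟨C₀, hC₀, H₀⟩ := exists_lintegral_waveOp_sq_le hac hs
  obtain ⟨C₁, hC₁, H₁⟩ := fourthMomentBound_of_zero_notMem hε ha hs h0
  obtain ⟨C₂, hC₂, H₂⟩ := exists_norm_waveExt_le ha hs h0
  set u := α + 3 * β - 1 with hu
  set v := 2 * (1 - α - β) with hv
  set w := α - β with hw
  set q := 1 / β with hq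
  have hq0 : 0 < q := by positivity
  have hu0 : 0 ≤ u := by linarith
  have hv0 : 0 ≤ v := by linarith
  have hw0 : 0 ≤ w := by linarith
  have hv1 : v ≤ 4 := by linarith
  refine ⟨2 ^ q * (2 * C₀ ^ (1 / 2 : ℝ)) ^ (u * q) * (2 * (C₁ * 2 ^ (1 + ε)) ^ (1 / 4 : ℝ)) ^ (v * q) *
    (2 * C₂) ^ (w * q), by positivity, fun T hT F hF hFm => ?_⟩
  have hT0 : 0 < T := by linarith
  have hmeas : ∀ F, Integrable F → Measurable (waveOp a F) := fun F hF =>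
    (continuous_waveOp hac hs hF).measurable
  have D₀ : DualBound volume (volume.restrict (timeSlab T)) (waveOp a) (1 / 2) (1 - 1 / 2)
      ((C₀ * T) ^ (1 / 2 : ℝ)) :=
    dualBound_of_lintegral_le one_lt_two (by positivity) hmeas fun F hF hFm hFb => by
      simpa using H₀ T hT0.le F hF hFm hFb
  have D₁ : DualBound volume (volume.restrict (timeSlab T)) (waveOp a) (1 / 4) (1 - 1 / 4)
      ((C₁ * (2 * T) ^ (1 + ε)) ^ (1 / 4 : ℝ)) :=
    dualBound_of_lintegral_le (by norm_num) (by positivity) hmeas fun F hF hFm hFb => by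
      have hsub : timeSlab T ⊆ {y : (ℝ × ℝ) × ℝ | |y.2| ≤ 2 * T} := fun y hy =>
        abs_le.2 ⟨hy.2.1, by linarith [hy.2.2]⟩
      exact_mod_cast (lintegral_mono_set hsub).trans (H₁ (2 * T) (by linarith) F hF hFm hFb)
  have hk : ∀ y ∈ timeSlab T, ∀ x, ‖waveExt a (x, y.2)‖ ≤ C₂ / √T := fun y hy x => by
    obtain ⟨-, h4, h5⟩ := hy
    refine (H₂ (x, y.2) (by simp only; linarith)).trans ?_
    have := Real.sqrt_pos.2 hT0
    gcongr
    linarith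
  have D₂ : DualBound volume (volume.restrict (timeSlab T)) (waveOp a) 1 1 (C₂ / √T) := by
    intro F hF hFm hFb G hG
    simp only [div_one, ENNReal.rpow_one]
    rw [← lintegral_const_mul' _ _ (ENNReal.mul_ne_top ENNReal.ofReal_ne_top
      hF.hasFiniteIntegral.ne)]
    refine setLIntegral_mono' (measurableSet_timeSlab T) fun y hy => ?_
    gcongr
    exact enorm_waveOp_le hac hs hF y (hk y hy)
  have key := D₀.lintegral_rpow_le D₁ D₂ (u := u) (v := v) (w := w) (q := q) (by norm_num)
    (by norm_num) (by norm_num) (by norm_num) one_pos one_pos (by positivity) (by positivity)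
    (by positivity) hu0 hv0 hw0 (by rw [hu, hv, hw]; ring)
    (by rw [hq, one_lt_div hβ]; linarith) (by rw [hu, hv, hw, hq, one_div_one_div]; ring)
    (fun s φ x hφ => waveOp_sum hac hs s φ x hφ) hmeas (fun F hF hFm hFb k => ?_)
    (K := ENNReal.ofReal (∫ ξ, ‖a ξ‖)) ENNReal.ofReal_ne_top
    (fun F G hF hG y => by
      rw [waveOp_sub hac hs hF hG]
      exact enorm_waveOp_le hac hs (hF.sub hG) y fun x => norm_waveExt_le _ _) hF hFm
  · have e1 : u * (1 / 2) + v * (1 / 4) + w * 1 = α := by rw [hu, hv, hw]; ring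
    rw [e1] at key
    refine key.trans ?_
    rw [show α * q = α / β by rw [hq]; ring]
    refine mul_le_mul_left (ENNReal.ofReal_le_ofReal ?_) _
    have e2 : (2 * (C₀ * T) ^ (1 / 2 : ℝ)) ^ (u * q) =
        (2 * C₀ ^ (1 / 2 : ℝ)) ^ (u * q) * T ^ (1 / 2 * (u * q)) := by
      rw [Real.mul_rpow hC₀.le hT0.le, ← mul_assoc, Real.mul_rpow (by positivity) (by positivity),
        ← Real.rpow_mul hT0.le]
    have e3 : (2 * (C₁ * (2 * T) ^ (1 + ε)) ^ (1 / 4 : ℝ)) ^ (v * q) =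
        (2 * (C₁ * 2 ^ (1 + ε)) ^ (1 / 4 : ℝ)) ^ (v * q) * T ^ ((1 + ε) / 4 * (v * q)) := by
      have e6 : (C₁ * (2 * T) ^ (1 + ε)) ^ (1 / 4 : ℝ) =
          (C₁ * 2 ^ (1 + ε)) ^ (1 / 4 : ℝ) * T ^ ((1 + ε) * (1 / 4)) := by
        rw [Real.mul_rpow zero_le_two hT0.le, ← mul_assoc, Real.mul_rpow (by positivity)
          (by positivity), ← Real.rpow_mul hT0.le]
      rw [e6, ← mul_assoc 2, Real.mul_rpow (by positivity) (by positivity), ← Real.rpow_mul hT0.le]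
      congr 2; ring
    have e4 : (2 * (C₂ / √T)) ^ (w * q) = (2 * C₂) ^ (w * q) * T ^ (-(1 / 2) * (w * q)) := by
      rw [Real.sqrt_eq_rpow, div_eq_mul_inv, ← Real.rpow_neg hT0.le, ← mul_assoc,
        Real.mul_rpow (by positivity) (by positivity), ← Real.rpow_mul hT0.le]
    rw [e2, e3, e4]
    have e5 : T ^ (1 / 2 * (u * q)) * T ^ ((1 + ε) / 4 * (v * q)) * T ^ (-(1 / 2) * (w * q)) ≤
        T ^ ((3 / 2 * β - α / 2 + ε) / β) := by
      rw [← Real.rpow_add hT0, ← Real.rpow_add hT0]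
      refine Real.rpow_le_rpow_of_exponent_le hT ?_
      have : 1 / 2 * (u * q) + (1 + ε) / 4 * (v * q) + -(1 / 2) * (w * q) =
        (3 / 2 * β - α / 2 + v / 4 * ε) / β := by rw [hu, hv, hw, hq]; ring
      rw [this]
      gcongr
      nlinarith
    calc _ = 2 ^ q * (2 * C₀ ^ (1 / 2 : ℝ)) ^ (u * q) *
          (2 * (C₁ * 2 ^ (1 + ε)) ^ (1 / 4 : ℝ)) ^ (v * q) * (2 * C₂) ^ (w * q) *
          (T ^ (1 / 2 * (u * q)) * T ^ ((1 + ε) / 4 * (v * q)) * T ^ (-(1 / 2) * (w * q))) := by ring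
      _ ≤ _ := by gcongr
  · obtain ⟨m, hm⟩ := hFb
    have h2 := (memLp_two_of_bound hF hm)
    have h4 : ∫⁻ x, ‖F x‖ₑ ^ 2 ≠ ∞ := by
      have := h2.eLpNorm_lt_top
      rw [eLpNorm_lt_top_iff_lintegral_rpow_enorm_lt_top two_ne_zero ENNReal.ofNat_ne_top] at this
      simpa using this.ne
    have h5 := (H₀ T hT0.le F hF hFm ⟨m, hm⟩).trans_lt (ENNReal.mul_lt_top ENNReal.ofReal_lt_top
      h4.lt_top)
    have h6 := mul_meas_ge_le_lintegral (μ := volume.restrict (timeSlab T))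
      ((hmeas F hF).enorm.pow_const 2) (ENNReal.ofReal (((2 : ℝ) ^ k) ^ 2))
    have h7 : volume.restrict (timeSlab T) {y | ENNReal.ofReal (((2 : ℝ) ^ k) ^ 2) ≤
        ‖waveOp a F y‖ₑ ^ 2} ≠ ∞ := fun h => by
      rw [h, ENNReal.mul_top (ENNReal.ofReal_pos.2 (by positivity)).ne'] at h6
      exact (h6.trans_lt h5).ne rfl
    refine ne_top_of_le_ne_top h7 (measure_mono fun y hy => ?_)
    have := hy.1
    simp only [mem_ofPred_eq]
    rw [ENNReal.ofReal_pow (by positivity), ← ofReal_norm]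
    gcongr

end

section
variable {a F : ℝ × ℝ → ℂ}

theorem ft2_ift2_mul_ft2 (ha : ContDiff ℝ (⊤ : ℕ∞) a) (hs : HasCompactSupport a)
    (hF : Integrable F) (ξ : ℝ × ℝ) : ft2 (ift2 fun η => a η * ft2 F η) ξ = a ξ * ft2 F ξ := by
  have hK := integrable_ift2 ha hs
  have e1 : ∀ x, ift2 (fun η => a η * ft2 F η) x = ∫ z, F z * ift2 a (x - z) := fun x => by
    rw [ift2_eq_ft2, ft2_mul_ft2 (ha.continuous.integrable_of_hasCompactSupport hs) hF,
      ← integral_const_mul]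
    congr 1 with z
    rw [ift2_eq_ft2, neg_sub, sub_eq_neg_add]
    ring
  have hd := continuous_dot2
  have hInt : Integrable (fun p : (ℝ × ℝ) × (ℝ × ℝ) =>
      Complex.exp (-Complex.I * (dot2 p.1 ξ : ℂ)) * (F p.2 * ift2 a (p.1 - p.2)))
      (volume.prod volume) :=
    (hF.convolution_integrand (ContinuousLinearMap.mul ℝ ℂ) hK).bdd_mul (c := 1)
      (Continuous.aestronglyMeasurable (by fun_prop))
      (Filter.Eventually.of_forall fun p => (norm_exp_neg_I_mul _).le)
  calc _ = ∫ x, ∫ z, Complex.exp (-Complex.I * (dot2 x ξ : ℂ)) * (F z * ift2 a (x - z)) := by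
        rw [ft2_eq]
        congr 1 with x
        rw [e1, integral_const_mul]
    _ = ∫ z, ∫ x, Complex.exp (-Complex.I * (dot2 x ξ : ℂ)) * (F z * ift2 a (x - z)) :=
        integral_integral_swap hInt
    _ = ∫ z, a ξ * (Complex.exp (-Complex.I * (dot2 z ξ : ℂ)) * F z) := by
        congr 1 with z
        rw [← integral_add_right_eq_self _ z, ← ft2_ift2 ha hs ξ, ft2_eq, ← integral_mul_const]
        congr 1 with x
        rw [add_sub_cancel_right, dot2_add_left, show -Complex.I * ((dot2 x ξ + dot2 z ξ : ℝ) : ℂ) =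
          -Complex.I * (dot2 x ξ : ℂ) + -Complex.I * (dot2 z ξ : ℂ) by push_cast; ring,
          Complex.exp_add]
        ring
    _ = _ := by rw [integral_const_mul, ← ft2_eq]

end

theorem dot2_smul_left (r : ℝ) (x ξ : ℝ × ℝ) : dot2 (r • x) ξ = r * dot2 x ξ := by
  simp only [dot2, Prod.smul_fst, Prod.smul_snd, smul_eq_mul]; ring

theorem enorm2_smul {r : ℝ} (hr : 0 ≤ r) (ξ : ℝ × ℝ) : enorm2 (r • ξ) = r * enorm2 ξ := by
  rw [enorm2, enorm2, ← Real.sqrt_sq hr, ← Real.sqrt_mul (sq_nonneg r), Real.sqrt_sq hr]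
  congr 1
  simp only [Prod.smul_fst, Prod.smul_snd, smul_eq_mul]; ring

theorem ft2_comp_smul (F : ℝ × ℝ → ℂ) {r : ℝ} (hr : 0 < r) (ξ : ℝ × ℝ) :
    ft2 (fun x => F (r⁻¹ • x)) ξ = (r ^ 2 : ℝ) * ft2 F (r • ξ) := by
  have h := Measure.integral_comp_inv_smul_of_nonneg (volume : Measure (ℝ × ℝ))
    (fun y => Complex.exp (-Complex.I * (dot2 y (r • ξ) : ℂ)) * F y) hr.le
  rw [ft2_eq, ft2_eq, ← Complex.real_smul]
  simp only [Module.finrank_prod, Module.finrank_self] at h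
  rw [← h]
  congr 1 with y
  rw [dot2_comm, dot2_comm (r⁻¹ • y), dot2_smul_left, dot2_comm ξ (r⁻¹ • y), dot2_smul_left,
    mul_inv_cancel_left₀ hr.ne', dot2_comm]

theorem waveExt_comp_smul (b : ℝ × ℝ → ℂ) {r : ℝ} (hr : 0 < r) (y : (ℝ × ℝ) × ℝ) :
    waveExt (fun ξ => (r ^ 2 : ℝ) * b (r • ξ)) (r • y) = waveExt b y := by
  have h := Measure.integral_comp_smul (volume : Measure (ℝ × ℝ))
    (fun ξ => Complex.exp (-Complex.I * ((dot2 y.1 ξ + y.2 * enorm2 ξ : ℝ) : ℂ)) * b ξ) r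
  simp only [Module.finrank_prod, Module.finrank_self, one_add_one_eq_two] at h
  rw [abs_of_pos (by positivity), eq_inv_smul_iff₀ (by positivity), ← integral_smul] at h
  rw [waveExt, waveExt, ← h]
  congr 1 with ξ
  rw [Prod.smul_fst, Prod.smul_snd, dot2_smul_left, dot2_comm y.1 (r • ξ), dot2_smul_left,
    dot2_comm ξ, enorm2_smul hr.le, Complex.real_smul, smul_eq_mul, mul_left_comm y.2, mul_assoc r]
  ring

theorem smul_neg_mem_timeSlab {r : ℝ} (hr : 0 < r) (t : ℝ) (z : (ℝ × ℝ) × ℝ) :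
    r • -z ∈ timeSlab (r * t) ↔ z ∈ (univ : Set (ℝ × ℝ)) ×ˢ Icc t (2 * t) := by
  simp only [timeSlab, mem_prod, mem_univ, true_and, Prod.smul_snd, Prod.snd_neg, smul_eq_mul,
    mul_neg, mem_Icc, neg_le_neg_iff]
  rw [mul_left_comm, mul_le_mul_iff_right₀ hr, mul_le_mul_iff_right₀ hr, and_comm]

theorem setLIntegral_comp_smul_neg {r : ℝ} (hr : 0 < r) (t : ℝ) (G : (ℝ × ℝ) × ℝ → ℝ≥0∞) :
    ∫⁻ z in (univ : Set (ℝ × ℝ)) ×ˢ Icc t (2 * t), G (r • -z) =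
      ENNReal.ofReal ((r ^ 3)⁻¹) * ∫⁻ y in timeSlab (r * t), G y := by
  rw [← lintegral_indicator (MeasurableSet.univ.prod measurableSet_Icc),
    ← lintegral_indicator (measurableSet_timeSlab _)]
  have h := lintegral_comp_smul_real volume ((timeSlab (r * t)).indicator G) hr
  simp only [Module.finrank_prod, Module.finrank_self] at h
  norm_num at h
  rw [← h, ← lintegral_neg_eq_self fun x => (timeSlab (r * t)).indicator G (r • x)]
  congr 1 with z
  by_cases hz : z ∈ (univ : Set (ℝ × ℝ)) ×ˢ Icc t (2 * t)
  · rw [indicator_of_mem hz, indicator_of_mem ((smul_neg_mem_timeSlab hr t z).2 hz)]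
  · rw [indicator_of_notMem hz, indicator_of_notMem (mt (smul_neg_mem_timeSlab hr t z).1 hz)]

/-- The multiplier of the Littlewood–Paley projection to unit frequency. -/
def lpSymbol (φ : ℝ → ℝ) (ξ : ℝ × ℝ) : ℂ := φ (enorm2 ξ)

section
variable {φ : ℝ → ℝ}

theorem lpSymbol_eq_zero (hφ : IsLPBump φ) {ξ : ℝ × ℝ} (h : enorm2 ξ < 1 / 2 ∨ 3 < enorm2 ξ) :
    lpSymbol φ ξ = 0 := by
  rw [lpSymbol, Complex.ofReal_eq_zero]
  by_contra h'
  obtain ⟨h1, h2⟩ := hφ.2.2.1 h'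
  rcases h with h | h <;> linarith

theorem zero_notMem_tsupport_lpSymbol (hφ : IsLPBump φ) : (0 : ℝ × ℝ) ∉ tsupport (lpSymbol φ) := by
  rw [notMem_tsupport_iff_eventuallyEq]
  have : ∀ᶠ ξ in nhds (0 : ℝ × ℝ), enorm2 ξ < 1 / 2 :=
    continuous_enorm2.continuousAt.eventually_lt continuousAt_const (by simp [enorm2])
  exact this.mono fun ξ h => lpSymbol_eq_zero hφ (.inl h)

theorem contDiff_lpSymbol (hφ : IsLPBump φ) : ContDiff ℝ (⊤ : ℕ∞) (lpSymbol φ) := by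
  rw [contDiff_iff_contDiffAt]
  intro ξ
  rcases (enorm2_nonneg ξ).lt_or_eq with h | h
  · exact Complex.ofRealCLM.contDiff.contDiffAt.comp ξ
      (hφ.1.contDiffAt.comp ξ (contDiffAt_enorm2 h))
  · refine contDiffAt_const (c := (0 : ℂ)) |>.congr_of_eventuallyEq ?_
    have : ∀ᶠ ξ' in nhds ξ, enorm2 ξ' < 1 / 2 :=
      continuous_enorm2.continuousAt.eventually_lt continuousAt_const (by rw [← h]; norm_num)
    exact this.mono fun ξ h => lpSymbol_eq_zero hφ (.inl h)

theorem hasCompactSupport_lpSymbol (hφ : IsLPBump φ) : HasCompactSupport (lpSymbol φ) := by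
  refine HasCompactSupport.of_support_subset_isCompact (isCompact_closedBall 0 3) fun ξ h => ?_
  have h1 : enorm2 ξ ≤ 3 := by
    by_contra! h'
    exact h (lpSymbol_eq_zero hφ (.inr h'))
  have h2 := enorm2_sq ξ
  have h3 := enorm2_nonneg ξ
  rw [mem_closedBall_zero_iff, Prod.norm_def, max_le_iff]
  constructor <;> refine abs_le_of_sq_le_sq (by nlinarith) (by norm_num)

/-- Rescaling a frequency localised wave to unit frequency. -/
theorem waveProp_proj (hφ : IsLPBump φ) (j : ℤ) {f : ℝ × ℝ → ℂ} (hf : Integrable f)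
    (z : (ℝ × ℝ) × ℝ) : waveProp (proj φ j f) z.2 z.1 = (((2 * π) ^ (-2 : ℤ) : ℝ) : ℂ) *
      waveOp (lpSymbol φ) (fun x => f (((2 : ℝ) ^ j)⁻¹ • x)) ((2 : ℝ) ^ j • -z) := by
  set r : ℝ := 2 ^ j with hr
  have hr0 : 0 < r := by positivity
  set b : ℝ × ℝ → ℂ := fun ξ => lpSymbol φ (r⁻¹ • ξ) with hb
  have hbd : ContDiff ℝ (⊤ : ℕ∞) b := (contDiff_lpSymbol hφ).comp (contDiff_id.const_smul _)
  have hbs : HasCompactSupport b := (hasCompactSupport_lpSymbol hφ).comp_smul (inv_ne_zero hr0.ne')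
  have h1 : proj φ j f = ift2 fun ξ => b ξ * ft2 f ξ := by
    ext x
    simp only [proj, ift2, hb, lpSymbol, enorm2_smul (inv_nonneg.2 hr0.le), mul_assoc, dot2]
    simp only [hr, zpow_neg]
  have h2 : waveOp (lpSymbol φ) (fun x => f (r⁻¹ • x)) (r • -z) =
      waveExt (fun ξ => b ξ * ft2 f ξ) (-z) := by
    rw [← waveExt_comp_smul _ hr0, waveOp]
    congr 1 with ξ
    rw [ft2_comp_smul f hr0, hb]
    simp only [inv_smul_smul₀ hr0.ne']
    ring
  rw [h2, waveProp, waveExt]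
  congr 2 with ξ
  rw [h1, ft2_ift2_mul_ft2 hbd hbs hf, Prod.fst_neg, Prod.snd_neg, dot2_neg_left]
  simp only [dot2]
  congr 2
  push_cast
  ring

end

section
variable {φ : ℝ → ℝ}

theorem ft2_congr_ae {f g : ℝ × ℝ → ℂ} (h : f =ᵐ[volume] g) : ft2 f = ft2 g := by
  ext ξ
  refine integral_congr_ae (h.mono fun x hx => ?_)
  simp only [hx]

theorem ft2_of_not_integrable {f : ℝ × ℝ → ℂ} (h : ¬ Integrable f) : ft2 f = 0 := by
  ext ξ
  refine integral_undef fun h' => h ?_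
  have h1 : Integrable (fun y => Complex.exp (-(-Complex.I * (dot2 y ξ : ℂ))) *
      (Complex.exp (-Complex.I * (dot2 y ξ : ℂ)) * f y)) := by
    have hd := continuous_dot2
    refine h'.bdd_mul (c := 1) (Continuous.aestronglyMeasurable (by fun_prop))
      (Filter.Eventually.of_forall fun y => ?_)
    rw [show -(-Complex.I * (dot2 y ξ : ℂ)) = -Complex.I * ((-dot2 y ξ : ℝ) : ℂ) by
      push_cast; ring, norm_exp_neg_I_mul]
  refine h1.congr (Filter.Eventually.of_forall fun y => ?_)
  simp only
  rw [← mul_assoc, ← Complex.exp_add, neg_add_cancel, Complex.exp_zero, one_mul]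

theorem waveProp_proj_congr {f g : ℝ × ℝ → ℂ} (h : ft2 f = ft2 g) (j : ℤ) :
    waveProp (proj φ j f) = waveProp (proj φ j g) := by
  have : proj φ j f = proj φ j g := by
    ext x
    rw [proj, proj, h]
  rw [this]

theorem waveProp_proj_of_not_integrable {f : ℝ × ℝ → ℂ} (h : ¬ Integrable f) (j : ℤ) :
    waveProp (proj φ j f) = 0 := by
  have : proj φ j f = 0 := by
    ext x
    simp [proj, ft2_of_not_integrable h]
  ext t x
  simp [this, waveProp, ft2]

theorem enorm_two_pi_zpow_le : ‖(((2 * π) ^ (-2 : ℤ) : ℝ) : ℂ)‖ₑ ≤ 1 := by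
  rw [← ofReal_norm, Complex.norm_real, Real.norm_of_nonneg (by positivity)]
  refine ENNReal.ofReal_le_one.2 (zpow_le_one_of_nonpos₀ ?_ (by norm_num))
  linarith [pi_gt_three]

/-- To bound a Littlewood–Paley localised wave it suffices to consider unit frequency. -/
theorem eLpNorm_waveProp_proj_le (hφ : IsLPBump φ) {l j : ℤ} {f : ℝ × ℝ → ℂ} (hf : Integrable f)
    {q : ℝ≥0∞} (hq0 : q ≠ 0) (hq : q ≠ ∞) :
    eLpNorm (fun z : (ℝ × ℝ) × ℝ => waveProp (proj φ j f) z.2 z.1) q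
      (volume.restrict (univ ×ˢ Icc ((2 : ℝ) ^ l) ((2 : ℝ) ^ (l + 1)))) ≤
    (ENNReal.ofReal ((((2 : ℝ) ^ j) ^ 3)⁻¹) * ∫⁻ y in timeSlab ((2 : ℝ) ^ j * (2 : ℝ) ^ l),
      ‖waveOp (lpSymbol φ) (fun x => f (((2 : ℝ) ^ j)⁻¹ • x)) y‖ₑ ^ q.toReal) ^ (1 / q.toReal) := by
  rw [eLpNorm_eq_lintegral_rpow_enorm_toReal hq0 hq]
  gcongr
  rw [← setLIntegral_comp_smul_neg (by positivity), zpow_add_one₀ two_ne_zero, mul_comm _ (2 : ℝ)]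
  refine lintegral_mono fun z => ?_
  simp only
  rw [waveProp_proj hφ j hf z, enorm_mul]
  gcongr
  exact mul_le_of_le_one_left' enorm_two_pi_zpow_le

theorem lintegral_enorm_rpow_comp_inv_smul (f : ℝ × ℝ → ℂ) (s : ℝ) {r : ℝ} (hr : 0 < r) :
    ∫⁻ x, ‖f (r⁻¹ • x)‖ₑ ^ s = ENNReal.ofReal (r ^ 2) * ∫⁻ x, ‖f x‖ₑ ^ s := by
  have h := lintegral_comp_smul_real (volume : Measure (ℝ × ℝ)) (fun x => ‖f x‖ₑ ^ s)
    (inv_pos.2 hr)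
  simpa [one_add_one_eq_two] using h

theorem exists_eLpNorm_waveProp_proj_le_of_lt_top (hφ : IsLPBump φ) {p q : ℝ≥0∞} (hpq : p ≤ q)
    (hq : q ≠ ∞) (hpq1 : 1 / p + 1 / q ≤ 1) (hpq2 : 1 ≤ 1 / p + 3 / q) {ε : ℝ} (hε : 0 < ε) :
    ∃ C : ℝ, 0 < C ∧ ∀ l j : ℤ, -l ≤ j → ∀ f : ℝ × ℝ → ℂ, Integrable f → Measurable f →
      eLpNorm (fun z : (ℝ × ℝ) × ℝ => waveProp (proj φ j f) z.2 z.1) q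
          (volume.restrict (univ ×ˢ Icc ((2 : ℝ) ^ l) ((2 : ℝ) ^ (l + 1)))) ≤
        ENNReal.ofReal (C * (2 : ℝ) ^
            (3 / 2 * ((1 / p).toReal - (1 / q).toReal) * ((l : ℝ) + (j : ℝ)) +
              (3 * (1 / q).toReal - 2 * (1 / p).toReal) * (l : ℝ) + ε * ((l : ℝ) + (j : ℝ)))) *
          eLpNorm f p volume := by
  have hp : p ≠ ∞ := ne_top_of_le_ne_top hq hpq
  have hp0 : p ≠ 0 := by
    rintro rfl
    simp at hpq1
  have hq0 : q ≠ 0 := fun h => hp0 (le_antisymm (h ▸ hpq) zero_le)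
  obtain ⟨P, rfl⟩ : ∃ P, p = ENNReal.ofReal P := ⟨p.toReal, (ENNReal.ofReal_toReal hp).symm⟩
  obtain ⟨Q, rfl⟩ : ∃ Q, q = ENNReal.ofReal Q := ⟨q.toReal, (ENNReal.ofReal_toReal hq).symm⟩
  have hP : 0 < P := ENNReal.ofReal_pos.1 (pos_iff_ne_zero.2 hp0)
  have hQ : 0 < Q := ENNReal.ofReal_pos.1 (pos_iff_ne_zero.2 hq0)
  have eP : (1 : ℝ≥0∞) / ENNReal.ofReal P = ENNReal.ofReal (1 / P) := by
    rw [ENNReal.ofReal_div_of_pos hP, ENNReal.ofReal_one]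
  have eQ : (1 : ℝ≥0∞) / ENNReal.ofReal Q = ENNReal.ofReal (1 / Q) := by
    rw [ENNReal.ofReal_div_of_pos hQ, ENNReal.ofReal_one]
  have eQ3 : (3 : ℝ≥0∞) / ENNReal.ofReal Q = ENNReal.ofReal (3 * (1 / Q)) := by
    rw [mul_one_div, ENNReal.ofReal_div_of_pos hQ, ENNReal.ofReal_ofNat]
  rw [eP, eQ, ← ENNReal.ofReal_add (by positivity) (by positivity), ENNReal.ofReal_le_one] at hpq1
  rw [eP, eQ3, ← ENNReal.ofReal_add (by positivity) (by positivity), ENNReal.one_le_ofReal] at hpq2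
  rw [eP, eQ, ENNReal.toReal_ofReal (by positivity), ENNReal.toReal_ofReal (by positivity)]
  have hPQ : 1 / Q ≤ 1 / P := one_div_le_one_div_of_le hP ((ENNReal.ofReal_le_ofReal_iff hQ.le).1 hpq)
  obtain ⟨C, hC, H⟩ := exists_lintegral_waveOp_rpow_le (contDiff_lpSymbol hφ)
    (hasCompactSupport_lpSymbol hφ) (zero_notMem_tsupport_lpSymbol hφ) hε (one_div_pos.2 hQ) hPQ
    hpq1 hpq2
  refine ⟨C ^ (1 / Q), by positivity, fun l j hlj f hf hfm => ?_⟩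
  refine (eLpNorm_waveProp_proj_le hφ hf hq0 hq).trans ?_
  rw [eLpNorm_eq_lintegral_rpow_enorm_toReal hp0 hp, ENNReal.toReal_ofReal hP.le,
    ENNReal.toReal_ofReal hQ.le]
  set r : ℝ := (2 : ℝ) ^ j with hr
  set T : ℝ := r * (2 : ℝ) ^ l with hT
  have hr0 : 0 < r := by positivity
  have hT1 : 1 ≤ T := by
    rw [hT, hr, ← zpow_add₀ two_ne_zero]
    exact one_le_zpow₀ one_le_two (by omega)
  have hsm : Measurable fun x : ℝ × ℝ => r⁻¹ • x := by fun_prop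
  have h1 := H T hT1 (fun x => f (r⁻¹ • x)) (hf.comp_smul (inv_ne_zero hr0.ne')) (hfm.comp hsm)
  simp only [one_div_one_div, lintegral_enorm_rpow_comp_inv_smul f _ hr0] at h1
  refine (ENNReal.rpow_le_rpow (mul_le_mul_right h1 _) (by positivity)).trans ?_
  have hQ1 : 0 ≤ 1 / Q := by positivity
  have hPQ1 : 0 ≤ 1 / P / (1 / Q) := by positivity
  rw [ENNReal.mul_rpow_of_nonneg _ _ hPQ1, ENNReal.ofReal_rpow_of_nonneg (by positivity) hPQ1,
    ← mul_assoc, ← mul_assoc, ← ENNReal.ofReal_mul (by positivity),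
    ← ENNReal.ofReal_mul (by positivity), ENNReal.mul_rpow_of_nonneg _ _ hQ1, ← ENNReal.rpow_mul,
    ENNReal.ofReal_rpow_of_nonneg (by positivity) hQ1, div_mul_cancel₀ _ (by positivity)]
  refine mul_le_mul_left (ENNReal.ofReal_le_ofReal (le_of_eq ?_)) _
  have e1 : (r ^ 3)⁻¹ = (2 : ℝ) ^ (-(3 * (j : ℝ))) := by
    rw [hr, Real.rpow_neg zero_le_two, mul_comm, Real.rpow_mul zero_le_two, Real.rpow_intCast]
    norm_cast
  have e2 : r ^ 2 = (2 : ℝ) ^ (2 * (j : ℝ)) := by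
    rw [hr, mul_comm, Real.rpow_mul zero_le_two, Real.rpow_intCast]
    norm_cast
  have e3 : T = (2 : ℝ) ^ ((j : ℝ) + l) := by
    rw [hT, hr, Real.rpow_add two_pos, Real.rpow_intCast, Real.rpow_intCast]
  rw [e1, e2, e3, ← Real.rpow_mul zero_le_two, ← Real.rpow_mul zero_le_two, mul_left_comm,
    mul_assoc, mul_assoc, ← Real.rpow_add two_pos, ← Real.rpow_add two_pos,
    Real.mul_rpow hC.le (by positivity), ← Real.rpow_mul zero_le_two]
  congr 2
  field_simp
  ring

theorem exists_eLpNorm_waveProp_proj_le_top (hφ : IsLPBump φ) {ε : ℝ} (hε : 0 < ε) :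
    ∃ C : ℝ, 0 < C ∧ ∀ l j : ℤ, -l ≤ j → ∀ f : ℝ × ℝ → ℂ, Integrable f →
      eLpNorm (fun z : (ℝ × ℝ) × ℝ => waveProp (proj φ j f) z.2 z.1) ∞
          (volume.restrict (univ ×ˢ Icc ((2 : ℝ) ^ l) ((2 : ℝ) ^ (l + 1)))) ≤
        ENNReal.ofReal (C * (2 : ℝ) ^
            (3 / 2 * (1 - 0) * ((l : ℝ) + (j : ℝ)) +
              (3 * 0 - 2 * 1) * (l : ℝ) + ε * ((l : ℝ) + (j : ℝ)))) * eLpNorm f 1 volume := by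
  have hsm := contDiff_lpSymbol hφ
  have hcs := hasCompactSupport_lpSymbol hφ
  obtain ⟨C, hC, H⟩ := exists_norm_waveExt_le hsm hcs (zero_notMem_tsupport_lpSymbol hφ)
  refine ⟨C, hC, fun l j hlj f hf => ?_⟩
  rw [eLpNorm_exponent_top, eLpNorm_one_eq_lintegral_enorm]
  refine eLpNormEssSup_le_of_ae_enorm_bound ?_
  refine (ae_restrict_iff' (MeasurableSet.univ.prod measurableSet_Icc)).2
    (Filter.Eventually.of_forall fun z hz => ?_)
  have hr0 : (0 : ℝ) < 2 ^ j := by positivity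
  have hl0 : (0 : ℝ) < 2 ^ l := by positivity
  have h2 : (2 : ℝ) ^ l ≤ z.2 := hz.2.1
  have hz0 : 0 < z.2 := hl0.trans_le h2
  rw [waveProp_proj hφ j hf z, enorm_mul]
  refine (mul_le_of_le_one_left' enorm_two_pi_zpow_le).trans ?_
  have e0 : ((2 : ℝ) ^ j • -z).2 = -(2 ^ j * z.2) := by simp
  refine (enorm_waveOp_le hsm.continuous hcs (hf.comp_smul (inv_ne_zero hr0.ne')) _
    (M := C / √(2 ^ j * 2 ^ l)) fun x => ?_).trans ?_
  · rw [e0]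
    refine (H _ (by simp only; rw [neg_lt_zero]; positivity)).trans ?_
    rw [neg_neg]
    gcongr
  have e2 := lintegral_enorm_rpow_comp_inv_smul f 1 hr0
  simp only [ENNReal.rpow_one] at e2
  rw [e2, ← mul_assoc, ← ENNReal.ofReal_mul (by positivity)]
  refine mul_le_mul_left (ENNReal.ofReal_le_ofReal ?_) _
  rw [div_mul_eq_mul_div, mul_div_assoc]
  gcongr
  have hlj' : (0 : ℝ) ≤ (l : ℝ) + j := by exact_mod_cast (by omega : 0 ≤ l + j)
  rw [← zpow_add₀ two_ne_zero, Real.sqrt_eq_rpow, ← Real.rpow_intCast, ← Real.rpow_intCast,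
    ← Real.rpow_mul_natCast zero_le_two, ← Real.rpow_mul zero_le_two, ← Real.rpow_sub two_pos]
  refine Real.rpow_le_rpow_of_exponent_le one_le_two ?_
  push_cast
  nlinarith

end

/-- Rescaled local smoothing (Lemma 3.2): for `ℓ ∈ ℤ`, `j ≥ −ℓ`, on the same range of
`(p,q)`, `‖e^{it√(−Δ)} 𝒫_j f‖_{L^q(ℝ²×[2^ℓ,2^{ℓ+1}])} ≲
2^{(3/2)(1/p−1/q)(ℓ+j)+(3/q−2/p)ℓ+ε(ℓ+j)} ‖f‖_{L^p(ℝ²)}`,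
with constant independent of `j, ℓ, f`. -/
theorem local_smoothing_wave_2d_rescaled
    (φ : ℝ → ℝ) (hφ : IsLPBump φ) (p q : ℝ≥0∞)
    (hpq : p ≤ q) (hpq1 : 1/p + 1/q ≤ 1) (hpq2 : 1 ≤ 1/p + 3/q)
    (ε : ℝ) (hε : 0 < ε) :
    ∃ C : ℝ, 0 < C ∧ ∀ l j : ℤ, -l ≤ j → ∀ f : ℝ × ℝ → ℂ,
      eLpNorm (fun z : (ℝ × ℝ) × ℝ => waveProp (proj φ j f) z.2 z.1) q
          (volume.restrict (Set.univ ×ˢ Set.Icc ((2:ℝ) ^ l) ((2:ℝ) ^ (l + 1)))) ≤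
        ENNReal.ofReal (C * (2:ℝ) ^
            (3/2 * ((1/p).toReal - (1/q).toReal) * ((l:ℝ) + (j:ℝ)) +
              (3 * (1/q).toReal - 2 * (1/p).toReal) * (l:ℝ) + ε * ((l:ℝ) + (j:ℝ)))) *
          eLpNorm f p volume := by
  have hfin : ∃ C : ℝ, 0 < C ∧ ∀ l j : ℤ, -l ≤ j → ∀ f : ℝ × ℝ → ℂ, Integrable f → Measurable f →
      eLpNorm (fun z : (ℝ × ℝ) × ℝ => waveProp (proj φ j f) z.2 z.1) q
          (volume.restrict (univ ×ˢ Icc ((2 : ℝ) ^ l) ((2 : ℝ) ^ (l + 1)))) ≤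
        ENNReal.ofReal (C * (2 : ℝ) ^
            (3 / 2 * ((1 / p).toReal - (1 / q).toReal) * ((l : ℝ) + (j : ℝ)) +
              (3 * (1 / q).toReal - 2 * (1 / p).toReal) * (l : ℝ) + ε * ((l : ℝ) + (j : ℝ)))) *
          eLpNorm f p volume := by
    rcases eq_or_ne q ∞ with rfl | hq
    · obtain rfl : p = 1 := by
        simp only [one_div, ENNReal.inv_top, add_zero, ENNReal.div_top] at hpq1 hpq2
        exact ENNReal.inv_eq_one.1 (le_antisymm hpq1 hpq2)
      obtain ⟨C, hC, H⟩ := exists_eLpNorm_waveProp_proj_le_top hφ hε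
      exact ⟨C, hC, fun l j hlj f hf _ => by simpa using H l j hlj f hf⟩
    · exact exists_eLpNorm_waveProp_proj_le_of_lt_top hφ hpq hq hpq1 hpq2 hε
  obtain ⟨C, hC, H⟩ := hfin
  refine ⟨C, hC, fun l j hlj f => ?_⟩
  by_cases hf : Integrable f
  · obtain ⟨g, hg, hfg⟩ := hf.1
    rw [waveProp_proj_congr (ft2_congr_ae hfg) j, eLpNorm_congr_ae hfg]
    exact H l j hlj g (hf.congr hfg) hg.measurable
  · rw [waveProp_proj_of_not_integrable hf j]
    simp

end
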